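/- There exist absolute constants C₁, C₂ > 0 such that the following holds. Let N be a positive integer and H ≥ 16 with log H ≤ √((log N)/𝓛), and let 𝐏 be a set of primes in [1, H] with 𝓛 = ∑_{p∈𝐏} 1/p ≥ 1. Then for every real K with 1 ≤ K ≤ (log N)/(𝓛 (log H)²) there exists a subset 𝒳 ⊆ 𝐍 with |𝐍 ∖ 𝒳| ≤ C₁ e^{−√(K𝓛) log K} N, such that every eigenvalue of the restricted operator A|_𝒳 has absolute value at most C₂ √(K𝓛) · log log log H. -/

import Mathlib

/-- The operator `A` from the paper: for `f : ℤ → ℂ` (thought of as a function on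
`𝐍 = {N+1, …, 2N}`), `(A f)(n) = ∑_{σ=±1} ∑_{p ∈ 𝐏, p ∣ n, n+σp ∈ 𝐍} f(n+σp)
− ∑_{σ=±1} ∑_{p ∈ 𝐏, n+σp ∈ 𝐍} f(n+σp)/p`. -/
noncomputable def opA (N : ℕ) (P : Finset ℕ) (f : ℤ → ℂ) (n : ℤ) : ℂ :=
  (∑ σ ∈ ({-1, 1} : Finset ℤ), ∑ p ∈ P,
      if (p : ℤ) ∣ n ∧ n + σ * (p : ℤ) ∈ Finset.Ioc (N : ℤ) (2 * (N : ℤ))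
      then f (n + σ * (p : ℤ)) else 0)
  - (∑ σ ∈ ({-1, 1} : Finset ℤ), ∑ p ∈ P,
      if n + σ * (p : ℤ) ∈ Finset.Ioc (N : ℤ) (2 * (N : ℤ))
      then f (n + σ * (p : ℤ)) / (p : ℂ) else 0)

/-- The restriction `A|_X : f ↦ (A(f·1_X))·1_X`. -/
noncomputable def opARestrict (N : ℕ) (P : Finset ℕ) (X : Finset ℤ) (f : ℤ → ℂ) (n : ℤ) : ℂ :=
  if n ∈ X then opA N P (fun m => if m ∈ X then f m else 0) n else 0

open Finset

section Cheb

variable {V ι : Type*} [AddCommGroup V] [Module ℝ V] [Fintype ι]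

/-- States: sums over reduced words, total and by first letter class. -/
noncomputable def chSt (a : ι → V →ₗ[ℝ] V) (f : V) : ℕ → V × (ι → V)
  | 0 => (f, fun _ => 0)
  | j + 1 => (∑ p, a p ((chSt a f j).1 - (chSt a f j).2 p),
      fun p => a p ((chSt a f j).1 - (chSt a f j).2 p))

noncomputable def chK (B : V →ₗ[ℝ] V →ₗ[ℝ] ℝ) (a : ι → V →ₗ[ℝ] V) (f : V) (n : ℕ) : ℝ :=
  B f (chSt a f n).1

variable (B : V →ₗ[ℝ] V →ₗ[ℝ] ℝ) (a : ι → V →ₗ[ℝ] V) (f : V)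

lemma ch_step (hsym : ∀ p x y, B (a p x) y = B x (a p y)) (i j : ℕ) :
    B (chSt a f (i+1)).1 (chSt a f j).1 - ∑ p, B ((chSt a f (i+1)).2 p) ((chSt a f j).2 p)
    = B (chSt a f i).1 (chSt a f (j+1)).1
      - ∑ p, B ((chSt a f i).2 p) ((chSt a f (j+1)).2 p) := by
  have h1 : ∀ i j, B (chSt a f (i+1)).1 (chSt a f j).1
      - ∑ p, B ((chSt a f (i+1)).2 p) ((chSt a f j).2 p)
      = ∑ p, B (a p ((chSt a f i).1 - (chSt a f i).2 p))
          ((chSt a f j).1 - (chSt a f j).2 p) := by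
    intro i j
    simp only [chSt, map_sum, LinearMap.sum_apply]
    rw [← Finset.sum_sub_distrib]
    refine Finset.sum_congr rfl fun p _ => ?_
    rw [map_sub (B (a p _))]
  have h2 : ∀ i j, B (chSt a f i).1 (chSt a f (j+1)).1
      - ∑ p, B ((chSt a f i).2 p) ((chSt a f (j+1)).2 p)
      = ∑ p, B ((chSt a f i).1 - (chSt a f i).2 p)
          (a p ((chSt a f j).1 - (chSt a f j).2 p)) := by
    intro i j
    simp only [chSt, map_sum]
    rw [← Finset.sum_sub_distrib]
    refine Finset.sum_congr rfl fun p _ => ?_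
    rw [map_sub B, LinearMap.sub_apply]
  rw [h1, h2]
  exact Finset.sum_congr rfl fun p _ => hsym p _ _

lemma ch_K (hsym : ∀ p x y, B (a p x) y = B x (a p y)) (i j : ℕ) :
    B (chSt a f i).1 (chSt a f j).1 - ∑ p, B ((chSt a f i).2 p) ((chSt a f j).2 p)
    = chK B a f (i + j) := by
  induction i generalizing j with
  | zero => simp [chSt, chK]
  | succ i ih => rw [ch_step B a f hsym, ih, show i + 1 + j = i + (j+1) by ring]

noncomputable def chY (c : ℕ → ℝ) (n t : ℕ) : V :=
  ∑ j ∈ range n, if t ≤ j then c j • (chSt a f (j - t)).1 else 0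

noncomputable def chYp (c : ℕ → ℝ) (n t : ℕ) (p : ι) : V :=
  ∑ j ∈ range n, if t ≤ j then c j • (chSt a f (j - t)).2 p else 0

lemma ch_Yp (c : ℕ → ℝ) (n t : ℕ) (p : ι) :
    chYp a f c n t p = a p (chY a f c n (t+1) - chYp a f c n (t+1) p) := by
  unfold chY chYp
  rw [← Finset.sum_sub_distrib, map_sum]
  refine Finset.sum_congr rfl fun j _ => ?_
  rcases lt_trichotomy j t with h | h | h
  · simp [not_le.2 h, show ¬ t + 1 ≤ j by omega]
  · subst h
    simp [chSt]
  · obtain ⟨d, rfl⟩ : ∃ d, j = t + 1 + d := ⟨j - (t+1), by omega⟩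
    rw [if_pos (by omega), if_pos (by omega), if_pos (by omega), ← smul_sub, map_smul]
    rw [show t + 1 + d - t = d + 1 by omega, show t + 1 + d - (t+1) = d by omega]
    rfl

lemma ch_Ydiff (hsym : ∀ p x y, B (a p x) y = B x (a p y)) (c : ℕ → ℝ) (n t : ℕ) :
    B (chY a f c n t) (chY a f c n t) - ∑ p, B (chYp a f c n t p) (chYp a f c n t p)
    = ∑ i ∈ range n, ∑ j ∈ range n, if t ≤ i ∧ t ≤ j then
        c i * c j * chK B a f ((i - t) + (j - t)) else 0 := by
  unfold chY chYp
  have hb : ∀ x y : ℕ → V, B (∑ i ∈ range n, x i) (∑ j ∈ range n, y j)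
      = ∑ i ∈ range n, ∑ j ∈ range n, B (x i) (y j) := by
    intro x y
    simp only [map_sum, LinearMap.sum_apply]
    rw [Finset.sum_comm]
  simp only [hb]
  rw [Finset.sum_comm (s := univ), ← Finset.sum_sub_distrib]
  refine Finset.sum_congr rfl fun i _ => ?_
  rw [Finset.sum_comm (s := univ), ← Finset.sum_sub_distrib]
  refine Finset.sum_congr rfl fun j _ => ?_
  by_cases h1 : t ≤ i
  · by_cases h2 : t ≤ j
    · rw [if_pos (And.intro h1 h2 : t ≤ i ∧ t ≤ j), ← ch_K B a f hsym]
      simp only [if_pos h1, if_pos h2, map_smul, LinearMap.smul_apply, smul_eq_mul]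
      rw [mul_sub, Finset.mul_sum]
      congr 1
      · ring
      · exact Finset.sum_congr rfl fun p _ => by ring
    · simp [h2]
  · simp [h1]

/-- the quadratic form coefficients -/
noncomputable def chG (v : ℝ) (i j : ℕ) : ℝ :=
  ∑ t ∈ range (min i j + 1), v ^ t * chK B a f (i + j - 2 * t)

lemma ch_pos (hsym : ∀ p x y, B (a p x) y = B x (a p y)) (hpsd : ∀ x, 0 ≤ B x x)
    (be V0 v : ℝ) (hbe : ∀ p x, B (a p x) (a p x) ≤ be * B x x)
    (hV0 : ∀ x, ∑ p, B (a p x) (a p x) ≤ V0 * B x x)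
    (hv0 : 0 ≤ v) (hv1 : 4 * V0 ≤ v) (hv2 : 4 * be ≤ v) (c : ℕ → ℝ) (n : ℕ) :
    0 ≤ ∑ i ∈ range n, ∑ j ∈ range n, c i * c j * chG B a f v i j := by
  set y : ℕ → ℝ := fun t => B (chY a f c n t) (chY a f c n t) with hy
  set Q : ℕ → ℝ := fun t => ∑ p, B (chYp a f c n t p) (chYp a f c n t p) with hQ
  have hy0 : ∀ t, 0 ≤ y t := fun t => hpsd _
  have hQ0 : ∀ t, 0 ≤ Q t := fun t => Finset.sum_nonneg fun p _ => hpsd _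
  have par : ∀ x z, B (x - z) (x - z) ≤ 2 * B x x + 2 * B z z := by
    intro x z
    have h := hpsd (x + z)
    have e1 : B (x + z) (x + z) = B x x + B x z + B z x + B z z := by
      simp only [map_add, LinearMap.add_apply]; ring
    have e2 : B (x - z) (x - z) = B x x - B x z - B z x + B z z := by
      simp only [map_sub, LinearMap.sub_apply]; ring
    linarith
  have hrec : ∀ t, Q t ≤ v / 2 * y (t+1) + v / 2 * Q (t+1) := by
    intro t
    have : Q t ≤ 2 * (V0 * y (t+1)) + 2 * (be * Q (t+1)) := by
      simp only [hQ, hy]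
      calc ∑ p, B (chYp a f c n t p) (chYp a f c n t p)
          ≤ ∑ p, (2 * B (a p (chY a f c n (t+1))) (a p (chY a f c n (t+1)))
              + 2 * (be * B (chYp a f c n (t+1) p) (chYp a f c n (t+1) p))) := by
            refine Finset.sum_le_sum fun p _ => ?_
            rw [ch_Yp a f c n t p, map_sub (a p)]
            refine (par _ _).trans ?_
            have := hbe p (chYp a f c n (t+1) p)
            linarith
        _ = 2 * (∑ p, B (a p (chY a f c n (t+1))) (a p (chY a f c n (t+1))))
              + 2 * (be * ∑ p, B (chYp a f c n (t+1) p) (chYp a f c n (t+1) p)) := by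
            rw [Finset.sum_add_distrib, Finset.mul_sum, Finset.mul_sum, Finset.mul_sum]
        _ ≤ _ := by
            have := hV0 (chY a f c n (t+1))
            linarith
    have h1 : V0 * y (t+1) ≤ v / 4 * y (t+1) :=
      mul_le_mul_of_nonneg_right (by linarith) (hy0 _)
    have h2 : be * Q (t+1) ≤ v / 4 * Q (t+1) :=
      mul_le_mul_of_nonneg_right (by linarith) (hQ0 _)
    linarith
  have hyn : y n = 0 := by
    simp only [hy]
    have : chY a f c n n = 0 := by
      unfold chY
      refine Finset.sum_eq_zero fun j hj => ?_
      rw [if_neg (by have := Finset.mem_range.1 hj; omega)]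
    rw [this]; simp
  have hQn : Q n = 0 := by
    simp only [hQ]
    refine Finset.sum_eq_zero fun p _ => ?_
    have : chYp a f c n n p = 0 := by
      unfold chYp
      refine Finset.sum_eq_zero fun j hj => ?_
      rw [if_neg (by have := Finset.mem_range.1 hj; omega)]
    rw [this]; simp
  have shift : ∀ z : ℕ → ℝ, (∀ t, 0 ≤ z t) → z n = 0 →
      ∑ t ∈ range n, v ^ (t+1) * z (t+1) ≤ ∑ t ∈ range n, v ^ t * z t := by
    intro z hz hzn
    have h1 := Finset.sum_range_succ' (fun t => v ^ t * z t) n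
    have h2 := Finset.sum_range_succ (fun t => v ^ t * z t) n
    rw [h2] at h1
    simp only [hzn, mul_zero, add_zero, pow_zero, one_mul] at h1
    have := hz 0
    linarith
  have main : ∑ t ∈ range n, v ^ t * Q t ≤ ∑ t ∈ range n, v ^ t * y t := by
    have : ∑ t ∈ range n, v ^ t * Q t ≤ 1/2 * ∑ t ∈ range n, v ^ (t+1) * y (t+1)
        + 1/2 * ∑ t ∈ range n, v ^ (t+1) * Q (t+1) := by
      rw [Finset.mul_sum, Finset.mul_sum, ← Finset.sum_add_distrib]
      refine Finset.sum_le_sum fun t _ => ?_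
      have := mul_le_mul_of_nonneg_left (hrec t) (pow_nonneg hv0 t)
      refine this.trans (le_of_eq ?_)
      ring
    have s1 := shift y hy0 hyn
    have s2 := shift Q hQ0 hQn
    linarith
  have key : ∑ i ∈ range n, ∑ j ∈ range n, c i * c j * chG B a f v i j
      = ∑ t ∈ range n, v ^ t * (y t - Q t) := by
    simp only [hy, hQ, ch_Ydiff B a f hsym, Finset.mul_sum]
    rw [Finset.sum_comm]
    rw [Finset.sum_comm (s := range n) (t := range n)
      (f := fun t i => ∑ j ∈ range n, v ^ t * if t ≤ i ∧ t ≤ j then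
        c i * c j * chK B a f ((i - t) + (j - t)) else 0)]
    rw [Finset.sum_comm]
    refine Finset.sum_congr rfl fun i hi => ?_
    rw [Finset.sum_comm]
    refine Finset.sum_congr rfl fun j hj => ?_
    unfold chG
    rw [Finset.mul_sum]
    rw [← Finset.sum_subset (s₁ := range (min i j + 1)) (s₂ := range n)]
    · refine Finset.sum_congr rfl fun t ht => ?_
      have := Finset.mem_range.1 ht
      rw [if_pos (by omega), show i - t + (j - t) = i + j - 2 * t by omega]
      ring
    · intro t ht
      simp only [Finset.mem_range] at *
      omega
    · intro t _ ht
      simp only [Finset.mem_range] at *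
      rw [if_neg (by omega), mul_zero]
  rw [key]
  simp only [mul_sub, Finset.sum_sub_distrib]
  linarith

lemma ch_eval (l m n : ℕ) (v x : ℝ) (hl : l < n) (hm : m < n) (F : ℕ → ℝ) :
    ∑ i ∈ range n, ((if i = l then (1:ℝ) else 0) - v * (if i = m then 1 else 0)
      - x * (if i = 0 then 1 else 0)) * F i = F l - v * F m - x * F 0 := by
  have : 0 < n := by omega
  have e : ∀ i, ((if i = l then (1:ℝ) else 0) - v * (if i = m then 1 else 0)
      - x * (if i = 0 then 1 else 0)) * F i
      = (if i = l then F i else 0) - (if i = m then v * F i else 0)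
        - (if i = 0 then x * F i else 0) := by
    intro i
    split_ifs <;> ring
  simp only [e, Finset.sum_sub_distrib]
  simp [hl, hm, this]

lemma ch_tau (hsym : ∀ p x y, B (a p x) y = B x (a p y)) (hpsd : ∀ x, 0 ≤ B x x)
    (be V0 v : ℝ) (hbe : ∀ p x, B (a p x) (a p x) ≤ be * B x x)
    (hV0 : ∀ x, ∑ p, B (a p x) (a p x) ≤ V0 * B x x)
    (hv0 : 0 ≤ v) (hv1 : 4 * V0 ≤ v) (hv2 : 4 * be ≤ v) (hf : B f f = 1) (l : ℕ)
    (x : ℝ) :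
    2 * x * (chK B a f (l+2) - v * chK B a f l) - x ^ 2 ≤
      chK B a f (2*l+4) - v * chK B a f (2*l+2) + 2 * v ^ (l+2) := by
  have h := ch_pos B a f hsym hpsd be V0 v hbe hV0 hv0 hv1 hv2
    (fun i => (if i = l+2 then (1:ℝ) else 0) - v * (if i = l then 1 else 0)
      - x * (if i = 0 then 1 else 0)) (l+3)
  have hk0 : chK B a f 0 = 1 := by simpa [chK, chSt] using hf
  have e : ∀ i j : ℕ, ((if i = l+2 then (1:ℝ) else 0) - v * (if i = l then 1 else 0)
      - x * (if i = 0 then 1 else 0)) * ((if j = l+2 then (1:ℝ) else 0)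
      - v * (if j = l then 1 else 0) - x * (if j = 0 then 1 else 0)) * chG B a f v i j
      = ((if i = l+2 then (1:ℝ) else 0) - v * (if i = l then 1 else 0)
      - x * (if i = 0 then 1 else 0)) * (((if j = l+2 then (1:ℝ) else 0)
      - v * (if j = l then 1 else 0) - x * (if j = 0 then 1 else 0)) * chG B a f v i j) :=
    fun i j => by ring
  simp only [e] at h
  simp only [← Finset.mul_sum] at h
  simp only [ch_eval (l+2) l (l+3) v x (by omega) (by omega)] at h
  have g0 : ∀ i, chG B a f v i 0 = chK B a f i := by intro i; simp [chG]
  have g0' : ∀ i, chG B a f v 0 i = chK B a f i := by intro i; simp [chG]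
  have gs : chG B a f v l (l+2) = chG B a f v (l+2) l := by
    simp only [chG, min_comm, add_comm]
  have g1 : chG B a f v (l+2) (l+2) = chK B a f (2*l+4) + v * chG B a f v (l+2) l
      + v ^ (l+2) := by
    simp only [chG, min_self, min_eq_right (show l ≤ l + 2 by omega)]
    rw [Finset.sum_range_succ' , Finset.sum_range_succ, Finset.mul_sum]
    have : l + 2 + (l + 2) - 2 * (l + 1 + 1) = 0 := by omega
    rw [this, hk0]
    have : ∀ t ∈ range (l+1), v ^ (t+1) * chK B a f (l + 2 + (l + 2) - 2 * (t + 1))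
        = v * (v ^ t * chK B a f (l + 2 + l - 2 * t)) := by
      intro t _
      rw [show l + 2 + (l + 2) - 2 * (t + 1) = l + 2 + l - 2 * t by omega]; ring
    rw [Finset.sum_congr rfl this]
    simp only [pow_zero, one_mul, mul_zero, Nat.sub_zero, mul_one]
    rw [show l + 2 + (l+2) = 2 * l + 4 by ring, show l + 1 + 1 = l + 2 by ring]
    ring
  have g2 : chG B a f v (l+2) l + v ^ (l+1) = chK B a f (2*l+2) + v * chG B a f v l l := by
    simp only [chG, min_self, min_eq_right (show l ≤ l + 2 by omega)]
    rw [Finset.sum_range_succ', Finset.sum_range_succ (n := l), mul_add, Finset.mul_sum]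
    have : l + l - 2 * l = 0 := by omega
    rw [this, hk0]
    have : ∀ t ∈ range l, v ^ (t+1) * chK B a f (l + 2 + l - 2 * (t + 1))
        = v * (v ^ t * chK B a f (l + l - 2 * t)) := by
      intro t ht
      have := Finset.mem_range.1 ht
      rw [show l + 2 + l - 2 * (t + 1) = l + l - 2 * t by omega]; ring
    rw [Finset.sum_congr rfl this]
    simp only [pow_zero, one_mul, mul_zero, Nat.sub_zero, mul_one]
    rw [show l + 2 + l = 2 * l + 2 by ring]
    ring
  rw [gs, g1, g0, g0, g0', g0'] at h
  have g2' := congrArg (fun z => v * z) g2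
  simp only [mul_add] at g2'
  simp only [g0, hk0] at h
  have : v ^ (l+2) = v * v ^ (l+1) := by ring
  nlinarith

lemma ch_tau1 (hsym : ∀ p x y, B (a p x) y = B x (a p y)) (hpsd : ∀ x, 0 ≤ B x x)
    (be V0 v : ℝ) (hbe : ∀ p x, B (a p x) (a p x) ≤ be * B x x)
    (hV0 : ∀ x, ∑ p, B (a p x) (a p x) ≤ V0 * B x x)
    (hv0 : 0 ≤ v) (hv1 : 4 * V0 ≤ v) (hv2 : 4 * be ≤ v) (hf : B f f = 1) :
    chK B a f 1 ^ 2 ≤ chK B a f 2 + v := by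
  have h := ch_pos B a f hsym hpsd be V0 v hbe hV0 hv0 hv1 hv2
    (fun i => if i = 1 then 1 else - chK B a f 1) 2
  have hk0 : chK B a f 0 = 1 := by simpa [chK, chSt] using hf
  simp [Finset.sum_range_succ, chG, hk0] at h
  nlinarith

theorem cheb_main (hsym : ∀ p x y, B (a p x) y = B x (a p y)) (hpsd : ∀ x, 0 ≤ B x x)
    (be V0 v : ℝ) (hbe : ∀ p x, B (a p x) (a p x) ≤ be * B x x)
    (hV0 : ∀ x, ∑ p, B (a p x) (a p x) ≤ V0 * B x x)
    (hv0 : 0 ≤ v) (hv1 : 4 * V0 ≤ v) (hv2 : 4 * be ≤ v) (hf : B f f = 1)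
    (hmu : 4 * v ≤ chK B a f 1 ^ 2) (e : ℕ) :
    2 * (|chK B a f 1| / 2) ^ (2 ^ (e+1)) ≤
      chK B a f (2 ^ (e+1)) - v * chK B a f (2 ^ (e+1) - 2) := by
  have hk0 : chK B a f 0 = 1 := by simpa [chK, chSt] using hf
  set m := |chK B a f 1| / 2 with hm
  have hm0 : 0 ≤ m := by positivity
  have hm2 : v ≤ m ^ 2 := by
    rw [hm, div_pow, sq_abs]; linarith
  induction e with
  | zero =>
    have := ch_tau1 B a f hsym hpsd be V0 v hbe hV0 hv0 hv1 hv2 hf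
    have h2 : m ^ 2 = chK B a f 1 ^ 2 / 4 := by rw [hm, div_pow, sq_abs]; norm_num
    simp only [zero_add, pow_one, Nat.sub_self, hk0]
    nlinarith
  | succ e ih =>
    obtain ⟨l, hl⟩ : ∃ l, 2 ^ (e+1) = l + 2 := ⟨2 ^ (e+1) - 2, by
      have : 2 ^ 1 ≤ 2 ^ (e+1) := Nat.pow_le_pow_right (by norm_num) (by omega)
      omega⟩
    have hl2 : 2 ^ (e+1+1) = 2 * l + 4 := by rw [pow_succ, hl]; ring
    rw [hl] at ih
    rw [hl2]
    simp only [Nat.add_sub_cancel] at ih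
    rw [show 2 * l + 4 - 2 = 2 * l + 2 by omega]
    have h := ch_tau B a f hsym hpsd be V0 v hbe hV0 hv0 hv1 hv2 hf l (2 * m ^ (l+2))
    have h3 : v ^ (l+2) ≤ m ^ (2 * l + 4) := by
      calc v ^ (l+2) ≤ (m ^ 2) ^ (l+2) := pow_le_pow_left₀ hv0 hm2 _
        _ = _ := by rw [← pow_mul]; ring_nf
    have h4 : m ^ (2*l+4) = m ^ (l+2) * m ^ (l+2) := by rw [← pow_add]; congr 1; ring
    have h5 : 0 ≤ m ^ (l+2) := by positivity
    nlinarith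

end Cheb

open Finset

section Equi

lemma sum_Ioc_range (F : ℤ → ℝ) (a : ℤ) (n : ℕ) :
    ∑ m ∈ Ioc a (a + n), F m = ∑ i ∈ range n, F (a + 1 + i) := by
  symm
  refine Finset.sum_nbij' (fun i => a + 1 + (i:ℤ)) (fun m => (m - a - 1).toNat) ?_ ?_ ?_ ?_ ?_
  · intro i hi; simp only [Finset.mem_range, Finset.mem_Ioc] at *; omega
  · intro i hi; simp only [Finset.mem_range, Finset.mem_Ioc] at *; omega
  · intro i hi; simp only [Finset.mem_range] at *; omega
  · intro i hi; simp only [Finset.mem_Ioc] at *; omega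
  · intro i hi; rfl

lemma per_mod {F : ℤ → ℝ} {Q : ℕ} (hF : ∀ n, F (n + Q) = F n) (n : ℤ) (k : ℤ) :
    F (n + k * Q) = F n := by
  have h : Function.Periodic F (Q:ℤ) := hF
  simpa using h.int_mul k n

lemma per_modEq {F : ℤ → ℝ} {Q : ℕ} (hF : ∀ n, F (n + Q) = F n) {n m : ℤ}
    (h : (Q:ℤ) ∣ n - m) : F n = F m := by
  obtain ⟨k, hk⟩ := h
  have := per_mod hF m k
  rw [← this]; congr 1; linarith

lemma per_sum {F : ℤ → ℝ} {Q : ℕ} (hF : ∀ n, F (n + Q) = F n) (a : ℤ) :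
    ∑ i ∈ range Q, F (a + i) = ∑ i ∈ range Q, F i := by
  have step : ∀ a : ℤ, ∑ i ∈ range Q, F (a + 1 + i) = ∑ i ∈ range Q, F (a + i) := by
    intro a
    have h1 := Finset.sum_range_succ' (fun i : ℕ => F (a + i)) Q
    have h2 := Finset.sum_range_succ (fun i : ℕ => F (a + i)) Q
    rw [h2] at h1
    simp only [Nat.cast_zero, add_zero, hF] at h1
    have h3 : ∑ i ∈ range Q, F (a + i) = ∑ i ∈ range Q, F (a + ((i+1 : ℕ):ℤ)) := by linarith
    rw [h3]
    refine Finset.sum_congr rfl fun i _ => ?_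
    congr 1; push_cast; ring
  induction a using Int.induction_on with
  | zero => simp
  | succ i ih => rw [step, ih]
  | pred i ih => rw [← ih, ← step]; simp

lemma crt_sum {F G : ℤ → ℝ} {a b : ℕ} (ha : 0 < a) (hb : 0 < b) (hco : Nat.Coprime a b)
    (hF : ∀ n, F (n + a) = F n) (hG : ∀ n, G (n + b) = G n) :
    ∑ n ∈ range (a * b), F n * G n = (∑ i ∈ range a, F i) * (∑ j ∈ range b, G j) := by
  rw [Finset.sum_mul_sum, ← Finset.sum_product']
  have hm : ∀ n c : ℕ, (c:ℤ) ∣ (n:ℤ) - ((n % c : ℕ):ℤ) := by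
    intro n c
    refine ⟨(n / c : ℕ), ?_⟩
    have := Nat.div_add_mod n c
    have h2 : ((c * (n / c) + n % c : ℕ) : ℤ) = n := by rw [this]
    push_cast at h2 ⊢
    linarith
  refine Finset.sum_nbij' (fun n => (n % a, n % b))
    (fun x => (Nat.chineseRemainder hco x.1 x.2 : ℕ)) ?_ ?_ ?_ ?_ ?_
  · intro n _
    simp only [Finset.mem_product, Finset.mem_range]
    exact ⟨Nat.mod_lt _ ha, Nat.mod_lt _ hb⟩
  · intro x _
    simp only [Finset.mem_range]
    exact Nat.chineseRemainder_lt_mul hco _ _ ha.ne' hb.ne'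
  · intro n hn
    have hn := Finset.mem_range.1 hn
    have h1 := (Nat.chineseRemainder hco (n % a) (n % b)).2
    have h2 : ((Nat.chineseRemainder hco (n % a) (n % b) : ℕ)) ≡ n [MOD a * b] := by
      rw [← Nat.modEq_and_modEq_iff_modEq_mul hco]
      exact ⟨h1.1.trans (Nat.mod_modEq _ _), h1.2.trans (Nat.mod_modEq _ _)⟩
    exact Nat.ModEq.eq_of_lt_of_lt h2
      (Nat.chineseRemainder_lt_mul hco _ _ ha.ne' hb.ne') hn
  · intro x hx
    simp only [Finset.mem_product, Finset.mem_range] at hx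
    have h1 := (Nat.chineseRemainder hco x.1 x.2).2
    refine Prod.ext ?_ ?_
    · exact Eq.trans h1.1 (Nat.mod_eq_of_lt hx.1)
    · exact Eq.trans h1.2 (Nat.mod_eq_of_lt hx.2)
  · intro n _
    simp only
    rw [per_modEq hF (hm n a), per_modEq hG (hm n b)]

lemma prod_per (S : Finset ℕ) (h : ℕ → ℤ → ℝ) (hper : ∀ q ∈ S, ∀ n, h q (n + q) = h q n)
    (n : ℤ) : ∏ q ∈ S, h q (n + ((∏ q ∈ S, q : ℕ) : ℤ)) = ∏ q ∈ S, h q n := by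
  refine Finset.prod_congr rfl fun q hq => ?_
  refine per_modEq (hper q hq) ?_
  have : q ∣ ∏ q ∈ S, q := Finset.dvd_prod_of_mem _ hq
  simpa using Int.natCast_dvd_natCast.2 this

lemma prod_sum (S : Finset ℕ) (hS : ∀ q ∈ S, q.Prime) (h : ℕ → ℤ → ℝ)
    (hper : ∀ q ∈ S, ∀ n, h q (n + q) = h q n) :
    ∑ n ∈ range (∏ q ∈ S, q), ∏ q ∈ S, h q n = ∏ q ∈ S, ∑ r ∈ range q, h q r := by
  induction S using Finset.induction_on with
  | empty => simp
  | insert q S hq ih =>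
    rw [Finset.prod_insert hq, Finset.prod_insert hq]
    simp only [Finset.prod_insert hq]
    rw [← ih (fun r hr => hS r (Finset.mem_insert_of_mem hr))
      (fun r hr => hper r (Finset.mem_insert_of_mem hr))]
    refine crt_sum (F := h q) (G := fun n => ∏ r ∈ S, h r n)
      (hS q (Finset.mem_insert_self _ _)).pos ?_ ?_
      (hper q (Finset.mem_insert_self _ _)) ?_
    · exact Finset.prod_pos fun r hr => (hS r (Finset.mem_insert_of_mem hr)).pos
    · refine Nat.Coprime.prod_right fun r hr => ?_
      refine (Nat.coprime_primes (hS q (Finset.mem_insert_self _ _))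
        (hS r (Finset.mem_insert_of_mem hr))).2 ?_
      rintro rfl; exact hq hr
    · exact prod_per S h (fun r hr => hper r (Finset.mem_insert_of_mem hr))

/-- average over a period -/
noncomputable def avg (q : ℕ) (h : ℤ → ℝ) : ℝ := (∑ r ∈ range q, h r) / q

lemma equi_aux {F : ℤ → ℝ} {Q : ℕ} (hQ : 0 < Q) (hF : ∀ n, F (n + Q) = F n)
    (hF1 : ∀ n, |F n| ≤ 1) (n : ℕ) (a : ℤ) :
    |∑ i ∈ range n, F (a + i) - n * avg Q F| ≤ 2 * Q := by
  have hQr : (0:ℝ) < Q := by exact_mod_cast hQ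
  induction n using Nat.strong_induction_on generalizing a with
  | _ n ih =>
    rcases lt_or_ge n Q with h | h
    · have h1 : |∑ i ∈ range n, F (a + i)| ≤ n := by
        refine (Finset.abs_sum_le_sum_abs _ _).trans ?_
        calc _ ≤ ∑ i ∈ range n, (1:ℝ) := Finset.sum_le_sum fun i _ => hF1 _
          _ = n := by simp
      have h2 : |avg Q F| ≤ 1 := by
        unfold avg
        rw [abs_div, Nat.abs_cast, div_le_one hQr]
        refine (Finset.abs_sum_le_sum_abs _ _).trans ?_
        calc _ ≤ ∑ i ∈ range Q, (1:ℝ) := Finset.sum_le_sum fun i _ => hF1 _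
          _ = Q := by simp
      have h3 : |(n:ℝ) * avg Q F| ≤ n := by
        rw [abs_mul, Nat.abs_cast]
        exact mul_le_of_le_one_right (by positivity) h2
      have h4 : (n:ℝ) ≤ Q := by exact_mod_cast h.le
      refine (abs_sub _ _).trans ?_
      linarith
    · obtain ⟨m, rfl⟩ : ∃ m, n = Q + m := ⟨n - Q, by omega⟩
      rw [Finset.sum_range_add]
      have := ih m (by omega) (a + Q)
      rw [per_sum hF a]
      have e : ∑ r ∈ range Q, F r = Q * avg Q F := by unfold avg; field_simp
      rw [e]
      have e2 : ∀ x : ℕ, a + Q + (x:ℤ) = a + ((Q + x : ℕ) : ℤ) := by intro x; push_cast; ring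
      simp only [e2] at this
      push_cast at this ⊢
      convert this using 2
      ring

theorem equi (S : Finset ℕ) (hS : ∀ q ∈ S, q.Prime) (h : ℕ → ℤ → ℝ)
    (hper : ∀ q ∈ S, ∀ n, h q (n + q) = h q n) (h1 : ∀ q ∈ S, ∀ n, |h q n| ≤ 1)
    (a : ℤ) (n : ℕ) :
    |∑ m ∈ Ioc a (a + n), ∏ q ∈ S, h q m - n * ∏ q ∈ S, avg q (h q)|
      ≤ 2 * ∏ q ∈ S, (q:ℝ) := by
  rw [sum_Ioc_range (fun m => ∏ q ∈ S, h q m)]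
  have := equi_aux (F := fun m => ∏ q ∈ S, h q m) (Q := ∏ q ∈ S, q)
    (Finset.prod_pos fun r hr => (hS r hr).pos) (prod_per S h hper) (fun m => by
      rw [Finset.abs_prod]
      exact Finset.prod_le_one (fun _ _ => abs_nonneg _) fun q hq => h1 q hq m) n (a+1)
  have e : avg (∏ q ∈ S, q) (fun m => ∏ q ∈ S, h q m) = ∏ q ∈ S, avg q (h q) := by
    unfold avg
    rw [prod_sum S hS h hper, Finset.prod_div_distrib]
    push_cast; rfl
  rw [e] at this
  push_cast at this
  exact this

end Equi

open Finset

section Bonf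

/-- elementary symmetric sums -/
noncomputable def es (x : ℕ → ℝ) (S : Finset ℕ) (j : ℕ) : ℝ :=
  ∑ A ∈ S.powersetCard j, ∏ q ∈ A, x q

lemma es_zero (x : ℕ → ℝ) (S : Finset ℕ) : es x S 0 = 1 := by simp [es]

lemma es_empty_succ (x : ℕ → ℝ) (j : ℕ) : es x ∅ (j+1) = 0 := by
  unfold es
  rw [Finset.powersetCard_eq_empty.2 (by simp)]; simp

lemma es_succ_insert (x : ℕ → ℝ) {S : Finset ℕ} {q : ℕ} (hq : q ∉ S) (j : ℕ) :
    es x (insert q S) (j+1) = es x S (j+1) + x q * es x S j := by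
  unfold es
  rw [Finset.powersetCard_succ_insert hq, Finset.sum_union]
  · congr 1
    rw [Finset.sum_image, Finset.mul_sum]
    · refine Finset.sum_congr rfl fun A hA => ?_
      have := (Finset.mem_powersetCard.1 hA).1
      rw [Finset.prod_insert fun h => hq (this h)]
    · intro A hA A' hA' h
      have h1 := (Finset.mem_powersetCard.1 hA).1
      have h2 := (Finset.mem_powersetCard.1 hA').1
      have e1 := Finset.erase_insert (fun h => hq (h1 h))
      have e2 := Finset.erase_insert (fun h => hq (h2 h))
      rw [← e1, ← e2]
      exact congrArg (fun z => z.erase q) h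
  · rw [Finset.disjoint_left]
    intro A hA hA'
    obtain ⟨A', _, rfl⟩ := Finset.mem_image.1 hA'
    exact hq ((Finset.mem_powersetCard.1 hA).1 (Finset.mem_insert_self _ _))

lemma es_nonneg {x : ℕ → ℝ} {S : Finset ℕ} (hx : ∀ q ∈ S, 0 ≤ x q) (j : ℕ) : 0 ≤ es x S j :=
  Finset.sum_nonneg fun A hA => Finset.prod_nonneg fun q hq =>
    hx q ((Finset.mem_powersetCard.1 hA).1 hq)

lemma add_pow_ge {s x : ℝ} (hs : 0 ≤ s) (hx : 0 ≤ x) (J : ℕ) :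
    s ^ (J+1) + (J+1) * x * s ^ J ≤ (s + x) ^ (J+1) := by
  induction J with
  | zero => simp
  | succ J ih =>
    have h := mul_le_mul_of_nonneg_right ih (add_nonneg hs hx)
    have h1 : 0 ≤ (J+1) * x * s ^ J * x := by positivity
    rw [pow_succ (s+x)]
    push_cast
    have e : s ^ (J+1+1) + ((J:ℝ)+1+1) * x * s ^ (J+1) + (J+1) * x * s ^ J * x
      = (s ^ (J+1) + (J+1) * x * s ^ J) * (s + x) := by ring
    linarith

lemma es_le {x : ℕ → ℝ} {S : Finset ℕ} (hx : ∀ q ∈ S, 0 ≤ x q) (J : ℕ) :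
    es x S J * J.factorial ≤ (∑ q ∈ S, x q) ^ J := by
  induction S using Finset.induction_on generalizing J with
  | empty =>
    cases J with
    | zero => simp [es_zero]
    | succ J => simp [es_empty_succ]
  | insert q S hq ih =>
    have hx' : ∀ r ∈ S, 0 ≤ x r := fun r hr => hx r (Finset.mem_insert_of_mem hr)
    have hxq := hx q (Finset.mem_insert_self _ _)
    cases J with
    | zero => simp [es_zero]
    | succ J =>
      rw [es_succ_insert x hq, Finset.sum_insert hq, add_comm (x q)]
      have h1 := ih hx' (J+1)
      have h2 := ih hx' J
      have h3 := add_pow_ge (Finset.sum_nonneg hx') hxq J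
      have h4 : ((J:ℝ)+1) * x q * (es x S J * J.factorial)
          ≤ (J+1) * x q * (∑ r ∈ S, x r) ^ J := mul_le_mul_of_nonneg_left h2 (by positivity)
      rw [Nat.factorial_succ] at *
      push_cast at *
      nlinarith

lemma bonf {x : ℕ → ℝ} {S : Finset ℕ} (hx : ∀ q ∈ S, 0 ≤ x q ∧ x q ≤ 1) (J : ℕ) :
    |∏ q ∈ S, (1 - x q) - ∑ j ∈ range J, (-1) ^ j * es x S j| ≤ es x S J := by
  induction S using Finset.induction_on generalizing J with
  | empty =>
    cases J with
    | zero => simp [es_zero]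
    | succ J =>
      rw [Finset.sum_range_succ']
      simp [es_empty_succ, es_zero]
  | insert q S hq ih =>
    have hx' : ∀ r ∈ S, 0 ≤ x r ∧ x r ≤ 1 := fun r hr => hx r (Finset.mem_insert_of_mem hr)
    have hxq := hx q (Finset.mem_insert_self _ _)
    cases J with
    | zero =>
      simp only [Finset.range_zero, Finset.sum_empty, sub_zero, es_zero]
      rw [Finset.abs_prod]
      refine Finset.prod_le_one (fun _ _ => abs_nonneg _) fun r hr => ?_
      have := hx r hr
      rw [abs_le]; constructor <;> linarith
    | succ J =>
      rw [es_succ_insert x hq, Finset.prod_insert hq]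
      have h1 := ih hx' (J+1)
      have h2 := ih hx' J
      have e : ∑ j ∈ range (J+1), (-1:ℝ) ^ j * es x (insert q S) j
          = ∑ j ∈ range (J+1), (-1:ℝ) ^ j * es x S j
            - x q * ∑ j ∈ range J, (-1:ℝ) ^ j * es x S j := by
        rw [Finset.sum_range_succ', Finset.sum_range_succ' (fun j => (-1:ℝ) ^ j * es x S j),
          Finset.mul_sum]
        simp only [es_zero, es_succ_insert x hq]
        rw [add_sub_right_comm, ← Finset.sum_sub_distrib]
        congr 1
        refine Finset.sum_congr rfl fun j _ => ?_
        ring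
      rw [e]
      set A := ∏ r ∈ S, (1 - x r)
      set B1 := ∑ j ∈ range (J+1), (-1:ℝ) ^ j * es x S j
      set B2 := ∑ j ∈ range J, (-1:ℝ) ^ j * es x S j
      calc |(1 - x q) * A - (B1 - x q * B2)| = |(A - B1) - x q * (A - B2)| := by ring_nf
        _ ≤ |A - B1| + |x q * (A - B2)| := abs_sub _ _
        _ ≤ _ := by
          rw [abs_mul, abs_of_nonneg hxq.1]
          have := mul_le_mul_of_nonneg_left h2 hxq.1
          linarith

/-- Equidistribution with a mask. -/
theorem equi_mask (S0 S : Finset ℕ) (hS0 : ∀ q ∈ S0, q.Prime) (hS : ∀ q ∈ S, q.Prime)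
    (hdis : Disjoint S0 S) (h x : ℕ → ℤ → ℝ)
    (hper : ∀ q ∈ S0, ∀ n, h q (n + q) = h q n) (h1 : ∀ q ∈ S0, ∀ n, |h q n| ≤ 1)
    (xper : ∀ q ∈ S, ∀ n, x q (n + q) = x q n) (hx : ∀ q ∈ S, ∀ n, 0 ≤ x q n ∧ x q n ≤ 1)
    (a : ℤ) (n J : ℕ) :
    |∑ m ∈ Ioc a (a + n), (∏ q ∈ S0, h q m) * ∏ q ∈ S, (1 - x q m)|
      ≤ n * (|∏ q ∈ S0, avg q (h q)|
          + 2 * (∏ q ∈ S0, avg q (fun m => |h q m|)) * es (fun q => avg q (x q)) S J)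
        + 2 * (∏ q ∈ S0, (q:ℝ)) * ∑ j ∈ range (J+1), es (fun q => (q:ℝ)) S j := by
  set γ : ℕ → ℝ := fun q => avg q (x q) with hγ
  have hγ0 : ∀ q ∈ S, 0 ≤ γ q ∧ γ q ≤ 1 := by
    intro q hq
    have hq0 : (0:ℝ) < q := by exact_mod_cast (hS q hq).pos
    constructor
    · exact div_nonneg (Finset.sum_nonneg fun r _ => (hx q hq r).1) hq0.le
    · simp only [hγ, avg]
      rw [div_le_one hq0]
      calc _ ≤ ∑ r ∈ range q, (1:ℝ) := Finset.sum_le_sum fun r _ => (hx q hq r).2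
        _ = q := by simp
  -- general equidistribution for H * es
  have gen : ∀ (k : ℕ → ℤ → ℝ) (_ : ∀ q ∈ S0, ∀ n, k q (n + q) = k q n)
      (_ : ∀ q ∈ S0, ∀ n, |k q n| ≤ 1) (j : ℕ),
      |∑ m ∈ Ioc a (a + n), (∏ q ∈ S0, k q m) * es (fun q => x q m) S j
        - n * ((∏ q ∈ S0, avg q (k q)) * es γ S j)|
      ≤ 2 * (∏ q ∈ S0, (q:ℝ)) * es (fun q => (q:ℝ)) S j := by
    intro k kper k1 j
    unfold es
    simp only [Finset.mul_sum]
    rw [Finset.sum_comm, ← Finset.sum_sub_distrib]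
    refine (Finset.abs_sum_le_sum_abs _ _).trans ?_
    refine Finset.sum_le_sum fun A hA => ?_
    have hAS := (Finset.mem_powersetCard.1 hA).1
    have hd : Disjoint S0 A := Finset.disjoint_of_subset_right hAS hdis
    have key := equi (S0 ∪ A) (by
        intro q hq
        rcases Finset.mem_union.1 hq with hq | hq
        · exact hS0 q hq
        · exact hS q (hAS hq)) (fun q m => if q ∈ S0 then k q m else x q m) (by
        intro q hq m
        by_cases h0 : q ∈ S0
        · simp only [if_pos h0]; exact kper q h0 m
        · simp only [if_neg h0]
          exact xper q (hAS ((Finset.mem_union.1 hq).resolve_left h0)) m) (by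
        intro q hq m
        by_cases h0 : q ∈ S0
        · simp only [if_pos h0]; exact k1 q h0 m
        · simp only [if_neg h0]
          have := hx q (hAS ((Finset.mem_union.1 hq).resolve_left h0)) m
          rw [abs_le]; constructor <;> linarith) a n
    rw [Finset.prod_union hd, Finset.prod_union hd] at key
    simp only [Finset.prod_union hd] at key
    have hn : ∀ q ∈ A, q ∉ S0 := fun q hq h0 => Finset.disjoint_left.1 hd h0 hq
    have c1 : ∀ m, ∏ q ∈ S0, (if q ∈ S0 then k q m else x q m) = ∏ q ∈ S0, k q m :=
      fun m => Finset.prod_congr rfl fun q hq => if_pos hq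
    have c2 : ∀ m, ∏ q ∈ A, (if q ∈ S0 then k q m else x q m) = ∏ q ∈ A, x q m :=
      fun m => Finset.prod_congr rfl fun q hq => if_neg (hn q hq)
    have c3 : ∏ q ∈ S0, avg q (fun m => if q ∈ S0 then k q m else x q m)
        = ∏ q ∈ S0, avg q (k q) :=
      Finset.prod_congr rfl fun q hq => by simp only [if_pos hq]
    have c4 : ∏ q ∈ A, avg q (fun m => if q ∈ S0 then k q m else x q m)
        = ∏ q ∈ A, γ q :=
      Finset.prod_congr rfl fun q hq => by simp only [if_neg (hn q hq)]; rfl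
    simp only [c1, c2, c3, c4] at key
    refine key.trans (le_of_eq ?_)
    rw [mul_assoc]
  set H := ∏ q ∈ S0, avg q (h q) with hH
  set H1 := ∏ q ∈ S0, avg q (fun m => |h q m|) with hH1
  set Q := ∏ q ∈ S0, (q:ℝ) with hQ
  have hH1n : 0 ≤ H1 := Finset.prod_nonneg fun q _ =>
    div_nonneg (Finset.sum_nonneg fun _ _ => abs_nonneg _) (by positivity)
  have hHH1 : |H| ≤ H1 := by
    rw [hH, Finset.abs_prod]
    refine Finset.prod_le_prod (fun _ _ => abs_nonneg _) fun q _ => ?_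
    unfold avg
    rw [abs_div, Nat.abs_cast]
    gcongr
    exact Finset.abs_sum_le_sum_abs _ _
  -- decompose
  have dec : ∑ m ∈ Ioc a (a + n), (∏ q ∈ S0, h q m) * ∏ q ∈ S, (1 - x q m)
      = ∑ m ∈ Ioc a (a + n), (∏ q ∈ S0, h q m) * (∏ q ∈ S, (1 - x q m)
          - ∑ j ∈ range J, (-1) ^ j * es (fun q => x q m) S j)
        + ∑ j ∈ range J, (-1) ^ j * (∑ m ∈ Ioc a (a + n),
            (∏ q ∈ S0, h q m) * es (fun q => x q m) S j
            - n * (H * es γ S j))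
        + n * (H * ∑ j ∈ range J, (-1) ^ j * es γ S j) := by
    have e1 : ∑ j ∈ range J, (-1:ℝ) ^ j * (∑ m ∈ Ioc a (a + n),
            (∏ q ∈ S0, h q m) * es (fun q => x q m) S j)
        = ∑ m ∈ Ioc a (a + n), (∏ q ∈ S0, h q m) *
            ∑ j ∈ range J, (-1:ℝ) ^ j * es (fun q => x q m) S j := by
      simp only [Finset.mul_sum]
      rw [Finset.sum_comm]
      refine Finset.sum_congr rfl fun m _ => Finset.sum_congr rfl fun j _ => by ring
    have e2 : ∑ j ∈ range J, (-1:ℝ) ^ j * ((n:ℝ) * (H * es γ S j))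
        = n * (H * ∑ j ∈ range J, (-1) ^ j * es γ S j) := by
      simp only [Finset.mul_sum]
      exact Finset.sum_congr rfl fun j _ => by ring
    simp only [mul_sub, Finset.sum_sub_distrib, e1, e2]
    ring
  rw [dec]
  have b1 : |∑ m ∈ Ioc a (a + n), (∏ q ∈ S0, h q m) * (∏ q ∈ S, (1 - x q m)
          - ∑ j ∈ range J, (-1) ^ j * es (fun q => x q m) S j)|
      ≤ n * (H1 * es γ S J) + 2 * Q * es (fun q => (q:ℝ)) S J := by
    have g := gen (fun q m => |h q m|) (fun q hq m => by rw [hper q hq])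
      (fun q hq m => by rw [abs_abs]; exact h1 q hq m) J
    have g' := (abs_le.1 g).2
    refine (Finset.abs_sum_le_sum_abs _ _).trans ?_
    have : ∑ m ∈ Ioc a (a + n), |(∏ q ∈ S0, h q m) * (∏ q ∈ S, (1 - x q m)
          - ∑ j ∈ range J, (-1) ^ j * es (fun q => x q m) S j)|
        ≤ ∑ m ∈ Ioc a (a + n), (∏ q ∈ S0, |h q m|) * es (fun q => x q m) S J := by
      refine Finset.sum_le_sum fun m _ => ?_
      rw [abs_mul, Finset.abs_prod]
      exact mul_le_mul_of_nonneg_left (bonf (fun q hq => hx q hq m) J)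
        (Finset.prod_nonneg fun _ _ => abs_nonneg _)
    linarith
  have b2 : |∑ j ∈ range J, (-1) ^ j * (∑ m ∈ Ioc a (a + n),
            (∏ q ∈ S0, h q m) * es (fun q => x q m) S j - n * (H * es γ S j))|
      ≤ 2 * Q * ∑ j ∈ range J, es (fun q => (q:ℝ)) S j := by
    refine (Finset.abs_sum_le_sum_abs _ _).trans ?_
    rw [Finset.mul_sum]
    refine Finset.sum_le_sum fun j _ => ?_
    rw [abs_mul, abs_pow, abs_neg, abs_one, one_pow, one_mul]
    exact gen h hper h1 j
  have b3 : |(n:ℝ) * (H * ∑ j ∈ range J, (-1) ^ j * es γ S j)|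
      ≤ n * (|H| + H1 * es γ S J) := by
    rw [abs_mul, Nat.abs_cast, abs_mul]
    refine mul_le_mul_of_nonneg_left ?_ (by positivity)
    have hb := bonf hγ0 J
    have hp0 : 0 ≤ ∏ q ∈ S, (1 - γ q) :=
      Finset.prod_nonneg fun q hq => by linarith [(hγ0 q hq).2]
    have hp1 : ∏ q ∈ S, (1 - γ q) ≤ 1 :=
      Finset.prod_le_one (fun q hq => by linarith [(hγ0 q hq).2])
        (fun q hq => by linarith [(hγ0 q hq).1])
    have he : 0 ≤ es γ S J := es_nonneg (fun q hq => (hγ0 q hq).1) J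
    have : |∑ j ∈ range J, (-1) ^ j * es γ S j| ≤ 1 + es γ S J := by
      have := abs_le.1 hb
      rw [abs_le]; constructor <;> linarith
    calc _ ≤ |H| * (1 + es γ S J) := mul_le_mul_of_nonneg_left this (abs_nonneg _)
      _ ≤ _ := by nlinarith
  rw [Finset.sum_range_succ, mul_add (2 * Q)]
  refine (abs_add_three _ _ _).trans ?_
  linarith

end Bonf

open Finset

section Kern

/-- signed prime letters -/
abbrev Lt (P : Finset ℕ) := {p // p ∈ P} × Bool

variable {P : Finset ℕ}

def stp (s : Lt P) : ℤ := if s.2 then (s.1.1 : ℤ) else -(s.1.1 : ℤ)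

noncomputable def lit (p : ℕ) (n : ℤ) : ℝ := (if (p:ℤ) ∣ n then 1 else 0) - 1 / (p:ℝ)

noncomputable def al (φ : ℤ → ℝ) (s : Lt P) (n : ℤ) : ℝ :=
  φ n * lit s.1.1 n * φ (n + stp s)

lemma dvd_stp (s : Lt P) : (s.1.1 : ℤ) ∣ stp s := by
  unfold stp; split_ifs <;> simp

lemma lit_congr {p : ℕ} {n m : ℤ} (h : (p:ℤ) ∣ m - n) : lit p m = lit p n := by
  unfold lit
  have : (p:ℤ) ∣ m ↔ (p:ℤ) ∣ n := by
    rw [show m = n + (m - n) by ring]; exact dvd_add_left h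
  simp only [this]

lemma lit_stp (s : Lt P) (n : ℤ) : lit s.1.1 (n + stp s) = lit s.1.1 n :=
  lit_congr (by simpa using dvd_stp s)

def flipL (s : Lt P) : Lt P := (s.1, !s.2)

lemma stp_flip (s : Lt P) : stp (flipL s) = - stp s := by
  unfold stp flipL; cases h : s.2 <;> simp

lemma flipL_flipL (s : Lt P) : flipL (flipL s) = s := by
  unfold flipL; simp

lemma al_flip (φ : ℤ → ℝ) (s : Lt P) (n : ℤ) : al φ (flipL s) (n + stp s) = al φ s n := by
  unfold al
  rw [stp_flip]
  have : lit (flipL s).1.1 (n + stp s) = lit s.1.1 n := lit_stp s n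
  rw [this, show n + stp s + -stp s = n by ring]; ring

lemma abs_lit_le {p : ℕ} (hp : p.Prime) (n : ℤ) : |lit p n| ≤ 1 := by
  have h1 : (1:ℝ) ≤ p := by exact_mod_cast hp.one_le
  have h2 : 1 / (p:ℝ) ≤ 1 := by rw [div_le_one (by linarith)]; exact h1
  have h3 : 0 ≤ 1 / (p:ℝ) := by positivity
  unfold lit
  rw [abs_le]; split_ifs <;> constructor <;> linarith

lemma abs_lit_le2 (p : ℕ) (n : ℤ) :
    |lit p n| ≤ (if (p:ℤ) ∣ n then 1 else 0) + 1 / (p:ℝ) := by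
  have h3 : 0 ≤ 1 / (p:ℝ) := by positivity
  unfold lit
  rw [abs_le]; split_ifs <;> constructor <;> linarith

/-- one-prime operator -/
noncomputable def aop (φ : ℤ → ℝ) (p : {p // p ∈ P}) : (ℤ → ℝ) →ₗ[ℝ] (ℤ → ℝ) where
  toFun x := fun n => ∑ σ : Bool, al φ (p, σ) n * x (n + stp (P := P) (p, σ))
  map_add' x y := by ext n; simp [mul_add, add_add_add_comm]
  map_smul' c x := by ext n; simp; ring

/-- bilinear form on an interval -/
noncomputable def BI (I : Finset ℤ) : (ℤ → ℝ) →ₗ[ℝ] (ℤ → ℝ) →ₗ[ℝ] ℝ :=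
  LinearMap.mk₂ ℝ (fun f g => ∑ n ∈ I, f n * g n)
    (by intros; simp [add_mul, Finset.sum_add_distrib])
    (by intros; simp [Finset.mul_sum, mul_assoc])
    (by intros; simp [mul_add, Finset.sum_add_distrib])
    (by intros; simp only [Pi.smul_apply, smul_eq_mul, Finset.mul_sum]
        exact Finset.sum_congr rfl fun _ _ => by ring)

lemma BI_apply (I : Finset ℤ) (f g : ℤ → ℝ) : BI I f g = ∑ n ∈ I, f n * g n := rfl

lemma BI_nonneg (I : Finset ℤ) (f : ℤ → ℝ) : 0 ≤ BI I f f :=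
  Finset.sum_nonneg fun _ _ => mul_self_nonneg _

lemma BI_comm (I : Finset ℤ) (f g : ℤ → ℝ) : BI I f g = BI I g f :=
  Finset.sum_congr rfl fun _ _ => mul_comm _ _

lemma shift_sum (I : Finset ℤ) (c : ℤ) (F : ℤ → ℝ)
    (h : ∀ n, F n ≠ 0 → n ∈ I ∧ n + c ∈ I) :
    ∑ n ∈ I, F n = ∑ m ∈ I, F (m - c) := by
  refine Finset.sum_bij_ne_zero (fun n _ _ => n + c) ?_ ?_ ?_ ?_
  · intro n _ hn; exact (h n hn).2
  · intro a _ _ b _ _ hab; exact add_right_cancel hab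
  · intro m _ hm'
    have := h _ hm'
    exact ⟨m - c, this.1, hm', by ring⟩
  · intro n _ _; rw [add_sub_cancel_right]

/-- The number of primes of P dividing n. -/
def om (P : Finset ℕ) (n : ℤ) : ℕ := (P.filter fun p : ℕ => (p:ℤ) ∣ n).card

structure Mask (P : Finset ℕ) (I : Finset ℤ) (L : ℝ) (φ : ℤ → ℝ) : Prop where
  prime : ∀ p ∈ P, p.Prime
  nonneg : ∀ n, 0 ≤ φ n
  le_one : ∀ n, φ n ≤ 1
  supp : ∀ n, n ∉ I → φ n = 0
  mul_om : ∀ n, φ n * om P n ≤ L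
  sum_le : ∑ p ∈ P, 1 / (p:ℝ) ≤ L
  one_le : 1 ≤ L

variable {I : Finset ℤ} {L : ℝ} {φ : ℤ → ℝ}

lemma sum_lit_le (hM : Mask P I L φ) (n : ℤ) :
    φ n * ∑ p : {p // p ∈ P}, |lit p.1 n| ≤ 2 * L := by
  have h1 : ∑ p : {p // p ∈ P}, |lit p.1 n| ≤ om P n + L := by
    rw [Finset.sum_coe_sort P (fun p => |lit p n|)]
    calc _ ≤ ∑ p ∈ P, ((if (p:ℤ) ∣ n then (1:ℝ) else 0) + 1 / (p:ℝ)) :=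
          Finset.sum_le_sum fun p _ => abs_lit_le2 p n
      _ = om P n + ∑ p ∈ P, 1 / (p:ℝ) := by
          rw [Finset.sum_add_distrib]; simp [om, Finset.sum_ite]
      _ ≤ _ := by linarith [hM.sum_le]
  have h2 := mul_le_mul_of_nonneg_left h1 (hM.nonneg n)
  have h3 := hM.mul_om n
  have h4 : φ n * L ≤ L := mul_le_of_le_one_left (by linarith [hM.one_le]) (hM.le_one n)
  linarith

lemma al_abs_le_right (hM : Mask P I L φ) (s : Lt P) (n : ℤ) :
    |al φ s n| ≤ φ (n + stp s) * |lit s.1.1 (n + stp s)| := by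
  unfold al
  rw [abs_mul, abs_mul, abs_of_nonneg (hM.nonneg _), abs_of_nonneg (hM.nonneg _), lit_stp]
  have := mul_le_of_le_one_left (mul_nonneg (abs_nonneg (lit s.1.1 n)) (hM.nonneg (n + stp s)))
    (hM.le_one n)
  linarith

lemma al_abs_le_left (hM : Mask P I L φ) (s : Lt P) (n : ℤ) :
    |al φ s n| ≤ φ n * |lit s.1.1 n| := by
  unfold al
  rw [abs_mul, abs_mul, abs_of_nonneg (hM.nonneg _), abs_of_nonneg (hM.nonneg _)]
  exact mul_le_of_le_one_right (mul_nonneg (hM.nonneg n) (abs_nonneg _)) (hM.le_one _)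

lemma al_abs_le_one (hM : Mask P I L φ) (s : Lt P) (n : ℤ) : |al φ s n| ≤ 1 := by
  refine (al_abs_le_left hM s n).trans ?_
  exact mul_le_one₀ (hM.le_one n) (abs_nonneg _) (abs_lit_le (hM.prime _ s.1.2) n)

lemma al_ne_zero (hM : Mask P I L φ) {s : Lt P} {n : ℤ} (h : al φ s n ≠ 0) :
    n ∈ I ∧ n + stp s ∈ I := by
  constructor
  · by_contra h1; exact h (by simp [al, hM.supp n h1])
  · by_contra h1; exact h (by simp [al, hM.supp _ h1])

lemma row_sum_le (hM : Mask P I L φ) (n : ℤ) : ∑ s : Lt P, |al φ s n| ≤ 4 * L := by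
  calc ∑ s : Lt P, |al φ s n| ≤ ∑ s : Lt P, φ n * |lit s.1.1 n| :=
        Finset.sum_le_sum fun s _ => al_abs_le_left hM s n
    _ = 2 * (φ n * ∑ p : {p // p ∈ P}, |lit p.1 n|) := by
        rw [Fintype.sum_prod_type]
        simp [Finset.mul_sum]
    _ ≤ _ := by linarith [sum_lit_le hM n]

lemma shift_sum_le (s : Lt P) (hM : Mask P I L φ) (F : ℤ → ℝ) :
    ∑ n ∈ I, |al φ s n| * F (n + stp s) = ∑ m ∈ I, |al φ s (m - stp s)| * F m := by
  rw [shift_sum I (stp s)]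
  · simp
  · intro n hn
    have : al φ s n ≠ 0 := by
      intro h; apply hn; simp [h]
    exact al_ne_zero hM this

/-- column sums -/
lemma col_sum_le (hM : Mask P I L φ) (G : ℤ → ℝ) (hG : ∀ n, 0 ≤ G n) :
    ∑ n ∈ I, ∑ s : Lt P, |al φ s n| * G (n + stp s) ≤ 4 * L * ∑ n ∈ I, G n := by
  rw [Finset.sum_comm]
  simp only [fun s => shift_sum_le (I := I) s hM G]
  rw [Finset.sum_comm, Finset.mul_sum]
  refine Finset.sum_le_sum fun m _ => ?_
  rw [← Finset.sum_mul]
  refine mul_le_mul_of_nonneg_right ?_ (hG m)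
  calc ∑ s : Lt P, |al φ s (m - stp s)| ≤ ∑ s : Lt P, φ m * |lit s.1.1 m| :=
        Finset.sum_le_sum fun s _ => by
          have := al_abs_le_right hM s (m - stp s)
          simpa using this
    _ = 2 * (φ m * ∑ p : {p // p ∈ P}, |lit p.1 m|) := by
        rw [Fintype.sum_prod_type]
        simp [Finset.mul_sum]
    _ ≤ _ := by linarith [sum_lit_le hM m]

lemma aop_sym (hM : Mask P I L φ) (p : {p // p ∈ P}) (x y : ℤ → ℝ) :
    BI I (aop φ p x) y = BI I x (aop φ p y) := by
  simp only [BI_apply, aop, LinearMap.coe_mk, AddHom.coe_mk, Finset.sum_mul, Finset.mul_sum]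
  rw [Finset.sum_comm, Finset.sum_comm (s := I)]
  have : ∀ σ : Bool, ∑ n ∈ I, al φ (p, σ) n * x (n + stp (p, σ)) * y n
      = ∑ m ∈ I, x m * (al φ (p, !σ) m * y (m + stp (p, !σ))) := by
    intro σ
    rw [shift_sum I (stp (p, σ))]
    · refine Finset.sum_congr rfl fun m _ => ?_
      have h1 := al_flip φ (p, σ) (m - stp (p, σ))
      have h2 := stp_flip (p, σ)
      simp only [flipL] at h1 h2
      rw [sub_add_cancel] at h1 ⊢
      rw [h2, ← h1, ← sub_eq_add_neg]; ring
    · intro n hn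
      exact al_ne_zero hM (left_ne_zero_of_mul (left_ne_zero_of_mul hn))
  simp only [this]
  exact Fintype.sum_equiv Equiv.boolNot _ _ (fun σ => rfl)

lemma aop_sq_le (x : ℤ → ℝ) (p : {p // p ∈ P}) (n : ℤ) :
    aop φ p x n * aop φ p x n ≤
      2 * ∑ σ : Bool, |al φ (p, σ) n| ^ 2 * x (n + stp (P := P) (p, σ)) ^ 2 := by
  simp only [aop, LinearMap.coe_mk, AddHom.coe_mk, Fintype.sum_bool, sq_abs]
  nlinarith [sq_nonneg (al φ (p, true) n * x (n + stp (P := P) (p, true))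
    - al φ (p, false) n * x (n + stp (P := P) (p, false)))]

lemma aop_norm (hM : Mask P I L φ) (p : {p // p ∈ P}) (x : ℤ → ℝ) :
    BI I (aop φ p x) (aop φ p x) ≤ 4 * BI I x x := by
  simp only [BI_apply]
  calc ∑ n ∈ I, aop φ p x n * aop φ p x n
      ≤ ∑ n ∈ I, 2 * ∑ σ : Bool, |al φ (p, σ) n| * x (n + stp (P := P) (p, σ)) ^ 2 := by
        refine Finset.sum_le_sum fun n _ => (aop_sq_le x p n).trans ?_
        refine mul_le_mul_of_nonneg_left (Finset.sum_le_sum fun σ _ => ?_) (by norm_num)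
        refine mul_le_mul_of_nonneg_right ?_ (sq_nonneg _)
        exact pow_le_of_le_one (abs_nonneg _) (al_abs_le_one hM _ _) (by norm_num)
    _ = 2 * ∑ σ : Bool, ∑ n ∈ I, |al φ (p, σ) n| * x (n + stp (P := P) (p, σ)) ^ 2 := by
        rw [← Finset.mul_sum, Finset.sum_comm]
    _ = 2 * ∑ σ : Bool, ∑ m ∈ I, |al φ (p, σ) (m - stp (p, σ))| * x m ^ 2 := by
        simp only [fun σ => shift_sum_le (I := I) (p, σ) hM (fun m => x m ^ 2)]
    _ ≤ 2 * ∑ σ : Bool, ∑ m ∈ I, x m * x m := by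
        refine mul_le_mul_of_nonneg_left (Finset.sum_le_sum fun σ _ =>
          Finset.sum_le_sum fun m _ => ?_) (by norm_num)
        rw [← sq]
        exact mul_le_of_le_one_left (sq_nonneg _) (al_abs_le_one hM _ _)
    _ = _ := by simp; ring

lemma aop_sum_norm (hM : Mask P I L φ) (x : ℤ → ℝ) :
    ∑ p : {p // p ∈ P}, BI I (aop φ p x) (aop φ p x) ≤ 8 * L * BI I x x := by
  simp only [BI_apply]
  calc ∑ p : {p // p ∈ P}, ∑ n ∈ I, aop φ p x n * aop φ p x n
      ≤ ∑ p : {p // p ∈ P}, ∑ n ∈ I, 2 * ∑ σ : Bool,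
          |al φ (p, σ) n| * x (n + stp (P := P) (p, σ)) ^ 2 := by
        refine Finset.sum_le_sum fun p _ => ?_
        refine Finset.sum_le_sum fun n _ => (aop_sq_le x p n).trans ?_
        refine mul_le_mul_of_nonneg_left (Finset.sum_le_sum fun σ _ => ?_) (by norm_num)
        refine mul_le_mul_of_nonneg_right ?_ (sq_nonneg _)
        exact pow_le_of_le_one (abs_nonneg _) (al_abs_le_one hM _ _) (by norm_num)
    _ = 2 * ∑ n ∈ I, ∑ s : Lt P, |al φ s n| * x (n + stp s) ^ 2 := by
        rw [Finset.sum_comm, Finset.mul_sum]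
        refine Finset.sum_congr rfl fun n _ => ?_
        rw [Fintype.sum_prod_type, Finset.mul_sum]
    _ ≤ 2 * (4 * L * ∑ n ∈ I, x n ^ 2) := by
        linarith [col_sum_le hM (fun n => x n ^ 2) (fun n => sq_nonneg _)]
    _ = _ := by simp only [sq]; ring

end Kern

open Finset

section Words

variable {P : Finset ℕ} {I : Finset ℤ} {L : ℝ} {φ : ℤ → ℝ} {g : ℕ}

/-- initial sums of a finite sequence of integers -/
def psum (d : Fin g → ℤ) (i : ℕ) : ℤ := ∑ j : Fin g, if j.1 < i then d j else 0

lemma psum_zero (d : Fin g → ℤ) : psum d 0 = 0 := by simp [psum]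

lemma psum_finCons (s : ℤ) (d : Fin g → ℤ) (i : ℕ) :
    psum (Fin.cons s d : Fin (g+1) → ℤ) (i+1) = s + psum d i := by
  unfold psum
  rw [Fin.sum_univ_succ]; simp

lemma psum_succ (d : Fin g → ℤ) (i : Fin g) : psum d (i.1+1) = psum d i.1 + d i := by
  unfold psum
  have : ∀ j : Fin g, (if j.1 < i.1 + 1 then d j else 0)
      = (if j.1 < i.1 then d j else 0) + (if j = i then d j else 0) := by
    intro j
    by_cases h : j = i
    · subst h; simp
    · have : j.1 ≠ i.1 := fun e => h (Fin.ext e)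
      by_cases h2 : j.1 < i.1
      · simp [h, h2, show j.1 < i.1 + 1 by omega]
      · simp [h, h2, show ¬ j.1 < i.1 + 1 by omega]
  simp only [this, Finset.sum_add_distrib]
  simp

lemma psum_full (d : Fin g → ℤ) {i : ℕ} (hi : g ≤ i) : psum d i = ∑ j, d j := by
  unfold psum
  exact Finset.sum_congr rfl fun j _ => if_pos (by omega)

/-- node positions of a word -/
def pos (w : Fin g → Lt P) (i : ℕ) : ℤ := psum (fun j => stp (w j)) i

lemma pos_zero (w : Fin g → Lt P) : pos w 0 = 0 := psum_zero _

lemma pos_cons (s : Lt P) (w : Fin g → Lt P) (i : ℕ) :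
    pos (Fin.cons s w : Fin (g+1) → Lt P) (i+1) = stp s + pos w i := by
  unfold pos
  rw [← psum_finCons]
  congr 1
  ext j; refine Fin.cases ?_ (fun j => ?_) j <;> simp

lemma pos_succ (w : Fin g → Lt P) (i : Fin g) : pos w (i.1+1) = pos w i.1 + stp (w i) :=
  psum_succ _ _

noncomputable def wt (φ : ℤ → ℝ) (w : Fin g → Lt P) (n : ℤ) : ℝ :=
  ∏ i : Fin g, al φ (w i) (n + pos w i.1)

lemma wt_cons (s : Lt P) (w : Fin g → Lt P) (n : ℤ) :
    wt φ (Fin.cons s w : Fin (g+1) → Lt P) n = al φ s n * wt φ w (n + stp s) := by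
  unfold wt
  rw [Fin.prod_univ_succ]
  simp only [Fin.cons_zero, Fin.cons_succ, Fin.val_zero, pos_zero, add_zero, Fin.val_succ,
    pos_cons, add_assoc]

def revw (w : Fin g → Lt P) : Fin g → Lt P := fun i => flipL (w (Fin.rev i))

lemma revw_revw (w : Fin g → Lt P) : revw (revw w) = w := by
  ext i : 1; simp [revw, flipL_flipL]

lemma pos_revw (w : Fin g → Lt P) (i : ℕ) (hi : i ≤ g) :
    pos (revw w) i = pos w (g - i) - pos w g := by
  induction i with
  | zero => simp [pos_zero]
  | succ i ih =>
    have h1 := pos_succ (revw w) ⟨i, by omega⟩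
    have h2 := pos_succ w (Fin.rev ⟨i, by omega⟩)
    simp only [Fin.val_rev] at h1 h2
    rw [h1, ih (by omega)]
    rw [show g - (i+1) + 1 = g - i by omega] at h2
    rw [h2]
    simp only [revw, stp_flip]
    ring

lemma wt_revw (w : Fin g → Lt P) (n : ℤ) : wt φ (revw w) (n + pos w g) = wt φ w n := by
  unfold wt
  refine Fintype.prod_equiv Fin.revPerm _ _ fun i => ?_
  simp only [Fin.revPerm_apply]
  rw [pos_revw w i.1 i.2.le]
  have h2 := pos_succ w (Fin.rev i)
  simp only [Fin.val_rev] at h2 ⊢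
  rw [show g - (i.1+1) + 1 = g - i.1 by omega] at h2
  rw [← al_flip φ (w (Fin.rev i))]
  unfold revw
  congr 1
  rw [h2]; ring

lemma wt_ne_zero (hM : Mask P I L φ) (hg : 0 < g) {w : Fin g → Lt P} {n : ℤ}
    (h : wt φ w n ≠ 0) : n ∈ I ∧ n + pos w g ∈ I := by
  have h1 : ∀ i : Fin g, al φ (w i) (n + pos w i.1) ≠ 0 := fun i =>
    (Finset.prod_ne_zero_iff.1 h) i (Finset.mem_univ _)
  constructor
  · have := (al_ne_zero hM (h1 ⟨0, hg⟩)).1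
    simpa [pos_zero] using this
  · have h2 := (al_ne_zero hM (h1 ⟨g-1, by omega⟩)).2
    have h3 := pos_succ w ⟨g-1, by omega⟩
    simp only at h2 h3
    rw [add_assoc, ← h3, show g - 1 + 1 = g by omega] at h2
    exact h2

open Classical in
/-- operator given by a family of words -/
noncomputable def wop (φ : ℤ → ℝ) (Q : (Fin g → Lt P) → Prop) : (ℤ → ℝ) →ₗ[ℝ] (ℤ → ℝ) where
  toFun f := fun n => ∑ w : Fin g → Lt P, if Q w then wt φ w n * f (n + pos w g) else 0
  map_add' x y := by
    ext n
    simp only [Pi.add_apply, mul_add]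
    rw [← Finset.sum_add_distrib]
    refine Finset.sum_congr rfl fun w _ => ?_
    split_ifs <;> simp
  map_smul' c x := by
    ext n
    simp only [Pi.smul_apply, smul_eq_mul, RingHom.id_apply, Finset.mul_sum]
    refine Finset.sum_congr rfl fun w _ => ?_
    split_ifs <;> ring

open Classical in
lemma wop_apply (Q : (Fin g → Lt P) → Prop) (f : ℤ → ℝ) (n : ℤ) :
    wop φ Q f n = ∑ w : Fin g → Lt P, if Q w then wt φ w n * f (n + pos w g) else 0 := rfl

lemma wop_sym (hM : Mask P I L φ) (hg : 0 < g) (Q : (Fin g → Lt P) → Prop)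
    (hQ : ∀ w, Q w → Q (revw w)) (x y : ℤ → ℝ) :
    BI I (wop φ Q x) y = BI I x (wop φ Q y) := by
  classical
  simp only [BI_apply, wop_apply, Finset.sum_mul, Finset.mul_sum]
  rw [Finset.sum_comm, Finset.sum_comm (s := I)]
  refine Fintype.sum_equiv ⟨revw, revw, revw_revw, revw_revw⟩ _ _ fun w => ?_
  simp only [Equiv.coe_fn_mk]
  have hQ' : Q (revw w) ↔ Q w := ⟨fun h => by simpa [revw_revw] using hQ _ h, hQ w⟩
  simp only [hQ']
  by_cases hw : Q w
  · simp only [if_pos hw]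
    rw [shift_sum I (pos w g)]
    · refine Finset.sum_congr rfl fun m _ => ?_
      have h1 := wt_revw (φ := φ) w (m - pos w g)
      rw [sub_add_cancel] at h1 ⊢
      have h2 := pos_revw w g le_rfl
      rw [Nat.sub_self, pos_zero, zero_sub] at h2
      rw [h1, h2, ← sub_eq_add_neg]; ring
    · intro n hn
      exact wt_ne_zero hM hg (left_ne_zero_of_mul (left_ne_zero_of_mul hn))
  · simp [hw]

open Classical in
lemma wop_schur (hM : Mask P I L φ) (hg : 0 < g) (Q : (Fin g → Lt P) → Prop)
    (hQ : ∀ w, Q w → Q (revw w)) (h : ℤ → ℝ) (b : ℝ)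
    (hb : ∀ n, h n ≠ 0 → ∑ w : Fin g → Lt P, (if Q w then |wt φ w n| else 0) ≤ b) :
    |BI I h (wop φ Q h)| ≤ b * BI I h h := by
  simp only [BI_apply, wop_apply, Finset.mul_sum]
  have h1 : |∑ n ∈ I, ∑ w : Fin g → Lt P,
        h n * (if Q w then wt φ w n * h (n + pos w g) else 0)|
      ≤ ∑ n ∈ I, ∑ w : Fin g → Lt P, ((if Q w then |wt φ w n| * (h n ^ 2 / 2) else 0)
        + (if Q w then |wt φ w n| * (h (n + pos w g) ^ 2 / 2) else 0)) := by
    refine (Finset.abs_sum_le_sum_abs _ _).trans (Finset.sum_le_sum fun n _ => ?_)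
    refine (Finset.abs_sum_le_sum_abs _ _).trans (Finset.sum_le_sum fun w _ => ?_)
    split_ifs
    · rw [abs_mul, abs_mul]
      have h2 : |h n| * |h (n + pos w g)| ≤ h n ^ 2 / 2 + h (n + pos w g) ^ 2 / 2 := by
        rw [← sq_abs (h n), ← sq_abs (h (n + pos w g))]
        nlinarith [sq_nonneg (|h n| - |h (n + pos w g)|)]
      have h3 := mul_le_mul_of_nonneg_left h2 (abs_nonneg (wt φ w n))
      linarith
    · simp
  refine h1.trans ?_
  simp only [Finset.sum_add_distrib]
  have h2 : ∑ n ∈ I, ∑ w : Fin g → Lt P,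
      (if Q w then |wt φ w n| * (h (n + pos w g) ^ 2 / 2) else 0)
      = ∑ n ∈ I, ∑ w : Fin g → Lt P, (if Q w then |wt φ w n| * (h n ^ 2 / 2) else 0) := by
    rw [Finset.sum_comm, Finset.sum_comm (s := I)]
    refine Fintype.sum_equiv ⟨revw, revw, revw_revw, revw_revw⟩ _ _ fun w => ?_
    simp only [Equiv.coe_fn_mk]
    have hQ' : Q (revw w) ↔ Q w := ⟨fun h => by simpa [revw_revw] using hQ _ h, hQ w⟩
    simp only [hQ']
    by_cases hw : Q w
    · simp only [if_pos hw]
      rw [shift_sum I (pos w g)]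
      · refine Finset.sum_congr rfl fun m _ => ?_
        have h1 := wt_revw (φ := φ) w (m - pos w g)
        rw [sub_add_cancel] at h1 ⊢
        rw [h1]
      · intro n hn
        exact wt_ne_zero hM hg (abs_ne_zero.1 (left_ne_zero_of_mul hn))
    · simp [hw]
  rw [h2, ← Finset.sum_add_distrib]
  refine Finset.sum_le_sum fun n _ => ?_
  by_cases hn : h n = 0
  · simp [hn]
  · have e : ∀ w : Fin g → Lt P, (if Q w then |wt φ w n| * (h n ^ 2 / 2) else 0)
        = (if Q w then |wt φ w n| else 0) * (h n ^ 2 / 2) := by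
      intro w; split_ifs <;> simp
    simp only [e, ← Finset.sum_mul]
    have := mul_le_mul_of_nonneg_right (hb n hn) (sq_nonneg (h n))
    rw [← sq]; linarith

/-- reduced words -/
def red (w : Fin g → Lt P) : Prop := ∀ i j : Fin g, i.1 + 1 = j.1 → (w i).1 ≠ (w j).1

def stw (p : {p // p ∈ P}) (w : Fin g → Lt P) : Prop := ∃ i : Fin g, i.1 = 0 ∧ (w i).1 = p

lemma red_cons (s : Lt P) (w : Fin g → Lt P) :
    red (Fin.cons s w : Fin (g+1) → Lt P) ↔ red w ∧ ¬ stw s.1 w := by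
  constructor
  · intro h
    refine ⟨fun i j hij => ?_, ?_⟩
    · have := h i.succ j.succ (by simp [hij])
      simpa using this
    · rintro ⟨i, hi, hs⟩
      have := h 0 i.succ (by simp [hi])
      simp at this
      exact this hs.symm
  · rintro ⟨h1, h2⟩ i j hij
    refine Fin.cases ?_ (fun j => ?_) j hij
    · intro h; simp at h
    · refine Fin.cases ?_ (fun i => ?_) i
      · intro h hs
        simp at h hs
        exact h2 ⟨j, by omega, hs.symm⟩
      · intro h
        simp at h ⊢
        exact h1 i j h

lemma stw_cons (p : {p // p ∈ P}) (s : Lt P) (w : Fin g → Lt P) :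
    stw p (Fin.cons s w : Fin (g+1) → Lt P) ↔ s.1 = p := by
  constructor
  · rintro ⟨i, hi, h⟩
    have : i = 0 := Fin.ext hi
    subst this; simpa using h
  · intro h; exact ⟨0, rfl, by simpa using h⟩

lemma sum_finCons {M : Type*} [AddCommMonoid M] {α : Type*} [Fintype α]
    (F : (Fin (g+1) → α) → M) :
    ∑ w : Fin (g+1) → α, F w = ∑ s : α, ∑ w : Fin g → α, F (Fin.cons s w) := by
  rw [← Fintype.sum_prod_type']
  exact (Fintype.sum_equiv (Fin.consEquiv (fun _ => α)) _ _ (fun x => rfl)).symm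

lemma chSt_eq (f : ℤ → ℝ) (j : ℕ) :
    (chSt (aop (P := P) φ) f j).1 = wop φ (fun w : Fin j → Lt P => red w) f ∧
    ∀ p, (chSt (aop (P := P) φ) f j).2 p = wop φ (fun w : Fin j → Lt P => red w ∧ stw p w) f := by
  classical
  induction j with
  | zero =>
    constructor
    · ext n
      rw [wop_apply]
      simp [chSt, red, wt, pos_zero]
    · intro p
      ext n
      rw [wop_apply]
      simp [chSt, stw]
  | succ j ih =>
    have key : ∀ p, (chSt (aop (P := P) φ) f (j+1)).2 p
        = wop φ (fun w : Fin (j+1) → Lt P => red w ∧ stw p w) f := by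
      intro p
      ext n
      rw [wop_apply, sum_finCons, Fintype.sum_prod_type]
      simp only [chSt, ih.1, ih.2, red_cons, stw_cons]
      rw [Finset.sum_eq_single p]
      · simp only [aop, LinearMap.coe_mk, AddHom.coe_mk, Pi.sub_apply, wop_apply]
        refine Finset.sum_congr rfl fun σ _ => ?_
        rw [← Finset.sum_sub_distrib, Finset.mul_sum]
        refine Finset.sum_congr rfl fun w _ => ?_
        rw [wt_cons, pos_cons, ← add_assoc]
        by_cases h1 : red w <;> by_cases h2 : stw p w <;> simp [h1, h2]
        ring
      · intro p' _ hp'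
        simp [hp']
      · simp
    refine ⟨?_, key⟩
    have e : (chSt (aop (P := P) φ) f (j+1)).1 = ∑ p, (chSt (aop (P := P) φ) f (j+1)).2 p := rfl
    rw [e]
    ext n
    simp only [key, Finset.sum_apply, wop_apply]
    rw [Finset.sum_comm]
    refine Finset.sum_congr rfl fun w _ => ?_
    have : ∀ p, stw p w ↔ p = (w 0).1 := by
      intro p
      constructor
      · rintro ⟨i, hi, h⟩
        have : i = 0 := Fin.ext hi
        subst this; exact h.symm
      · rintro rfl; exact ⟨0, rfl, rfl⟩
    simp only [this]
    by_cases h : red w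
    · simp [h]
    · simp [h]

/-- multi-block words -/
def bpos {M : ℕ} (W : Fin M → Fin g → Lt P) (i : ℕ) : ℤ := psum (fun b => pos (W b) g) i

noncomputable def Wt (φ : ℤ → ℝ) {M : ℕ} (W : Fin M → Fin g → Lt P) (n : ℤ) : ℝ :=
  ∏ b : Fin M, wt φ (W b) (n + bpos W b.1)

open Classical in
lemma wop_pow (Q : (Fin g → Lt P) → Prop) (M : ℕ) (f : ℤ → ℝ) (n : ℤ) :
    ((wop φ Q) ^ M) f n = ∑ W : Fin M → Fin g → Lt P,
      if ∀ b, Q (W b) then Wt φ W n * f (n + bpos W M) else 0 := by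
  induction M generalizing n with
  | zero => simp [Wt, bpos, psum_zero]
  | succ M ih =>
    rw [pow_succ', Module.End.mul_apply, wop_apply, sum_finCons]
    refine Finset.sum_congr rfl fun w _ => ?_
    have hb : ∀ (W : Fin M → Fin g → Lt P) (i : ℕ),
        bpos (Fin.cons w W : Fin (M+1) → Fin g → Lt P) (i+1) = pos w g + bpos W i := by
      intro W i
      unfold bpos
      rw [← psum_finCons]
      congr 1
      ext j; refine Fin.cases ?_ (fun j => ?_) j <;> simp
    have hW : ∀ (W : Fin M → Fin g → Lt P), Wt φ (Fin.cons w W : Fin (M+1) → Fin g → Lt P) n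
        = wt φ w n * Wt φ W (n + pos w g) := by
      intro W
      unfold Wt
      rw [Fin.prod_univ_succ]
      simp only [Fin.cons_zero, Fin.cons_succ, Fin.val_zero, Fin.val_succ, hb]
      simp [bpos, psum_zero, add_assoc]
    by_cases hw : Q w
    · rw [if_pos hw, ih, Finset.mul_sum]
      refine Finset.sum_congr rfl fun W _ => ?_
      rw [hW, hb]
      simp only [Fin.forall_fin_succ, Fin.cons_zero, Fin.cons_succ, hw, true_and]
      split_ifs
      · rw [add_assoc]; ring
      · simp
    · rw [if_neg hw]
      symm
      refine Finset.sum_eq_zero fun W _ => ?_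
      simp [Fin.forall_fin_succ, hw]

/-- abstract power trick -/
lemma pow_trick {V : Type*} [AddCommGroup V] [Module ℝ V] (B : V →ₗ[ℝ] V →ₗ[ℝ] ℝ)
    (hs : ∀ x y, B x y = B y x) (hpsd : ∀ x, 0 ≤ B x x) (T : V →ₗ[ℝ] V)
    (hT : ∀ x y, B (T x) y = B x (T y)) (h : V) (hh : B h h = 1) (b : ℕ) :
    B h (T h) ^ (2 ^ (b+1)) ≤ B h ((T ^ (2 ^ (b+1))) h) := by
  have cs : ∀ x, B h x ^ 2 ≤ B x x := by
    intro x
    have := hpsd (x - B h x • h)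
    simp only [map_sub, LinearMap.sub_apply, map_smul, LinearMap.smul_apply, smul_eq_mul,
      hh, hs x h] at this
    nlinarith
  have hTp : ∀ k x y, B ((T ^ k) x) y = B x ((T ^ k) y) := by
    intro k
    induction k with
    | zero => simp
    | succ k ih =>
      intro x y
      rw [pow_succ', Module.End.mul_apply, hT, ih, ← Module.End.mul_apply, ← pow_succ, pow_succ']
  have sq : ∀ k, B h ((T ^ k) h) ^ 2 ≤ B h ((T ^ (2 * k)) h) := by
    intro k
    refine (cs _).trans (le_of_eq ?_)
    rw [hTp, ← Module.End.mul_apply, ← pow_add, two_mul]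
  induction b with
  | zero => simpa using sq 1
  | succ b ih =>
    rw [pow_succ 2 (b+1), pow_mul, mul_comm (2 ^ (b+1)) 2]
    refine le_trans ?_ (sq _)
    refine pow_le_pow_left₀ ?_ ih 2
    rw [pow_succ 2 b, mul_comm, pow_mul]
    positivity

/-- trace bound -/
lemma trace_bd (T : (ℤ → ℝ) →ₗ[ℝ] (ℤ → ℝ))
    (hT : ∀ x y, BI I (T x) y = BI I x (T y)) (h : ℤ → ℝ) (hh : BI I h h = 1)
    (J : Finset ℤ) (hJI : J ⊆ I) (hJ : ∀ n, n ∉ J → h n = 0) (b : ℕ) :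
    BI I h (T h) ^ (2 ^ (b+1)) ≤
      ∑ n ∈ J, ((T ^ (2 ^ (b+1))) (fun m => if m = n then 1 else 0)) n ∧
    ∀ n ∈ I, 0 ≤ ((T ^ (2 ^ (b+1))) (fun m => if m = n then 1 else 0)) n := by
  have hTp : ∀ k x y, BI I ((T ^ k) x) y = BI I x ((T ^ k) y) := by
    intro k
    induction k with
    | zero => simp
    | succ k ih =>
      intro x y
      rw [pow_succ', Module.End.mul_apply, hT, ih, ← Module.End.mul_apply, ← pow_succ, pow_succ']
  set S := T ^ (2 ^ b) with hS
  have hSS : T ^ (2 ^ (b+1)) = S * S := by rw [hS, ← pow_add, pow_succ]; congr 1; ring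
  set δ : ℤ → ℤ → ℝ := fun n m => if m = n then 1 else 0 with hδ
  have hd : ∀ n ∈ I, ((T ^ (2 ^ (b+1))) (δ n)) n = BI I (S (δ n)) (S (δ n)) := by
    intro n hn
    rw [hTp (2 ^ b), ← Module.End.mul_apply, ← hSS, BI_apply]
    simp [hδ, hn]
  refine ⟨?_, fun n hn => ?_⟩
  · refine (pow_trick (BI I) (BI_comm I) (BI_nonneg I) T hT h hh b).trans ?_
    have hsum : h = ∑ n ∈ J, h n • δ n := by
      ext m
      simp only [Finset.sum_apply, Pi.smul_apply, smul_eq_mul, hδ]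
      simp only [mul_ite, mul_one, mul_zero]
      rw [Finset.sum_ite_eq]
      split_ifs with hm
      · rfl
      · exact hJ m hm
    rw [hSS, Module.End.mul_apply, ← hTp (2 ^ b), BI_apply]
    have e : ∀ m, S h m = ∑ n ∈ J, h n * S (δ n) m := by
      intro m
      conv_lhs => rw [hsum]
      simp
    have hJh : ∑ n ∈ J, h n ^ 2 = 1 := by
      rw [← hh, BI_apply]
      rw [← Finset.sum_subset hJI]
      · exact Finset.sum_congr rfl fun _ _ => sq _
      · intro n _ hn; simp [hJ n hn]
    calc ∑ m ∈ I, S h m * S h m ≤ ∑ m ∈ I, ∑ n ∈ J, S (δ n) m ^ 2 := by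
          refine Finset.sum_le_sum fun m _ => ?_
          rw [← sq, e]
          refine (Finset.sum_mul_sq_le_sq_mul_sq J _ _).trans ?_
          rw [hJh, one_mul]
      _ = ∑ n ∈ J, BI I (S (δ n)) (S (δ n)) := by
          rw [Finset.sum_comm]
          refine Finset.sum_congr rfl fun n _ => ?_
          rw [BI_apply]
          exact Finset.sum_congr rfl fun _ _ => sq _
      _ = _ := Finset.sum_congr rfl fun n hn => by
          rw [← hd n (hJI hn), hSS]
  · have := hd n hn
    rw [this]; exact BI_nonneg I _

end Words

open Finset

section Local

lemma avg_mono {q : ℕ} {f h : ℤ → ℝ} (H : ∀ n, f n ≤ h n) : avg q f ≤ avg q h := by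
  unfold avg
  gcongr
  exact H _

lemma avg_add (q : ℕ) (f h : ℤ → ℝ) : avg q (fun n => f n + h n) = avg q f + avg q h := by
  unfold avg; rw [Finset.sum_add_distrib, add_div]

lemma avg_smul (q : ℕ) (c : ℝ) (f : ℤ → ℝ) : avg q (fun n => c * f n) = c * avg q f := by
  unfold avg; rw [← Finset.mul_sum, mul_div_assoc]

lemma avg_const {q : ℕ} (hq : 0 < q) (c : ℝ) : avg q (fun _ => c) = c := by
  have : (q:ℝ) ≠ 0 := by positivity
  unfold avg; simp; field_simp

lemma avg_sum {ι : Type*} (s : Finset ι) (q : ℕ) (f : ι → ℤ → ℝ) :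
    avg q (fun n => ∑ i ∈ s, f i n) = ∑ i ∈ s, avg q (f i) := by
  unfold avg; rw [Finset.sum_comm, Finset.sum_div]

lemma avg_ind {q : ℕ} (hq : 0 < q) (a : ℤ) :
    avg q (fun n => if (q:ℤ) ∣ n + a then (1:ℝ) else 0) = 1 / q := by
  unfold avg
  congr 1
  have := per_sum (F := fun n => if (q:ℤ) ∣ n then (1:ℝ) else 0) (Q := q)
    (fun n => by simp) a
  simp only [add_comm] at this ⊢
  rw [this, Finset.sum_eq_single 0]
  · simp
  · intro i hi hi0
    rw [if_neg]
    intro h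
    have h' := Int.natCast_dvd_natCast.1 h
    exact hi0 (Nat.eq_zero_of_dvd_of_lt h' (Finset.mem_range.1 hi))
  · intro h; exact absurd (Finset.mem_range.2 hq) h

variable {T : Type*} [Fintype T]

/-- number of nodes divisible by p -/
def cc (y y' : T → ℤ) (p : ℕ) (n : ℤ) : ℕ :=
  ∑ t, ((if (p:ℤ) ∣ n + y t then 1 else 0) + (if (p:ℤ) ∣ n + y' t then 1 else 0))

lemma cc_per (y y' : T → ℤ) (p : ℕ) (n : ℤ) : cc y y' p (n + p) = cc y y' p n := by
  unfold cc
  refine Finset.sum_congr rfl fun t _ => ?_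
  have : ∀ a : ℤ, (p:ℤ) ∣ n + p + a ↔ (p:ℤ) ∣ n + a := by
    intro a
    rw [show n + p + a = (n + a) + p by ring]; exact dvd_add_self_right
  simp only [this]

lemma avg_cc {p : ℕ} (hp : 0 < p) (y y' : T → ℤ) :
    avg p (fun n => (cc y y' p n : ℝ)) = 2 * Fintype.card T / p := by
  have : (fun n => (cc y y' p n : ℝ)) = fun n => ∑ t : T,
      ((if (p:ℤ) ∣ n + y t then (1:ℝ) else 0) + (if (p:ℤ) ∣ n + y' t then (1:ℝ) else 0)) := by
    ext n; unfold cc; push_cast; rfl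
  rw [this, avg_sum]
  simp only [avg_add, avg_ind hp]
  rw [Finset.sum_const, Finset.card_univ, nsmul_eq_mul]; ring

lemma one_sub_exp_le {L : ℝ} (c : ℕ) :
    1 - Real.exp (-1 / L) ^ c ≤ c / L := by
  rw [← Real.exp_nat_mul]
  have := Real.add_one_le_exp ((c:ℝ) * (-1 / L))
  have e : (c:ℝ) * (-1 / L) = - (c / L) := by ring
  rw [e] at this ⊢
  linarith

lemma theta_mem {L : ℝ} (hL : 0 < L) (c : ℕ) :
    0 < Real.exp (-1 / L) ^ c ∧ Real.exp (-1 / L) ^ c ≤ 1 := by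
  refine ⟨by positivity, pow_le_one₀ (Real.exp_pos _).le ?_⟩
  rw [Real.exp_le_one_iff]
  exact div_nonpos_of_nonpos_of_nonneg (by norm_num) hL.le

open Classical in
theorem local_bd (P : Finset ℕ) (hP : ∀ p ∈ P, p.Prime) (q : T → ℕ) (hq : ∀ t, q t ∈ P)
    (y y' : T → ℤ) (L : ℝ) (hL : 2 ≤ L) (hPL : ∑ p ∈ P, 1 / (p:ℝ) ≤ L)
    (Pm k : ℕ) (hk : Fintype.card T = k) (hkp : ∀ p ∈ P, k ≤ p) (hPm : ∀ p ∈ P, p ≤ Pm) (hPm1 : 1 ≤ Pm)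
    (wst su : ℕ → Prop) (η : ℝ) (hη : ∀ p ∈ P, 3 / (2 * p) ≤ η)
    (hη0 : 0 ≤ η)
    (hw : ∀ p ∈ P, wst p → ∃ t t', q t = p ∧ q t' = p ∧ ¬ (p:ℤ) ∣ y t' - y t)
    (hsu : ∀ p ∈ P, su p → ∃ t, q t = p ∧ (∀ t', q t' = p → t' = t) ∧
      ∀ n : ℤ, (p:ℤ) ∣ n + y t → cc y y' p n ≤ 4)
    (J : ℕ) (hJ : (2 * k : ℝ) ^ J ≤ J.factorial * (2 / L) ^ k) (a : ℤ) (N : ℕ) :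
    |∑ n ∈ Ioc a (a + N), (∏ t, lit (q t) (n + y t)) *
        ∏ p ∈ P, Real.exp (-1 / L) ^ (cc y y' p n)| ≤
      3 * N * ∏ p ∈ univ.image q, (2 / (p:ℝ) * (if wst p then η else 1)
        * (if su p then 2 / L else 1)) + 2 * (J + 1) * (Pm:ℝ) ^ (k + 2 * J) := by
  set θ := Real.exp (-1 / L) with hθ
  have hL0 : 0 < L := by linarith
  have hth : ∀ c : ℕ, 0 < θ ^ c ∧ θ ^ c ≤ 1 := fun c => theta_mem hL0 c
  have hth2 : ∀ c : ℕ, 1 - θ ^ c ≤ c / L := fun c => one_sub_exp_le c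
  set S0 := univ.image q with hS0
  have hS0P : S0 ⊆ P := by
    intro p hp
    obtain ⟨t, _, rfl⟩ := Finset.mem_image.1 hp
    exact hq t
  set S := P \ S0 with hS
  set h : ℕ → ℤ → ℝ := fun p n =>
    (∏ t ∈ univ.filter (fun t => q t = p), lit p (n + y t)) * θ ^ cc y y' p n with hh
  set x : ℕ → ℤ → ℝ := fun p n => 1 - θ ^ cc y y' p n with hx
  have hpp : ∀ p ∈ P, (0:ℝ) < p := fun p hp => by exact_mod_cast (hP p hp).pos
  have hper : ∀ p n, h p (n + p) = h p n := by
    intro p n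
    simp only [hh, cc_per]
    congr 1
    refine Finset.prod_congr rfl fun t _ => lit_congr ?_
    ring_nf; simp
  have hxper : ∀ p n, x p (n + p) = x p n := by intro p n; simp only [hx, cc_per]
  have hx01 : ∀ p n, 0 ≤ x p n ∧ x p n ≤ 1 := by
    intro p n
    have := hth (cc y y' p n)
    simp only [hx]; constructor <;> linarith
  -- bounds for |h|
  have habs1 : ∀ p ∈ P, ∀ A ⊆ univ.filter (fun t => q t = p), ∀ n,
      |h p n| ≤ ∏ t ∈ A, |lit p (n + y t)| := by
    intro p hp A hA n
    simp only [hh]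
    rw [abs_mul, abs_of_pos (hth _).1, Finset.abs_prod]
    have h1 : ∏ t ∈ univ.filter (fun t => q t = p), |lit p (n + y t)|
        ≤ ∏ t ∈ A, |lit p (n + y t)| := by
      rw [← Finset.prod_sdiff hA]
      refine mul_le_of_le_one_left (Finset.prod_nonneg fun _ _ => abs_nonneg _) ?_
      exact Finset.prod_le_one (fun _ _ => abs_nonneg _) fun t _ => abs_lit_le (hP p hp) _
    refine le_trans ?_ h1
    exact mul_le_of_le_one_right (Finset.prod_nonneg fun _ _ => abs_nonneg _) (hth _).2
  have h1 : ∀ p ∈ S0, ∀ n, |h p n| ≤ 1 := by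
    intro p hp n
    simpa using habs1 p (hS0P hp) ∅ (by simp) n
  have key := equi_mask S0 S (fun p hp => hP p (hS0P hp))
    (fun p hp => hP p (Finset.mem_sdiff.1 hp).1) Finset.disjoint_sdiff h x
    (fun p _ => hper p) h1 (fun p _ => hxper p) (fun p _ => hx01 p) a N J
  have hrew : ∀ n, (∏ t, lit (q t) (n + y t)) * ∏ p ∈ P, θ ^ (cc y y' p n)
      = (∏ p ∈ S0, h p n) * ∏ p ∈ S, (1 - x p n) := by
    intro n
    simp only [hh, hx, sub_sub_cancel]
    rw [Finset.prod_mul_distrib, mul_assoc, hS, mul_comm (∏ p ∈ S0, θ ^ cc y y' p n),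
      Finset.prod_sdiff hS0P]
    congr 1
    rw [← Finset.prod_fiberwise_of_maps_to (s := univ) (t := S0) (g := q)
      (fun t _ => Finset.mem_image_of_mem _ (Finset.mem_univ _))]
    refine Finset.prod_congr rfl fun p _ => Finset.prod_congr rfl fun t ht => ?_
    rw [(Finset.mem_filter.1 ht).2]
  simp only [hrew]
  refine key.trans ?_
  -- averages of |h|
  have hV0 : ∀ p ∈ S0, avg p (fun n => |h p n|) ≤ 2 / (p:ℝ) * (if wst p then η else 1) := by
    intro p hp
    have hpP := hS0P hp
    have hp0 := hpp p hpP
    have hpn := (hP p hpP).pos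
    split_ifs with hwp
    · obtain ⟨t, t', ht, ht', hd⟩ := hw p hpP hwp
      have hne : t ≠ t' := by rintro rfl; simp at hd
      have : avg p (fun n => |h p n|) ≤ 3 / (p:ℝ) ^ 2 := by
        have e : avg p (fun n => ((1 / (p:ℝ)) * (if (p:ℤ) ∣ n + y t then (1:ℝ) else 0)
            + (1 / (p:ℝ)) * (if (p:ℤ) ∣ n + y t' then (1:ℝ) else 0)) + 1 / (p:ℝ) ^ 2)
            = 3 / (p:ℝ) ^ 2 := by
          rw [avg_add, avg_add, avg_smul, avg_smul, avg_ind hpn, avg_ind hpn, avg_const hpn]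
          field_simp; norm_num
        rw [← e]
        refine avg_mono fun n => ?_
        refine (habs1 p hpP {t, t'} (by
          intro s hs
          rcases Finset.mem_insert.1 hs with rfl | hs
          · simp [ht]
          · rw [Finset.mem_singleton.1 hs]; simp [ht']) n).trans ?_
        rw [Finset.prod_pair hne]
        have b1 := abs_lit_le2 p (n + y t)
        have b2 := abs_lit_le2 p (n + y t')
        refine (mul_le_mul b1 b2 (abs_nonneg _) (by positivity)).trans ?_
        have : ¬ ((p:ℤ) ∣ n + y t ∧ (p:ℤ) ∣ n + y t') := by
          rintro ⟨u1, u2⟩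
          apply hd
          have := dvd_sub u2 u1
          rwa [add_sub_add_left_eq_sub] at this
        by_cases u1 : (p:ℤ) ∣ n + y t
        · by_cases u2 : (p:ℤ) ∣ n + y t'
          · exact absurd ⟨u1, u2⟩ this
          · simp only [u1, u2, if_true, if_false]; apply le_of_eq; ring
        · by_cases u2 : (p:ℤ) ∣ n + y t'
          · simp only [u1, u2, if_true, if_false]; apply le_of_eq; ring
          · simp only [u1, u2, if_false]; apply le_of_eq; ring
      refine this.trans ?_
      have h3 := mul_le_mul_of_nonneg_left (hη p hpP) (show 0 ≤ 2 / (p:ℝ) by positivity)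
      refine le_trans (le_of_eq ?_) h3
      field_simp
    · obtain ⟨t, _, ht⟩ := Finset.mem_image.1 hp
      have e : avg p (fun n => (if (p:ℤ) ∣ n + y t then (1:ℝ) else 0) + 1 / (p:ℝ))
            = 2 / (p:ℝ) := by
        rw [avg_add, avg_ind hpn, avg_const hpn]; ring
      rw [mul_one, ← e]
      refine avg_mono fun n => ?_
      refine (habs1 p hpP {t} (by simp [ht]) n).trans ?_
      rw [Finset.prod_singleton]
      exact abs_lit_le2 p _
  have havg_abs : ∀ p, |avg p (h p)| ≤ avg p (fun n => |h p n|) := by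
    intro p
    unfold avg
    rw [abs_div, Nat.abs_cast]
    gcongr
    exact Finset.abs_sum_le_sum_abs _ _
  have hγ : ∀ p ∈ P, avg p (x p) ≤ 2 * k / (L * p) := by
    intro p hp
    have hp0 := hpp p hp
    calc avg p (x p) ≤ avg p (fun n => (1 / L) * (cc y y' p n : ℝ)) :=
          avg_mono fun n => by
            have := hth2 (cc y y' p n)
            simp only [hx]
            rw [one_div_mul_eq_div]; exact this
      _ = _ := by
          rw [avg_smul, avg_cc (hP p hp).pos, hk]; field_simp
  have hγ0 : ∀ p ∈ P, 0 ≤ avg p (x p) := by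
    intro p hp
    exact div_nonneg (Finset.sum_nonneg fun n _ => (hx01 p n).1) (hpp p hp).le
  have hV : ∀ p ∈ S0, |avg p (h p)| ≤ 2 / (p:ℝ) * (if wst p then η else 1)
        * (if su p then 2 / L else 1) := by
    intro p hp
    have hpP := hS0P hp
    have hp0 := hpp p hpP
    have hpn := (hP p hpP).pos
    by_cases hs : su p
    · obtain ⟨t, ht, huniq, hc4⟩ := hsu p hpP hs
      have hnw : ¬ wst p := by
        intro hwp
        obtain ⟨s, s', hs1, hs2, hd⟩ := hw p hpP hwp
        rw [huniq s hs1, huniq s' hs2] at hd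
        simp at hd
      rw [if_neg hnw, if_pos hs, mul_one]
      have hfil : univ.filter (fun t => q t = p) = {t} := by
        ext s; simp only [Finset.mem_filter, Finset.mem_univ, true_and, Finset.mem_singleton]
        exact ⟨fun h => huniq s h, fun h => h ▸ ht⟩
      set Ind : ℤ → ℝ := fun n => if (p:ℤ) ∣ n + y t then (1:ℝ) else 0 with hInd
      have e : avg p (h p) + avg p (fun n => Ind n * x p n) = (1 / (p:ℝ)) * avg p (x p) := by
        have : ∀ n, h p n + Ind n * x p n = (Ind n + (- (1 / (p:ℝ)))) + (1 / (p:ℝ)) * x p n := by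
          intro n
          simp only [hh, hfil, Finset.prod_singleton, lit, hx, hInd]
          split_ifs <;> ring
        rw [← avg_add]
        simp only [this]
        rw [avg_add, avg_add, avg_const hpn, avg_smul, avg_ind hpn]; ring
      have b1 : 0 ≤ avg p (fun n => Ind n * x p n) := by
        refine div_nonneg (Finset.sum_nonneg fun n _ => mul_nonneg ?_ (hx01 p n).1) hp0.le
        simp only [hInd]; split_ifs <;> norm_num
      have b2 : avg p (fun n => Ind n * x p n) ≤ (4 / L) * (1 / p) := by
        have : avg p (fun n => (4 / L) * Ind n) = (4 / L) * (1 / p) := by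
          rw [avg_smul, avg_ind hpn]
        rw [← this]
        refine avg_mono fun n => ?_
        simp only [hInd]
        split_ifs with hd
        · rw [one_mul, mul_one]
          have h5 := hth2 (cc y y' p n)
          have h6 : (cc y y' p n : ℝ) ≤ 4 := by exact_mod_cast hc4 n hd
          simp only [hx]
          refine h5.trans ?_
          gcongr
        · simp
      have b3 : (1 / (p:ℝ)) * avg p (x p) ≤ (4 / L) * (1 / p) := by
        have h5 := hγ p hpP
        have h6 : (k:ℝ) ≤ p := by exact_mod_cast hkp p hpP
        have h7 : 2 * (k:ℝ) / (L * p) ≤ 4 / L := by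
          rw [div_le_div_iff₀ (by positivity) hL0]
          nlinarith
        rw [mul_comm]
        gcongr
        exact h5.trans h7
      have b4 : 0 ≤ (1 / (p:ℝ)) * avg p (x p) := mul_nonneg (by positivity) (hγ0 p hpP)
      have : (4 / L) * (1 / (p:ℝ)) = 2 / (p:ℝ) * (2 / L) := by field_simp; norm_num
      rw [← this, abs_le]; constructor <;> linarith
    · rw [if_neg hs, mul_one]
      exact (havg_abs p).trans (hV0 p hp)
  -- products
  set ε := 2 / L with hε
  have hε0 : 0 < ε := by positivity
  have hε1 : ε ≤ 1 := by rw [hε, div_le_one hL0]; exact hL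
  have hw0 : ∀ p, 0 ≤ (if wst p then η else 1) := by intro p; split_ifs <;> [exact hη0; norm_num]
  set V := ∏ p ∈ S0, (2 / (p:ℝ) * (if wst p then η else 1) * (if su p then ε else 1)) with hVdef
  set V0 := ∏ p ∈ S0, (2 / (p:ℝ) * (if wst p then η else 1)) with hV0def
  have hV0n : 0 ≤ V0 := Finset.prod_nonneg fun p _ => mul_nonneg (by positivity) (hw0 p)
  have c1 : |∏ p ∈ S0, avg p (h p)| ≤ V := by
    rw [Finset.abs_prod]
    exact Finset.prod_le_prod (fun _ _ => abs_nonneg _) hV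
  have c2 : ∏ p ∈ S0, avg p (fun n => |h p n|) ≤ V0 :=
    Finset.prod_le_prod (fun p _ => div_nonneg (Finset.sum_nonneg fun _ _ => abs_nonneg _)
      (by positivity)) hV0
  have hcard : S0.card ≤ k := by rw [← hk]; exact Finset.card_image_le
  have c3 : V0 * ε ^ k ≤ V := by
    rw [hVdef, Finset.prod_mul_distrib, ← hV0def]
    refine mul_le_mul_of_nonneg_left ?_ hV0n
    calc ε ^ k ≤ ε ^ S0.card := pow_le_pow_of_le_one hε0.le hε1 hcard
      _ = ∏ p ∈ S0, ε := by simp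
      _ ≤ _ := Finset.prod_le_prod (fun _ _ => hε0.le) fun p _ => by
          split_ifs
          · exact le_rfl
          · exact hε1
  have c4 : es (fun p => avg p (x p)) S J ≤ ε ^ k := by
    have e1 := es_le (x := fun p => avg p (x p)) (S := S)
      (fun p hp => hγ0 p (Finset.mem_sdiff.1 hp).1) J
    have e2 : ∑ p ∈ S, avg p (x p) ≤ 2 * k := by
      calc ∑ p ∈ S, avg p (x p) ≤ ∑ p ∈ P, avg p (x p) :=
            Finset.sum_le_sum_of_subset_of_nonneg Finset.sdiff_subset fun p hp _ => hγ0 p hp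
        _ ≤ ∑ p ∈ P, 2 * k / L * (1 / (p:ℝ)) := Finset.sum_le_sum fun p hp => by
            refine (hγ p hp).trans (le_of_eq ?_)
            have := hpp p hp
            field_simp
        _ = 2 * k / L * ∑ p ∈ P, 1 / (p:ℝ) := by rw [Finset.mul_sum]
        _ ≤ 2 * k / L * L := by gcongr
        _ = 2 * k := by field_simp
    have e3 : (∑ p ∈ S, avg p (x p)) ^ J ≤ (2 * k) ^ J :=
      pow_le_pow_left₀ (Finset.sum_nonneg fun p hp => hγ0 p (Finset.mem_sdiff.1 hp).1) e2 J
    have e4 : es (fun p => avg p (x p)) S J * J.factorial ≤ ε ^ k * J.factorial := by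
      linarith
    have : (0:ℝ) < J.factorial := by positivity
    exact le_of_mul_le_mul_right e4 this
  have c5 : 2 * (∏ p ∈ S0, (p:ℝ)) * ∑ j ∈ range (J+1), es (fun p => (p:ℝ)) S j
      ≤ 2 * (J + 1) * (Pm:ℝ) ^ (k + 2 * J) := by
    have hPmR : (1:ℝ) ≤ Pm := by exact_mod_cast hPm1
    have f1 : ∏ p ∈ S0, (p:ℝ) ≤ (Pm:ℝ) ^ k := by
      calc ∏ p ∈ S0, (p:ℝ) ≤ ∏ p ∈ S0, (Pm:ℝ) :=
            Finset.prod_le_prod (fun _ _ => by positivity)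
              fun p hp => by exact_mod_cast hPm p (hS0P hp)
        _ = (Pm:ℝ) ^ S0.card := by simp
        _ ≤ _ := pow_le_pow_right₀ hPmR hcard
    have f2 : ∑ p ∈ S, (p:ℝ) ≤ (Pm:ℝ) ^ 2 := by
      have hsub : S ⊆ Finset.Icc 1 Pm := fun p hp => by
        have hpP := (Finset.mem_sdiff.1 hp).1
        exact Finset.mem_Icc.2 ⟨(hP p hpP).pos, hPm p hpP⟩
      have hc : S.card ≤ Pm := by simpa using Finset.card_le_card hsub
      calc ∑ p ∈ S, (p:ℝ) ≤ ∑ p ∈ S, (Pm:ℝ) := Finset.sum_le_sum fun p hp => by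
            exact_mod_cast hPm p (Finset.mem_sdiff.1 hp).1
        _ = S.card * (Pm:ℝ) := by simp
        _ ≤ Pm * Pm := by gcongr
        _ = _ := by ring
    have f3 : ∀ j ∈ range (J+1), es (fun p => (p:ℝ)) S j ≤ (Pm:ℝ) ^ (2 * J) := by
      intro j hj
      have hjJ : j ≤ J := by simpa [Nat.lt_succ_iff] using hj
      have e1 := es_le (x := fun p : ℕ => (p:ℝ)) (S := S) (fun p _ => by positivity) j
      have e0 := es_nonneg (x := fun p : ℕ => (p:ℝ)) (S := S) (fun p _ => by positivity) j
      have e2 : (1:ℝ) ≤ j.factorial := by exact_mod_cast Nat.one_le_iff_ne_zero.2 j.factorial_ne_zero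
      calc es (fun p => (p:ℝ)) S j ≤ es (fun p => (p:ℝ)) S j * j.factorial :=
            le_mul_of_one_le_right e0 e2
        _ ≤ (∑ p ∈ S, (p:ℝ)) ^ j := e1
        _ ≤ ((Pm:ℝ) ^ 2) ^ j := pow_le_pow_left₀ (Finset.sum_nonneg fun _ _ => by positivity) f2 j
        _ ≤ ((Pm:ℝ) ^ 2) ^ J := pow_le_pow_right₀ (one_le_pow₀ hPmR) hjJ
        _ = _ := by rw [← pow_mul]
    have f4 : ∑ j ∈ range (J+1), es (fun p => (p:ℝ)) S j ≤ (J + 1) * (Pm:ℝ) ^ (2 * J) := by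
      refine (Finset.sum_le_sum f3).trans (le_of_eq ?_)
      simp
    have f5 : 0 ≤ ∑ j ∈ range (J+1), es (fun p => (p:ℝ)) S j :=
      Finset.sum_nonneg fun j _ => es_nonneg (fun p _ => by positivity) j
    calc _ ≤ 2 * (Pm:ℝ) ^ k * ((J + 1) * (Pm:ℝ) ^ (2 * J)) := by gcongr
      _ = _ := by rw [pow_add]; ring
  have hes0 : 0 ≤ es (fun p => avg p (x p)) S J :=
    es_nonneg (fun p hp => hγ0 p (Finset.mem_sdiff.1 hp).1) J
  have c6 : (∏ p ∈ S0, avg p (fun n => |h p n|)) * es (fun p => avg p (x p)) S J ≤ V := by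
    refine le_trans ?_ c3
    exact mul_le_mul c2 c4 hes0 hV0n
  have hN : (0:ℝ) ≤ N := by positivity
  nlinarith

end Local

open Finset

section Conn

variable {P : Finset ℕ} {g M : ℕ}

/-- good words -/
def good (w : Fin g → Lt P) : Prop :=
  (∀ i j, (w i).1 = (w j).1 → i = j) ∧
  ∀ (i : Fin g) (j : ℕ), j ≤ g → j ≠ i.1 → j ≠ i.1 + 1 →
    ¬ (((w i).1.1 : ℕ) : ℤ) ∣ pos w j - pos w i.1

/-- node positions in a multi-block word -/
def nd (W : Fin M → Fin g → Lt P) (b : Fin M) (i : ℕ) : ℤ := bpos W b.1 + pos (W b) i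

def contam (W : Fin M → Fin g → Lt P) (b : Fin M) (i : Fin g) : Prop :=
  ∃ b', b' ≠ b ∧ ∃ j ≤ g, (((W b i).1.1 : ℕ) : ℤ) ∣ nd W b' j - nd W b i.1

def wstd (W : Fin M → Fin g → Lt P) (p : ℕ) : Prop :=
  ∃ t t' : Fin M × Fin g, (W t.1 t.2).1.1 = p ∧ (W t'.1 t'.2).1.1 = p ∧
    ¬ (p:ℤ) ∣ nd W t'.1 t'.2.1 - nd W t.1 t.2.1

def snu (W : Fin M → Fin g → Lt P) (p : ℕ) : Prop :=
  ∃ t : Fin M × Fin g, (W t.1 t.2).1.1 = p ∧ (∀ t' : Fin M × Fin g, (W t'.1 t'.2).1.1 = p → t' = t) ∧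
    ¬ contam W t.1 t.2

open Classical in
noncomputable def wval (L η : ℝ) (W : Fin M → Fin g → Lt P) : ℝ :=
  ∏ p ∈ univ.image (fun t : Fin M × Fin g => (W t.1 t.2).1.1),
    (2 / (p:ℝ) * (if wstd W p then η else 1) * (if snu W p then 2 / L else 1))

lemma nd_succ (W : Fin M → Fin g → Lt P) (b : Fin M) (i : Fin g) :
    nd W b (i.1 + 1) = nd W b i.1 + stp (W b i) := by
  unfold nd; rw [pos_succ]; ring

open Classical in
noncomputable def phi (P : Finset ℕ) (I : Finset ℤ) (L : ℝ) (n : ℤ) : ℝ :=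
  if n ∈ I then Real.exp (-1 / L) ^ om P n else 0

lemma pow_om (θ : ℝ) (n : ℤ) : θ ^ om P n = ∏ p ∈ P, θ ^ (if (p:ℤ) ∣ n then 1 else 0) := by
  unfold om
  rw [Finset.prod_pow_eq_pow_sum]
  congr 1
  simp

lemma cc_le_four (W : Fin M → Fin g → Lt P) (hW : ∀ b, good (W b)) (b : Fin M) (i : Fin g)
    (hc : ¬ contam W b i) (n : ℤ) (hn : (((W b i).1.1 : ℕ) : ℤ) ∣ n + nd W b i.1) :
    cc (fun t : Fin M × Fin g => nd W t.1 t.2.1) (fun t => nd W t.1 (t.2.1+1)) (W b i).1.1 n ≤ 4 := by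
  classical
  set p := (W b i).1.1 with hp
  have key : ∀ b' j, j ≤ g → (p:ℤ) ∣ n + nd W b' j → b' = b ∧ (j = i.1 ∨ j = i.1 + 1) := by
    intro b' j hj hd
    have h1 : (p:ℤ) ∣ nd W b' j - nd W b i.1 := by
      have := dvd_sub hd hn; rwa [add_sub_add_left_eq_sub] at this
    have hb : b' = b := by
      by_contra hne; exact hc ⟨b', hne, j, hj, h1⟩
    subst hb
    refine ⟨rfl, ?_⟩
    by_contra hne
    push Not at hne
    refine (hW b').2 i j hj hne.1 hne.2 ?_
    have : nd W b' j - nd W b' i.1 = pos (W b') j - pos (W b') i.1 := by unfold nd; ring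
    rwa [this] at h1
  unfold cc
  rw [Finset.sum_add_distrib, ← Finset.card_filter, ← Finset.card_filter]
  have c1 : (univ.filter fun t : Fin M × Fin g => (p:ℤ) ∣ n + nd W t.1 t.2.1).card ≤ 2 := by
    have : Set.InjOn (fun t : Fin M × Fin g => t.2.1)
        (univ.filter fun t : Fin M × Fin g => (p:ℤ) ∣ n + nd W t.1 t.2.1) := by
      intro t ht t' ht' h
      simp only [Finset.coe_filter, Finset.mem_univ, true_and, Set.mem_ofPred_eq] at ht ht'
      have a1 := key _ _ t.2.2.le ht
      have a2 := key _ _ t'.2.2.le ht'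
      exact Prod.ext (a1.1.trans a2.1.symm) (Fin.ext h)
    rw [← Finset.card_image_of_injOn this]
    refine (Finset.card_le_card (t := {i.1, i.1+1}) ?_).trans Finset.card_le_two
    intro x hx
    obtain ⟨t, ht, rfl⟩ := Finset.mem_image.1 hx
    have := (key _ _ t.2.2.le (Finset.mem_filter.1 ht).2).2
    simpa using this
  have c2 : (univ.filter fun t : Fin M × Fin g => (p:ℤ) ∣ n + nd W t.1 (t.2.1+1)).card ≤ 2 := by
    have : Set.InjOn (fun t : Fin M × Fin g => t.2.1 + 1)
        (univ.filter fun t : Fin M × Fin g => (p:ℤ) ∣ n + nd W t.1 (t.2.1+1)) := by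
      intro t ht t' ht' h
      simp only [Finset.coe_filter, Finset.mem_univ, true_and, Set.mem_ofPred_eq] at ht ht'
      have a1 := key _ _ t.2.2 ht
      have a2 := key _ _ t'.2.2 ht'
      exact Prod.ext (a1.1.trans a2.1.symm) (Fin.ext (by simpa using h))
    rw [← Finset.card_image_of_injOn this]
    refine (Finset.card_le_card (t := {i.1, i.1+1}) ?_).trans Finset.card_le_two
    intro x hx
    obtain ⟨t, ht, rfl⟩ := Finset.mem_image.1 hx
    have := (key _ _ t.2.2 (Finset.mem_filter.1 ht).2).2
    simpa using this
  exact (Nat.add_le_add c1 c2).trans (by norm_num)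

theorem conn_bd (hP : ∀ p ∈ P, p.Prime) (I : Finset ℤ) (W : Fin M → Fin g → Lt P)
    (hW : ∀ b, good (W b)) (L : ℝ) (hL : 2 ≤ L) (hPL : ∑ p ∈ P, 1 / (p:ℝ) ≤ L)
    (Pm k : ℕ) (hk : M * g = k) (hkp : ∀ p ∈ P, k ≤ p) (hPm : ∀ p ∈ P, p ≤ Pm) (hPm1 : 1 ≤ Pm)
    (η : ℝ) (hη : ∀ p ∈ P, 3 / (2 * (p:ℝ)) ≤ η) (hη0 : 0 ≤ η)
    (J : ℕ) (hJ : (2 * k : ℝ) ^ J ≤ J.factorial * (2 / L) ^ k) (a : ℤ) (N : ℕ)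
    (hI : ∀ n ∈ Ioc a (a + N), ∀ b, ∀ i ≤ g, n + nd W b i ∈ I) :
    |∑ n ∈ Ioc a (a + N), Wt (phi P I L) W n| ≤
      3 * N * wval L η W + 2 * (J + 1) * (Pm:ℝ) ^ (k + 2 * J) := by
  have := local_bd (T := Fin M × Fin g) P hP (fun t => (W t.1 t.2).1.1)
    (fun t => (W t.1 t.2).1.2) (fun t => nd W t.1 t.2.1) (fun t => nd W t.1 (t.2.1+1)) L hL hPL
    Pm k (by simp [hk]) hkp hPm hPm1 (wstd W) (snu W) η hη hη0
    (by
      rintro p hp ⟨t, t', h1, h2, h3⟩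
      exact ⟨t, t', h1, h2, h3⟩)
    (by
      rintro p hp ⟨t, h1, h2, h3⟩
      refine ⟨t, h1, h2, fun n hn => ?_⟩
      subst h1
      exact cc_le_four W hW t.1 t.2 h3 n hn) J hJ a N
  refine le_trans (le_of_eq ?_) this
  congr 1
  refine Finset.sum_congr rfl fun n hn => ?_
  have e : ∀ b i, i ≤ g → phi P I L (n + nd W b i)
      = ∏ p ∈ P, Real.exp (-1 / L) ^ (if (p:ℤ) ∣ n + nd W b i then 1 else 0) := by
    intro b i hi
    rw [phi, if_pos (hI n hn b i hi), pow_om]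
  unfold Wt wt
  rw [← Finset.prod_product', Finset.univ_product_univ]
  have e2 : ∀ t : Fin M × Fin g, al (phi P I L) (W t.1 t.2) (n + bpos W t.1.1 + pos (W t.1) t.2.1)
      = lit (W t.1 t.2).1.1 (n + nd W t.1 t.2.1) * ∏ p ∈ P, Real.exp (-1 / L) ^
        ((if (p:ℤ) ∣ n + nd W t.1 t.2.1 then 1 else 0)
          + (if (p:ℤ) ∣ n + nd W t.1 (t.2.1+1) then 1 else 0)) := by
    intro t
    have h0 : n + bpos W t.1.1 + pos (W t.1) t.2.1 = n + nd W t.1 t.2.1 := by unfold nd; ring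
    have h1 : n + nd W t.1 t.2.1 + stp (W t.1 t.2) = n + nd W t.1 (t.2.1+1) := by
      rw [nd_succ]; ring
    rw [h0]
    unfold al
    rw [h1, e _ _ t.2.2.le, e _ _ t.2.2]
    simp only [pow_add, Finset.prod_mul_distrib]
    ring
  rw [Finset.prod_congr rfl fun t _ => e2 t, Finset.prod_mul_distrib]
  congr 1
  rw [Finset.prod_comm]
  refine Finset.prod_congr rfl fun p _ => ?_
  rw [Finset.prod_pow_eq_pow_sum]
  rfl

end Conn

open Finset

section Det

set_option linter.unusedSectionVars false

variable {T α : Type*} [Fintype T] [Fintype α]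

noncomputable def rep (s : Setoid T) (t : T) : T := (Quotient.mk s t).out

lemma rep_rel (s : Setoid T) (t : T) : s (rep s t) t := Quotient.mk_out t

lemma rep_eq_iff (s : Setoid T) (t t' : T) : rep s t = rep s t' ↔ s t t' := by
  constructor
  · intro h
    have h1 := rep_rel s t
    rw [h] at h1
    exact s.trans (s.symm h1) (rep_rel s t')
  · intro h
    unfold rep
    rw [Quotient.sound (s := s) h]

lemma rep_rep (s : Setoid T) (t : T) : rep s (rep s t) = rep s t :=
  (rep_eq_iff s _ _).2 (rep_rel s t)

open Classical in
noncomputable def Fx (s : Setoid T) : Finset T := univ.filter fun t => rep s t = t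

lemma rep_mem_Fx (s : Setoid T) (t : T) : rep s t ∈ Fx s := by
  classical
  simp [Fx, rep_rep]

lemma ker_rep {q : T → α} {s : Setoid T} (h : Setoid.ker q = s) (t : T) : q (rep s t) = q t := by
  have := rep_rel s t
  rw [← h] at this
  rw [← h]
  exact this

lemma ker_rep_eq {q : T → α} {s : Setoid T} (h : Setoid.ker q = s) (t t' : T) :
    rep s t = rep s t' ↔ q t = q t' := by
  rw [rep_eq_iff, ← h]; exact Iff.rfl

open Classical in
lemma prod_image_Fx {q : T → α} {s : Setoid T} (h : Setoid.ker q = s) (F : α → ℝ) :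
    ∏ p ∈ univ.image q, F p = ∏ t ∈ Fx s, F (q t) := by
  have : univ.image q = (Fx s).image q := by
    ext p
    simp only [Finset.mem_image, Finset.mem_univ, true_and]
    constructor
    · rintro ⟨t, rfl⟩
      exact ⟨rep s t, rep_mem_Fx s t, ker_rep h t⟩
    · rintro ⟨t, _, rfl⟩; exact ⟨t, rfl⟩
  rw [this, Finset.prod_image]
  intro t ht t' ht' he
  have a1 : rep s t = t := (Finset.mem_filter.1 ht).2
  have a2 : rep s t' = t' := (Finset.mem_filter.1 ht').2
  rw [← a1, ← a2]
  exact (ker_rep_eq h _ _).2 he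

open Classical in
theorem detl (s : Setoid T) (x : α → ℝ) (hx : ∀ a, 0 ≤ x a) (xm : ℝ) (hxm0 : 0 ≤ xm) (hxm : ∀ a, x a ≤ xm)
    (L : ℝ) (hL : 1 ≤ L) (hxL : ∑ a, x a ≤ L) (Bs : Finset (T → α))
    (hB : ∀ q ∈ Bs, Setoid.ker q = s) {E : ℕ} (c : Fin E → T)
    (hc : ∀ q ∈ Bs, Function.Injective fun k => q (c k)) (M0 : ℕ)
    (Φ : Fin E → (T → α) → Finset α)
    (hΦ : ∀ q ∈ Bs, ∀ k, q (c k) ∈ Φ k q ∧ (Φ k q).card ≤ M0)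
    (hdep : ∀ q ∈ Bs, ∀ q' ∈ Bs, ∀ k,
      (∀ t, (∀ j, k ≤ j → q t ≠ q (c j)) → q t = q' t) → Φ k q = Φ k q') :
    ∑ q ∈ Bs, ∏ t ∈ Fx s, x (q t) ≤ L ^ (Fx s).card * (M0 * xm) ^ E := by
  rcases Bs.eq_empty_or_nonempty with rfl | ⟨q0, hq0⟩
  · rw [Finset.sum_empty]; positivity
  set C : Finset T := univ.image (fun k => rep s (c k)) with hC
  have hinj : Function.Injective fun k => rep s (c k) := by
    intro k k' h
    exact hc q0 hq0 ((ker_rep_eq (hB q0 hq0) _ _).1 h)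
  have hCF : C ⊆ Fx s := by
    intro t ht
    obtain ⟨k, _, rfl⟩ := Finset.mem_image.1 ht
    exact rep_mem_Fx s _
  have hCc : C.card = E := by
    rw [hC, Finset.card_image_of_injective _ hinj]; simp
  set R := Fx s \ C with hR
  -- choose injections
  have hch : ∀ S : Finset α, ∃ e : α → Option (Fin M0), S.card ≤ M0 →
      (∀ a ∈ S, ∃ r, e a = some r) ∧ ∀ a ∈ S, ∀ a' ∈ S, e a = e a' → a = a' := by
    intro S
    refine ⟨fun a => if h : a ∈ S ∧ S.card ≤ M0 then
      some (Fin.castLE h.2 (S.equivFin ⟨a, h.1⟩)) else none, fun hS => ⟨?_, ?_⟩⟩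
    · intro a ha; simp [ha, hS]
    · intro a ha a' ha'
      simp [ha, ha', hS]
  choose e he using hch
  have hch2 : ∀ q ∈ Bs, ∀ k, ∃ r, e (Φ k q) (q (c k)) = some r := fun q hq k =>
    (he _ (hΦ q hq k).2).1 _ (hΦ q hq k).1
  set F : (T → α) → (R → α) × (Fin E → Option (Fin M0)) := fun q =>
    (fun t => q t.1, fun k => e (Φ k q) (q (c k))) with hF
  have hFinj : Set.InjOn F Bs := by
    intro q hq q' hq' h
    have h1 : ∀ t ∈ R, q t = q' t := fun t ht => congrFun (congrArg Prod.fst h) ⟨t, ht⟩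
    have h2 : ∀ k, e (Φ k q) (q (c k)) = e (Φ k q') (q' (c k)) :=
      fun k => congrFun (congrArg Prod.snd h) k
    have key : ∀ n : ℕ, ∀ k : Fin E, k.1 < n → q (c k) = q' (c k) := by
      intro n
      induction n with
      | zero => intro k hk; omega
      | succ n ih =>
        intro k hk
        have hΦe : Φ k q = Φ k q' := by
          refine hdep q hq q' hq' k fun t ht => ?_
          rw [← ker_rep (hB q hq) t, ← ker_rep (hB q' hq') t]
          by_cases htC : rep s t ∈ C
          · obtain ⟨j, _, hj⟩ := Finset.mem_image.1 htC
            have hj' : j < k := by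
              by_contra hlt
              exact ht j (not_lt.1 hlt) ((ker_rep_eq (hB q hq) _ _).1 hj).symm
            rw [← hj, ker_rep (hB q hq), ker_rep (hB q' hq')]
            exact ih j (by have : j.1 < k.1 := hj'; omega)
          · exact h1 _ (Finset.mem_sdiff.2 ⟨rep_mem_Fx s t, htC⟩)
        have h3 := h2 k
        have h4 := hΦ q' hq' k
        rw [← hΦe] at h3 h4
        exact (he _ (hΦ q hq k).2).2 _ (hΦ q hq k).1 _ h4.1 h3
    ext t
    rw [← ker_rep (hB q hq) t, ← ker_rep (hB q' hq') t]
    by_cases htC : rep s t ∈ C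
    · obtain ⟨j, _, hj⟩ := Finset.mem_image.1 htC
      rw [← hj, ker_rep (hB q hq), ker_rep (hB q' hq')]
      exact key E j j.2
    · exact h1 _ (Finset.mem_sdiff.2 ⟨rep_mem_Fx s t, htC⟩)
  set G : (R → α) × (Fin E → Option (Fin M0)) → ℝ := fun z => xm ^ E * ∏ t, x (z.1 t) with hG
  have hle : ∀ q ∈ Bs, ∏ t ∈ Fx s, x (q t) ≤ G (F q) := by
    intro q hq
    rw [← Finset.prod_sdiff hCF, mul_comm]
    simp only [hG, hF]
    rw [Finset.prod_coe_sort R (fun t => x (q t))]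
    refine mul_le_mul_of_nonneg_right ?_ (Finset.prod_nonneg fun _ _ => hx _)
    calc ∏ t ∈ C, x (q t) ≤ ∏ t ∈ C, xm := Finset.prod_le_prod (fun _ _ => hx _) fun _ _ => hxm _
      _ = xm ^ E := by simp [hCc]
  set D : Finset ((R → α) × (Fin E → Option (Fin M0))) :=
    univ ×ˢ Fintype.piFinset (fun _ => univ.image some) with hD
  have hG0 : ∀ z, 0 ≤ G z := fun z =>
    mul_nonneg (pow_nonneg hxm0 _) (Finset.prod_nonneg fun _ _ => hx _)
  calc ∑ q ∈ Bs, ∏ t ∈ Fx s, x (q t) ≤ ∑ q ∈ Bs, G (F q) := Finset.sum_le_sum hle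
    _ = ∑ z ∈ Bs.image F, G z := by rw [Finset.sum_image hFinj]
    _ ≤ ∑ z ∈ D, G z := by
        refine Finset.sum_le_sum_of_subset_of_nonneg ?_ fun z _ _ => hG0 z
        intro z hz
        obtain ⟨q, hq, rfl⟩ := Finset.mem_image.1 hz
        simp only [hD, Finset.mem_product, Finset.mem_univ, true_and, Fintype.mem_piFinset,
          Finset.mem_image]
        intro k
        obtain ⟨r, hr⟩ := hch2 q hq k
        exact ⟨r, hr.symm⟩
    _ = (M0:ℝ) ^ E * (xm ^ E * ∑ f : R → α, ∏ t, x (f t)) := by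
        rw [hD, Finset.sum_product_right]
        simp only [hG]
        rw [Finset.sum_const, Fintype.card_piFinset]
        rw [← Finset.mul_sum]
        simp [Finset.card_image_of_injective _ (Option.some_injective _)]
    _ = (M0:ℝ) ^ E * (xm ^ E * (∑ a, x a) ^ R.card) := by
        congr 2
        have := Finset.prod_univ_sum (fun _ : R => (univ : Finset α)) (fun _ a => x a)
        rw [Fintype.piFinset_univ] at this
        rw [← this]
        simp
    _ ≤ (M0:ℝ) ^ E * (xm ^ E * L ^ (Fx s).card) := by
        have h0 : 0 ≤ ∑ a, x a := Finset.sum_nonneg fun _ _ => hx _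
        gcongr
        calc (∑ a, x a) ^ R.card ≤ L ^ R.card := pow_le_pow_left₀ h0 hxL _
          _ ≤ _ := pow_le_pow_right₀ hL (Finset.card_le_card Finset.sdiff_subset)
    _ = _ := by rw [mul_pow]; ring

end Det

open Finset

section ES

variable {α : Type*}

/-- chains of a relation -/
def IC (S : Finset α) (r : α → α → Prop) : ℕ → α → Prop
  | 0, x => x ∈ S
  | n+1, x => x ∈ S ∧ ∃ y, r y x ∧ IC S r n y

lemma IC_chain (S : Finset α) (r : α → α → Prop) (n : ℕ) (x : α) (h : IC S r n x) :
    ∃ i : ℕ → α, i n = x ∧ (∀ k ≤ n, i k ∈ S) ∧ ∀ k < n, r (i k) (i (k+1)) := by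
  induction n generalizing x with
  | zero =>
    refine ⟨fun _ => x, rfl, fun _ _ => h, fun k hk => by omega⟩
  | succ n ih =>
    obtain ⟨hx, y, hy, hyc⟩ := h
    obtain ⟨i, hi, hS, hr⟩ := ih y hyc
    refine ⟨fun k => if k = n + 1 then x else i k, by simp, ?_, ?_⟩
    · intro k hk
      by_cases h : k = n + 1
      · simpa [h] using hx
      · simpa [h] using hS k (by omega)
    · intro k hk
      by_cases h : k = n
      · subst h; simpa [hi] using hy
      · have h1 : k ≠ n + 1 := by omega
        simp only [h1, if_false, Nat.add_right_cancel_iff, h]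
        exact hr k (by omega)

lemma chain_fin {S : Finset α} {r : α → α → Prop} (ht : ∀ x y z, r x y → r y z → r x z)
    {n : ℕ} {x : α} (h : IC S r n x) :
    ∃ i : Fin (n+1) → α, (∀ k, i k ∈ S) ∧ ∀ k l, k < l → r (i k) (i l) := by
  obtain ⟨i, _, hS, hr⟩ := IC_chain S r n x h
  refine ⟨fun k => i k.1, fun k => hS _ (by omega), ?_⟩
  have key : ∀ d k, k + d + 1 ≤ n → r (i k) (i (k + d + 1)) := by
    intro d
    induction d with
    | zero => intro k hk; exact hr k (by omega)
    | succ d ih =>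
      intro k hk
      exact ht _ _ _ (ih k (by omega)) (by
        have := hr (k + d + 1) (by omega)
        rwa [show k + (d+1) + 1 = k + d + 1 + 1 by ring])
  intro k l hkl
  have h1 : k.1 < l.1 := hkl
  have := key (l.1 - k.1 - 1) k.1 (by omega)
  rwa [show k.1 + (l.1 - k.1 - 1) + 1 = l.1 by omega] at this

open Classical in
theorem es_chain {g : ℕ} (E : ℕ) (S : Finset (Fin g)) (f : Fin g → ℕ)
    (hf : ∀ x ∈ S, ∀ y ∈ S, f x = f y → x = y) (hS : E ^ 2 < S.card) :
    ∃ i : Fin (E+1) → Fin g, (∀ k, i k ∈ S) ∧ StrictMono i ∧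
      (StrictMono (fun k => f (i k)) ∨ StrictAnti (fun k => f (i k))) := by
  by_contra hcon
  set r1 : Fin g → Fin g → Prop := fun x y => x < y ∧ f x < f y with hr1
  set r2 : Fin g → Fin g → Prop := fun x y => x < y ∧ f y < f x with hr2
  have n1 : ∀ x, ¬ IC S r1 E x := by
    intro x h
    obtain ⟨i, hi, hr⟩ := chain_fin (fun x y z h1 h2 => ⟨h1.1.trans h2.1, h1.2.trans h2.2⟩) h
    exact hcon ⟨i, hi, fun k l h => (hr k l h).1, Or.inl fun k l h => (hr k l h).2⟩
  have n2 : ∀ x, ¬ IC S r2 E x := by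
    intro x h
    obtain ⟨i, hi, hr⟩ := chain_fin (fun x y z h1 h2 => ⟨h1.1.trans h2.1, h2.2.trans h1.2⟩) h
    exact hcon ⟨i, hi, fun k l h => (hr k l h).1, Or.inr fun k l h => (hr k l h).2⟩
  have hE : 0 < E := by
    rcases Nat.eq_zero_or_pos E with rfl | h
    · exfalso
      obtain ⟨x, hx⟩ := Finset.card_pos.1 (lt_of_le_of_lt (Nat.zero_le _) hS)
      exact n1 x hx
    · exact h
  have gen : ∀ (r : Fin g → Fin g → Prop), (∀ x, ¬ IC S r E x) →
      ∃ a : Fin g → ℕ, (∀ x ∈ S, a x < E) ∧ ∀ x ∈ S, ∀ y ∈ S, r x y → a x < a y := by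
    intro r hn
    refine ⟨fun x => Nat.findGreatest (fun n => IC S r n x) E, fun x hx => ?_, ?_⟩
    · have h1 := Nat.findGreatest_spec (P := fun n => IC S r n x) (Nat.zero_le E) hx
      have h2 := Nat.findGreatest_le (P := fun n => IC S r n x) E
      refine lt_of_le_of_ne h2 fun h => ?_
      dsimp only at h
      rw [h] at h1
      exact hn x h1
    · intro x hx y hy hxy
      have h1 := Nat.findGreatest_spec (P := fun n => IC S r n x) (Nat.zero_le E) hx
      have h2 := Nat.findGreatest_le (P := fun n => IC S r n x) E
      have h3 : Nat.findGreatest (fun n => IC S r n x) E ≠ E := by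
        intro h; rw [h] at h1; exact hn x h1
      have h4 : IC S r (Nat.findGreatest (fun n => IC S r n x) E + 1) y := ⟨hy, x, hxy, h1⟩
      have := Nat.le_findGreatest (P := fun n => IC S r n y)
        (show Nat.findGreatest (fun n => IC S r n x) E + 1 ≤ E by omega) h4
      exact this
  obtain ⟨a, ha, ha'⟩ := gen r1 n1
  obtain ⟨d, hd, hd'⟩ := gen r2 n2
  have hcard : S.card ≤ (range E ×ˢ range E).card := by
    refine Finset.card_le_card_of_injOn (fun x => (a x, d x)) ?_ ?_
    · intro x hx
      have h1 := ha x hx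
      have h2 := hd x hx
      simp [h1, h2]
    · intro x hx y hy h
      have e1 : a x = a y := congrArg Prod.fst h
      have e2 : d x = d y := congrArg Prod.snd h
      by_contra hne
      have hfne : f x ≠ f y := fun h => hne (hf x hx y hy h)
      rcases lt_or_gt_of_ne hne with hlt | hlt <;> rcases lt_or_gt_of_ne hfne with hl | hl
      · have := ha' x hx y hy ⟨hlt, hl⟩; omega
      · have := hd' x hx y hy ⟨hlt, hl⟩; omega
      · have := hd' y hy x hx ⟨hlt, hl⟩; omega
      · have := ha' y hy x hx ⟨hlt, hl⟩; omega
  rw [Finset.card_product, Finset.card_range] at hcard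
  nlinarith

end ES

open Finset

section Data

variable {P : Finset ℕ} {g M E : ℕ}

def mkW (sg : Fin M → Fin g → Bool) (q : Fin M × Fin g → {p // p ∈ P}) : Fin M → Fin g → Lt P :=
  fun b i => (q (b, i), sg b i)

def NZ (W : Fin M → Fin g → Lt P) (β β' : Fin M) (τ : Bool) (i : Fin E → Fin g)
    (y : Fin E → Fin (g+1)) : Prop :=
  StrictMono i ∧
  (∀ k, (((W β (i k)).1.1 : ℕ) : ℤ) ∣ nd W β' (y k).1 - nd W β (i k).1 ∧
    nd W β' (y k).1 - nd W β (i k).1 ≠ 0) ∧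
  ∀ k j, k ≤ j → ∀ u : Fin g, (if τ then u.1 < (y k).1 else (y k).1 ≤ u.1) →
    (W β' u).1 ≠ (W β (i j)).1

def ZD (W : Fin M → Fin g → Lt P) (β β' : Fin M) (i : Fin (E+1) → Fin g)
    (w : Fin (E+1) → Fin (g+1)) (c : Fin E → Fin g) : Prop :=
  (∀ k, nd W β (i k).1 = nd W β' (w k).1) ∧
  (∀ k : Fin E, i k.castSucc ≤ c k ∧ c k < i k.succ) ∧
  ∀ k u, (W β' u).1 ≠ (W β (c k)).1

/-- tail sums -/
def tsm (d : Fin g → ℤ) (i : ℕ) : ℤ := ∑ j : Fin g, if i ≤ j.1 then d j else 0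

lemma psum_add_tsm (d : Fin g → ℤ) (i : ℕ) : psum d i + tsm d i = ∑ j, d j := by
  unfold psum tsm
  rw [← Finset.sum_add_distrib]
  refine Finset.sum_congr rfl fun j _ => ?_
  by_cases h : j.1 < i
  · rw [if_pos h, if_neg (by omega)]; ring
  · rw [if_neg h, if_pos (by omega)]; ring

lemma abs_stp_le {Pm : ℕ} (hPm : ∀ p ∈ P, p ≤ Pm) (s : Lt P) : |stp s| ≤ Pm := by
  have := hPm _ s.1.2
  unfold stp
  split_ifs
  · rw [abs_of_nonneg (by positivity)]; exact_mod_cast this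
  · rw [abs_neg, abs_of_nonneg (by positivity)]; exact_mod_cast this

lemma abs_psum_le (d : Fin g → ℤ) (B : ℤ) (hB0 : 0 ≤ B) (hd : ∀ j, |d j| ≤ B) (i : ℕ) :
    |psum d i| ≤ g * B := by
  unfold psum
  refine (Finset.abs_sum_le_sum_abs _ _).trans ?_
  calc _ ≤ ∑ j : Fin g, B := Finset.sum_le_sum fun j _ => by
        split_ifs
        · exact hd j
        · simpa using hB0
    _ = g * B := by simp

lemma abs_tsm_le (d : Fin g → ℤ) (B : ℤ) (hB0 : 0 ≤ B) (hd : ∀ j, |d j| ≤ B) (i : ℕ) :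
    |tsm d i| ≤ g * B := by
  unfold tsm
  refine (Finset.abs_sum_le_sum_abs _ _).trans ?_
  calc _ ≤ ∑ j : Fin g, B := Finset.sum_le_sum fun j _ => by
        split_ifs
        · exact hd j
        · simpa using hB0
    _ = g * B := by simp

lemma card_dvd_le (hP : ∀ p ∈ P, p.Prime) {D : ℤ} (hD : D ≠ 0) {M0 : ℕ}
    (hM : D.natAbs ≤ 2 ^ M0) :
    (univ.filter fun p : {p // p ∈ P} => ((p.1 : ℕ) : ℤ) ∣ D).card ≤ M0 := by
  set F := univ.filter fun p : {p // p ∈ P} => ((p.1 : ℕ) : ℤ) ∣ D with hF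
  have h1 : ∏ p ∈ F.image Subtype.val, p ∣ D.natAbs := by
    refine Finset.prod_primes_dvd _ (fun p hp => ?_) (fun p hp => ?_)
    · obtain ⟨q, _, rfl⟩ := Finset.mem_image.1 hp
      exact (hP _ q.2).prime
    · obtain ⟨q, hq, rfl⟩ := Finset.mem_image.1 hp
      exact Int.natCast_dvd.1 (Finset.mem_filter.1 hq).2
  have h2 := Nat.le_of_dvd (Int.natAbs_pos.2 hD) h1
  have h3 : 2 ^ F.card ≤ ∏ p ∈ F.image Subtype.val, p := by
    rw [← Finset.card_image_of_injective F Subtype.val_injective]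
    refine Finset.pow_card_le_prod _ _ _ fun p hp => ?_
    obtain ⟨q, _, rfl⟩ := Finset.mem_image.1 hp
    exact (hP _ q.2).two_le
  exact (Nat.pow_le_pow_iff_right (by norm_num)).1 ((h3.trans h2).trans hM)

open Classical in
theorem nz_sum (hP : ∀ p ∈ P, p.Prime) (sg : Fin M → Fin g → Bool)
    (s : Setoid (Fin M × Fin g)) (L xm : ℝ) (hL : 1 ≤ L) (hPL : ∑ p ∈ P, 1 / (p:ℝ) ≤ L)
    (hxm0 : 0 ≤ xm) (hxm : ∀ p ∈ P, 1 / (p:ℝ) ≤ xm) (Pm M0 : ℕ) (hPm : ∀ p ∈ P, p ≤ Pm)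
    (hM0 : 5 * M * g * Pm ≤ 2 ^ M0) (β β' : Fin M) (τ : Bool) (i : Fin E → Fin g)
    (y : Fin E → Fin (g+1)) :
    ∑ q ∈ univ.filter (fun q : Fin M × Fin g → {p // p ∈ P} =>
        Setoid.ker q = s ∧ (∀ b, good (mkW sg q b)) ∧ NZ (mkW sg q) β β' τ i y),
      ∏ t ∈ Fx s, 1 / ((q t).1 : ℝ) ≤
    (6 * M * g * Pm + 1) * (L ^ (Fx s).card * (M0 * xm) ^ E) := by
  set Bs := univ.filter (fun q : Fin M × Fin g → {p // p ∈ P} =>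
        Setoid.ker q = s ∧ (∀ b, good (mkW sg q b)) ∧ NZ (mkW sg q) β β' τ i y) with hBs
  set dl : (Fin M × Fin g → {p // p ∈ P}) → ℤ := fun q =>
    if τ then bpos (mkW sg q) β'.1 - bpos (mkW sg q) β.1
    else bpos (mkW sg q) β'.1 + pos (mkW sg q β') g - bpos (mkW sg q) β.1 with hdl
  set R : ℤ := 3 * M * g * Pm with hR
  have hM1 : (1:ℤ) ≤ M := by have := β.2; omega
  have hpos : ∀ q b j, |pos (mkW (P := P) sg q b) j| ≤ g * Pm := fun q b j =>
    abs_psum_le _ _ (by positivity) (fun j => abs_stp_le hPm _) _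
  have hbp : ∀ q j, |bpos (mkW (P := P) sg q) j| ≤ M * (g * Pm) := fun q j =>
    abs_psum_le _ _ (by positivity) (fun j => hpos q j g) _
  have hgP : (0:ℤ) ≤ g * Pm := by positivity
  have hdlR : ∀ q, |dl q| ≤ R := by
    intro q
    have h1 := abs_le.1 (hbp q β.1)
    have h2 := abs_le.1 (hbp q β'.1)
    have h3 := abs_le.1 (hpos q β' g)
    have h4 : (g * Pm : ℤ) ≤ M * (g * Pm) := le_mul_of_one_le_left hgP hM1
    have h5 : R = 3 * (M * (g * Pm)) := by rw [hR]; ring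
    simp only [hdl, h5]
    split_ifs <;> rw [abs_le] <;> constructor <;> linarith
  rw [← Finset.sum_fiberwise_of_maps_to (t := Finset.Icc (-R) R) (g := dl)
    (fun q _ => Finset.mem_Icc.2 (abs_le.1 (hdlR q)))]
  have hcard : ((Finset.Icc (-R) R).card : ℝ) = 6 * M * g * Pm + 1 := by
    rw [Int.card_Icc]
    have h0 : 0 ≤ R + 1 - -R := by have : 0 ≤ R := by positivity
                                   linarith
    have : (((R + 1 - -R).toNat : ℤ) : ℝ) = 6 * M * g * Pm + 1 := by
      rw [Int.toNat_of_nonneg h0, hR]; push_cast; ring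
    exact_mod_cast this
  rw [← hcard, ← nsmul_eq_mul]
  refine Finset.sum_le_card_nsmul _ _ _ fun Δ hΔ => ?_
  have hΔR : |Δ| ≤ R := abs_le.2 (Finset.mem_Icc.1 hΔ)
  set st : (Fin M × Fin g → {p // p ∈ P}) → Fin M → Fin g → ℤ := fun q b j =>
    stp (mkW sg q b j) with hst
  set D : Fin E → (Fin M × Fin g → {p // p ∈ P}) → ℤ := fun k q =>
    Δ + (if τ then psum (st q β') (y k).1 else - tsm (st q β') (y k).1) - psum (st q β) (i k).1
    with hD
  have hDval : ∀ q, dl q = Δ → ∀ k, D k q = nd (mkW sg q) β' (y k).1 - nd (mkW sg q) β (i k).1 := by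
    intro q hq k
    simp only [hD, ← hq, hdl, nd]
    have e := psum_add_tsm (st q β') (y k).1
    have e2 : pos (mkW sg q β') g = ∑ j, st q β' j := psum_full _ le_rfl
    have e3 : pos (mkW sg q β') (y k).1 = psum (st q β') (y k).1 := rfl
    have e4 : pos (mkW sg q β) (i k).1 = psum (st q β) (i k).1 := rfl
    split_ifs <;> linarith
  have hDle : ∀ k q, (D k q).natAbs ≤ 2 ^ M0 := by
    intro k q
    refine le_trans ?_ hM0
    have h1 := abs_le.1 hΔR
    have h2 := abs_le.1 (abs_psum_le (st q β') Pm (by positivity) (fun j => abs_stp_le hPm _) (y k).1)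
    have h3 := abs_le.1 (abs_psum_le (st q β) Pm (by positivity) (fun j => abs_stp_le hPm _) (i k).1)
    have h6 := abs_le.1 (abs_tsm_le (st q β') Pm (by positivity) (fun j => abs_stp_le hPm _) (y k).1)
    have h4 : (g * Pm : ℤ) ≤ M * (g * Pm) := le_mul_of_one_le_left hgP hM1
    have h5 : R = 3 * (M * (g * Pm)) := by rw [hR]; ring
    have : |D k q| ≤ 5 * (M * (g * Pm)) := by
      simp only [hD]
      split_ifs <;> rw [abs_le] <;> constructor <;> linarith
    have h7 : (((D k q).natAbs : ℕ) : ℤ) ≤ ((5 * M * g * Pm : ℕ) : ℤ) := by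
      rw [Int.natCast_natAbs]; push_cast; linarith
    exact_mod_cast h7
  have hmem : ∀ q ∈ Bs.filter (fun q => dl q = Δ), Setoid.ker q = s ∧
      (∀ b, good (mkW sg q b)) ∧ NZ (mkW sg q) β β' τ i y ∧ dl q = Δ := by
    intro q hq
    have h1 := Finset.mem_filter.1 hq
    have h2 := Finset.mem_filter.1 h1.1
    exact ⟨h2.2.1, h2.2.2.1, h2.2.2.2, h1.2⟩
  refine detl s (fun p : {p // p ∈ P} => 1 / (p.1:ℝ)) (fun _ => by positivity) xm hxm0
    (fun p => hxm _ p.2) L hL ?_ _ (fun q hq => (hmem q hq).1) (fun k => (β, i k)) ?_ M0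
    (fun k q => if D k q = 0 then ∅ else univ.filter fun p : {p // p ∈ P} => ((p.1 : ℕ) : ℤ) ∣ D k q)
    ?_ ?_
  · rw [Finset.sum_coe_sort P (fun p => 1 / (p:ℝ))]; exact hPL
  · intro q hq k k' h
    obtain ⟨_, hg, hnz, _⟩ := hmem q hq
    exact hnz.1.injective ((hg β).1 _ _ h)
  · intro q hq k
    obtain ⟨_, hg, hnz, hdq⟩ := hmem q hq
    have h1 := hnz.2.1 k
    rw [← hDval q hdq k] at h1
    rw [if_neg h1.2]
    refine ⟨?_, card_dvd_le hP h1.2 (hDle k q)⟩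
    simp only [Finset.mem_filter, Finset.mem_univ, true_and]
    exact h1.1
  · intro q hq q' hq' k hag
    obtain ⟨_, hg, hnz, hdq⟩ := hmem q hq
    have e1 : psum (st q β) (i k).1 = psum (st q' β) (i k).1 := by
      unfold psum
      refine Finset.sum_congr rfl fun u _ => ?_
      split_ifs with hu
      · simp only [hst, mkW]
        rw [hag (β, u)]
        intro j hj h
        have := (hg β).1 u (i j) h
        have h2 : i k ≤ i j := hnz.1.monotone hj
        have h3 : (i k).1 ≤ (i j).1 := h2
        omega
      · rfl
    have e2 : (if τ then psum (st q β') (y k).1 else - tsm (st q β') (y k).1)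
        = (if τ then psum (st q' β') (y k).1 else - tsm (st q' β') (y k).1) := by
      have h0 : ∀ u : Fin g, (if τ then u.1 < (y k).1 else (y k).1 ≤ u.1) →
          st q β' u = st q' β' u := by
        intro u hu
        simp only [hst, mkW]
        rw [hag (β', u)]
        intro j hj h
        exact hnz.2.2 k j hj u hu h
      cases τ
      · simp only [Bool.false_eq_true, if_false] at h0 ⊢
        congr 1
        unfold tsm
        refine Finset.sum_congr rfl fun u _ => ?_
        split_ifs with hu
        · exact h0 u hu
        · rfl
      · simp only [if_true] at h0 ⊢
        unfold psum
        refine Finset.sum_congr rfl fun u _ => ?_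
        split_ifs with hu
        · exact h0 u hu
        · rfl
    have : D k q = D k q' := by simp only [hD, e1, e2]
    simp only [this]

lemma psum_sub (d : Fin g → ℤ) {a b : ℕ} (hab : a ≤ b) :
    psum d b - psum d a = ∑ j : Fin g, if a ≤ j.1 ∧ j.1 < b then d j else 0 := by
  unfold psum
  rw [← Finset.sum_sub_distrib]
  refine Finset.sum_congr rfl fun j _ => ?_
  by_cases h1 : j.1 < a
  · rw [if_pos (by omega), if_pos h1, if_neg (by omega)]; ring
  · by_cases h2 : j.1 < b
    · rw [if_pos h2, if_neg h1, if_pos (by omega)]; ring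
    · rw [if_neg h2, if_neg h1, if_neg (by omega)]; ring

lemma ZD_mono {W : Fin M → Fin g → Lt P} {β β' : Fin M} {i : Fin (E+1) → Fin g}
    {w : Fin (E+1) → Fin (g+1)} {c : Fin E → Fin g} (h : ZD W β β' i w c) :
    StrictMono i ∧ StrictMono c := by
  have h1 : StrictMono i := Fin.strictMono_iff_lt_succ.2 fun k => lt_of_le_of_lt (h.2.1 k).1 (h.2.1 k).2
  refine ⟨h1, fun k l hkl => ?_⟩
  refine lt_of_lt_of_le (h.2.1 k).2 (le_trans (h1.monotone ?_) (h.2.1 l).1)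
  exact Fin.succ_le_castSucc_iff.2 hkl

open Classical in
theorem zd_sum (sg : Fin M → Fin g → Bool)
    (s : Setoid (Fin M × Fin g)) (L xm : ℝ) (hL : 1 ≤ L) (hPL : ∑ p ∈ P, 1 / (p:ℝ) ≤ L)
    (hxm0 : 0 ≤ xm) (hxm : ∀ p ∈ P, 1 / (p:ℝ) ≤ xm) (M0 : ℕ)
    (hM0 : 1 ≤ M0) (β β' : Fin M) (i : Fin (E+1) → Fin g)
    (w : Fin (E+1) → Fin (g+1)) (c : Fin E → Fin g) :
    ∑ q ∈ univ.filter (fun q : Fin M × Fin g → {p // p ∈ P} =>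
        Setoid.ker q = s ∧ (∀ b, good (mkW sg q b)) ∧ ZD (mkW sg q) β β' i w c),
      ∏ t ∈ Fx s, 1 / ((q t).1 : ℝ) ≤
    L ^ (Fx s).card * (M0 * xm) ^ E := by
  set st : (Fin M × Fin g → {p // p ∈ P}) → Fin M → Fin g → ℤ := fun q b j =>
    stp (mkW sg q b j) with hst
  set D : Fin E → (Fin M × Fin g → {p // p ∈ P}) → ℤ := fun k q =>
    psum (st q β') (w k.succ).1 - psum (st q β') (w k.castSucc).1
      - ∑ j : Fin g, if ((i k.castSucc).1 ≤ j.1 ∧ j.1 < (i k.succ).1) ∧ j ≠ c k then st q β j else 0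
    with hD
  have hmem : ∀ q ∈ univ.filter (fun q : Fin M × Fin g → {p // p ∈ P} =>
        Setoid.ker q = s ∧ (∀ b, good (mkW sg q b)) ∧ ZD (mkW sg q) β β' i w c),
      Setoid.ker q = s ∧
      (∀ b, good (mkW sg q b)) ∧ ZD (mkW sg q) β β' i w c := by
    intro q hq
    exact (Finset.mem_filter.1 hq).2
  refine detl s (fun p : {p // p ∈ P} => 1 / (p.1:ℝ)) (fun _ => by positivity) xm hxm0
    (fun p => hxm _ p.2) L hL ?_ _ (fun q hq => (hmem q hq).1) (fun k => (β, c k)) ?_ M0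
    (fun k q => univ.filter fun p : {p // p ∈ P} => stp (P := P) (p, sg β (c k)) = D k q)
    ?_ ?_
  · rw [Finset.sum_coe_sort P (fun p => 1 / (p:ℝ))]; exact hPL
  · intro q hq k k' h
    obtain ⟨_, hg, hz⟩ := hmem q hq
    exact (ZD_mono hz).2.injective ((hg β).1 _ _ h)
  · intro q hq k
    obtain ⟨_, hg, hz⟩ := hmem q hq
    constructor
    · simp only [Finset.mem_filter, Finset.mem_univ, true_and]
      have h1 := hz.1 k.succ
      have h2 := hz.1 k.castSucc
      have h3 := hz.2.1 k
      simp only [nd] at h1 h2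
      have e1 : pos (mkW sg q β) (i k.succ).1 - pos (mkW sg q β) (i k.castSucc).1
        = ∑ j : Fin g, if (i k.castSucc).1 ≤ j.1 ∧ j.1 < (i k.succ).1 then st q β j else 0 :=
        psum_sub _ ((ZD_mono hz).1.monotone (Fin.castSucc_lt_succ).le)
      have e2 : (∑ j : Fin g, if (i k.castSucc).1 ≤ j.1 ∧ j.1 < (i k.succ).1 then st q β j else 0)
        = st q β (c k) + ∑ j : Fin g, if ((i k.castSucc).1 ≤ j.1 ∧ j.1 < (i k.succ).1) ∧ j ≠ c k
            then st q β j else 0 := by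
        have : ∀ j : Fin g, (if (i k.castSucc).1 ≤ j.1 ∧ j.1 < (i k.succ).1 then st q β j else 0)
          = (if j = c k then st q β j else 0) +
            (if ((i k.castSucc).1 ≤ j.1 ∧ j.1 < (i k.succ).1) ∧ j ≠ c k
            then st q β j else 0) := by
          intro j
          by_cases hj : j = c k
          · subst hj
            have a1 : (i k.castSucc).1 ≤ (c k).1 := h3.1
            have a2 : (c k).1 < (i k.succ).1 := h3.2
            simp [a1, a2]
          · simp [hj]
        rw [Finset.sum_congr rfl fun j _ => this j, Finset.sum_add_distrib]
        simp
      have e3 : pos (mkW sg q β') (w k.succ).1 = psum (st q β') (w k.succ).1 := rfl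
      have e4 : pos (mkW sg q β') (w k.castSucc).1 = psum (st q β') (w k.castSucc).1 := rfl
      have e5 : stp (P := P) (q (β, c k), sg β (c k)) = st q β (c k) := rfl
      rw [e5]
      simp only [hD]
      linarith
    · refine le_trans (Finset.card_le_one.2 ?_) hM0
      intro a ha b hb
      simp only [Finset.mem_filter, Finset.mem_univ, true_and] at ha hb
      have : stp (P := P) (a, sg β (c k)) = stp (P := P) (b, sg β (c k)) := ha.trans hb.symm
      apply Subtype.ext
      unfold stp at this
      simp only at this
      split_ifs at this <;> omega
  · intro q hq q' hq' k hag
    obtain ⟨_, hg, hz⟩ := hmem q hq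
    have hm := ZD_mono hz
    have e1 : ∀ u, st q β' u = st q' β' u := by
      intro u
      simp only [hst, mkW]
      rw [hag (β', u)]
      intro j hj h
      exact hz.2.2 j u h
    have e2 : ∀ j : Fin g, ((i k.castSucc).1 ≤ j.1 ∧ j.1 < (i k.succ).1) ∧ j ≠ c k →
        st q β j = st q' β j := by
      rintro u ⟨⟨hu1, hu2⟩, hu3⟩
      simp only [hst, mkW]
      rw [hag (β, u)]
      intro j hj h
      have h1 := (hg β).1 u (c j) h
      rcases eq_or_lt_of_le hj with rfl | hlt
      · exact hu3 h1
      · have h2 : i k.succ ≤ i j.castSucc := hm.1.monotone (Fin.succ_le_castSucc_iff.2 hlt)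
        have h3 := (hz.2.1 j).1
        have h4 : (i k.succ).1 ≤ (c j).1 := h2.trans h3
        rw [← h1] at h4
        omega
    have : D k q = D k q' := by
      simp only [hD]
      have a1 : st q β' = st q' β' := funext e1
      rw [a1]
      congr 1
      refine Finset.sum_congr rfl fun j _ => ?_
      split_ifs with h
      · exact e2 j h
      · rfl
    simp only [this]

end Data

open Finset

section Irr

def prd (f : ℕ → Option ℤ) : ℕ → Option ℤ
  | 0 => none
  | 1 => none
  | i+2 => match f (i+1), f i with
    | some a, some b => some (2 * a - b)
    | _, _ => none

open Classical in
noncomputable def irr (g : ℕ) (f : ℕ → Option ℤ) : Finset ℕ := (range g).filter fun i => f i ≠ prd f i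

def isBr (f : ℕ → Option ℤ) (i : ℕ) : Prop :=
  f i ≠ none ∧ ¬ ∃ a b, f i = some a ∧ f (i+1) = some b ∧ |b - a| = 1

open Classical in
noncomputable def brk (g : ℕ) (f : ℕ → Option ℤ) : Finset ℕ := (range g).filter fun i => isBr f i

open Classical in
lemma irr_le (g : ℕ) (f : ℕ → Option ℤ) (hg : ∀ i, g ≤ i → f i = none)
    (hinj : ∀ i j a, f i = some a → f j = some a → i = j) :
    (irr g f).card ≤ 4 * (brk g f).card := by
  set D := (range g).filter fun i => f i ≠ none with hD
  set St := (range g).filter fun i => f i ≠ none ∧ (i = 0 ∨ f (i-1) = none) with hSt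
  have hmem : ∀ i, f i ≠ none → i < g := by
    intro i hi
    by_contra h
    exact hi (hg i (by omega))
  have hStB : St.card ≤ (brk g f).card := by
    set A := D.filter fun i => i ≠ 0 ∧ f (i-1) ≠ none
    set B := D.filter fun i => f (i+1) ≠ none
    have hAB : A.card = B.card := by
      refine Finset.card_bij (fun i _ => i - 1) ?_ ?_ ?_
      · intro i hi
        simp only [A, B, D, Finset.mem_filter, Finset.mem_range] at hi ⊢
        refine ⟨⟨hmem _ hi.2.2, hi.2.2⟩, ?_⟩
        rw [Nat.sub_add_cancel (by omega)]; exact hi.1.2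
      · intro i hi j hj h
        simp only [A, Finset.mem_filter] at hi hj
        omega
      · intro i hi
        simp only [A, B, D, Finset.mem_filter, Finset.mem_range] at hi ⊢
        exact ⟨i+1, ⟨⟨hmem _ hi.2, hi.2⟩, by omega, by simpa using hi.1.2⟩, by simp⟩
    have h1 : St ⊆ D \ A := by
      intro i hi
      simp only [hSt, A, D, Finset.mem_sdiff, Finset.mem_filter, Finset.mem_range] at hi ⊢
      tauto
    have h2 : D \ B ⊆ brk g f := by
      intro i hi
      simp only [B, D, Finset.mem_sdiff, Finset.mem_filter, Finset.mem_range] at hi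
      refine Finset.mem_filter.2 ⟨Finset.mem_range.2 hi.1.1, hi.1.2, ?_⟩
      rintro ⟨a, b, h1, h2, _⟩
      exact hi.2 ⟨hi.1, by rw [h2]; simp⟩
    calc St.card ≤ (D \ A).card := Finset.card_le_card h1
      _ = (D \ B).card := by
          rw [Finset.card_sdiff_of_subset (Finset.filter_subset _ _),
            Finset.card_sdiff_of_subset (Finset.filter_subset _ _), hAB]
      _ ≤ _ := Finset.card_le_card h2
  have hsub : irr g f ⊆ (St ∪ St.image (· + 1)) ∪ ((brk g f).image (· + 1) ∪ (brk g f).image (· + 2)) := by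
    intro i hi
    obtain ⟨hig, hir⟩ := Finset.mem_filter.1 hi
    rw [Finset.mem_range] at hig
    have bk : ∀ j, isBr f j → j ∈ brk g f := fun j hj =>
      Finset.mem_filter.2 ⟨Finset.mem_range.2 (hmem j hj.1), hj⟩
    have sk : ∀ j, f j ≠ none → (j = 0 ∨ f (j-1) = none) → j ∈ St := fun j h1 h2 =>
      Finset.mem_filter.2 ⟨Finset.mem_range.2 (hmem j h1), h1, h2⟩
    simp only [Finset.mem_union, Finset.mem_image]
    match i, hir with
    | 0, hir => exact Or.inl (Or.inl (sk 0 hir (Or.inl rfl)))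
    | 1, hir =>
      have h1 : f 1 ≠ none := hir
      by_cases h0 : f 0 = none
      · exact Or.inl (Or.inl (sk 1 h1 (Or.inr h0)))
      · exact Or.inl (Or.inr ⟨0, sk 0 h0 (Or.inl rfl), rfl⟩)
    | i+2, hir =>
      unfold prd at hir
      cases h1 : f (i+1) with
      | none =>
        simp only [h1] at hir
        exact Or.inl (Or.inl (sk (i+2) hir (Or.inr h1)))
      | some a =>
        cases h0 : f i with
        | none =>
          exact Or.inl (Or.inr ⟨i+1, sk (i+1) (by simp [h1]) (Or.inr (by simpa using h0)), rfl⟩)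
        | some b =>
          simp only [h1, h0] at hir
          by_cases b1 : isBr f (i+1)
          · exact Or.inr (Or.inl ⟨i+1, bk _ b1, rfl⟩)
          by_cases b2 : isBr f i
          · exact Or.inr (Or.inr ⟨i, bk _ b2, rfl⟩)
          exfalso
          simp only [isBr, h1, h0, ne_eq, reduceCtorEq, not_false_eq_true, true_and, not_not] at b1 b2
          obtain ⟨a1, c, e1, e2, e3⟩ := b1
          obtain ⟨b1, a2, e4, e5, e6⟩ := b2
          obtain rfl : a = a1 := by simpa using e1
          obtain rfl : b = b1 := by simpa using e4
          obtain rfl : a = a2 := by simpa using e5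
          have hcb : c ≠ b := by
            rintro rfl
            have := hinj _ _ _ e2 h0
            omega
          apply hir
          have e2' : f (i+2) = some c := e2
          rw [e2']
          congr 1
          rcases abs_eq (by norm_num : (0:ℤ) ≤ 1) |>.1 e3 with h | h <;>
          rcases abs_eq (by norm_num : (0:ℤ) ≤ 1) |>.1 e6 with h' | h' <;> omega
  calc _ ≤ _ := Finset.card_le_card hsub
    _ ≤ (St.card + St.card) + ((brk g f).card + (brk g f).card) := by
        refine (Finset.card_union_le _ _).trans (Nat.add_le_add ?_ ?_)
        · exact (Finset.card_union_le _ _).trans (Nat.add_le_add le_rfl Finset.card_image_le)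
        · exact (Finset.card_union_le _ _).trans
            (Nat.add_le_add Finset.card_image_le Finset.card_image_le)
    _ ≤ _ := by omega

lemma irr_det (g : ℕ) (f f' : ℕ → Option ℤ) (hg : ∀ i, g ≤ i → f i = none)
    (hg' : ∀ i, g ≤ i → f' i = none) (h : ∀ i, i ∈ irr g f ∨ i ∈ irr g f' → f i = f' i) : f = f' := by
  classical
  have key : ∀ n, ∀ i < n, f i = f' i := by
    intro n
    induction n with
    | zero => intro i hi; omega
    | succ n ih =>
      intro i hi
      by_cases hig : g ≤ i
      · rw [hg i hig, hg' i hig]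
      by_cases h1 : i ∈ irr g f ∨ i ∈ irr g f'
      · exact h i h1
      · push Not at h1
        simp only [irr, Finset.mem_filter, Finset.mem_range, not_and, not_not, ne_eq] at h1
        rw [h1.1 (by omega), h1.2 (by omega)]
        match i, hi with
        | 0, _ => rfl
        | 1, _ => rfl
        | i+2, hi => simp only [prd, ih (i+1) (by omega), ih i (by omega)]
  ext1 i
  exact key (i+1) i (by omega)

open Classical in
lemma card_small_sets {α : Type*} [Fintype α] (Y : ℕ) :
    (univ.filter fun S : Finset α => S.card ≤ Y).card ≤ (Fintype.card α + 1) ^ Y := by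
  have : (univ.filter fun S : Finset α => S.card ≤ Y).card ≤ (univ : Finset (Fin Y → Option α)).card := by
    refine Finset.card_le_card_of_surjOn (fun v => univ.filter fun a => ∃ k, v k = some a) ?_
    intro S hS
    have hS : S.card ≤ Y := (Finset.mem_filter.1 hS).2
    refine ⟨fun k => if h : k.1 < S.card then some (S.equivFin.symm ⟨k.1, h⟩).1 else none, by simp, ?_⟩
    ext a
    simp only [Finset.mem_filter, Finset.mem_univ, true_and]
    constructor
    · rintro ⟨k, hk⟩
      split_ifs at hk with h
      have := Option.some.inj hk
      rw [← this]; exact Subtype.property _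
    · intro ha
      refine ⟨⟨(S.equivFin ⟨a, ha⟩).1, lt_of_lt_of_le (S.equivFin ⟨a, ha⟩).2 hS⟩, ?_⟩
      simp
  refine this.trans ?_
  simp

end Irr

open Finset

section Claims

variable {P : Finset ℕ} {g M : ℕ}

def HasData (E : ℕ) (W : Fin M → Fin g → Lt P) : Prop :=
  ∃ β β' : Fin M, (∃ (τ : Bool) (i : Fin E → Fin g) (y : Fin E → Fin (g+1)), NZ W β β' τ i y) ∨
    ∃ (i : Fin (E+1) → Fin g) (w : Fin (E+1) → Fin (g+1)) (c : Fin E → Fin g), ZD W β β' i w c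

def single (W : Fin M → Fin g → Lt P) (t : Fin M × Fin g) : Prop :=
  ∀ t' : Fin M × Fin g, (W t'.1 t'.2).1 = (W t.1 t.2).1 → t' = t

lemma exists_mono {n : ℕ} (S : Finset (Fin g)) (h : n ≤ S.card) :
    ∃ i : Fin n → Fin g, StrictMono i ∧ ∀ k, i k ∈ S :=
  ⟨S.orderEmbOfCardLe h, (S.orderEmbOfCardLe h).strictMono, fun k => S.orderEmbOfCardLe_mem h k⟩

open Classical in
lemma contam_pair {E : ℕ} (W : Fin M → Fin g → Lt P) (hn : ¬ HasData E W) (β β' : Fin M) (hb : β' ≠ β) :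
    (univ.filter fun i : Fin g => single W (β, i) ∧ ∃ j ≤ g,
      (((W β i).1.1 : ℕ) : ℤ) ∣ nd W β' j - nd W β i.1).card ≤ 2 * E := by
  set S1 := univ.filter fun i : Fin g => single W (β, i) ∧ ∃ j ≤ g,
      (((W β i).1.1 : ℕ) : ℤ) ∣ nd W β' j - nd W β i.1 ∧ nd W β' j - nd W β i.1 ≠ 0 with hS1
  set S2 := univ.filter fun i : Fin g => single W (β, i) ∧ ∃ j ≤ g, nd W β i.1 = nd W β' j with hS2
  have hne : ∀ i, single W (β, i) → ∀ u : Fin g, (W β' u).1 ≠ (W β i).1 := by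
    intro i hi u h
    have := hi (β', u) h
    exact hb (by simpa using congrArg Prod.fst this)
  have h1 : S1.card ≤ E := by
    by_contra hc
    obtain ⟨i, hm, hi⟩ := exists_mono (n := E) S1 (by omega)
    have hi' := fun k => (Finset.mem_filter.1 (hi k)).2
    choose hs y hy hd using hi'
    exact hn ⟨β, β', Or.inl ⟨true, i, fun k => ⟨y k, by have := hy k; omega⟩, hm, hd,
      fun k j _ u _ => hne _ (hs j) u⟩⟩
  have h2 : S2.card ≤ E := by
    by_contra hc
    obtain ⟨i, hm, hi⟩ := exists_mono (n := E+1) S2 (by omega)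
    have hi' := fun k => (Finset.mem_filter.1 (hi k)).2
    choose hs y hy hd using hi'
    exact hn ⟨β, β', Or.inr ⟨i, fun k => ⟨y k, by have := hy k; omega⟩, fun k => i k.castSucc,
      hd, fun k => ⟨le_rfl, hm (Fin.castSucc_lt_succ)⟩, fun k u => hne _ (hs _) u⟩⟩
  have h3 : (univ.filter fun i : Fin g => single W (β, i) ∧ ∃ j ≤ g,
      (((W β i).1.1 : ℕ) : ℤ) ∣ nd W β' j - nd W β i.1) ⊆ S1 ∪ S2 := by
    intro i hi
    obtain ⟨_, hs, j, hj, hd⟩ := Finset.mem_filter.1 hi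
    by_cases h : nd W β' j - nd W β i.1 = 0
    · exact Finset.mem_union_right _ (Finset.mem_filter.2 ⟨Finset.mem_univ _, hs, j, hj, by linarith⟩)
    · exact Finset.mem_union_left _ (Finset.mem_filter.2 ⟨Finset.mem_univ _, hs, j, hj, hd, h⟩)
  have := (Finset.card_le_card h3).trans (Finset.card_union_le _ _)
  omega

open Classical in
lemma claim1 {E : ℕ} (W : Fin M → Fin g → Lt P) (hn : ¬ HasData E W) :
    (univ.filter fun t : Fin M × Fin g => single W t ∧ contam W t.1 t.2).card ≤ 2 * E * M ^ 2 := by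
  set F : Fin M × Fin M → Finset (Fin M × Fin g) := fun bb =>
    if bb.2 ≠ bb.1 then (univ.filter fun i : Fin g => single W (bb.1, i) ∧ ∃ j ≤ g,
      (((W bb.1 i).1.1 : ℕ) : ℤ) ∣ nd W bb.2 j - nd W bb.1 i.1).image (fun i => (bb.1, i)) else ∅ with hF
  have hsub : (univ.filter fun t : Fin M × Fin g => single W t ∧ contam W t.1 t.2) ⊆
      (univ : Finset (Fin M × Fin M)).biUnion F := by
    rintro ⟨b, i⟩ ht
    obtain ⟨_, hs, b', hb, hd⟩ := Finset.mem_filter.1 ht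
    refine Finset.mem_biUnion.2 ⟨(b, b'), Finset.mem_univ _, ?_⟩
    simp only [hF]
    rw [if_pos hb]
    exact Finset.mem_image.2 ⟨i, Finset.mem_filter.2 ⟨Finset.mem_univ _, hs, hd⟩, rfl⟩
  refine (Finset.card_le_card hsub).trans (Finset.card_biUnion_le.trans ?_)
  calc ∑ bb : Fin M × Fin M, (F bb).card ≤ ∑ bb : Fin M × Fin M, 2 * E := by
        refine Finset.sum_le_sum fun bb _ => ?_
        simp only [hF]
        split_ifs with h
        · exact Finset.card_image_le.trans (contam_pair W hn bb.1 bb.2 h)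
        · simp
    _ = _ := by simp; ring


open Classical in
noncomputable def mtch (s : Setoid (Fin M × Fin g)) (β β' : Fin M) (i : ℕ) : Option ℤ :=
  if h : ∃ (hi : i < g) (u : Fin g), s (β, ⟨i, hi⟩) (β', u) then
    some ((Classical.choose (Classical.choose_spec h)).1 : ℤ) else none

lemma mtch_some {s : Setoid (Fin M × Fin g)} {β β' : Fin M} {i : ℕ} {a : ℤ} (h : mtch s β β' i = some a) :
    ∃ (hi : i < g) (u : Fin g), a = u.1 ∧ s (β, ⟨i, hi⟩) (β', u) := by
  classical
  unfold mtch at h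
  split_ifs at h with h1
  exact ⟨_, _, (Option.some.inj h).symm, Classical.choose_spec (Classical.choose_spec h1)⟩

lemma mtch_eq {s : Setoid (Fin M × Fin g)} (hs : ∀ b i j, s (b, i) (b, j) → i = j) {β β' : Fin M} {i : ℕ}
    (hi : i < g) {u : Fin g} (h : s (β, ⟨i, hi⟩) (β', u)) : mtch s β β' i = some (u.1 : ℤ) := by
  classical
  have h1 : ∃ (hi : i < g) (u : Fin g), s (β, ⟨i, hi⟩) (β', u) := ⟨hi, u, h⟩
  cases h2 : mtch s β β' i with
  | none => unfold mtch at h2; rw [dif_pos h1] at h2; exact absurd h2 (by simp)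
  | some a =>
    obtain ⟨hi', u', rfl, h3⟩ := mtch_some h2
    rw [hs β' _ _ (s.trans (s.symm h3) h)]

lemma mtch_ge (s : Setoid (Fin M × Fin g)) (β β' : Fin M) (i : ℕ) (hi : g ≤ i) : mtch s β β' i = none := by
  cases h2 : mtch s β β' i with
  | none => rfl
  | some a => obtain ⟨hi', _⟩ := mtch_some h2; omega

lemma mtch_inj {s : Setoid (Fin M × Fin g)} (hs : ∀ b i j, s (b, i) (b, j) → i = j) (β β' : Fin M)
    (i j : ℕ) (a : ℤ) (h1 : mtch s β β' i = some a) (h2 : mtch s β β' j = some a) : i = j := by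
  obtain ⟨hi, u, rfl, h3⟩ := mtch_some h1
  obtain ⟨hj, v, hv, h4⟩ := mtch_some h2
  have : u = v := Fin.ext (by exact_mod_cast hv)
  subst this
  have := hs β _ _ (s.trans h3 (s.symm h4))
  simpa using this

def kW (W : Fin M → Fin g → Lt P) : Setoid (Fin M × Fin g) := Setoid.ker fun t => (W t.1 t.2).1

lemma kW_good {W : Fin M → Fin g → Lt P} (hW : ∀ b, good (W b)) (b : Fin M) (i j : Fin g)
    (h : kW W (b, i) (b, j)) : i = j := (hW b).1 i j h

open Classical in
lemma claim2 {E : ℕ} (W : Fin M → Fin g → Lt P) (hW : ∀ b, good (W b)) (hn : ¬ HasData E W)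
    (hw : ((univ.image fun t : Fin M × Fin g => (W t.1 t.2).1.1).filter fun p => wstd W p).card < E)
    (β β' : Fin M) :
    (brk g (mtch (kW W) β β')).card ≤ 2 * (E + E ^ 2) + E + 1 := by
  set f := mtch (kW W) β β' with hf
  set D := univ.filter fun i : Fin g => ∃ u : Fin g, (W β' u).1 = (W β i).1 with hD
  have hex : ∀ i : Fin g, ∃ u : Fin g, (∃ u : Fin g, (W β' u).1 = (W β i).1) → (W β' u).1 = (W β i).1 := by
    intro i
    by_cases h : ∃ u : Fin g, (W β' u).1 = (W β i).1
    · exact ⟨h.choose, fun _ => h.choose_spec⟩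
    · exact ⟨i, fun h' => absurd h' h⟩
  choose F hF using hex
  have hFD : ∀ i ∈ D, (W β' (F i)).1 = (W β i).1 := fun i hi => hF i (Finset.mem_filter.1 hi).2
  have hFu : ∀ i ∈ D, ∀ u, (W β' u).1 = (W β i).1 → u = F i := fun i hi u hu =>
    (hW β').1 _ _ (hu.trans (hFD i hi).symm)
  have hFi : ∀ i ∈ D, ∀ j ∈ D, F i = F j → i = j := by
    intro i hi j hj h
    exact (hW β).1 _ _ (by rw [← hFD i hi, ← hFD j hj, h])
  set Z : Fin g → Prop := fun i => nd W β i.1 = nd W β' (F i).1 ∨ nd W β i.1 = nd W β' ((F i).1 + 1) with hZ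
  set Nw := D.filter fun i => ¬ Z i ∧ wstd W (W β i).1.1 with hNw
  set Nc := D.filter fun i => ¬ Z i ∧ ¬ wstd W (W β i).1.1 with hNc
  set Ze := D.filter fun i => Z i ∧ ∀ h : i.1 + 1 < g, (⟨i.1+1, h⟩ : Fin g) ∉ D with hZe
  set Ze' := Ze.filter fun i => i.1 + 1 < g with hZe'
  have cNw : Nw.card ≤ E := by
    refine le_trans ?_ hw.le
    refine Finset.card_le_card_of_injOn (fun i => (W β i).1.1) ?_ ?_
    · intro i hi
      have hi := (Finset.mem_filter.1 hi).2
      exact Finset.mem_filter.2 ⟨Finset.mem_image.2 ⟨(β, i), Finset.mem_univ _, rfl⟩, hi.2⟩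
    · intro i _ j _ h
      exact (hW β).1 _ _ (Subtype.ext h)
  have cNc : Nc.card ≤ E ^ 2 := by
    by_contra hc
    have hND : ∀ x ∈ Nc, x ∈ D := fun x hx => (Finset.mem_filter.1 hx).1
    obtain ⟨i, hi, hm, hor⟩ := es_chain E Nc (fun x => (F x).1)
      (fun x hx y hy h => hFi x (hND x hx) y (hND y hy) (Fin.ext h)) (by omega)
    have hdv : ∀ x ∈ Nc, (((W β x).1.1 : ℕ) : ℤ) ∣ nd W β' (F x).1 - nd W β x.1 ∧
        nd W β' (F x).1 - nd W β x.1 ≠ 0 ∧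
        (((W β x).1.1 : ℕ) : ℤ) ∣ nd W β' ((F x).1+1) - nd W β x.1 ∧
        nd W β' ((F x).1+1) - nd W β x.1 ≠ 0 := by
      intro x hx
      obtain ⟨hxD, hz, hwx⟩ := Finset.mem_filter.1 hx
      have h1 : (((W β x).1.1 : ℕ) : ℤ) ∣ nd W β' (F x).1 - nd W β x.1 := by
        by_contra h
        exact hwx ⟨(β, x), (β', F x), rfl, congrArg Subtype.val (hFD x hxD), h⟩
      simp only [hZ, not_or] at hz
      refine ⟨h1, fun h => hz.1 (by linarith), ?_, fun h => hz.2 (by linarith)⟩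
      rw [nd_succ]
      have h2 : (((W β x).1.1 : ℕ) : ℤ) ∣ stp (W β' (F x)) := by
        rw [← hFD x hxD]; exact dvd_stp _
      have := dvd_add h1 h2
      exact (by ring : nd W β' (F x).1 - nd W β x.1 + stp (W β' (F x)) = nd W β' (F x).1 + stp (W β' (F x)) - nd W β x.1) ▸ this
    rcases hor with hinc | hdec
    · refine hn ⟨β, β', Or.inl ⟨true, fun k => i k.castSucc, fun k => ⟨(F (i k.castSucc)).1, by omega⟩,
        ?_, ?_, ?_⟩⟩
      · intro a b hab; exact hm (Fin.castSucc_lt_castSucc_iff.2 hab)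
      · intro k; have := hdv _ (hi k.castSucc); exact ⟨this.1, this.2.1⟩
      · intro k j hkj u hu h
        have h1 := hFu _ (hND _ (hi j.castSucc)) u h
        have h2 := hinc.monotone (Fin.castSucc_le_castSucc_iff.2 hkj)
        simp only [if_true] at hu
        simp only [h1] at hu
        omega
    · refine hn ⟨β, β', Or.inl ⟨false, fun k => i k.castSucc, fun k => ⟨(F (i k.castSucc)).1+1, by omega⟩,
        ?_, ?_, ?_⟩⟩
      · intro a b hab; exact hm (Fin.castSucc_lt_castSucc_iff.2 hab)
      · intro k; have := hdv _ (hi k.castSucc); exact ⟨this.2.2.1, this.2.2.2⟩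
      · intro k j hkj u hu h
        have h1 := hFu _ (hND _ (hi j.castSucc)) u h
        have h2 := hdec.antitone (Fin.castSucc_le_castSucc_iff.2 hkj)
        simp only [Bool.false_eq_true, if_false] at hu
        simp only [h1] at hu
        omega
  have cZe : Ze'.card ≤ E := by
    by_contra hc
    obtain ⟨i, hm, hi⟩ := exists_mono (n := E+1) Ze' (by omega)
    have hi1 : ∀ k, i k ∈ D := fun k => (Finset.mem_filter.1 (Finset.mem_filter.1 (hi k)).1).1
    have hi2 : ∀ k, Z (i k) := fun k => (Finset.mem_filter.1 (Finset.mem_filter.1 (hi k)).1).2.1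
    have hi3 : ∀ k, ∀ h : (i k).1 + 1 < g, (⟨(i k).1+1, h⟩ : Fin g) ∉ D :=
      fun k => (Finset.mem_filter.1 (Finset.mem_filter.1 (hi k)).1).2.2
    have hi4 : ∀ k, (i k).1 + 1 < g := fun k => (Finset.mem_filter.1 (hi k)).2
    have hw : ∀ k, ∃ w : Fin (g+1), nd W β (i k).1 = nd W β' w.1 := by
      intro k
      rcases hi2 k with h | h
      · exact ⟨⟨(F (i k)).1, by omega⟩, h⟩
      · exact ⟨⟨(F (i k)).1+1, by omega⟩, h⟩
    choose w hw using hw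
    refine hn ⟨β, β', Or.inr ⟨i, w, fun k => ⟨(i k.castSucc).1+1, hi4 _⟩, hw, ?_, ?_⟩⟩
    · intro k
      have h1 := hm (Fin.castSucc_lt_succ (i := k))
      have h2 : i k.succ ≠ ⟨(i k.castSucc).1+1, hi4 _⟩ := fun h => hi3 k.castSucc (hi4 _) (h ▸ hi1 _)
      have h3 : (i k.succ).1 ≠ (i k.castSucc).1+1 := fun h => h2 (Fin.ext h)
      refine ⟨Fin.mk_le_mk.2 (by simp), ?_⟩
      rw [Fin.lt_def] at h1 ⊢
      simp only
      omega
    · intro k u h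
      exact hi3 k.castSucc (hi4 _) (Finset.mem_filter.2 ⟨Finset.mem_univ _, u, h⟩)
  have hadj : ∀ i ∈ D, ∀ h : i.1 + 1 < g, (⟨i.1+1, h⟩ : Fin g) ∈ D → Z i → Z ⟨i.1+1, h⟩ →
      |((F ⟨i.1+1, h⟩).1 : ℤ) - (F i).1| = 1 := by
    intro i hi h hi' hz hz'
    set i' : Fin g := ⟨i.1+1, h⟩ with hi'd
    have hne : (F i').1 ≠ (F i).1 := by
      intro h1
      have := hFi _ hi' _ hi (Fin.ext h1)
      have := congrArg Fin.val this
      simp [hi'd] at this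
    have hg := (hW β').2 (F i)
    rw [hFD i hi] at hg
    have hs : nd W β i'.1 = nd W β i.1 + stp (W β i) := nd_succ W β i
    have hd1 := dvd_stp (W β i)
    have hd2 : (((W β i).1.1 : ℕ) : ℤ) ∣ stp (W β' (F i)) := by
      rw [← hFD i hi]; exact dvd_stp _
    -- nd β i ≡ nd β' (F i)
    have hA : (((W β i).1.1 : ℕ) : ℤ) ∣ nd W β i'.1 - nd W β' (F i).1 := by
      rcases hz with h1 | h1
      · rw [hs, h1]; simpa using hd1
      · rw [hs, h1, nd_succ]
        have := dvd_add hd1 hd2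
        exact (by ring : stp (W β i) + stp (W β' (F i)) = nd W β' (F i).1 + stp (W β' (F i)) + stp (W β i) - nd W β' (F i).1) ▸ this
    have hB : ∀ j, j ≤ g → nd W β i'.1 = nd W β' j → j = (F i).1 ∨ j = (F i).1 + 1 := by
      intro j hj h1
      by_contra hcon
      push Not at hcon
      refine hg j hj hcon.1 hcon.2 ?_
      rw [h1] at hA
      unfold nd at hA
      convert hA using 1; ring
    rcases hz' with h1 | h1
    · rcases hB _ (by omega) h1 with h2 | h2
      · exact absurd h2 hne
      · rw [h2]; push_cast; norm_num
    · rcases hB _ (by omega) h1 with h2 | h2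
      · rw [← h2]; push_cast; norm_num
      · omega
  have hfD : ∀ i : Fin g, i ∈ D → f i.1 = some ((F i).1 : ℤ) := fun i hi =>
    mtch_eq (kW_good hW) i.2 (hFD i hi).symm
  have hsub : brk g f ⊆ (((Nw ∪ Nc).image Fin.val) ∪ ((Nw ∪ Nc).image fun i => i.1 - 1)) ∪
      (Ze'.image Fin.val ∪ {g - 1}) := by
    intro i hi
    obtain ⟨hig, hne, hbr⟩ := Finset.mem_filter.1 hi
    rw [Finset.mem_range] at hig
    have hD : (⟨i, hig⟩ : Fin g) ∈ D := by
      cases h : f i with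
      | none => exact absurd h hne
      | some a =>
        obtain ⟨_, u, _, hu⟩ := mtch_some h
        exact Finset.mem_filter.2 ⟨Finset.mem_univ _, u, hu.symm⟩
    have hNN : ∀ j ∈ D, ¬ Z j → j ∈ Nw ∪ Nc := by
      intro j hj hz
      by_cases h : wstd W (W β j).1.1
      · exact Finset.mem_union_left _ (Finset.mem_filter.2 ⟨hj, hz, h⟩)
      · exact Finset.mem_union_right _ (Finset.mem_filter.2 ⟨hj, hz, h⟩)
    by_cases hz : Z ⟨i, hig⟩
    swap
    · exact Finset.mem_union_left _ (Finset.mem_union_left _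
        (Finset.mem_image.2 ⟨⟨i, hig⟩, hNN _ hD hz, rfl⟩))
    by_cases h1 : i + 1 < g
    swap
    · refine Finset.mem_union_right _ (Finset.mem_union_right _ ?_)
      rw [Finset.mem_singleton]; omega
    by_cases h2 : (⟨i+1, h1⟩ : Fin g) ∈ D
    swap
    · refine Finset.mem_union_right _ (Finset.mem_union_left _ ?_)
      exact Finset.mem_image.2 ⟨⟨i, hig⟩, Finset.mem_filter.2
        ⟨Finset.mem_filter.2 ⟨hD, hz, fun _ => h2⟩, h1⟩, rfl⟩
    by_cases h3 : Z ⟨i+1, h1⟩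
    · exfalso
      refine hbr ⟨_, _, hfD _ hD, hfD _ h2, hadj ⟨i, hig⟩ hD h1 h2 hz h3⟩
    · refine Finset.mem_union_left _ (Finset.mem_union_right _ ?_)
      exact Finset.mem_image.2 ⟨⟨i+1, h1⟩, hNN _ h2 h3, by simp⟩
  have hN : (Nw ∪ Nc).card ≤ E + E ^ 2 := (Finset.card_union_le _ _).trans (by omega)
  calc (brk g f).card ≤ _ := Finset.card_le_card hsub
    _ ≤ ((Nw ∪ Nc).card + (Nw ∪ Nc).card) + (Ze'.card + 1) := by
        refine (Finset.card_union_le _ _).trans (Nat.add_le_add ?_ ?_)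
        · exact (Finset.card_union_le _ _).trans (Nat.add_le_add Finset.card_image_le Finset.card_image_le)
        · exact (Finset.card_union_le _ _).trans (Nat.add_le_add Finset.card_image_le (by simp))
    _ ≤ _ := by omega

end Claims

open Finset

section Tame

variable {g M : ℕ}

def Tame (X : ℕ) (s : Setoid (Fin M × Fin g)) : Prop :=
  (∀ b i j, s (b, i) (b, j) → i = j) ∧ ∀ β β', (irr g (mtch s β β')).card ≤ X

open Classical in
noncomputable def code (s : Setoid (Fin M × Fin g)) :
    Finset ((Fin M × Fin M) × Fin g × Option (Fin g)) :=
  univ.filter fun x => x.2.1.1 ∈ irr g (mtch s x.1.1 x.1.2) ∧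
    mtch s x.1.1 x.1.2 x.2.1.1 = Option.map (fun u : Fin g => (u.1 : ℤ)) x.2.2

lemma omap_inj (a b : Option (Fin g)) (h : Option.map (fun u : Fin g => (u.1 : ℤ)) a
    = Option.map (fun u : Fin g => (u.1 : ℤ)) b) : a = b :=
  Option.map_injective (fun u v huv => Fin.ext (by exact_mod_cast huv)) h

lemma mtch_omap (s : Setoid (Fin M × Fin g)) (β β' : Fin M) (i : ℕ) :
    ∃ o : Option (Fin g), mtch s β β' i = Option.map (fun u : Fin g => (u.1 : ℤ)) o := by
  cases h : mtch s β β' i with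
  | none => exact ⟨none, rfl⟩
  | some a => obtain ⟨_, u, rfl, _⟩ := mtch_some h; exact ⟨some u, rfl⟩

open Classical in
lemma code_card {X : ℕ} {s : Setoid (Fin M × Fin g)} (hs : Tame X s) : (code s).card ≤ M ^ 2 * X := by
  set U : Finset ((Fin M × Fin M) × ℕ) := univ.biUnion fun bb : Fin M × Fin M =>
    (irr g (mtch s bb.1 bb.2)).image fun i => (bb, i) with hU
  have h1 : (code s).card ≤ U.card := by
    refine Finset.card_le_card_of_injOn (fun x => (x.1, x.2.1.1)) ?_ ?_
    · intro x hx
      have hx := (Finset.mem_filter.1 hx).2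
      exact Finset.mem_biUnion.2 ⟨x.1, Finset.mem_univ _, Finset.mem_image.2 ⟨_, hx.1, rfl⟩⟩
    · rintro ⟨bb, i, o⟩ hx ⟨bb', i', o'⟩ hx' h
      have hx := (Finset.mem_filter.1 hx).2.2
      have hx' := (Finset.mem_filter.1 hx').2.2
      simp only [Prod.mk.injEq] at h
      obtain ⟨rfl, h2⟩ := h
      obtain rfl : i = i' := Fin.ext h2
      have := omap_inj _ _ (hx.symm.trans hx')
      simp only at this
      rw [this]
  refine h1.trans (Finset.card_biUnion_le.trans ?_)
  calc _ ≤ ∑ bb : Fin M × Fin M, X := Finset.sum_le_sum fun bb _ =>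
        Finset.card_image_le.trans (hs.2 bb.1 bb.2)
    _ = _ := by simp [pow_two]

lemma code_inj {X : ℕ} {s s' : Setoid (Fin M × Fin g)} (hs : Tame X s) (hs' : Tame X s')
    (h : code s = code s') : s = s' := by
  classical
  have key : ∀ s s' : Setoid (Fin M × Fin g), code s = code s' → ∀ β β' i,
      i ∈ irr g (mtch s β β') → mtch s β β' i = mtch s' β β' i := by
    intro s s' h β β' i hi
    obtain ⟨o, ho⟩ := mtch_omap s β β' i
    have hig : i < g := Finset.mem_range.1 (Finset.mem_filter.1 hi).1
    have h1 : ((β, β'), (⟨i, hig⟩ : Fin g), o) ∈ code s :=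
      Finset.mem_filter.2 ⟨Finset.mem_univ _, hi, ho⟩
    rw [h] at h1
    have h2 := (Finset.mem_filter.1 h1).2.2
    rw [ho]; exact h2.symm
  have hm : ∀ β β', mtch s β β' = mtch s' β β' := by
    intro β β'
    refine irr_det g _ _ (mtch_ge s β β') (mtch_ge s' β β') ?_
    rintro i (hi | hi)
    · exact key s s' h β β' i hi
    · exact (key s' s h.symm β β' i hi).symm
  have sub : ∀ {s s' : Setoid (Fin M × Fin g)}, (∀ b i j, s (b, i) (b, j) → i = j) →
      (∀ β β', mtch s β β' = mtch s' β β') → ∀ t t', s t t' → s' t t' := by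
    intro s s' hs hm t t' h
    obtain ⟨b, i⟩ := t
    obtain ⟨b', j⟩ := t'
    have h1 := mtch_eq hs i.2 h
    rw [hm] at h1
    obtain ⟨_, u, hu, h2⟩ := mtch_some h1
    have : j = u := Fin.ext (by exact_mod_cast hu)
    rw [this]; exact h2
  ext t t'
  exact ⟨sub hs.1 hm t t', sub hs'.1 (fun a b => (hm a b).symm) t t'⟩

theorem tame_count {X : ℕ} (S : Finset (Setoid (Fin M × Fin g))) (hS : ∀ s ∈ S, Tame X s) :
    S.card ≤ (M ^ 2 * (g * (g + 1)) + 1) ^ (M ^ 2 * X) := by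
  classical
  have h1 : S.card ≤ (univ.filter fun Y : Finset ((Fin M × Fin M) × Fin g × Option (Fin g)) =>
      Y.card ≤ M ^ 2 * X).card := by
    refine Finset.card_le_card_of_injOn code ?_ ?_
    · intro s hs
      exact Finset.mem_filter.2 ⟨Finset.mem_univ _, code_card (hS s hs)⟩
    · intro s hs s' hs' h
      exact code_inj (hS s hs) (hS s' hs') h
  refine h1.trans ((card_small_sets _).trans (le_of_eq ?_))
  simp [pow_two]

lemma rep_injective {T : Type*} [Fintype T] : Function.Injective (fun s : Setoid T => rep s) := by
  intro s s' h
  have h' : rep s = rep s' := h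
  ext t t'
  rw [← rep_eq_iff, ← rep_eq_iff, h']

theorem ker_count {T : Type*} [Fintype T] (S : Finset (Setoid T)) :
    S.card ≤ (Fintype.card T) ^ (Fintype.card T) := by
  classical
  have : S.card ≤ (univ : Finset (T → T)).card :=
    Finset.card_le_card_of_injOn (fun s => rep s) (fun _ _ => Finset.mem_univ _)
      (rep_injective.injOn)
  simpa using this

open Classical in
lemma Fx_card {T : Type*} [Fintype T] (s : Setoid T) :
    2 * (Fx s).card ≤ Fintype.card T + (univ.filter fun t : T => ∀ t', s t' t → t' = t).card := by
  set S1 := univ.filter fun t : T => ∀ t', s t' t → t' = t with hS1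
  have h : ((Fx s) \ S1).card ≤ (univ \ Fx s).card := by
    have hex : ∀ t : T, ∃ t', t ∈ (Fx s) \ S1 → s t' t ∧ t' ≠ t := by
      intro t
      by_cases h : ∀ t', s t' t → t' = t
      · exact ⟨t, fun h' => absurd (Finset.mem_filter.2 ⟨Finset.mem_univ _, h⟩) (Finset.mem_sdiff.1 h').2⟩
      · push Not at h
        obtain ⟨t', h1, h2⟩ := h
        exact ⟨t', fun _ => ⟨h1, h2⟩⟩
    choose φ hφ using hex
    have hr : ∀ t ∈ (Fx s) \ S1, rep s (φ t) = t := by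
      intro t ht
      rw [(rep_eq_iff s _ _).2 (hφ t ht).1]
      exact (Finset.mem_filter.1 (Finset.mem_sdiff.1 ht).1).2
    refine Finset.card_le_card_of_injOn φ ?_ ?_
    · intro t ht
      refine Finset.mem_sdiff.2 ⟨Finset.mem_univ _, fun h => ?_⟩
      have h1 := (Finset.mem_filter.1 h).2
      rw [hr t ht] at h1
      exact (hφ t ht).2 h1.symm
    · intro t ht t' ht' h
      rw [← hr t ht, ← hr t' ht', h]
  have h1 : (Fx s).card ≤ ((Fx s) \ S1).card + S1.card := by
    have := Finset.card_le_card_sdiff_add_card (s := Fx s) (t := S1); omega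
  have h2 : (univ \ Fx s).card = Fintype.card T - (Fx s).card := by
    rw [Finset.card_sdiff_of_subset (Finset.subset_univ _)]; simp
  have h3 : (Fx s).card ≤ Fintype.card T := Finset.card_le_univ _
  omega

end Tame

open Finset

section Pattern

variable {P : Finset ℕ} {g M : ℕ}

noncomputable def PI (s : Setoid (Fin M × Fin g)) (q : Fin M × Fin g → {p // p ∈ P}) : ℝ :=
  ∏ t ∈ Fx s, 1 / ((q t).1 : ℝ)

lemma PI_nonneg (s : Setoid (Fin M × Fin g)) (q : Fin M × Fin g → {p // p ∈ P}) : 0 ≤ PI s q :=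
  Finset.prod_nonneg fun _ _ => by positivity

noncomputable def n1 (s : Setoid (Fin M × Fin g)) : ℕ := by
  classical exact (univ.filter fun t : Fin M × Fin g => ∀ t', s t' t → t' = t).card

open Classical in
lemma wval_eq (L η : ℝ) (sg : Fin M → Fin g → Bool) (q : Fin M × Fin g → {p // p ∈ P}) :
    wval L η (mkW sg q) = PI (Setoid.ker q) q *
      (2 ^ (Fx (Setoid.ker q)).card *
        η ^ ((Fx (Setoid.ker q)).filter fun t => wstd (mkW sg q) (q t).1).card *
        (2 / L) ^ ((Fx (Setoid.ker q)).filter fun t => snu (mkW sg q) (q t).1).card) := by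
  have this : ∀ G : ℕ → ℝ, ∏ p ∈ univ.image (fun t => (q t).1), G p = ∏ t ∈ Fx (Setoid.ker q), G (q t).1 := by
    intro G
    rw [show univ.image (fun t => (q t).1) = (univ.image q).image Subtype.val from by
      rw [Finset.image_image]; rfl, Finset.prod_image (fun a _ b _ h => Subtype.ext h)]
    convert prod_image_Fx (q := q) rfl (fun p => G p.1)
  have e : wval L η (mkW sg q) = ∏ p ∈ univ.image (fun t => (q t).1), (2 / (p:ℝ) *
    (if wstd (mkW sg q) p then η else 1) * (if snu (mkW sg q) p then 2 / L else 1)) := rfl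
  rw [e, this]
  unfold PI
  rw [Finset.prod_mul_distrib, Finset.prod_mul_distrib]
  have h2 : ∏ t ∈ Fx (Setoid.ker q), 2 / ((q t).1:ℝ) = (∏ t ∈ Fx (Setoid.ker q), 1 / ((q t).1:ℝ)) *
      2 ^ (Fx (Setoid.ker q)).card := by
    rw [← Finset.prod_const, ← Finset.prod_mul_distrib]
    exact Finset.prod_congr rfl fun t _ => by ring
  rw [h2, Finset.prod_ite, Finset.prod_ite]
  simp only [Finset.prod_const, one_pow, mul_one]
  ring

open Classical in
lemma wst_le (sg : Fin M → Fin g → Bool) (q : Fin M × Fin g → {p // p ∈ P}) :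
    ((univ.image fun t : Fin M × Fin g => (mkW sg q t.1 t.2).1.1).filter fun p => wstd (mkW sg q) p).card
      ≤ ((Fx (Setoid.ker q)).filter fun t => wstd (mkW sg q) (q t).1).card := by
  refine Finset.card_le_card_of_surjOn (fun t => (q t).1) ?_
  intro p hp
  obtain ⟨h1, h2⟩ := Finset.mem_filter.1 hp
  obtain ⟨t, _, rfl⟩ := Finset.mem_image.1 h1
  have e : q (rep (Setoid.ker q) t) = q t := ker_rep rfl t
  refine ⟨rep (Setoid.ker q) t, Finset.mem_coe.2 (Finset.mem_filter.2 ⟨rep_mem_Fx _ _, ?_⟩), ?_⟩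
  · rw [e]; exact h2
  · simp only [e]; rfl

open Classical in
lemma snu_ge {E : ℕ} (sg : Fin M → Fin g → Bool) (q : Fin M × Fin g → {p // p ∈ P})
    (hn : ¬ HasData E (mkW sg q)) :
    n1 (Setoid.ker q) - 2 * E * M ^ 2 ≤
      ((Fx (Setoid.ker q)).filter fun t => snu (mkW sg q) (q t).1).card := by
  have h1 := claim1 (mkW sg q) hn
  have hsub : (univ.filter fun t : Fin M × Fin g => ∀ t', Setoid.ker q t' t → t' = t) ⊆
      (univ.filter fun t : Fin M × Fin g => single (mkW sg q) t ∧ contam (mkW sg q) t.1 t.2) ∪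
      ((Fx (Setoid.ker q)).filter fun t => snu (mkW sg q) (q t).1) := by
    intro t ht
    have ht := (Finset.mem_filter.1 ht).2
    have hs : single (mkW sg q) t := fun t' h => ht t' h
    by_cases hc : contam (mkW sg q) t.1 t.2
    · exact Finset.mem_union_left _ (Finset.mem_filter.2 ⟨Finset.mem_univ _, hs, hc⟩)
    · refine Finset.mem_union_right _ (Finset.mem_filter.2 ⟨?_, t, rfl, ?_, hc⟩)
      · have := rep_mem_Fx (Setoid.ker q) t
        rwa [ht _ (rep_rel _ _)] at this
      · intro t' h; exact hs t' (Subtype.ext h)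
  have h2 := (Finset.card_le_card hsub).trans (Finset.card_union_le _ _)
  unfold n1
  omega

lemma tame_of {E : ℕ} (sg : Fin M → Fin g → Bool) (q : Fin M × Fin g → {p // p ∈ P})
    (hg : ∀ b, good (mkW sg q b)) (hn : ¬ HasData E (mkW sg q))
    (hw : by classical exact ((Fx (Setoid.ker q)).filter fun t => wstd (mkW sg q) (q t).1).card < E) :
    Tame (4 * (2 * (E + E ^ 2) + E + 1)) (Setoid.ker q) := by
  classical
  have hs : ∀ b i j, Setoid.ker q (b, i) (b, j) → i = j := fun b i j h => (hg b).1 i j h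
  refine ⟨hs, fun β β' => ?_⟩
  refine (irr_le g _ (mtch_ge _ β β') (mtch_inj hs β β')).trans ?_
  have := claim2 (mkW sg q) hg hn ((wst_le sg q).trans_lt hw) β β'
  have e : kW (mkW sg q) = Setoid.ker q := rfl
  rw [e] at this
  omega

open Classical in
noncomputable def DT (E : ℕ) (s : Setoid (Fin M × Fin g)) (sg : Fin M → Fin g → Bool)
    (q : Fin M × Fin g → {p // p ∈ P}) : ℝ :=
  ∑ bb : Fin M × Fin M,
    ((∑ x : Bool × (Fin E → Fin g) × (Fin E → Fin (g+1)),
      if (∀ b, good (mkW sg q b)) ∧ NZ (mkW sg q) bb.1 bb.2 x.1 x.2.1 x.2.2 then PI s q else 0) +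
    ∑ x : (Fin (E+1) → Fin g) × (Fin (E+1) → Fin (g+1)) × (Fin E → Fin g),
      if (∀ b, good (mkW sg q b)) ∧ ZD (mkW sg q) bb.1 bb.2 x.1 x.2.1 x.2.2 then PI s q else 0)

lemma DT_ge (E : ℕ) (s : Setoid (Fin M × Fin g)) (sg : Fin M → Fin g → Bool)
    (q : Fin M × Fin g → {p // p ∈ P}) (hg : ∀ b, good (mkW sg q b)) (h : HasData E (mkW sg q)) :
    PI s q ≤ DT E s sg q := by
  classical
  obtain ⟨β, β', h⟩ := h
  have p0 := PI_nonneg s q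
  have n1 : ∀ bb : Fin M × Fin M, 0 ≤ (∑ x : Bool × (Fin E → Fin g) × (Fin E → Fin (g+1)),
      if (∀ b, good (mkW sg q b)) ∧ NZ (mkW sg q) bb.1 bb.2 x.1 x.2.1 x.2.2 then PI s q else 0) :=
    fun bb => Finset.sum_nonneg fun x _ => by split_ifs <;> simp [p0]
  have n2 : ∀ bb : Fin M × Fin M, 0 ≤ ∑ x : (Fin (E+1) → Fin g) × (Fin (E+1) → Fin (g+1)) × (Fin E → Fin g),
      if (∀ b, good (mkW sg q b)) ∧ ZD (mkW sg q) bb.1 bb.2 x.1 x.2.1 x.2.2 then PI s q else 0 :=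
    fun bb => Finset.sum_nonneg fun x _ => by split_ifs <;> simp [p0]
  unfold DT
  refine le_trans ?_ (Finset.single_le_sum (fun bb _ => add_nonneg (n1 bb) (n2 bb))
    (Finset.mem_univ (β, β')))
  rcases h with ⟨τ, i, y, h⟩ | ⟨i, w, c, h⟩
  · refine le_trans ?_ (le_add_of_nonneg_right (n2 _))
    refine le_trans (le_of_eq ?_) (Finset.single_le_sum (fun x _ => by split_ifs <;> simp [p0])
      (Finset.mem_univ (τ, i, y)))
    rw [if_pos ⟨hg, h⟩]
  · refine le_trans ?_ (le_add_of_nonneg_left (n1 _))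
    refine le_trans (le_of_eq ?_) (Finset.single_le_sum (fun x _ => by split_ifs <;> simp [p0])
      (Finset.mem_univ (i, w, c)))
    rw [if_pos ⟨hg, h⟩]

lemma DT_nonneg (E : ℕ) (s : Setoid (Fin M × Fin g)) (sg : Fin M → Fin g → Bool)
    (q : Fin M × Fin g → {p // p ∈ P}) : 0 ≤ DT E s sg q := by
  classical
  have p0 := PI_nonneg s q
  refine Finset.sum_nonneg fun _ _ => add_nonneg (Finset.sum_nonneg fun x _ => ?_)
    (Finset.sum_nonneg fun x _ => ?_) <;> split_ifs <;> simp [p0]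

/-- pointwise bound -/
lemma wval_le (E k : ℕ) (hk : M * g = k) (L η : ℝ) (hL : 2 ≤ L) (hη0 : 0 ≤ η) (hη1 : η ≤ 1)
    (sg : Fin M → Fin g → Bool)
    (q : Fin M × Fin g → {p // p ∈ P}) (hg : ∀ b, good (mkW sg q b)) :
    wval L η (mkW sg q) ≤ 2 ^ k * η ^ E * PI (Setoid.ker q) q + 2 ^ k * DT E (Setoid.ker q) sg q +
      (by classical exact if Tame (4 * (2 * (E + E ^ 2) + E + 1)) (Setoid.ker q) then
        2 ^ k * (2 / L) ^ (n1 (Setoid.ker q) - 2 * E * M ^ 2) * PI (Setoid.ker q) q else 0) := by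
  classical
  rw [wval_eq]
  set s := Setoid.ker q
  set a := ((Fx s).filter fun t => wstd (mkW sg q) (q t).1).card with ha
  set b := ((Fx s).filter fun t => snu (mkW sg q) (q t).1).card with hb
  have p0 := PI_nonneg s q
  have d0 := DT_nonneg E s sg q
  have hF : (Fx s).card ≤ k := by
    have := Finset.card_le_univ (Fx s); simp [hk] at this; exact this
  have h2 : (2:ℝ) ^ (Fx s).card ≤ 2 ^ k := pow_le_pow_right₀ (by norm_num) hF
  have hL0 : 0 ≤ 2 / L := by positivity
  have hL1 : 2 / L ≤ 1 := by rw [div_le_one (by linarith)]; exact hL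
  have hb1 : (2 / L) ^ b ≤ 1 := pow_le_one₀ hL0 hL1
  have ha1 : η ^ a ≤ 1 := pow_le_one₀ hη0 hη1
  have t0 : 0 ≤ (if Tame (4 * (2 * (E + E ^ 2) + E + 1)) s then
        2 ^ k * (2 / L) ^ (n1 s - 2 * E * M ^ 2) * PI s q else 0) := by
    split_ifs <;> positivity
  have u0 : 0 ≤ 2 ^ k * η ^ E * PI s q := by positivity
  have u1 : 0 ≤ 2 ^ k * DT E s sg q := by positivity
  by_cases h1 : E ≤ a
  · have : PI s q * (2 ^ (Fx s).card * η ^ a * (2 / L) ^ b) ≤ PI s q * (2 ^ k * η ^ E * 1) := by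
      have := pow_le_pow_of_le_one hη0 hη1 h1
      gcongr
    linarith
  by_cases h3 : HasData E (mkW sg q)
  · have := DT_ge E s sg q hg h3
    have h4 : PI s q * (2 ^ (Fx s).card * η ^ a * (2 / L) ^ b) ≤ DT E s sg q * (2 ^ k * 1 * 1) := by
      gcongr
    linarith
  · have hT := tame_of sg q hg h3 (by push Not at h1; convert h1)
    have hs := snu_ge sg q h3
    rw [if_pos hT]
    have h4 : PI s q * (2 ^ (Fx s).card * η ^ a * (2 / L) ^ b) ≤
        PI s q * (2 ^ k * 1 * (2 / L) ^ (n1 s - 2 * E * M ^ 2)) := by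
      have : (2 / L) ^ b ≤ (2 / L) ^ (n1 s - 2 * E * M ^ 2) := by
        refine pow_le_pow_of_le_one hL0 hL1 ?_
        convert hs using 1
      gcongr
    linarith

open Classical in
lemma PI_sum (s : Setoid (Fin M × Fin g)) (L : ℝ) (hL : 1 ≤ L) (hPL : ∑ p ∈ P, 1 / (p:ℝ) ≤ L) :
    ∑ q ∈ univ.filter (fun q : Fin M × Fin g → {p // p ∈ P} => Setoid.ker q = s), PI s q ≤
      L ^ (Fx s).card := by
  have := detl s (fun p : {p // p ∈ P} => 1 / (p.1:ℝ)) (fun _ => by positivity) 1 zero_le_one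
    (fun p => by
      have : (0:ℝ) ≤ p.1 := by positivity
      rcases Nat.eq_zero_or_pos p.1 with h | h
      · simp [h]
      · rw [div_le_one (by exact_mod_cast h)]; exact_mod_cast h) L hL
    (by rw [Finset.sum_coe_sort P (fun p => 1 / (p:ℝ))]; exact hPL)
    (univ.filter (fun q : Fin M × Fin g → {p // p ∈ P} => Setoid.ker q = s))
    (fun q hq => (Finset.mem_filter.1 hq).2) (E := 0) Fin.elim0 (fun q hq a => a.elim0) 0
    (fun k => k.elim0) (fun q hq k => k.elim0) (fun q _ q' _ k => k.elim0)
  simpa [PI] using this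

noncomputable def DC (E g M Pm : ℕ) : ℝ :=
  M ^ 2 * (2 * (g ^ E * (g + 1) ^ E) * (6 * M * g * Pm + 1) + g ^ (E+1) * ((g + 1) ^ (E+1) * g ^ E))

open Classical in
lemma DT_sum (hP : ∀ p ∈ P, p.Prime) (E : ℕ) (sg : Fin M → Fin g → Bool)
    (s : Setoid (Fin M × Fin g)) (L xm : ℝ) (hL : 1 ≤ L) (hPL : ∑ p ∈ P, 1 / (p:ℝ) ≤ L)
    (hxm0 : 0 ≤ xm) (hxm : ∀ p ∈ P, 1 / (p:ℝ) ≤ xm) (Pm M0 : ℕ) (hPm : ∀ p ∈ P, p ≤ Pm)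
    (hM0 : 5 * M * g * Pm ≤ 2 ^ M0) (hM1 : 1 ≤ M0) :
    ∑ q ∈ univ.filter (fun q : Fin M × Fin g → {p // p ∈ P} => Setoid.ker q = s), DT E s sg q ≤
      DC E g M Pm * (L ^ (Fx s).card * (M0 * xm) ^ E) := by
  unfold DT
  rw [Finset.sum_comm]
  have hY : 0 ≤ L ^ (Fx s).card * (M0 * xm) ^ E := by positivity
  set Y := L ^ (Fx s).card * (M0 * xm) ^ E with hYd
  calc _ ≤ ∑ bb : Fin M × Fin M, ((∑ x : Bool × (Fin E → Fin g) × (Fin E → Fin (g+1)),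
            (6 * M * g * Pm + 1) * Y) +
          ∑ x : (Fin (E+1) → Fin g) × (Fin (E+1) → Fin (g+1)) × (Fin E → Fin g), Y) := by
        refine Finset.sum_le_sum fun bb _ => ?_
        rw [Finset.sum_add_distrib]
        refine add_le_add ?_ ?_
        · rw [Finset.sum_comm]
          refine Finset.sum_le_sum fun x _ => ?_
          refine le_trans (le_of_eq ?_) (nz_sum hP sg s L xm hL hPL hxm0 hxm Pm M0 hPm hM0
            bb.1 bb.2 x.1 x.2.1 x.2.2)
          rw [← Finset.sum_filter, Finset.filter_filter]
          rfl
        · rw [Finset.sum_comm]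
          refine Finset.sum_le_sum fun x _ => ?_
          refine le_trans (le_of_eq ?_) (zd_sum sg s L xm hL hPL hxm0 hxm M0 hM1
            bb.1 bb.2 x.1 x.2.1 x.2.2)
          rw [← Finset.sum_filter, Finset.filter_filter]
          rfl
    _ = _ := by
        simp only [Finset.sum_const, Finset.card_univ, Fintype.card_prod, Fintype.card_fin,
          Fintype.card_bool, Fintype.card_fun, nsmul_eq_mul, DC]
        push_cast
        ring

lemma tame_wt (s : Setoid (Fin M × Fin g)) (k a : ℕ) (hk : M * g = k) (L : ℝ) (hL : 2 ≤ L) :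
    (2 / L) ^ (n1 s - a) * L ^ (Fx s).card ≤ 2 ^ k * (Real.sqrt L ^ k * L ^ a) := by
  classical
  have hF := Fx_card s
  have hcard : Fintype.card (Fin M × Fin g) = k := by simp [hk]
  rw [hcard] at hF
  have hn : n1 s ≤ k := by
    unfold n1; rw [← hcard]; exact Finset.card_le_univ _
  have hF' : 2 * (Fx s).card ≤ k + n1 s := by unfold n1; convert hF
  set r := Real.sqrt L with hr
  have hr1 : 1 ≤ r := by rw [hr]; exact Real.one_le_sqrt.2 (by linarith)
  have hrL : r ^ 2 = L := Real.sq_sqrt (by linarith)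
  rw [← hrL, div_pow, div_mul_eq_mul_div, div_le_iff₀ (by positivity)]
  simp only [← pow_mul]
  have h1 : (2:ℝ) ^ (n1 s - a) ≤ 2 ^ k := pow_le_pow_right₀ (by norm_num) (by omega)
  have h2 : r ^ (2 * (Fx s).card) ≤ r ^ (k + 2 * a + 2 * (n1 s - a)) := pow_le_pow_right₀ hr1 (by omega)
  calc _ ≤ 2 ^ k * r ^ (k + 2 * a + 2 * (n1 s - a)) := by gcongr
    _ = _ := by ring

/-- The pattern sum. -/
theorem pattern_sum (hP : ∀ p ∈ P, p.Prime) (E k : ℕ) (hk : M * g = k) 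
    (L xm η : ℝ) (hL : 2 ≤ L) (hPL : ∑ p ∈ P, 1 / (p:ℝ) ≤ L) (hη0 : 0 ≤ η) (hη1 : η ≤ 1)
    (hxm0 : 0 ≤ xm) (hxm : ∀ p ∈ P, 1 / (p:ℝ) ≤ xm) (Pm M0 : ℕ) (hPm : ∀ p ∈ P, p ≤ Pm)
    (hM0 : 5 * M * g * Pm ≤ 2 ^ M0) (hM1 : 1 ≤ M0) :
    (by classical exact ∑ W : Fin M → Fin g → Lt P, if ∀ b, good (W b) then wval L η W else 0) ≤
      2 ^ k * (k ^ k * (2 ^ k * L ^ k * (η ^ E + DC E g M Pm * (M0 * xm) ^ E)) +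
        (M ^ 2 * (g * (g + 1)) + 1 : ℝ) ^ (M ^ 2 * (4 * (2 * (E + E ^ 2) + E + 1))) *
          (4 ^ k * (Real.sqrt L ^ k * L ^ (2 * E * M ^ 2)))) := by
  classical
  set X := 4 * (2 * (E + E ^ 2) + E + 1) with hX
  have hL1 : 1 ≤ L := by linarith
  have hcard : Fintype.card (Fin M × Fin g) = k := by simp [hk]
  -- reindex
  have e1 : ∑ W : Fin M → Fin g → Lt P, (if ∀ b, good (W b) then wval L η W else 0) =
      ∑ sg : Fin M → Fin g → Bool, ∑ q : Fin M × Fin g → {p // p ∈ P},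
        if ∀ b, good (mkW sg q b) then wval L η (mkW sg q) else 0 := by
    rw [← Fintype.sum_prod_type']
    refine Finset.sum_bij' (fun W _ => ((fun b i => (W b i).2), fun t => (W t.1 t.2).1))
      (fun x _ => mkW x.1 x.2) ?_ ?_ ?_ ?_ ?_ <;> intros <;> first | exact Finset.mem_univ _ | rfl
  rw [e1]
  have key : ∀ sg : Fin M → Fin g → Bool, ∑ q : Fin M × Fin g → {p // p ∈ P},
        (if ∀ b, good (mkW sg q b) then wval L η (mkW sg q) else 0) ≤
      k ^ k * (2 ^ k * L ^ k * (η ^ E + DC E g M Pm * (M0 * xm) ^ E)) +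
        (M ^ 2 * (g * (g + 1)) + 1 : ℝ) ^ (M ^ 2 * X) *
          (4 ^ k * (Real.sqrt L ^ k * L ^ (2 * E * M ^ 2))) := by
    intro sg
    set S : Finset (Setoid (Fin M × Fin g)) :=
      univ.image (fun q : Fin M × Fin g → {p // p ∈ P} => Setoid.ker q) with hS
    rw [← Finset.sum_fiberwise_of_maps_to (t := S) (g := fun q => Setoid.ker q)
      (fun q _ => Finset.mem_image_of_mem _ (Finset.mem_univ q))]
    set Yt : ℝ := 4 ^ k * (Real.sqrt L ^ k * L ^ (2 * E * M ^ 2)) with hYt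
    set Yd : ℝ := 2 ^ k * L ^ k * (η ^ E + DC E g M Pm * (M0 * xm) ^ E) with hYd
    have hDC : 0 ≤ DC E g M Pm := by unfold DC; positivity
    have hfib : ∀ s ∈ S, ∑ q ∈ univ.filter (fun q : Fin M × Fin g → {p // p ∈ P} => Setoid.ker q = s),
        (if ∀ b, good (mkW sg q b) then wval L η (mkW sg q) else 0) ≤
        Yd + if Tame X s then Yt else 0 := by
      intro s _
      have hFk : (Fx s).card ≤ k := by
        have := Finset.card_le_univ (Fx s); rw [hcard] at this; exact this
      have hLk : L ^ (Fx s).card ≤ L ^ k := pow_le_pow_right₀ hL1 hFk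
      calc _ ≤ ∑ q ∈ univ.filter (fun q : Fin M × Fin g → {p // p ∈ P} => Setoid.ker q = s),
            (2 ^ k * η ^ E * PI s q + 2 ^ k * DT E s sg q +
              if Tame X s then 2 ^ k * (2 / L) ^ (n1 s - 2 * E * M ^ 2) * PI s q else 0) := by
            refine Finset.sum_le_sum fun q hq => ?_
            have hq := (Finset.mem_filter.1 hq).2
            split_ifs with hg hT hT
            · have := wval_le E k hk L η hL hη0 hη1 sg q hg
              rw [hq, if_pos hT] at this; exact this
            · have := wval_le E k hk L η hL hη0 hη1 sg q hg
              rw [hq, if_neg hT] at this; exact this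
            · have := PI_nonneg s q; have := DT_nonneg E s sg q; positivity
            · have := PI_nonneg s q; have := DT_nonneg E s sg q; positivity
        _ = 2 ^ k * η ^ E * ∑ q ∈ univ.filter (fun q : Fin M × Fin g → {p // p ∈ P} => Setoid.ker q = s), PI s q
            + 2 ^ k * ∑ q ∈ univ.filter (fun q : Fin M × Fin g → {p // p ∈ P} => Setoid.ker q = s), DT E s sg q
            + if Tame X s then 2 ^ k * (2 / L) ^ (n1 s - 2 * E * M ^ 2) *
              ∑ q ∈ univ.filter (fun q : Fin M × Fin g → {p // p ∈ P} => Setoid.ker q = s), PI s q else 0 := by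
            rw [Finset.sum_add_distrib, Finset.sum_add_distrib, Finset.mul_sum, Finset.mul_sum]
            split_ifs
            · rw [Finset.mul_sum]
            · simp
        _ ≤ 2 ^ k * η ^ E * L ^ k + 2 ^ k * (DC E g M Pm * (L ^ k * (M0 * xm) ^ E))
            + if Tame X s then Yt else 0 := by
            have h1 := PI_sum (P := P) s L hL1 hPL
            have h2 := DT_sum hP E sg s L xm hL1 hPL hxm0 hxm Pm M0 hPm hM0 hM1
            have h3 : DC E g M Pm * (L ^ (Fx s).card * (M0 * xm) ^ E) ≤
              DC E g M Pm * (L ^ k * (M0 * xm) ^ E) := by gcongr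
            refine add_le_add (add_le_add ?_ ?_) ?_
            · exact mul_le_mul_of_nonneg_left (h1.trans hLk) (by positivity)
            · exact mul_le_mul_of_nonneg_left (h2.trans h3) (by positivity)
            · split_ifs
              · have h4 := tame_wt s k (2 * E * M ^ 2) hk L hL
                calc _ ≤ 2 ^ k * (2 / L) ^ (n1 s - 2 * E * M ^ 2) * L ^ (Fx s).card :=
                      mul_le_mul_of_nonneg_left h1 (by positivity)
                  _ = 2 ^ k * ((2 / L) ^ (n1 s - 2 * E * M ^ 2) * L ^ (Fx s).card) := by ring
                  _ ≤ 2 ^ k * (2 ^ k * (Real.sqrt L ^ k * L ^ (2 * E * M ^ 2))) := by gcongr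
                  _ = Yt := by
                      rw [hYt, show (4:ℝ) = 2 * 2 by norm_num, mul_pow]; ring
              · exact le_rfl
        _ = _ := by rw [hYd]; ring
    have hYt0 : 0 ≤ Yt := by positivity
    have hYd0 : 0 ≤ Yd := by positivity
    calc _ ≤ ∑ s ∈ S, (Yd + if Tame X s then Yt else 0) := Finset.sum_le_sum hfib
      _ = S.card * Yd + (S.filter (Tame X)).card * Yt := by
          rw [Finset.sum_add_distrib, ← Finset.sum_filter]; simp
      _ ≤ _ := by
          have c1 : (S.card : ℝ) ≤ (k:ℝ) ^ k := by
            have := ker_count S; rw [hcard] at this; exact_mod_cast this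
          have c2 : ((S.filter (Tame X)).card : ℝ) ≤ (M ^ 2 * (g * (g + 1)) + 1 : ℝ) ^ (M ^ 2 * X) := by
            have := tame_count (X := X) (S.filter (Tame X)) (fun s hs => (Finset.mem_filter.1 hs).2)
            exact_mod_cast this
          gcongr
  calc _ ≤ ∑ sg : Fin M → Fin g → Bool, _ := Finset.sum_le_sum fun sg _ => key sg
    _ = _ := by
        rw [Finset.sum_const, Finset.card_univ, nsmul_eq_mul]
        congr 1
        simp only [Fintype.card_fun, Fintype.card_bool, Fintype.card_fin]
        push_cast
        rw [← pow_mul, mul_comm g M, hk]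

end Pattern

open Finset

section Bad

variable {P : Finset ℕ} {g : ℕ}

def mkV (sg : Fin g → Bool) (q : Fin g → {p // p ∈ P}) : Fin g → Lt P := fun i => (q i, sg i)

def wb (w : Fin g → Lt P) (p : ℕ) : Prop :=
  ∃ t t' : Fin g, (w t).1.1 = p ∧ (w t').1.1 = p ∧ ¬ (p:ℤ) ∣ pos w t'.1 - pos w t.1

def HasD (w : Fin g → Lt P) (i a : Fin g) (b : ℕ) : Prop :=
  a.1 < b ∧ b ≤ g ∧ (∀ u : Fin g, a.1 ≤ u.1 → u.1 < b → (w u).1 ≠ (w i).1) ∧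
  (∀ u v : Fin g, a.1 ≤ u.1 → u.1 < b → a.1 ≤ v.1 → v.1 < b → (w u).1 = (w v).1 → u = v) ∧
  (((w i).1.1 : ℕ) : ℤ) ∣ pos w b - pos w a.1

lemma bad_cases (w : Fin g → Lt P) (hr : red w) (hg : ¬ good w) :
    (∃ p, wb w p ∧ p ∈ univ.image (fun t => (w t).1.1)) ∨ ∃ i a, ∃ b : ℕ, HasD w i a b := by
  classical
  by_cases hinj : ∀ i j, (w i).1 = (w j).1 → i = j
  · right
    have : ∃ (i : Fin g) (j : ℕ), j ≤ g ∧ j ≠ i.1 ∧ j ≠ i.1 + 1 ∧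
        (((w i).1.1 : ℕ) : ℤ) ∣ pos w j - pos w i.1 := by
      by_contra h
      push Not at h
      exact hg ⟨hinj, fun i j h1 h2 h3 => h i j h1 h2 h3⟩
    obtain ⟨i, j, h1, h2, h3, h4⟩ := this
    rcases lt_or_ge i.1 j with h | h
    · refine ⟨i, ⟨i.1+1, by omega⟩, j, by simp; omega, h1, ?_, ?_, ?_⟩
      · intro u hu hu' he
        have := hinj _ _ he
        subst this; simp at hu
      · intro u v _ _ _ _ he; exact hinj _ _ he
      · simp only
        rw [pos_succ, show pos w j - (pos w i.1 + stp (w i)) = (pos w j - pos w i.1) - stp (w i) by ring]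
        exact dvd_sub h4 (dvd_stp _)
    · refine ⟨i, ⟨j, by omega⟩, i.1, by simp; omega, i.2.le, ?_, ?_, ?_⟩
      · intro u hu hu' he
        have := hinj _ _ he
        subst this; simp at hu'
      · intro u v _ _ _ _ he; exact hinj _ _ he
      · simp only
        rw [← dvd_neg, neg_sub]; exact h4
  · push Not at hinj
    have hex : ∃ d : ℕ, ∃ i j : Fin g, (w i).1 = (w j).1 ∧ i.1 < j.1 ∧ j.1 - i.1 = d := by
      obtain ⟨i, j, h, hne⟩ := hinj
      rcases lt_trichotomy i.1 j.1 with h' | h' | h'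
      · exact ⟨_, i, j, h, h', rfl⟩
      · exact absurd (Fin.ext h') hne
      · exact ⟨_, j, i, h.symm, h', rfl⟩
    obtain ⟨i, j, h1, h2, h3⟩ := Nat.find_spec hex
    have hmin : ∀ u v : Fin g, (w u).1 = (w v).1 → u.1 < v.1 → Nat.find hex ≤ v.1 - u.1 := by
      intro u v a1 a2
      exact Nat.find_min' hex ⟨u, v, a1, a2, rfl⟩
    have hj2 : i.1 + 1 < j.1 := by
      rcases Nat.lt_or_ge (i.1+1) j.1 with h | h
      · exact h
      · exact absurd h1 (hr i j (by omega))
    by_cases hd : (((w i).1.1 : ℕ) : ℤ) ∣ pos w j.1 - pos w i.1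
    · right
      refine ⟨i, ⟨i.1+1, by omega⟩, j.1, by simpa using hj2, j.2.le, ?_, ?_, ?_⟩
      · intro u hu hu' he
        simp at hu
        have := hmin i u he.symm (by omega)
        omega
      · intro u v hu hu' hv hv' he
        simp at hu hv
        rcases lt_trichotomy u.1 v.1 with h' | h' | h'
        · have := hmin u v he h'; omega
        · exact Fin.ext h'
        · have := hmin v u he.symm h'; omega
      · simp only
        rw [pos_succ, show pos w j.1 - (pos w i.1 + stp (w i)) = (pos w j.1 - pos w i.1) - stp (w i) by ring]
        exact dvd_sub hd (dvd_stp _)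
    · left
      exact ⟨(w i).1.1, ⟨i, j, rfl, by rw [h1], hd⟩, Finset.mem_image_of_mem _ (Finset.mem_univ _)⟩

open Classical in
lemma abs_word_bd (hP : ∀ p ∈ P, p.Prime) (w : Fin g → Lt P) (Pm : ℕ) (hPm : ∀ p ∈ P, p ≤ Pm)
    (hPm1 : 1 ≤ Pm) (η : ℝ) (hη : ∀ p ∈ P, 3 / (2 * (p:ℝ)) ≤ η) (hη0 : 0 ≤ η) (a : ℤ) (N : ℕ) :
    ∑ n ∈ Ioc a (a + N), ∏ t, |lit (w t).1.1 (n + pos w t.1)| ≤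
      N * ∏ p ∈ univ.image (fun t => (w t).1.1), (2 / (p:ℝ) * (if wb w p then η else 1)) +
        2 * (Pm:ℝ) ^ g := by
  set S0 := univ.image (fun t => (w t).1.1) with hS0
  have hS0P : ∀ p ∈ S0, p ∈ P := by
    intro p hp
    obtain ⟨t, _, rfl⟩ := Finset.mem_image.1 hp
    exact (w t).1.2
  set y : Fin g → ℤ := fun t => pos w t.1 with hy
  set h : ℕ → ℤ → ℝ := fun p n =>
    ∏ t ∈ univ.filter (fun t => (w t).1.1 = p), |lit p (n + y t)| with hh
  have hper : ∀ p n, h p (n + p) = h p n := by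
    intro p n
    simp only [hh]
    refine Finset.prod_congr rfl fun t _ => ?_
    congr 1
    refine lit_congr ?_
    ring_nf; simp
  have h0 : ∀ p n, 0 ≤ h p n := fun p n => Finset.prod_nonneg fun _ _ => abs_nonneg _
  have habs1 : ∀ p ∈ P, ∀ A ⊆ univ.filter (fun t => (w t).1.1 = p), ∀ n,
      h p n ≤ ∏ t ∈ A, |lit p (n + y t)| := by
    intro p hp A hA n
    simp only [hh]
    rw [← Finset.prod_sdiff hA]
    refine mul_le_of_le_one_left (Finset.prod_nonneg fun _ _ => abs_nonneg _) ?_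
    exact Finset.prod_le_one (fun _ _ => abs_nonneg _) fun t _ => abs_lit_le (hP p hp) _
  have h1 : ∀ p ∈ S0, ∀ n, |h p n| ≤ 1 := by
    intro p hp n
    rw [abs_of_nonneg (h0 p n)]
    simpa using habs1 p (hS0P p hp) ∅ (by simp) n
  have key := equi S0 (fun p hp => hP p (hS0P p hp)) h (fun p _ => hper p) h1 a N
  have hrew : ∀ n, (∏ t, |lit (w t).1.1 (n + pos w t.1)|) = ∏ p ∈ S0, h p n := by
    intro n
    simp only [hh]
    rw [← Finset.prod_fiberwise_of_maps_to (s := univ) (t := S0) (g := fun t => (w t).1.1)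
      (fun t _ => Finset.mem_image_of_mem _ (Finset.mem_univ _))]
    refine Finset.prod_congr rfl fun p _ => Finset.prod_congr rfl fun t ht => ?_
    rw [(Finset.mem_filter.1 ht).2]
  simp only [hrew]
  have hV0 : ∀ p ∈ S0, avg p (h p) ≤ 2 / (p:ℝ) * (if wb w p then η else 1) := by
    intro p hp
    have hpP := hS0P p hp
    have hp0 : (0:ℝ) < p := by exact_mod_cast (hP p hpP).pos
    have hpn := (hP p hpP).pos
    split_ifs with hwp
    · obtain ⟨t, t', ht, ht', hd⟩ := hwp
      have hne : t ≠ t' := by rintro rfl; simp at hd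
      have : avg p (h p) ≤ 3 / (p:ℝ) ^ 2 := by
        have e : avg p (fun n => ((1 / (p:ℝ)) * (if (p:ℤ) ∣ n + y t then (1:ℝ) else 0)
            + (1 / (p:ℝ)) * (if (p:ℤ) ∣ n + y t' then (1:ℝ) else 0)) + 1 / (p:ℝ) ^ 2)
            = 3 / (p:ℝ) ^ 2 := by
          rw [avg_add, avg_add, avg_smul, avg_smul, avg_ind hpn, avg_ind hpn, avg_const hpn]
          field_simp; norm_num
        rw [← e]
        refine avg_mono fun n => ?_
        refine (habs1 p hpP {t, t'} (by
          intro s hs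
          rcases Finset.mem_insert.1 hs with rfl | hs
          · simp [ht]
          · rw [Finset.mem_singleton.1 hs]; simp [ht']) n).trans ?_
        rw [Finset.prod_pair hne]
        have b1 := abs_lit_le2 p (n + y t)
        have b2 := abs_lit_le2 p (n + y t')
        refine (mul_le_mul b1 b2 (abs_nonneg _) (by positivity)).trans ?_
        have : ¬ ((p:ℤ) ∣ n + y t ∧ (p:ℤ) ∣ n + y t') := by
          rintro ⟨u1, u2⟩
          apply hd
          have := dvd_sub u2 u1
          rwa [add_sub_add_left_eq_sub] at this
        by_cases u1 : (p:ℤ) ∣ n + y t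
        · by_cases u2 : (p:ℤ) ∣ n + y t'
          · exact absurd ⟨u1, u2⟩ this
          · simp only [u1, u2, if_true, if_false]; apply le_of_eq; ring
        · by_cases u2 : (p:ℤ) ∣ n + y t'
          · simp only [u1, u2, if_true, if_false]; apply le_of_eq; ring
          · simp only [u1, u2, if_false]; apply le_of_eq; ring
      refine this.trans ?_
      have h3 := mul_le_mul_of_nonneg_left (hη p hpP) (show 0 ≤ 2 / (p:ℝ) by positivity)
      refine le_trans (le_of_eq ?_) h3
      field_simp
    · obtain ⟨t, _, ht⟩ := Finset.mem_image.1 hp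
      have e : avg p (fun n => (if (p:ℤ) ∣ n + y t then (1:ℝ) else 0) + 1 / (p:ℝ))
            = 2 / (p:ℝ) := by
        rw [avg_add, avg_ind hpn, avg_const hpn]; ring
      rw [mul_one, ← e]
      refine avg_mono fun n => ?_
      refine (habs1 p hpP {t} (by simp [ht]) n).trans ?_
      rw [Finset.prod_singleton]
      exact abs_lit_le2 p _
  have k2 : ∏ p ∈ S0, avg p (h p) ≤ ∏ p ∈ S0, (2 / (p:ℝ) * (if wb w p then η else 1)) := by
    refine Finset.prod_le_prod (fun p _ => ?_) hV0
    unfold avg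
    exact div_nonneg (Finset.sum_nonneg fun _ _ => h0 _ _) (by positivity)
  have k3 : ∏ p ∈ S0, (p:ℝ) ≤ (Pm:ℝ) ^ g := by
    calc ∏ p ∈ S0, (p:ℝ) ≤ ∏ p ∈ S0, (Pm:ℝ) := Finset.prod_le_prod (fun _ _ => by positivity)
          fun p hp => by exact_mod_cast hPm p (hS0P p hp)
      _ = (Pm:ℝ) ^ S0.card := by simp
      _ ≤ _ := pow_le_pow_right₀ (by exact_mod_cast hPm1) (by
          have := Finset.card_image_le (s := (univ : Finset (Fin g))) (f := fun t => (w t).1.1)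
          simpa using this)
  have k4 := (abs_le.1 key).2
  have k5 := mul_le_mul_of_nonneg_left k2 (show (0:ℝ) ≤ N by positivity)
  linarith

open Classical in
lemma HasD_sum (hP : ∀ p ∈ P, p.Prime) (sg : Fin g → Bool) (s : Setoid (Fin g)) (i a : Fin g) (b : ℕ)
    (L xm : ℝ) (hL : 1 ≤ L) (hPL : ∑ p ∈ P, 1 / (p:ℝ) ≤ L)
    (hxm0 : 0 ≤ xm) (hxm : ∀ p ∈ P, 1 / (p:ℝ) ≤ xm) (Pm M0 : ℕ) (hPm : ∀ p ∈ P, p ≤ Pm)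
    (hM0 : 2 * g * Pm ≤ 2 ^ M0) (hM1 : 1 ≤ M0) :
    ∑ q ∈ univ.filter (fun q : Fin g → {p // p ∈ P} => Setoid.ker q = s ∧ HasD (mkV sg q) i a b),
      ∏ t ∈ Fx s, 1 / ((q t).1 : ℝ) ≤ 2 * (L ^ (Fx s).card * (M0 * xm)) := by
  set Dz : (Fin g → {p // p ∈ P}) → ℤ := fun q => pos (mkV sg q) b - pos (mkV sg q) a.1 with hDz
  have hsplit := Finset.sum_filter_add_sum_filter_not
    (univ.filter (fun q : Fin g → {p // p ∈ P} => Setoid.ker q = s ∧ HasD (mkV sg q) i a b))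
    (fun q => Dz q = 0) (fun q => ∏ t ∈ Fx s, 1 / ((q t).1 : ℝ))
  rw [← hsplit]
  have hdep0 : ∀ q q' : Fin g → {p // p ∈ P}, ∀ c : ℕ, c ≤ b →
      (∀ u : Fin g, c ≤ u.1 → u.1 < b → q u = q' u) →
      pos (mkV sg q) b - pos (mkV sg q) c = pos (mkV sg q') b - pos (mkV sg q') c := by
    intro q q' c hc h
    unfold pos
    rw [psum_sub _ hc, psum_sub _ hc]
    refine Finset.sum_congr rfl fun u _ => ?_
    split_ifs with hu
    · simp only [mkV, h u hu.1 hu.2]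
    · rfl
  have hxs : ∀ p : {p // p ∈ P}, 1 / (p.1:ℝ) ≤ xm := fun p => hxm _ p.2
  have hLs : ∑ p : {p // p ∈ P}, 1 / (p.1:ℝ) ≤ L := by
    rw [Finset.sum_coe_sort P (fun p => 1 / (p:ℝ))]; exact hPL
  have m1 := detl s (fun p : {p // p ∈ P} => 1 / (p.1:ℝ)) (fun _ => by positivity) xm hxm0 hxs L hL hLs
    ((univ.filter (fun q : Fin g → {p // p ∈ P} => Setoid.ker q = s ∧ HasD (mkV sg q) i a b)).filter
      fun q => Dz q = 0)
    (fun q hq => (Finset.mem_filter.1 (Finset.mem_filter.1 hq).1).2.1) (E := 1) (fun _ => a)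
    (fun q _ x y _ => Subsingleton.elim _ _) M0
    (fun _ q => univ.filter fun p : {p // p ∈ P} =>
      stp (p, sg a) = -(pos (mkV sg q) b - pos (mkV sg q) (a.1+1)))
    (by
      intro q hq k
      obtain ⟨h1, h2⟩ := Finset.mem_filter.1 hq
      constructor
      · simp only [Finset.mem_filter, Finset.mem_univ, true_and]
        have : pos (mkV sg q) (a.1+1) = pos (mkV sg q) a.1 + stp (mkV sg q a) := pos_succ _ _
        have e : mkV sg q a = (q a, sg a) := rfl
        rw [this, ← e]
        simp only [hDz] at h2
        linarith
      · refine (Finset.card_le_one.2 ?_).trans hM1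
        intro p hp p' hp'
        simp only [Finset.mem_filter, Finset.mem_univ, true_and] at hp hp'
        have h3 : stp (P := P) (p, sg a) = stp (p', sg a) := hp.trans hp'.symm
        unfold stp at h3
        apply Subtype.ext
        split_ifs at h3 <;> simpa using h3)
    (by
      intro q hq q' hq' k hag
      have h1 := (Finset.mem_filter.1 (Finset.mem_filter.1 hq).1).2.2
      have : pos (mkV sg q) b - pos (mkV sg q) (a.1+1) = pos (mkV sg q') b - pos (mkV sg q') (a.1+1) := by
        apply hdep0 _ _ _ h1.1
        intro u hu hu'
        refine hag u fun j _ he => ?_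
        have := h1.2.2.2.1 u a (by omega) hu' le_rfl h1.1 he
        subst this; omega
      simp only [this])
  have m2 := detl s (fun p : {p // p ∈ P} => 1 / (p.1:ℝ)) (fun _ => by positivity) xm hxm0 hxs L hL hLs
    ((univ.filter (fun q : Fin g → {p // p ∈ P} => Setoid.ker q = s ∧ HasD (mkV sg q) i a b)).filter
      fun q => ¬ Dz q = 0)
    (fun q hq => (Finset.mem_filter.1 (Finset.mem_filter.1 hq).1).2.1) (E := 1) (fun _ => i)
    (fun q _ x y _ => Subsingleton.elim _ _) M0
    (fun _ q => univ.filter fun p : {p // p ∈ P} => ((p.1:ℕ):ℤ) ∣ Dz q)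
    (by
      intro q hq k
      obtain ⟨h1, h2⟩ := Finset.mem_filter.1 hq
      have h3 := (Finset.mem_filter.1 h1).2.2
      constructor
      · simp only [Finset.mem_filter, Finset.mem_univ, true_and]
        exact h3.2.2.2.2
      · refine card_dvd_le hP h2 (le_trans ?_ hM0)
        have hb1 := abs_le.1 (abs_psum_le (fun j => stp (mkV sg q j)) (Pm:ℤ) (by positivity)
          (fun j => abs_stp_le hPm _) b)
        have hb2 := abs_le.1 (abs_psum_le (fun j => stp (mkV sg q j)) (Pm:ℤ) (by positivity)
          (fun j => abs_stp_le hPm _) a.1)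
        have : |Dz q| ≤ 2 * (g * Pm) := by
          rw [abs_le]; simp only [hDz, pos]; constructor <;> linarith
        have h7 : (((Dz q).natAbs : ℕ) : ℤ) ≤ ((2 * g * Pm : ℕ) : ℤ) := by
          rw [Int.natCast_natAbs]; push_cast; linarith
        exact_mod_cast h7)
    (by
      intro q hq q' hq' k hag
      have h1 := (Finset.mem_filter.1 (Finset.mem_filter.1 hq).1).2.2
      have : Dz q = Dz q' := by
        apply hdep0 _ _ _ h1.1.le
        intro u hu hu'
        exact hag u fun j _ he => h1.2.2.1 u hu hu' he
      simp only [this])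
  rw [pow_one] at m1 m2
  linarith

open Classical in
theorem bad_sum (hP : ∀ p ∈ P, p.Prime) (φ : ℤ → ℝ) (hφ0 : ∀ n, 0 ≤ φ n) (hφ1 : ∀ n, φ n ≤ 1)
    (L xm η : ℝ) (hL : 1 ≤ L) (hPL : ∑ p ∈ P, 1 / (p:ℝ) ≤ L)
    (hη : ∀ p ∈ P, 3 / (2 * (p:ℝ)) ≤ η) (hη0 : 0 ≤ η) (hη1 : η ≤ 1)
    (hxm0 : 0 ≤ xm) (hxm : ∀ p ∈ P, 1 / (p:ℝ) ≤ xm) (Pm M0 : ℕ) (hPm : ∀ p ∈ P, p ≤ Pm)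
    (hPm1 : 1 ≤ Pm)
    (hM0 : 2 * g * Pm ≤ 2 ^ M0) (hM1 : 1 ≤ M0) (a : ℤ) (N : ℕ) :
    ∑ n ∈ Ioc a (a + N), ∑ w : Fin g → Lt P, (if red w ∧ ¬ good w then |wt φ w n| else 0) ≤
      N * (2 ^ g * (g ^ g * (2 ^ g * L ^ g * (η + g * g * (g + 1) * (2 * (M0 * xm)))))) +
        (2 * Pm) ^ g * (2 * (Pm:ℝ) ^ g) := by
  set F : (Fin g → Lt P) → ℝ := fun w => ∏ p ∈ univ.image (fun t => (w t).1.1),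
    (2 / (p:ℝ) * (if wb w p then η else 1)) with hF
  have hF0 : ∀ w, 0 ≤ F w := fun w => Finset.prod_nonneg fun p _ => by
    split_ifs <;> positivity
  rw [Finset.sum_comm]
  have s1 : ∀ w : Fin g → Lt P, ∑ n ∈ Ioc a (a + N), (if red w ∧ ¬ good w then |wt φ w n| else 0) ≤
      N * (if red w ∧ ¬ good w then F w else 0) + 2 * (Pm:ℝ) ^ g := by
    intro w
    split_ifs with h
    · refine le_trans (Finset.sum_le_sum fun n _ => ?_) (abs_word_bd hP w Pm hPm hPm1 η hη hη0 a N)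
      unfold wt
      rw [Finset.abs_prod]
      refine Finset.prod_le_prod (fun _ _ => abs_nonneg _) fun t _ => ?_
      unfold al
      rw [abs_mul, abs_mul, abs_of_nonneg (hφ0 _), abs_of_nonneg (hφ0 _)]
      have h1 := mul_le_of_le_one_left (abs_nonneg (lit (w t).1.1 (n + pos w t.1))) (hφ1 (n + pos w t.1))
      exact (mul_le_of_le_one_right (mul_nonneg (hφ0 _) (abs_nonneg _)) (hφ1 _)).trans h1
    · simp only [Finset.sum_const_zero]; positivity
  refine (Finset.sum_le_sum fun w _ => s1 w).trans ?_
  rw [Finset.sum_add_distrib, ← Finset.mul_sum]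
  have hcardP : P.card ≤ Pm := by
    have : P ⊆ Icc 1 Pm := fun p hp => Finset.mem_Icc.2 ⟨(hP p hp).one_le, hPm p hp⟩
    simpa using Finset.card_le_card this
  refine add_le_add (mul_le_mul_of_nonneg_left ?_ (by positivity)) ?_
  swap
  · rw [Finset.sum_const, nsmul_eq_mul]
    refine mul_le_mul_of_nonneg_right ?_ (by positivity)
    rw [Finset.card_univ]
    simp only [Fintype.card_fun, Fintype.card_prod, Fintype.card_bool, Fintype.card_fin, Fintype.card_coe]
    push_cast
    rw [mul_comm (P.card : ℝ)]
    gcongr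
  have e1 : ∑ w : Fin g → Lt P, (if red w ∧ ¬ good w then F w else 0) =
      ∑ sg : Fin g → Bool, ∑ q : Fin g → {p // p ∈ P},
        if red (mkV sg q) ∧ ¬ good (mkV sg q) then F (mkV sg q) else 0 := by
    rw [← Fintype.sum_prod_type']
    refine Finset.sum_bij' (fun W _ => ((fun i => (W i).2), fun t => (W t).1))
      (fun x _ => mkV x.1 x.2) ?_ ?_ ?_ ?_ ?_ <;> intros <;> first | exact Finset.mem_univ _ | rfl
  rw [e1]
  set Y : ℝ := 2 ^ g * L ^ g * (η + g * g * (g + 1) * (2 * (M0 * xm))) with hY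
  have hY0 : 0 ≤ Y := by positivity
  have hLg : ∀ s : Setoid (Fin g), L ^ (Fx s).card ≤ L ^ g := fun s =>
    pow_le_pow_right₀ hL (by have := Finset.card_le_univ (Fx s); simpa using this)
  have key : ∀ sg : Fin g → Bool, ∑ q : Fin g → {p // p ∈ P},
        (if red (mkV sg q) ∧ ¬ good (mkV sg q) then F (mkV sg q) else 0) ≤ g ^ g * Y := by
    intro sg
    set S : Finset (Setoid (Fin g)) :=
      univ.image (fun q : Fin g → {p // p ∈ P} => Setoid.ker q) with hS
    rw [← Finset.sum_fiberwise_of_maps_to (t := S) (g := fun q => Setoid.ker q)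
      (fun q _ => Finset.mem_image_of_mem _ (Finset.mem_univ q))]
    have hfib : ∀ s ∈ S, ∑ q ∈ univ.filter (fun q : Fin g → {p // p ∈ P} => Setoid.ker q = s),
        (if red (mkV sg q) ∧ ¬ good (mkV sg q) then F (mkV sg q) else 0) ≤ Y := by
      intro s _
      set Pi : (Fin g → {p // p ∈ P}) → ℝ := fun q => ∏ t ∈ Fx s, 1 / ((q t).1 : ℝ) with hPi
      have hPi0 : ∀ q, 0 ≤ Pi q := fun q => Finset.prod_nonneg fun _ _ => by positivity
      have hb : ∀ q ∈ univ.filter (fun q : Fin g → {p // p ∈ P} => Setoid.ker q = s),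
          (if red (mkV sg q) ∧ ¬ good (mkV sg q) then F (mkV sg q) else 0) ≤
          2 ^ g * (η * Pi q + ∑ i : Fin g, ∑ a : Fin g, ∑ b ∈ range (g+1),
            if HasD (mkV sg q) i a b then Pi q else 0) := by
        intro q hq
        have hq := (Finset.mem_filter.1 hq).2
        have hsum0 : 0 ≤ ∑ i : Fin g, ∑ a : Fin g, ∑ b ∈ range (g+1),
            if HasD (mkV sg q) i a b then Pi q else 0 :=
          Finset.sum_nonneg fun _ _ => Finset.sum_nonneg fun _ _ => Finset.sum_nonneg fun _ _ => by
            split_ifs; exacts [hPi0 q, le_rfl]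
        split_ifs with h
        swap
        · have := hPi0 q; positivity
        have hpr : ∀ G : ℕ → ℝ, ∏ p ∈ univ.image (fun t => (q t).1), G p = ∏ t ∈ Fx s, G (q t).1 := by
          intro G
          rw [show univ.image (fun t => (q t).1) = (univ.image q).image Subtype.val from by
            rw [Finset.image_image]; rfl, Finset.prod_image (fun a _ b _ h => Subtype.ext h)]
          convert prod_image_Fx (q := q) hq (fun p => G p.1)
        have hF2 : F (mkV sg q) = (∏ t ∈ Fx s, 2 / ((q t).1:ℝ)) *
            ∏ p ∈ univ.image (fun t => (q t).1), (if wb (mkV sg q) p then η else 1) := by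
          rw [← hpr (fun p => 2 / (p:ℝ)), ← Finset.prod_mul_distrib]; rfl
        have h2 : ∏ t ∈ Fx s, 2 / ((q t).1:ℝ) ≤ 2 ^ g * Pi q := by
          have : ∏ t ∈ Fx s, 2 / ((q t).1:ℝ) = 2 ^ (Fx s).card * Pi q := by
            rw [hPi, ← Finset.prod_const, ← Finset.prod_mul_distrib]
            exact Finset.prod_congr rfl fun t _ => by ring
          rw [this]
          refine mul_le_mul_of_nonneg_right (pow_le_pow_right₀ (by norm_num) ?_) (hPi0 q)
          have := Finset.card_le_univ (Fx s); simpa using this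
        have h20 : 0 ≤ ∏ t ∈ Fx s, 2 / ((q t).1:ℝ) := Finset.prod_nonneg fun _ _ => by positivity
        rw [hF2]
        rcases bad_cases _ h.1 h.2 with ⟨p, hp, hpi⟩ | ⟨i, a, b, hD⟩
        · have : ∏ p ∈ univ.image (fun t => (q t).1), (if wb (mkV sg q) p then η else 1) ≤ η := by
            have hpi : p ∈ univ.image (fun t => (q t).1) := by convert hpi; rfl
            rw [← Finset.mul_prod_erase _ _ hpi, if_pos hp]
            refine mul_le_of_le_one_right hη0 (Finset.prod_le_one ?_ ?_)
            · intro _ _; split_ifs <;> linarith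
            · intro _ _; split_ifs <;> linarith
          calc _ ≤ 2 ^ g * Pi q * η := mul_le_mul h2 this (Finset.prod_nonneg fun _ _ => by
                split_ifs <;> linarith) (by have := hPi0 q; positivity)
            _ = 2 ^ g * (η * Pi q) := by ring
            _ ≤ _ := by
              refine mul_le_mul_of_nonneg_left ?_ (by positivity)
              linarith
        · have : ∏ p ∈ univ.image (fun t => (q t).1), (if wb (mkV sg q) p then η else 1) ≤ 1 := by
            refine (Finset.prod_le_one ?_ ?_)
            · intro _ _; split_ifs <;> linarith
            · intro _ _; split_ifs <;> linarith
          have h3 : Pi q ≤ ∑ i : Fin g, ∑ a : Fin g, ∑ b ∈ range (g+1),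
            if HasD (mkV sg q) i a b then Pi q else 0 := by
            have nn : ∀ i a b, 0 ≤ (if HasD (mkV sg q) i a b then Pi q else 0) := fun i a b => by
              split_ifs; exacts [hPi0 q, le_rfl]
            have e : Pi q = if HasD (mkV sg q) i a b then Pi q else 0 := by rw [if_pos hD]
            refine le_trans ?_ (Finset.single_le_sum (f := fun i => ∑ a : Fin g, ∑ b ∈ range (g+1),
              if HasD (mkV sg q) i a b then Pi q else 0)
              (fun _ _ => Finset.sum_nonneg fun _ _ => Finset.sum_nonneg fun _ _ => nn _ _ _)
              (Finset.mem_univ i))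
            refine le_trans ?_ (Finset.single_le_sum (f := fun a => ∑ b ∈ range (g+1),
              if HasD (mkV sg q) i a b then Pi q else 0)
              (fun _ _ => Finset.sum_nonneg fun _ _ => nn _ _ _)
              (Finset.mem_univ a))
            refine le_trans (le_of_eq e) (Finset.single_le_sum (f := fun b => 
              if HasD (mkV sg q) i a b then Pi q else 0)
              (fun _ _ => nn _ _ _) (Finset.mem_range.2 (Nat.lt_succ_of_le hD.2.1)))
          calc _ ≤ 2 ^ g * Pi q * 1 := mul_le_mul h2 this (Finset.prod_nonneg fun _ _ => by
                split_ifs <;> linarith) (by have := hPi0 q; positivity)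
            _ = 2 ^ g * Pi q := by ring
            _ ≤ _ := by
              refine mul_le_mul_of_nonneg_left ?_ (by positivity)
              have := mul_nonneg hη0 (hPi0 q)
              linarith
      refine (Finset.sum_le_sum hb).trans ?_
      rw [← Finset.mul_sum, Finset.sum_add_distrib, ← Finset.mul_sum]
      have p1 : ∑ q ∈ univ.filter (fun q : Fin g → {p // p ∈ P} => Setoid.ker q = s), Pi q ≤ L ^ g := by
        have := detl s (fun p : {p // p ∈ P} => 1 / (p.1:ℝ)) (fun _ => by positivity) xm hxm0
          (fun p => hxm _ p.2) L hL
          (by rw [Finset.sum_coe_sort P (fun p => 1 / (p:ℝ))]; exact hPL)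
          (univ.filter (fun q : Fin g → {p // p ∈ P} => Setoid.ker q = s))
          (fun q hq => (Finset.mem_filter.1 hq).2) (E := 0) Fin.elim0 (fun q hq a => a.elim0) 0
          (fun k => k.elim0) (fun q hq k => k.elim0) (fun q _ q' _ k => k.elim0)
        rw [pow_zero, mul_one] at this
        exact this.trans (hLg s)
      have p2 : ∑ q ∈ univ.filter (fun q : Fin g → {p // p ∈ P} => Setoid.ker q = s),
          ∑ i : Fin g, ∑ a : Fin g, ∑ b ∈ range (g+1), (if HasD (mkV sg q) i a b then Pi q else 0) ≤
          g * (g * ((g + 1) * (2 * (L ^ g * (M0 * xm))))) := by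
        rw [Finset.sum_comm]
        calc _ ≤ ∑ i : Fin g, (g * ((g + 1) * (2 * (L ^ g * (M0 * xm)))) : ℝ) := by
              refine Finset.sum_le_sum fun i _ => ?_
              rw [Finset.sum_comm]
              calc _ ≤ ∑ a : Fin g, ((g + 1) * (2 * (L ^ g * (M0 * xm))) : ℝ) := by
                    refine Finset.sum_le_sum fun a _ => ?_
                    rw [Finset.sum_comm]
                    calc _ ≤ ∑ b ∈ range (g+1), (2 * (L ^ g * (M0 * xm)) : ℝ) := by
                          refine Finset.sum_le_sum fun b _ => ?_
                          rw [← Finset.sum_filter, Finset.filter_filter]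
                          refine (HasD_sum hP sg s i a b L xm hL hPL hxm0 hxm Pm M0 hPm hM0 hM1).trans ?_
                          have := hLg s
                          gcongr
                      _ = _ := by simp
                _ = _ := by simp
          _ = _ := by simp
      calc _ ≤ 2 ^ g * (η * L ^ g + g * (g * ((g + 1) * (2 * (L ^ g * (M0 * xm)))))) := by gcongr
        _ = Y := by rw [hY]; ring
    calc _ ≤ ∑ s ∈ S, Y := Finset.sum_le_sum hfib
      _ = S.card * Y := by simp
      _ ≤ _ := by
          have c1 : (S.card : ℝ) ≤ (g:ℝ) ^ g := by
            have := ker_count S; rw [Fintype.card_fin] at this; exact_mod_cast this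
          gcongr
  calc _ ≤ ∑ sg : Fin g → Bool, _ := Finset.sum_le_sum fun sg _ => key sg
    _ = _ := by
        rw [Finset.sum_const, Finset.card_univ, nsmul_eq_mul]
        simp

end Bad

open Finset

section Win

variable {P : Finset ℕ} {g M : ℕ} {I : Finset ℤ} {L : ℝ} {φ : ℤ → ℝ}

lemma red_revw {w : Fin g → Lt P} (h : red w) : red (revw w) := by
  intro i j hij
  have := h (Fin.rev j) (Fin.rev i) (by simp [Fin.val_rev]; omega)
  simpa [revw, flipL] using this.symm

lemma good_revw {w : Fin g → Lt P} (h : good w) : good (revw w) := by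
  refine ⟨fun i j hij => ?_, fun i j hj h1 h2 hd => ?_⟩
  · have := h.1 (Fin.rev i) (Fin.rev j) (by simpa [revw, flipL] using hij)
    simpa using this
  · have e1 := pos_revw w _ hj
    have e2 := pos_revw w _ i.2.le
    rw [e1, e2] at hd
    have hi := i.2
    have hp : (((revw w i).1.1 : ℕ):ℤ) = (((w (Fin.rev i)).1.1 : ℕ) : ℤ) := rfl
    rw [hp] at hd
    refine h.2 (Fin.rev i) (g - j) (by omega) (by simp [Fin.val_rev]; omega)
      (by simp [Fin.val_rev]; omega) ?_
    have e3 : pos w (g - i.1) = pos w (Fin.rev i).1 + stp (w (Fin.rev i)) := by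
      rw [← pos_succ]; congr 1; simp [Fin.val_rev]; omega
    have : pos w (g - j) - pos w (Fin.rev i).1 =
        (pos w (g - j) - pos w g - (pos w (g - i.1) - pos w g)) + stp (w (Fin.rev i)) := by
      rw [e3]; ring
    rw [this]
    exact dvd_add hd (dvd_stp _)

lemma good_revw_iff {w : Fin g → Lt P} : good (revw w) ↔ good w :=
  ⟨fun h => by simpa [revw_revw] using good_revw h, good_revw⟩

/-- the diagonal of the M-th power of the good-word operator -/
noncomputable def tdiag (P : Finset ℕ) (φ : ℤ → ℝ) (g M : ℕ) (n : ℤ) : ℝ :=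
  ((wop φ (fun w : Fin g → Lt P => good w)) ^ M) (fun m => if m = n then 1 else 0) n

open Classical in
noncomputable def bet (P : Finset ℕ) (φ : ℤ → ℝ) (g : ℕ) (n : ℤ) : ℝ :=
  ∑ w : Fin g → Lt P, (if red w ∧ ¬ good w then |wt φ w n| else 0)

lemma good_red {w : Fin g → Lt P} (h : good w) : red w := by
  intro i j hij he
  have := h.1 i j he
  subst this; omega

lemma chK_bd (hM : Mask P I L φ) (hg : 0 < g) (b : ℕ) (h : ℤ → ℝ) (hh : BI I h h = 1)
    (J : Finset ℤ) (hJI : J ⊆ I) (hJ : ∀ n, n ∉ J → h n = 0) (R : ℝ) (hR : 0 ≤ R)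
    (hb : ∀ n, h n ≠ 0 → bet P φ g n ≤ 1)
    (ht : ∑ n ∈ J, tdiag P φ g (2 ^ (b+1)) n ≤ R ^ (2 ^ (b+1) * g)) :
    |chK (BI I) (aop (P := P) φ) h g| ≤ R ^ g + 1 := by
  classical
  unfold chK
  rw [(chSt_eq h g).1]
  have e : wop φ (fun w : Fin g → Lt P => red w) h = wop φ (fun w : Fin g → Lt P => good w) h
      + wop φ (fun w : Fin g → Lt P => red w ∧ ¬ good w) h := by
    ext n
    simp only [Pi.add_apply, wop_apply]
    rw [← Finset.sum_add_distrib]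
    refine Finset.sum_congr rfl fun w _ => ?_
    by_cases h1 : good w
    · simp [h1, good_red h1]
    · simp [h1]
  rw [e, map_add]
  have s1 := wop_schur hM hg (fun w : Fin g → Lt P => red w ∧ ¬ good w)
    (fun w hw => ⟨red_revw hw.1, fun h2 => hw.2 (good_revw_iff.1 h2)⟩) h 1 (fun n hn => by
      have := hb n hn
      unfold bet at this; convert this)
  rw [hh, one_mul] at s1
  have hs := wop_sym hM hg (fun w : Fin g → Lt P => good w) (fun w hw => good_revw hw)
  have s2 := (trace_bd _ hs h hh J hJI hJ b).1
  have s3 : |BI I h (wop φ (fun w : Fin g → Lt P => good w) h)| ≤ R ^ g := by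
    have h3 : BI I h (wop φ (fun w : Fin g → Lt P => good w) h) ^ (2 ^ (b+1)) ≤ (R ^ g) ^ (2 ^ (b+1)) := by
      rw [← pow_mul, mul_comm g]
      exact s2.trans ht
    have hev : Even (2 ^ (b+1)) := by rw [pow_succ']; exact even_two_mul _
    rw [← hev.pow_abs] at h3
    exact le_of_pow_le_pow_left₀ (by positivity) (by positivity) h3
  exact (abs_add_le _ _).trans (add_le_add s3 s1)

theorem window1 (hM : Mask P I L φ) (e b : ℕ) (h : ℤ → ℝ) (hh : BI I h h = 1) (he : 1 ≤ e)
    (J : Finset ℤ) (hJI : J ⊆ I) (hJ : ∀ n, n ∉ J → h n = 0) (R : ℝ) (hR1 : 1 ≤ R)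
    (hRL : 32 * L ≤ R ^ 2)
    (hb : ∀ g, (g = 2 ^ (e+1) ∨ g = 2 ^ (e+1) - 2) → ∀ n, h n ≠ 0 → bet P φ g n ≤ 1)
    (ht : ∀ g, (g = 2 ^ (e+1) ∨ g = 2 ^ (e+1) - 2) →
      ∑ n ∈ J, tdiag P φ g (2 ^ (b+1)) n ≤ R ^ (2 ^ (b+1) * g)) :
    |BI I h (∑ p : {p // p ∈ P}, aop φ p h)| ≤ 4 * R := by
  have hk1 : chK (BI I) (aop (P := P) φ) h 1 = BI I h (∑ p : {p // p ∈ P}, aop φ p h) := by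
    simp [chK, chSt]
  rw [← hk1]
  set k1 := chK (BI I) (aop (P := P) φ) h 1 with hk1'
  have hL1 := hM.one_le
  by_cases hmu : 4 * (32 * L) ≤ k1 ^ 2
  swap
  · push Not at hmu
    have : |k1| ^ 2 ≤ (4 * R) ^ 2 := by rw [sq_abs]; nlinarith
    exact le_of_pow_le_pow_left₀ (by norm_num) (by linarith) this
  have hc := cheb_main (BI I) (aop (P := P) φ) h (aop_sym hM) (BI_nonneg I) 4 (8 * L) (32 * L)
    (aop_norm hM) (aop_sum_norm hM) (by linarith) (by linarith) (by linarith) hh hmu e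
  have hg0 : 4 ≤ 2 ^ (e+1) := by
    calc 4 = 2 ^ 2 := by norm_num
      _ ≤ _ := Nat.pow_le_pow_right (by norm_num) (by omega)
  have c1 := chK_bd hM (g := 2 ^ (e+1)) (by omega) b h hh J hJI hJ R (by linarith) (hb _ (Or.inl rfl))
    (ht _ (Or.inl rfl))
  have c2 := chK_bd hM (g := 2 ^ (e+1) - 2) (by omega) b h hh J hJI hJ R (by linarith) (hb _ (Or.inr rfl))
    (ht _ (Or.inr rfl))
  set g0 := 2 ^ (e+1) with hg0'
  set x := R ^ (g0 - 2) with hx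
  have hx1 : 1 ≤ x := one_le_pow₀ hR1
  have hxg : R ^ g0 = x * R ^ 2 := by rw [hx, ← pow_add]; congr 1; omega
  have c1' := (abs_le.1 c1).2
  have c2' := (abs_le.1 c2).1
  have c3 : (|k1| / 2) ^ g0 ≤ 2 * R ^ g0 := by
    rw [hxg] at c1' ⊢
    have : 32 * L * (x + 1) ≤ R ^ 2 * (2 * x) :=
      mul_le_mul hRL (by linarith) (by linarith) (by positivity)
    have h3 : -(32 * L * (x + 1)) ≤ 32 * L * chK (BI I) (aop (P := P) φ) h (g0 - 2) := by
      have := mul_le_mul_of_nonneg_left c2' (show 0 ≤ 32 * L by linarith)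
      linarith
    have h4 : 1 ≤ x * R ^ 2 := by nlinarith
    linarith
  have c4 : (|k1| / 2) ^ g0 ≤ (2 * R) ^ g0 := by
    refine c3.trans ?_
    rw [mul_pow]
    refine mul_le_mul_of_nonneg_right ?_ (by positivity)
    calc (2:ℝ) = 2 ^ 1 := by norm_num
      _ ≤ 2 ^ g0 := pow_le_pow_right₀ (by norm_num) (by omega)
  have := le_of_pow_le_pow_left₀ (show g0 ≠ 0 by omega) (by linarith) c4
  linarith

theorem window (hM : Mask P I L φ) (e b : ℕ) (h : ℤ → ℝ) (he : 1 ≤ e)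
    (J : Finset ℤ) (hJI : J ⊆ I) (hJ : ∀ n, n ∉ J → h n = 0) (R : ℝ) (hR1 : 1 ≤ R)
    (hRL : 32 * L ≤ R ^ 2)
    (hb : ∀ g, (g = 2 ^ (e+1) ∨ g = 2 ^ (e+1) - 2) → ∀ n, h n ≠ 0 → bet P φ g n ≤ 1)
    (ht : ∀ g, (g = 2 ^ (e+1) ∨ g = 2 ^ (e+1) - 2) →
      ∑ n ∈ J, tdiag P φ g (2 ^ (b+1)) n ≤ R ^ (2 ^ (b+1) * g)) :
    |BI I h (∑ p : {p // p ∈ P}, aop φ p h)| ≤ 4 * R * BI I h h := by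
  by_cases h0 : BI I h h = 0
  · have : ∀ n ∈ I, h n = 0 := by
      intro n hn
      rw [BI_apply, Finset.sum_eq_zero_iff_of_nonneg (fun _ _ => mul_self_nonneg _)] at h0
      exact mul_self_eq_zero.1 (h0 n hn)
    have e : BI I h (∑ p : {p // p ∈ P}, aop φ p h) = 0 := by
      rw [BI_apply]; exact Finset.sum_eq_zero fun n hn => by rw [this n hn, zero_mul]
    rw [e, h0]; simp
  · have hpos : 0 < BI I h h := lt_of_le_of_ne (BI_nonneg I h) (Ne.symm h0)
    set c := Real.sqrt (BI I h h) with hc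
    have hc0 : 0 < c := Real.sqrt_pos.2 hpos
    have hcc : c * c = BI I h h := Real.mul_self_sqrt hpos.le
    have := window1 hM e b (c⁻¹ • h) (by
      simp only [map_smul, LinearMap.smul_apply, smul_eq_mul]
      rw [← hcc]; field_simp) he J hJI (fun n hn => by simp [hJ n hn]) R hR1 hRL
      (fun g hg n hn => hb g hg n (by
        intro h0; apply hn; simp [h0])) ht
    simp only [map_smul, LinearMap.smul_apply, smul_eq_mul, ← Finset.smul_sum] at this
    rw [← mul_assoc, abs_mul, abs_of_pos (by positivity : 0 < c⁻¹ * c⁻¹), ← mul_inv, hcc,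
      inv_mul_le_iff₀ hpos] at this
    linarith

end Win

open Finset

section Win2

variable {P : Finset ℕ} {g M : ℕ} {I : Finset ℤ} {L : ℝ} {φ : ℤ → ℝ}

lemma tri_sum (m : ℕ) (a : ℕ → ℕ → ℝ) (ha : ∀ i j, i + 2 ≤ j ∨ j + 2 ≤ i → a i j = 0)
    (h1 : ∀ i, a i m = 0) (h2 : ∀ i, a m i = 0) :
    ∑ i ∈ range m, ∑ j ∈ range m, a i j =
      ∑ i ∈ range m, (a i i + a i (i+1) + a (i+1) i) := by
  have hdec : ∀ i j, a i j = (if i = j then a i i else 0) + (if i + 1 = j then a i (i+1) else 0)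
      + (if j + 1 = i then a (j+1) j else 0) := by
    intro i j
    by_cases e1 : i = j
    · subst e1; simp
    by_cases e2 : i + 1 = j
    · subst e2; simp; try (intro h; omega)
    by_cases e3 : j + 1 = i
    · subst e3; simp; try (intro h; omega)
    simp only [e1, e2, e3, if_false]
    rw [ha i j (by omega)]; norm_num
  calc _ = ∑ i ∈ range m, ∑ j ∈ range m, ((if i = j then a i i else 0) +
        (if i + 1 = j then a i (i+1) else 0) + (if j + 1 = i then a (j+1) j else 0)) :=
        Finset.sum_congr rfl fun i _ => Finset.sum_congr rfl fun j _ => hdec i j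
    _ = _ := by
        simp only [Finset.sum_add_distrib]
        rw [Finset.sum_comm (f := fun i j => if j + 1 = i then a (j+1) j else 0)]
        simp only [Finset.sum_ite_eq]
        have aux : ∀ F : ℕ → ℝ, F m = 0 → ∑ i ∈ range m, (if i + 1 ∈ range m then F (i+1) else 0) =
            ∑ i ∈ range m, F (i+1) := by
          intro F hF
          refine Finset.sum_congr rfl fun i hi => ?_
          have := Finset.mem_range.1 hi
          split_ifs with h
          · rfl
          · have : i + 1 = m := by simp at h; omega
            rw [this, hF]
        congr 1
        · congr 1
          · exact Finset.sum_congr rfl fun i hi => by rw [if_pos hi]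
          · refine Finset.sum_congr rfl fun i hi => ?_
            have := Finset.mem_range.1 hi
            split_ifs with h
            · rfl
            · have : i + 1 = m := by simp at h; omega
              rw [this, h1]
        · refine Finset.sum_congr rfl fun i hi => ?_
          have := Finset.mem_range.1 hi
          split_ifs with h
          · rfl
          · have : i + 1 = m := by simp at h; omega
            rw [this, h2]

def idx (a : ℤ) (D : ℕ) (n : ℤ) : ℕ := ((n - a - 1) / D).toNat

lemma idx_close {a : ℤ} {D N : ℕ} (hD : 1 ≤ D) {n d : ℤ} (hn : n ∈ Ioc a (a + N))
    (hn' : n + d ∈ Ioc a (a + N)) (hd : |d| ≤ D) :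
    idx a D (n + d) ≤ idx a D n + 1 ∧ idx a D n ≤ idx a D (n + d) + 1 := by
  rw [Finset.mem_Ioc] at hn hn'
  have hd := abs_le.1 hd
  have hDz : (0:ℤ) < D := by exact_mod_cast hD
  unfold idx
  have h1 : 0 ≤ (n - a - 1) / D := Int.ediv_nonneg (by omega) hDz.le
  have h2 : 0 ≤ (n + d - a - 1) / D := Int.ediv_nonneg (by omega) hDz.le
  have h3 : (n + d - a - 1) / D ≤ (n - a - 1) / D + 1 := by
    have : (n - a - 1 + D) / (D:ℤ) = (n - a - 1) / D + 1 := by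
      rw [Int.add_ediv_of_dvd_right (dvd_refl _), Int.ediv_self hDz.ne']
    rw [← this]
    exact Int.ediv_le_ediv hDz (by linarith)
  have h4 : (n - a - 1) / D ≤ (n + d - a - 1) / D + 1 := by
    have : (n + d - a - 1 + D) / (D:ℤ) = (n + d - a - 1) / D + 1 := by
      rw [Int.add_ediv_of_dvd_right (dvd_refl _), Int.ediv_self hDz.ne']
    rw [← this]
    exact Int.ediv_le_ediv hDz (by linarith)
  omega

lemma idx_lt {a : ℤ} {D N : ℕ} (hD : 1 ≤ D) {n : ℤ} (hn : n ∈ Ioc a (a + N)) : idx a D n < N := by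
  rw [Finset.mem_Ioc] at hn
  have hDz : (0:ℤ) < D := by exact_mod_cast hD
  unfold idx
  have h1 : 0 ≤ (n - a - 1) / D := Int.ediv_nonneg (by omega) hDz.le
  have h2 : (n - a - 1) / D ≤ n - a - 1 := Int.ediv_le_self _ (by omega)
  omega

lemma idx_card {a : ℤ} {D N : ℕ} (hD : 1 ≤ D) (j : ℕ) :
    ((Ioc a (a + N)).filter fun n => idx a D n = j).card ≤ D := by
  have hDz : (0:ℤ) < D := by exact_mod_cast hD
  have : ((Ioc a (a + N)).filter fun n => idx a D n = j) ⊆ Ioc (a + j * D) (a + j * D + D) := by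
    intro n hn
    rw [Finset.mem_filter, Finset.mem_Ioc] at hn
    have h1 : 0 ≤ (n - a - 1) / D := Int.ediv_nonneg (by omega) hDz.le
    have h2 : (n - a - 1) / D = j := by
      have := hn.2; unfold idx at this; omega
    have h3 := Int.mul_ediv_add_emod (n - a - 1) D
    have h4 := Int.emod_nonneg (n - a - 1) hDz.ne'
    have h5 := Int.emod_lt_of_pos (n - a - 1) hDz
    rw [h2] at h3
    rw [Finset.mem_Ioc]
    constructor <;> nlinarith
  refine (Finset.card_le_card this).trans ?_
  simp

lemma quad_win (hM : Mask P I L φ) (a : ℤ) (N D : ℕ) (hD : 1 ≤ D) (hPD : ∀ p ∈ P, p ≤ D)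
    (h : ℤ → ℝ) (hs : ∀ n, h n ≠ 0 → n ∈ Ioc a (a + N)) (τ : ℝ) 
    (A : (ℤ → ℝ) →ₗ[ℝ] (ℤ → ℝ)) (hA : A = ∑ p : {p // p ∈ P}, aop φ p)
    (hτ : ∀ j c, |BI I (fun n => if idx a D n = j ∨ idx a D n = c then h n else 0)
        (A (fun n => if idx a D n = j ∨ idx a D n = c then h n else 0))| ≤
        τ * BI I (fun n => if idx a D n = j ∨ idx a D n = c then h n else 0)
          (fun n => if idx a D n = j ∨ idx a D n = c then h n else 0)) (hτ0 : 0 ≤ τ) :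
    |BI I h (A h)| ≤ 3 * τ * BI I h h := by
  set hj : ℕ → ℤ → ℝ := fun j n => if idx a D n = j then h n else 0 with hhj
  have hN : ∀ n, h n ≠ 0 → idx a D n < N := fun n hn => idx_lt hD (hs n hn)
  have hsum : h = ∑ j ∈ range N, hj j := by
    ext n
    simp only [Finset.sum_apply, hhj]
    rw [Finset.sum_ite_eq]
    by_cases h0 : h n = 0
    · simp [h0]
    · rw [if_pos (Finset.mem_range.2 (hN n h0))]
  have hjN : hj N = 0 := by
    ext n
    simp only [hhj, Pi.zero_apply, ite_eq_right_iff]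
    intro h1
    by_contra h0
    have := hN n h0; omega
  set al2 : ℕ → ℕ → ℝ := fun i j => BI I (hj i) (A (hj j)) with hal
  have e0 : BI I h (A h) = ∑ i ∈ range N, ∑ j ∈ range N, al2 i j := by
    conv_lhs => rw [hsum]
    simp only [map_sum, LinearMap.sum_apply, hal]
    rw [Finset.sum_comm]
  have far : ∀ i j, i + 2 ≤ j ∨ j + 2 ≤ i → al2 i j = 0 := by
    intro i j hij
    simp only [hal, hA, LinearMap.sum_apply, map_sum]
    refine Finset.sum_eq_zero fun p _ => ?_
    rw [BI_apply]
    refine Finset.sum_eq_zero fun n _ => ?_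
    simp only [aop, LinearMap.coe_mk, AddHom.coe_mk, Finset.mul_sum]
    refine Finset.sum_eq_zero fun σ _ => ?_
    by_contra hne
    have h1 : hj i n ≠ 0 := left_ne_zero_of_mul hne
    have h2 : hj j (n + stp (P := P) (p, σ)) ≠ 0 := right_ne_zero_of_mul (right_ne_zero_of_mul hne)
    simp only [hhj, ne_eq, ite_eq_right_iff, Classical.not_imp] at h1 h2
    have := idx_close hD (hs _ h1.2) (hs _ h2.2) (abs_stp_le hPD _)
    omega
  have e1 := tri_sum N al2 far (fun i => by simp [hal, hjN]) (fun i => by simp [hal, hjN])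
  have hpair : ∀ j, (fun n => if idx a D n = j ∨ idx a D n = j + 1 then h n else 0) = hj j + hj (j+1) := by
    intro j
    ext n
    simp only [hhj, Pi.add_apply]
    by_cases c1 : idx a D n = j
    · simp [c1]
    · by_cases c2 : idx a D n = j + 1
      · simp [c2]
      · simp [c1, c2]
  have horth : ∀ i j, i ≠ j → BI I (hj i) (hj j) = 0 := by
    intro i j hij
    rw [BI_apply]
    refine Finset.sum_eq_zero fun n _ => ?_
    simp only [hhj]
    split_ifs with c1 c2
    · omega
    all_goals simp
  have hnorm : BI I h h = ∑ j ∈ range N, BI I (hj j) (hj j) := by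
    conv_lhs => rw [hsum]
    simp only [map_sum, LinearMap.sum_apply]
    refine Finset.sum_congr rfl fun i hi => ?_
    rw [Finset.sum_eq_single i]
    · intro j _ hji; exact horth _ _ hji
    · intro h; exact absurd hi h
  have single : ∀ j, |al2 j j| ≤ τ * BI I (hj j) (hj j) := by
    intro j
    have := hτ j j
    simp only [or_self] at this
    exact this
  have pair : ∀ j, |al2 j j + al2 (j+1) (j+1) + al2 j (j+1) + al2 (j+1) j| ≤
      τ * (BI I (hj j) (hj j) + BI I (hj (j+1)) (hj (j+1))) := by
    intro j
    have := hτ j (j+1)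
    rw [hpair] at this
    simp only [map_add, LinearMap.add_apply] at this
    rw [horth j (j+1) (by omega), horth (j+1) j (by omega)] at this
    simp only [add_zero, zero_add] at this
    refine le_trans (le_of_eq ?_) this
    congr 1
    simp only [hal]; ring
  have hshift : ∑ j ∈ range N, BI I (hj (j+1)) (hj (j+1)) ≤ BI I h h := by
    have h1 := Finset.sum_range_succ' (fun j => BI I (hj j) (hj j)) N
    have h2 := Finset.sum_range_succ (fun j => BI I (hj j) (hj j)) N
    simp only [hjN, map_zero, add_zero] at h2
    have h3 := BI_nonneg I (hj 0)
    rw [hnorm]; linarith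
  rw [e0, e1]
  calc |∑ i ∈ range N, (al2 i i + al2 i (i+1) + al2 (i+1) i)|
      ≤ ∑ i ∈ range N, |al2 i i + al2 i (i+1) + al2 (i+1) i| := Finset.abs_sum_le_sum_abs _ _
    _ ≤ ∑ i ∈ range N, (τ * (BI I (hj i) (hj i)) + 2 * τ * BI I (hj (i+1)) (hj (i+1))) := by
        refine Finset.sum_le_sum fun i _ => ?_
        have h1 := abs_le.1 (pair i)
        have h2 := abs_le.1 (single (i+1))
        rw [abs_le]; constructor <;> linarith
    _ = τ * BI I h h + 2 * τ * ∑ i ∈ range N, BI I (hj (i+1)) (hj (i+1)) := by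
        rw [Finset.sum_add_distrib, ← Finset.mul_sum, ← Finset.mul_sum, hnorm]
    _ ≤ _ := by
        have := mul_le_mul_of_nonneg_left hshift (show 0 ≤ 2 * τ by linarith)
        linarith

theorem win_all (hM : Mask P I L φ) (e b : ℕ) (he : 1 ≤ e) (a : ℤ) (N D : ℕ)
    (hI : Ioc a (a + N) ⊆ I) (hD : 1 ≤ D) (hPD : ∀ p ∈ P, p ≤ D)
    (h : ℤ → ℝ) (hs : ∀ n, h n ≠ 0 → n ∈ Ioc a (a + N)) (R : ℝ) (hR1 : 1 ≤ R)
    (hRL : 32 * L ≤ R ^ 2)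
    (hb : ∀ g, (g = 2 ^ (e+1) ∨ g = 2 ^ (e+1) - 2) → ∀ n, h n ≠ 0 → bet P φ g n ≤ 1)
    (ht : ∀ g, (g = 2 ^ (e+1) ∨ g = 2 ^ (e+1) - 2) → ∀ n, h n ≠ 0 →
      ∑ m ∈ (Ioc a (a + N)).filter (fun m => idx a D m = idx a D n), tdiag P φ g (2 ^ (b+1)) m
        ≤ R ^ (2 ^ (b+1) * g)) :
    |BI I h (∑ p : {p // p ∈ P}, aop φ p h)| ≤ 24 * R * BI I h h := by
  classical
  have hg0 : 4 ≤ 2 ^ (e+1) := by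
    calc 4 = 2 ^ 2 := by norm_num
      _ ≤ _ := Nat.pow_le_pow_right (by norm_num) (by omega)
  have := quad_win hM a N D hD hPD h hs (4 * (2 * R)) (∑ p : {p // p ∈ P}, aop φ p) rfl ?_ (by linarith)
  · rw [LinearMap.sum_apply] at this
    linarith
  intro j c
  rw [LinearMap.sum_apply]
  set J : ℕ → Finset ℤ := fun j => (Ioc a (a + N)).filter fun m => idx a D m = j ∧ ∃ n, h n ≠ 0 ∧ idx a D n = j with hJ
  have hJs : ∀ g, (g = 2 ^ (e+1) ∨ g = 2 ^ (e+1) - 2) → ∀ j,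
      0 ≤ ∑ m ∈ J j, tdiag P φ g (2 ^ (b+1)) m ∧
      ∑ m ∈ J j, tdiag P φ g (2 ^ (b+1)) m ≤ R ^ (2 ^ (b+1) * g) := by
    intro g hg j
    constructor
    · refine Finset.sum_nonneg fun m hm => ?_
      have hgp : 0 < g := by rcases hg with rfl | rfl <;> omega
      have hmI : m ∈ I := hI (Finset.mem_filter.1 hm).1
      have hsy := wop_sym hM hgp (fun w : Fin g → Lt P => good w) (fun w hw => good_revw hw)
      exact (trace_bd _ hsy (fun k => if k = m then 1 else 0) (by
        rw [BI_apply]; simp [hmI]) {m} (by simpa using hmI) (fun n hn => by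
          simp at hn; simp [hn]) b).2 m hmI
    · by_cases hex : ∃ n, h n ≠ 0 ∧ idx a D n = j
      · obtain ⟨n, hn, hnj⟩ := hex
        have := ht g hg n hn
        rw [hnj] at this
        refine le_trans (le_of_eq ?_) this
        congr 1
        simp only [hJ]
        refine Finset.filter_congr fun m _ => ?_
        exact ⟨fun h => h.1, fun h => ⟨h, n, hn, hnj⟩⟩
      · have : J j = ∅ := by
          simp only [hJ]
          refine Finset.filter_false_of_mem fun m _ hm => hex hm.2
        rw [this, Finset.sum_empty]; positivity
  refine window hM e b _ he (J j ∪ J c) ?_ ?_ (2 * R) (by linarith) (by nlinarith) ?_ ?_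
  · intro m hm
    rcases Finset.mem_union.1 hm with hm | hm <;> exact hI (Finset.mem_filter.1 hm).1
  · intro n hn
    split_ifs with hc
    · by_contra h0
      apply hn
      rcases hc with hc | hc
      · exact Finset.mem_union_left _ (Finset.mem_filter.2 ⟨hs n h0, hc, n, h0, hc⟩)
      · exact Finset.mem_union_right _ (Finset.mem_filter.2 ⟨hs n h0, hc, n, h0, hc⟩)
    · rfl
  · intro g hg n hn
    refine hb g hg n fun h0 => hn ?_
    simp [h0]
  · intro g hg
    have hgp : 0 < g := by rcases hg with rfl | rfl <;> omega
    obtain ⟨a1, a2⟩ := hJs g hg j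
    obtain ⟨b1, b2⟩ := hJs g hg c
    have hpw : 2 * R ^ (2 ^ (b+1) * g) ≤ (2 * R) ^ (2 ^ (b+1) * g) := by
      rw [mul_pow]
      refine mul_le_mul_of_nonneg_right ?_ (by positivity)
      calc (2:ℝ) = 2 ^ 1 := by norm_num
        _ ≤ 2 ^ (2 ^ (b+1) * g) := pow_le_pow_right₀ (by norm_num) (Nat.mul_pos (by positivity) hgp)
    have hu := Finset.sum_union_inter (s₁ := J j) (s₂ := J c) (f := fun m => tdiag P φ g (2 ^ (b+1)) m)
    by_cases hjc : j = c
    · subst hjc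
      rw [Finset.union_idempotent]
      linarith
    · have : J j ∩ J c = ∅ := by
        ext m
        simp only [hJ, Finset.mem_inter, Finset.mem_filter, Finset.notMem_empty, iff_false]
        rintro ⟨⟨_, h1, _⟩, ⟨_, h2, _⟩⟩
        omega
      rw [this, Finset.sum_empty] at hu
      linarith

end Win2

open Finset

section Win3

variable {P : Finset ℕ} {g M : ℕ} {I : Finset ℤ} {L : ℝ} {φ : ℤ → ℝ}

lemma phi_mask (hP : ∀ p ∈ P, p.Prime) (I : Finset ℤ) (L : ℝ) (hL : 1 ≤ L)
    (hPL : ∑ p ∈ P, 1 / (p:ℝ) ≤ L) : Mask P I L (phi P I L) where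
  prime := hP
  nonneg n := by unfold phi; split_ifs <;> positivity
  le_one n := by
    unfold phi; split_ifs
    · refine pow_le_one₀ (by positivity) (Real.exp_le_one_iff.2 ?_)
      rw [neg_div]; have : 0 < 1 / L := by positivity
      linarith
    · norm_num
  supp n hn := by unfold phi; rw [if_neg hn]
  mul_om n := by
    unfold phi; split_ifs
    · rw [← Real.exp_nat_mul]
      set w : ℝ := (om P n : ℝ)
      have hL0 : 0 < L := by linarith
      have h1 := Real.add_one_le_exp (w / L)
      have h2 : w * (-1 / L) = - (w / L) := by ring
      rw [h2, Real.exp_neg, ← div_eq_inv_mul, div_le_iff₀ (Real.exp_pos _)]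
      have : w / L ≤ Real.exp (w / L) := by linarith
      rw [div_le_iff₀ hL0] at this
      linarith
    · rw [zero_mul]; linarith
  sum_le := hPL
  one_le := hL

lemma card_Lt_le {Pm : ℕ} (hP : ∀ p ∈ P, p.Prime) (hPm : ∀ p ∈ P, p ≤ Pm) :
    Fintype.card (Lt P) ≤ 2 * Pm := by
  have h : P.card ≤ Pm := by
    have : P ⊆ Finset.Icc 1 Pm := fun p hp => Finset.mem_Icc.2 ⟨(hP p hp).one_le, hPm p hp⟩
    simpa using Finset.card_le_card this
  simp only [Fintype.card_prod, Fintype.card_bool, Fintype.card_coe]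
  omega

lemma abs_nd_le {Pm : ℕ} (hPm : ∀ p ∈ P, p ≤ Pm) (W : Fin M → Fin g → Lt P) (b : Fin M) (i : ℕ) :
    |nd W b i| ≤ 2 * (M * (g * Pm)) := by
  have hpos : ∀ b i, |pos (W b) i| ≤ g * Pm := fun b i =>
    abs_psum_le _ _ (by positivity) (fun j => abs_stp_le hPm _) _
  have hb : |bpos W b.1| ≤ M * (g * Pm) :=
    abs_psum_le _ _ (by positivity) (fun j => hpos j g) _
  have hM1 : (1:ℤ) ≤ M := by have := b.2; omega
  have h4 : (g * Pm : ℤ) ≤ M * (g * Pm) := le_mul_of_one_le_left (by positivity) hM1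
  unfold nd
  have := abs_add_le (bpos W b.1) (pos (W b) i)
  linarith [hpos b i]

open Classical in
lemma tdiag_sum (hP : ∀ p ∈ P, p.Prime) (I : Finset ℤ)
    (L : ℝ) (hL : 2 ≤ L) (hPL : ∑ p ∈ P, 1 / (p:ℝ) ≤ L)
    (Pm k : ℕ) (hk : M * g = k) (hkp : ∀ p ∈ P, k ≤ p) (hPm : ∀ p ∈ P, p ≤ Pm) (hPm1 : 1 ≤ Pm)
    (η : ℝ) (hη : ∀ p ∈ P, 3 / (2 * (p:ℝ)) ≤ η) (hη0 : 0 ≤ η)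
    (J : ℕ) (hJ : (2 * k : ℝ) ^ J ≤ J.factorial * (2 / L) ^ k) (a : ℤ) (N B : ℕ)
    (hB : 2 * (k * Pm) ≤ B) (hI : Ioc (a - B) (a + N + B) ⊆ I) :
    ∑ n ∈ Ioc a (a + N), tdiag P (phi P I L) g M n ≤
      3 * N * (∑ W : Fin M → Fin g → Lt P, if ∀ b, good (W b) then wval L η W else 0) +
        (2 * Pm) ^ k * (2 * (J + 1) * (Pm:ℝ) ^ (k + 2 * J)) := by
  have hwv : ∀ W : Fin M → Fin g → Lt P, 0 ≤ wval L η W := by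
    intro W
    unfold wval
    refine Finset.prod_nonneg fun p _ => ?_
    have : 0 ≤ 2 / L := by positivity
    split_ifs <;> positivity
  simp only [tdiag, wop_pow]
  rw [Finset.sum_comm]
  have hW : ∀ W : Fin M → Fin g → Lt P,
      ∑ n ∈ Ioc a (a + N), (if ∀ b, good (W b) then
        Wt (phi P I L) W n * (if n + bpos W M = n then 1 else 0) else 0) ≤
      3 * N * (if ∀ b, good (W b) then wval L η W else 0) + 2 * (J + 1) * (Pm:ℝ) ^ (k + 2 * J) := by
    intro W
    have hpos : 0 ≤ 2 * (J + 1) * (Pm:ℝ) ^ (k + 2 * J) := by positivity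
    by_cases hg : ∀ b, good (W b)
    · simp only [if_pos hg]
      by_cases h0 : bpos W M = 0
      · simp only [h0, add_zero, if_true, mul_one]
        refine (le_abs_self _).trans (conn_bd hP I W hg L hL hPL Pm k hk hkp hPm hPm1 η hη hη0 J hJ a N ?_)
        intro n hn b i _
        apply hI
        have h1 := abs_le.1 (abs_nd_le hPm W b i)
        rw [Finset.mem_Ioc] at hn ⊢
        have h2 : (2 * (M * (g * Pm)) : ℤ) ≤ B := by
          rw [← mul_assoc (M:ℤ)]
          rw [← hk] at hB
          exact_mod_cast hB
        constructor <;> linarith [h1.1, h1.2, hn.1, hn.2]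
      · have : ∀ n : ℤ, ¬ (n + bpos W M = n) := fun n h => h0 (by linarith)
        simp only [this, if_false, mul_zero, Finset.sum_const_zero]
        have := hwv W
        positivity
    · simp only [if_neg hg, Finset.sum_const_zero, mul_zero, zero_add]
      exact hpos
  refine (Finset.sum_le_sum fun W _ => hW W).trans ?_
  rw [Finset.sum_add_distrib, ← Finset.mul_sum]
  refine add_le_add le_rfl ?_
  rw [Finset.sum_const, nsmul_eq_mul]
  refine mul_le_mul_of_nonneg_right ?_ (by positivity)
  rw [Finset.card_univ]
  have h1 : Fintype.card (Fin M → Fin g → Lt P) = (Fintype.card (Lt P)) ^ k := by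
    rw [Fintype.card_fun, Fintype.card_fun, Fintype.card_fin, Fintype.card_fin, ← pow_mul, ← hk, mul_comm]
  rw [h1]
  have := Nat.pow_le_pow_left (card_Lt_le hP hPm) k
  exact_mod_cast this

lemma markov_win {a : ℤ} {N D : ℕ} (hD : 1 ≤ D) (t : ℤ → ℝ) (ht : ∀ n ∈ Ioc a (a + N), 0 ≤ t n) (T : ℝ) (hT : 0 < T) :
    (((Ioc a (a + N)).filter fun n =>
      T < ∑ m ∈ (Ioc a (a + N)).filter (fun m => idx a D m = idx a D n), t m).card : ℝ) ≤
      D * (∑ n ∈ Ioc a (a + N), t n) / T := by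
  set S := (Ioc a (a + N)).filter fun n =>
      T < ∑ m ∈ (Ioc a (a + N)).filter (fun m => idx a D m = idx a D n), t m with hS
  rw [le_div_iff₀ hT]
  calc (S.card : ℝ) * T = ∑ n ∈ S, T := by simp
    _ ≤ ∑ n ∈ S, ∑ m ∈ (Ioc a (a + N)).filter (fun m => idx a D m = idx a D n), t m :=
        Finset.sum_le_sum fun n hn => (Finset.mem_filter.1 hn).2.le
    _ ≤ ∑ n ∈ Ioc a (a + N), ∑ m ∈ (Ioc a (a + N)).filter (fun m => idx a D m = idx a D n), t m := by
        refine Finset.sum_le_sum_of_subset_of_nonneg (Finset.filter_subset _ _) fun n _ _ => ?_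
        exact Finset.sum_nonneg fun m hm => ht m (Finset.mem_filter.1 hm).1
    _ = ∑ m ∈ Ioc a (a + N), ∑ n ∈ Ioc a (a + N), (if idx a D m = idx a D n then t m else 0) := by
        rw [Finset.sum_comm]
        refine Finset.sum_congr rfl fun n _ => ?_
        rw [Finset.sum_filter]
    _ ≤ ∑ m ∈ Ioc a (a + N), D * t m := by
        refine Finset.sum_le_sum fun m hm => ?_
        rw [← Finset.sum_filter, Finset.sum_const, nsmul_eq_mul]
        refine mul_le_mul_of_nonneg_right ?_ (ht m hm)
        have := idx_card (a := a) (N := N) hD (idx a D m)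
        simp only [eq_comm] at this ⊢
        exact_mod_cast this
    _ = _ := by rw [← Finset.mul_sum]

lemma markov_one {S : Finset ℤ} (t : ℤ → ℝ) (ht : ∀ n ∈ S, 0 ≤ t n) :
    ((S.filter fun n => 1 < t n).card : ℝ) ≤ ∑ n ∈ S, t n := by
  calc ((S.filter fun n => 1 < t n).card : ℝ) = ∑ n ∈ S.filter fun n => 1 < t n, 1 := by simp
    _ ≤ ∑ n ∈ S.filter fun n => 1 < t n, t n :=
        Finset.sum_le_sum fun n hn => (Finset.mem_filter.1 hn).2.le
    _ ≤ _ := Finset.sum_le_sum_of_subset_of_nonneg (Finset.filter_subset _ _) fun n hn _ => ht n hn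

/-- deletion set and the final quadratic form bound -/
theorem del_thm (hP : ∀ p ∈ P, p.Prime) (L : ℝ) (hL : 2 ≤ L) (hPL : ∑ p ∈ P, 1 / (p:ℝ) ≤ L)
    (e b : ℕ) (he : 1 ≤ e) (a : ℤ) (N B Pm : ℕ) (hPm : ∀ p ∈ P, p ≤ Pm) (hPm1 : 1 ≤ Pm)
    (I : Finset ℤ) (hI : I = Ioc (a - B) (a + N + B))
    (R TB BB : ℝ) (hR1 : 1 ≤ R) (hRL : 32 * L ≤ R ^ 2)
    (hBB : ∀ g, (g = 2 ^ (e+1) ∨ g = 2 ^ (e+1) - 2) →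
      ∑ n ∈ Ioc a (a + N), bet P (phi P I L) g n ≤ BB)
    (hTB : ∀ g, (g = 2 ^ (e+1) ∨ g = 2 ^ (e+1) - 2) →
      (∑ n ∈ Ioc a (a + N), tdiag P (phi P I L) g (2 ^ (b+1)) n) ≤ TB * R ^ (2 ^ (b+1) * g)) :
    ∃ E : Finset ℤ, (E.card : ℝ) ≤ 2 * (BB + Pm * TB) ∧ ∀ (Dd : ℝ) (f : ℤ → ℝ),
      (∀ n, f n ≠ 0 → n ∈ Ioc a (a + N) ∧ n ∉ E ∧ (om P n : ℝ) ≤ Dd * L) →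
      |∑ n ∈ Ioc a (a + N), ∑ s : Lt P, f n * lit s.1.1 n * f (n + stp s)| ≤
        24 * R * Real.exp (2 * Dd) * ∑ n ∈ Ioc a (a + N), f n ^ 2 := by
  classical
  have hM := phi_mask hP I L (by linarith) hPL
  set φ := phi P I L with hφ
  set t : ℕ → ℤ → ℝ := fun g n => tdiag P φ g (2 ^ (b+1)) n with ht
  have hsub : Ioc a (a + N) ⊆ I := by
    rw [hI]; intro n hn; rw [Finset.mem_Ioc] at hn ⊢; constructor <;> omega
  have hg0 : 4 ≤ 2 ^ (e+1) := by
    calc 4 = 2 ^ 2 := by norm_num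
      _ ≤ _ := Nat.pow_le_pow_right (by norm_num) (by omega)
  have htn : ∀ g, (g = 2 ^ (e+1) ∨ g = 2 ^ (e+1) - 2) → ∀ n ∈ Ioc a (a + N), 0 ≤ t g n := by
    intro g hg m hm
    have hgp : 0 < g := by rcases hg with rfl | rfl <;> omega
    have hmI : m ∈ I := hsub hm
    have hsy := wop_sym hM hgp (fun w : Fin g → Lt P => good w) (fun w hw => good_revw hw)
    exact (trace_bd _ hsy (fun k => if k = m then 1 else 0) (by
      rw [BI_apply]; simp [hmI]) {m} (by simpa using hmI) (fun n hn => by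
        simp at hn; simp [hn]) b).2 m hmI
  have hbn : ∀ g n, 0 ≤ bet P φ g n := by
    intro g n
    unfold bet
    refine Finset.sum_nonneg fun w _ => ?_
    split_ifs <;> positivity
  set E1 : ℕ → Finset ℤ := fun g => (Ioc a (a + N)).filter fun n => 1 < bet P φ g n with hE1
  set E2 : ℕ → Finset ℤ := fun g => (Ioc a (a + N)).filter fun n =>
      R ^ (2 ^ (b+1) * g) < ∑ m ∈ (Ioc a (a + N)).filter (fun m => idx a Pm m = idx a Pm n), t g m with hE2
  have hc1 : ∀ g, (g = 2 ^ (e+1) ∨ g = 2 ^ (e+1) - 2) → ((E1 g).card : ℝ) ≤ BB := fun g hg =>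
    (markov_one _ fun n _ => hbn g n).trans (hBB g hg)
  have hc2 : ∀ g, (g = 2 ^ (e+1) ∨ g = 2 ^ (e+1) - 2) → ((E2 g).card : ℝ) ≤ Pm * TB := by
    intro g hg
    have hRp : 0 < R ^ (2 ^ (b+1) * g) := by positivity
    refine (markov_win hPm1 (t g) (htn g hg) _ hRp).trans ?_
    rw [div_le_iff₀ hRp, mul_assoc]
    exact mul_le_mul_of_nonneg_left (hTB g hg) (by positivity)
  refine ⟨E1 (2 ^ (e+1)) ∪ E2 (2 ^ (e+1)) ∪ (E1 (2 ^ (e+1) - 2) ∪ E2 (2 ^ (e+1) - 2)), ?_, ?_⟩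
  · have u1 : ∀ A B : Finset ℤ, ((A ∪ B).card : ℝ) ≤ A.card + B.card := fun A B => by
      exact_mod_cast Finset.card_union_le A B
    have h1 := hc1 _ (Or.inl rfl)
    have h2 := hc1 _ (Or.inr rfl)
    have h3 := hc2 _ (Or.inl rfl)
    have h4 := hc2 _ (Or.inr rfl)
    refine (u1 _ _).trans ?_
    have := u1 (E1 (2 ^ (e+1))) (E2 (2 ^ (e+1)))
    have := u1 (E1 (2 ^ (e+1) - 2)) (E2 (2 ^ (e+1) - 2))
    linarith
  intro Dd f hf
  have hEg : ∀ g, (g = 2 ^ (e+1) ∨ g = 2 ^ (e+1) - 2) → ∀ n, f n ≠ 0 → n ∉ E1 g ∧ n ∉ E2 g := by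
    intro g hg n hn
    have := (hf n hn).2.1
    simp only [Finset.mem_union, not_or] at this
    rcases hg with rfl | rfl
    · exact this.1
    · exact this.2
  set h : ℤ → ℝ := fun n => f n * Real.exp ((om P n : ℝ) / L) with hh
  have hh0 : ∀ n, h n ≠ 0 → f n ≠ 0 := fun n hn => left_ne_zero_of_mul hn
  have hfh : ∀ n, φ n * h n = f n := by
    intro n
    by_cases h0 : f n = 0
    · simp [hh, h0]
    · have hnI : n ∈ I := hsub (hf n h0).1
      simp only [hφ, phi, if_pos hnI, hh]
      rw [← Real.exp_nat_mul]
      rw [show Real.exp (↑(om P n) * (-1 / L)) * (f n * Real.exp (↑(om P n) / L)) =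
        f n * (Real.exp (↑(om P n) * (-1 / L)) * Real.exp (↑(om P n) / L)) by ring, ← Real.exp_add,
        show (↑(om P n) * (-1 / L) + ↑(om P n) / L : ℝ) = 0 by ring, Real.exp_zero, mul_one]
  have key := win_all hM e b he a N Pm hsub hPm1 hPm h (fun n hn => (hf n (hh0 n hn)).1) R hR1 hRL
    (fun g hg n hn => by
      have h1 := (hEg g hg n (hh0 n hn)).1
      by_contra hc
      exact h1 (Finset.mem_filter.2 ⟨(hf n (hh0 n hn)).1, not_le.1 hc⟩))
    (fun g hg n hn => by
      have h1 := (hEg g hg n (hh0 n hn)).2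
      by_contra hc
      exact h1 (Finset.mem_filter.2 ⟨(hf n (hh0 n hn)).1, not_le.1 hc⟩))
  have e1 : BI I h (∑ p : {p // p ∈ P}, aop φ p h) =
      ∑ n ∈ Ioc a (a + N), ∑ s : Lt P, f n * lit s.1.1 n * f (n + stp s) := by
    rw [BI_apply]
    have : ∀ n, h n * (∑ p : {p // p ∈ P}, aop φ p h) n = 
        ∑ s : Lt P, f n * lit s.1.1 n * f (n + stp s) := by
      intro n
      rw [Finset.sum_apply, Fintype.sum_prod_type, Finset.mul_sum]
      refine Finset.sum_congr rfl fun p _ => ?_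
      simp only [aop, LinearMap.coe_mk, AddHom.coe_mk, Finset.mul_sum]
      refine Finset.sum_congr rfl fun σ _ => ?_
      rw [← hfh n, ← hfh (n + stp (P := P) (p, σ))]
      unfold al
      ring
    simp only [this]
    symm
    refine Finset.sum_subset hsub fun n _ hn => ?_
    have : f n = 0 := by by_contra h0; exact hn (hf n h0).1
    simp [this]
  have e2 : BI I h h ≤ Real.exp (2 * Dd) * ∑ n ∈ Ioc a (a + N), f n ^ 2 := by
    rw [BI_apply]
    have : ∑ n ∈ I, h n * h n = ∑ n ∈ Ioc a (a + N), h n * h n := by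
      symm
      refine Finset.sum_subset hsub fun n _ hn => ?_
      have : f n = 0 := by by_contra h0; exact hn (hf n h0).1
      simp [hh, this]
    rw [this, Finset.mul_sum]
    refine Finset.sum_le_sum fun n hn => ?_
    by_cases h0 : f n = 0
    · simp [hh, h0]
    · have h1 := (hf n h0).2.2
      have h2 : (om P n : ℝ) / L ≤ Dd := by rw [div_le_iff₀ (by linarith)]; exact h1
      have h3 : h n * h n = Real.exp (2 * ((om P n : ℝ) / L)) * f n ^ 2 := by
        simp only [hh]; rw [two_mul, Real.exp_add]; ring
      rw [h3]
      exact mul_le_mul_of_nonneg_right (Real.exp_le_exp.2 (by linarith)) (sq_nonneg _)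
  rw [e1] at key
  refine key.trans ?_
  rw [mul_assoc (24 * R)]
  exact mul_le_mul_of_nonneg_left e2 (by linarith)

end Win3

open Finset

section Num

lemma pow_le_exp {x y : ℝ} (hx : 0 ≤ x) (h : x ≤ Real.exp y) (n : ℕ) : x ^ n ≤ Real.exp (n * y) := by
  rw [Real.exp_nat_mul]; exact pow_le_pow_left₀ hx h n

lemma pow_le_exp' {x y z : ℝ} (hx : 0 ≤ x) (h : x ≤ Real.exp y) (n : ℕ) (hz : n * y ≤ z) :
    x ^ n ≤ Real.exp z := (pow_le_exp hx h n).trans (Real.exp_le_exp.2 hz)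

lemma mul_le_exp {x y a b : ℝ} (hx : 0 ≤ x) (h : x ≤ Real.exp a) (h' : y ≤ Real.exp b) :
    x * y ≤ Real.exp (a + b) := by
  rw [Real.exp_add]
  calc x * y ≤ x * Real.exp b := mul_le_mul_of_nonneg_left h' hx
    _ ≤ _ := mul_le_mul_of_nonneg_right h (Real.exp_pos _).le

lemma le_exp_self (x : ℝ) : x ≤ Real.exp x := by linarith [Real.add_one_le_exp x]

lemma add_le_exp {x y a b c : ℝ} (h : x ≤ Real.exp a) (h' : y ≤ Real.exp b) (ha : a + 1 ≤ c) (hb : b + 1 ≤ c) :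
    x + y ≤ Real.exp c := by
  have h1 : Real.exp a ≤ Real.exp (c - 1) := Real.exp_le_exp.2 (by linarith)
  have h2 : Real.exp b ≤ Real.exp (c - 1) := Real.exp_le_exp.2 (by linarith)
  have h3 : 2 * Real.exp (c - 1) ≤ Real.exp c := by
    have e1 : (2:ℝ) ≤ Real.exp 1 := by linarith [Real.add_one_le_exp 1]
    rw [show c = 1 + (c - 1) by ring, Real.exp_add, show 1 + (c - 1) - 1 = c - 1 by ring]
    exact mul_le_mul_of_nonneg_right e1 (Real.exp_pos _).le
  linarith

lemma exp_le_two_pow {x : ℝ} {k : ℕ} (h : 2 * x ≤ k) : Real.exp x ≤ 2 ^ k := by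
  have h2 : Real.exp (1/2) ≤ 2 := by
    have := Real.exp_one_lt_d9
    have h3 : Real.exp (1/2) * Real.exp (1/2) = Real.exp 1 := by rw [← Real.exp_add]; norm_num
    nlinarith [Real.exp_pos (1/2)]
  calc Real.exp x ≤ Real.exp (k * (1/2)) := Real.exp_le_exp.2 (by linarith)
    _ = Real.exp (1/2) ^ k := by rw [Real.exp_nat_mul]
    _ ≤ _ := pow_le_pow_left₀ (Real.exp_pos _).le h2 k

lemma two_pow_big (κ : ℕ) (h : 100 ≤ κ) : 2 ^ 20 * κ ≤ 2 ^ κ := by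
  induction κ, h using Nat.le_induction with
  | base => norm_num
  | succ n hn ih => rw [pow_succ]; omega

/-- the parameter bounds -/
structure Prm (κ : ℕ) (U L : ℝ) : Prop where
  hU : U = 2 ^ κ
  hL : 2 ^ 110 ≤ L
  hLU : L ≤ U

variable {κ : ℕ} {U L : ℝ}

lemma Prm.kap (h : Prm κ U L) : 110 ≤ κ := by
  have : (2:ℝ) ^ 110 ≤ 2 ^ κ := by rw [← h.hU]; exact h.hL.trans h.hLU
  exact (pow_le_pow_iff_right₀ (by norm_num)).1 this

lemma Prm.kapU (h : Prm κ U L) : 2 ^ 20 * (κ:ℝ) ≤ U := by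
  rw [h.hU]; exact_mod_cast two_pow_big κ (by linarith [h.kap])

lemma Prm.Ubig (h : Prm κ U L) : 2 ^ 110 ≤ U := h.hL.trans h.hLU

lemma Prm.Uexp (h : Prm κ U L) : U ≤ Real.exp κ := by
  rw [h.hU]
  have := pow_le_exp (x := 2) (y := 1) (by norm_num) (by linarith [Real.add_one_le_exp 1]) κ
  simpa using this

lemma Prm.Upow (h : Prm κ U L) (j : ℕ) : U ^ j ≤ Real.exp (j * κ) :=
  pow_le_exp (by linarith [h.Ubig, show (0:ℝ) < 2 ^ 110 by positivity]) h.Uexp j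

/-- comparison of powers -/
lemma Prm.step (h : Prm κ U L) {i j : ℕ} (hij : i < j) : 2 ^ 110 * U ^ i ≤ U ^ j := by
  have hU0 : 1 ≤ U := le_trans (by norm_num) h.Ubig
  calc 2 ^ 110 * U ^ i ≤ U * U ^ i := mul_le_mul_of_nonneg_right h.Ubig (by positivity)
    _ = U ^ (i+1) := by ring
    _ ≤ U ^ j := pow_le_pow_right₀ hU0 hij

lemma Prm.stepk (h : Prm κ U L) {i j : ℕ} (hij : i < j) : 2 ^ 20 * (κ * U ^ i) ≤ U ^ j := by
  have hU0 : 1 ≤ U := le_trans (by norm_num) h.Ubig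
  calc 2 ^ 20 * (κ * U ^ i) = 2 ^ 20 * κ * U ^ i := by ring
    _ ≤ U * U ^ i := mul_le_mul_of_nonneg_right h.kapU (by positivity)
    _ = U ^ (i+1) := by ring
    _ ≤ U ^ j := pow_le_pow_right₀ hU0 hij

lemma Prm.const (h : Prm κ U L) {c : ℝ} (hc : c ≤ 4) : c ≤ Real.exp (2:ℝ) := by
  have := Real.add_one_le_exp 1
  have e : Real.exp 2 = Real.exp 1 * Real.exp 1 := by rw [← Real.exp_add]; norm_num
  rw [e]; nlinarith

/-- wild part of the pattern sum -/
lemma wild_num (h : Prm κ U L) (u E g M Pm k M0 : ℕ) (hu : (u:ℝ) = U) (hE : E = u ^ 3)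
    (hM : M = 8 * u ^ 4) (hg : g ≤ u ^ 16) (hk : M * g = k) (hM0 : M0 = 4 * u ^ 20)
    (hPm : (Pm:ℝ) ≤ Real.exp (U ^ 20)) (xm : ℝ) (hxm : xm = Real.exp (-U ^ 18)) :
    k ^ k * (2 ^ k * L ^ k * ((2 * xm) ^ E + DC E g M Pm * (M0 * xm) ^ E)) ≤ 1 := by
  have hκ : (110:ℝ) ≤ κ := by exact_mod_cast h.kap
  have hL0 : 0 ≤ L := le_trans (by positivity) h.hL
  have hU1 : 1 ≤ U := le_trans (by norm_num) h.Ubig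
  have hgR : (g:ℝ) ≤ U ^ 16 := by rw [← hu]; exact_mod_cast hg
  have hMR : (M:ℝ) = 8 * U ^ 4 := by rw [← hu, hM]; push_cast; ring
  have hER : (E:ℝ) = U ^ 3 := by rw [← hu, hE]; push_cast; ring
  have hM0R : (M0:ℝ) = 4 * U ^ 20 := by rw [← hu, hM0]; push_cast; ring
  have h8 : (8:ℝ) ≤ Real.exp κ := by linarith [le_exp_self κ]
  have hge : (g:ℝ) ≤ Real.exp (16 * κ) := hgR.trans (by simpa using h.Upow 16)
  have hg1 : ((g:ℝ)+1) ≤ Real.exp (17 * κ) :=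
    add_le_exp hge (b := 0) (by simp) (by linarith) (by linarith)
  have hge' : (g:ℝ) ≤ Real.exp (17 * κ) := by linarith
  have hMe : (M:ℝ) ≤ Real.exp (5 * κ) := by
    rw [hMR]
    refine (mul_le_exp (by norm_num) h8 (h.Upow 4)).trans (Real.exp_le_exp.2 (by push_cast; linarith))
  have hkR : (k:ℝ) ≤ 8 * U ^ 20 := by
    rw [← hk]; push_cast; rw [hMR]
    calc 8 * U ^ 4 * g ≤ 8 * U ^ 4 * U ^ 16 := mul_le_mul_of_nonneg_left hgR (by positivity)
      _ = _ := by ring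
  have hke : (k:ℝ) ≤ Real.exp (21 * κ) := by
    refine hkR.trans ((mul_le_exp (by norm_num) h8 (h.Upow 20)).trans (Real.exp_le_exp.2 (by push_cast; linarith)))
  have hM0e : (M0:ℝ) ≤ Real.exp (21 * κ) := by
    rw [hM0R]
    refine (mul_le_exp (by norm_num) (show (4:ℝ) ≤ Real.exp κ by linarith) (h.Upow 20)).trans (Real.exp_le_exp.2 (by push_cast; linarith))
  have h2e : (2:ℝ) ≤ Real.exp 1 := by linarith [Real.add_one_le_exp 1]
  have a1 : (k:ℝ) ^ k ≤ Real.exp (k * (21 * κ)) := pow_le_exp (by positivity) hke k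
  have a2 : (2:ℝ) ^ k ≤ Real.exp (k * 1) := pow_le_exp (by positivity) h2e k
  have a3 : L ^ k ≤ Real.exp (k * κ) := pow_le_exp hL0 (h.hLU.trans h.Uexp) k
  have a4 : (2 * xm) ^ E ≤ Real.exp (E * (1 + - U ^ 18)) :=
    pow_le_exp (by rw [hxm]; positivity) (by rw [hxm]; exact mul_le_exp (by norm_num) h2e le_rfl) E
  have a5 : (M0 * xm) ^ E ≤ Real.exp (E * (21 * κ + - U ^ 18)) :=
    pow_le_exp (by rw [hxm]; positivity) (by rw [hxm]; exact mul_le_exp (by positivity) hM0e le_rfl) E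
  have a6 : DC E g M Pm ≤ Real.exp (100 * (κ * U ^ 3) + 200 * κ + U ^ 20) := by
    unfold DC
    have c1 : (M:ℝ) ^ 2 ≤ Real.exp (10 * κ) := pow_le_exp' (by positivity) hMe 2 (by push_cast; linarith)
    have c2 : (g:ℝ) ^ E * ((g:ℝ)+1) ^ E ≤ Real.exp (34 * (κ * U ^ 3)) := by
      refine (mul_le_exp (by positivity) (pow_le_exp (by positivity) hge' E) (pow_le_exp (by positivity) hg1 E)).trans
        (Real.exp_le_exp.2 ?_)
      rw [hER]; linarith
    have c3 : 6 * (M:ℝ) * g * Pm + 1 ≤ Real.exp (25 * κ + U ^ 20) := by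
      have : 6 * (M:ℝ) * g * Pm ≤ Real.exp (κ + 5 * κ + 17 * κ + U ^ 20) := by
        refine mul_le_exp (by positivity) (mul_le_exp (by positivity) (mul_le_exp (by positivity) (by linarith) hMe) hge') hPm
      refine add_le_exp this (b := 0) (by simp) (by linarith) ?_
      have : 0 ≤ U ^ 20 := by positivity
      linarith
    have c4 : (g:ℝ) ^ (E+1) * (((g:ℝ)+1) ^ (E+1) * (g:ℝ) ^ E) ≤ Real.exp (51 * (κ * U ^ 3) + 34 * κ) := by
      refine (mul_le_exp (by positivity) (pow_le_exp (by positivity) hge' (E+1)) (mul_le_exp (by positivity) (pow_le_exp (by positivity) hg1 (E+1)) (pow_le_exp (by positivity) hge' E))).trans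
        (Real.exp_le_exp.2 ?_)
      push_cast
      rw [hER]; linarith
    have hp : 0 ≤ U ^ 20 := by positivity
    have hp3 : 0 ≤ κ * U ^ 3 := by positivity
    have c5 : 2 * ((g:ℝ) ^ E * ((g:ℝ)+1) ^ E) * (6 * (M:ℝ) * g * Pm + 1) ≤ Real.exp (1 + 34 * (κ * U ^ 3) + (25 * κ + U ^ 20)) :=
      mul_le_exp (by positivity) (mul_le_exp (by positivity) h2e c2) c3
    refine (mul_le_exp (by positivity) c1 (add_le_exp (c := 51 * (κ * U ^ 3) + 60 * κ + U ^ 20) c5 c4 (by linarith) (by linarith))).trans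
      (Real.exp_le_exp.2 (by linarith))
  have b1 : DC E g M Pm * (M0 * xm) ^ E ≤ Real.exp ((100 * (κ * U ^ 3) + 200 * κ + U ^ 20) + E * (21 * κ + - U ^ 18)) := by
    refine mul_le_exp ?_ a6 a5
    unfold DC; positivity
  have b2 := mul_le_exp (by positivity) a1 (mul_le_exp (by positivity) (mul_le_exp (by positivity) a2 a3)
    (add_le_exp a4 b1 (c := 300 * (κ * U ^ 3) + 200 * κ + U ^ 20 - U ^ 21 + U ^ 3 + 1)
      (by rw [hER]
          have : 0 ≤ U ^ 20 := by positivity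
          have : 0 ≤ κ * U ^ 3 := by positivity
          linarith [show U ^ 3 * (1 + -U ^ 18) = U ^ 3 - U ^ 21 by ring])
      (by rw [hER]
          have : 0 ≤ U ^ 3 := by positivity
          have : 0 ≤ κ * U ^ 3 := by positivity
          linarith [show U ^ 3 * (21 * κ + -U ^ 18) = 21 * (κ * U ^ 3) - U ^ 21 by ring])))
  refine b2.trans (Real.exp_le_one_iff.2 ?_)
  have s1 := h.step (show 20 < 21 by norm_num)
  have s2 := h.step (show 3 < 21 by norm_num)
  have s3 := h.step (show 0 < 21 by norm_num)
  have s4 := h.stepk (show 20 < 21 by norm_num)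
  have s5 := h.stepk (show 3 < 21 by norm_num)
  have s6 := h.stepk (show 0 < 21 by norm_num)
  rw [pow_zero] at s3 s6
  have t1 : (k:ℝ) * (21 * κ) ≤ 168 * (κ * U ^ 20) := by
    have := mul_le_mul_of_nonneg_right hkR (show (0:ℝ) ≤ 21 * κ by linarith)
    linarith
  have t2 : (k:ℝ) * κ ≤ 8 * (κ * U ^ 20) := by
    have := mul_le_mul_of_nonneg_right hkR (show (0:ℝ) ≤ κ by linarith)
    linarith
  linarith

lemma tame_num (h : Prm κ U L) (u E g M k : ℕ) (hu : (u:ℝ) = U) (hE : E = u ^ 3)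
    (hM : M = 8 * u ^ 4) (hg : g ≤ u ^ 16) (hg2 : u ^ 16 ≤ g + 2) (hk : M * g = k) :
    7 * U ^ 20 ≤ k ∧ (k:ℝ) ≤ 8 * U ^ 20 ∧
    (M ^ 2 * (g * (g + 1)) + 1 : ℝ) ^ (M ^ 2 * (4 * (2 * (E + E ^ 2) + E + 1))) *
          (4 ^ k * (Real.sqrt L ^ k * L ^ (2 * E * M ^ 2))) ≤ (16 * Real.sqrt L) ^ k := by
  have hκ : (110:ℝ) ≤ κ := by exact_mod_cast h.kap
  have hL0 : 0 ≤ L := le_trans (by positivity) h.hL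
  have hU1 : 1 ≤ U := le_trans (by norm_num) h.Ubig
  have hgR : (g:ℝ) ≤ U ^ 16 := by rw [← hu]; exact_mod_cast hg
  have hgR2 : U ^ 16 ≤ (g:ℝ) + 2 := by rw [← hu]; exact_mod_cast hg2
  have hMR : (M:ℝ) = 8 * U ^ 4 := by rw [← hu, hM]; push_cast; ring
  have hER : (E:ℝ) = U ^ 3 := by rw [← hu, hE]; push_cast; ring
  have h8 : (8:ℝ) ≤ Real.exp κ := by linarith [le_exp_self κ]
  have hge : (g:ℝ) ≤ Real.exp (16 * κ) := hgR.trans (by simpa using h.Upow 16)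
  have hg1 : ((g:ℝ)+1) ≤ Real.exp (17 * κ) :=
    add_le_exp hge (b := 0) (by simp) (by linarith) (by linarith)
  have hMe : (M:ℝ) ≤ Real.exp (5 * κ) := by
    rw [hMR]
    refine (mul_le_exp (by norm_num) h8 (h.Upow 4)).trans (Real.exp_le_exp.2 (by push_cast; linarith))
  have hkR : (k:ℝ) = 8 * U ^ 4 * g := by rw [← hk]; push_cast; rw [hMR]
  have hk2 : (k:ℝ) ≤ 8 * U ^ 20 := by
    rw [hkR]
    calc 8 * U ^ 4 * g ≤ 8 * U ^ 4 * U ^ 16 := mul_le_mul_of_nonneg_left hgR (by positivity)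
      _ = _ := by ring
  have hk1 : 7 * U ^ 20 ≤ k := by
    rw [hkR]
    have := mul_le_mul_of_nonneg_left hgR2 (show 0 ≤ 8 * U ^ 4 by positivity)
    have s := h.step (show 4 < 20 by norm_num)
    have s0 : 0 ≤ U ^ 4 := by positivity
    linarith [show 8 * U ^ 4 * U ^ 16 = 8 * U ^ 20 by ring]
  refine ⟨hk1, hk2, ?_⟩
  have c1 : (M:ℝ) ^ 2 ≤ Real.exp (10 * κ) := pow_le_exp' (by positivity) hMe 2 (by push_cast; linarith)
  have c2 : (M ^ 2 * (g * (g + 1)) + 1 : ℝ) ≤ Real.exp (45 * κ) := by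
    refine add_le_exp (mul_le_exp (by positivity) c1 (mul_le_exp (by positivity) hge hg1)) (b := 0) (by simp) (by linarith) (by linarith)
  have s0 := h.step (show 0 < 3 by norm_num)
  have s3 := h.step (show 3 < 6 by norm_num)
  have hs0 : 0 ≤ U ^ 3 := by positivity
  rw [pow_zero] at s0
  have hex : ((M ^ 2 * (4 * (2 * (E + E ^ 2) + E + 1)) : ℕ) : ℝ) ≤ 768 * U ^ 14 := by
    push_cast
    rw [hMR, hER]
    have : 2 * (U ^ 3 + (U ^ 3) ^ 2) + U ^ 3 + 1 ≤ 3 * U ^ 6 := by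
      linarith [show (U ^ 3) ^ 2 = U ^ 6 by ring]
    calc (8 * U ^ 4) ^ 2 * (4 * (2 * (U ^ 3 + (U ^ 3) ^ 2) + U ^ 3 + 1)) 
        ≤ (8 * U ^ 4) ^ 2 * (4 * (3 * U ^ 6)) := by
          refine mul_le_mul_of_nonneg_left (mul_le_mul_of_nonneg_left this (by norm_num)) (by positivity)
      _ = 768 * U ^ 14 := by ring
  have t1 := h.stepk (show 14 < 20 by norm_num)
  have t2 := h.stepk (show 11 < 20 by norm_num)
  have hp : 0 ≤ U ^ 20 := by positivity
  have a1 : (M ^ 2 * (g * (g + 1)) + 1 : ℝ) ^ (M ^ 2 * (4 * (2 * (E + E ^ 2) + E + 1))) ≤ 2 ^ k := by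
    refine (pow_le_exp (by positivity) c2 _).trans (exp_le_two_pow ?_)
    have := mul_le_mul_of_nonneg_right hex (show (0:ℝ) ≤ 45 * κ by linarith)
    linarith
  have a2 : L ^ (2 * E * M ^ 2) ≤ 2 ^ k := by
    refine (pow_le_exp hL0 (h.hLU.trans h.Uexp) _).trans (exp_le_two_pow ?_)
    push_cast
    rw [hMR, hER]
    linarith [show 2 * (2 * U ^ 3 * (8 * U ^ 4) ^ 2 * κ) = 256 * (κ * U ^ 11) by ring]
  calc _ ≤ 2 ^ k * (4 ^ k * (Real.sqrt L ^ k * 2 ^ k)) := by gcongr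
    _ = _ := by rw [mul_pow, show (16:ℝ) = 2 * 4 * 2 by norm_num, mul_pow, mul_pow]; ring

end Num

open Finset

section Cls

variable {κ : ℕ} {U L : ℝ}

lemma j_num (L : ℝ) (hL : 1 ≤ L) (k s J : ℕ) (hs : Real.sqrt L ≤ s) (hJ : J = 20 * k * s) :
    (2 * k : ℝ) ^ J ≤ J.factorial * (2 / L) ^ k := by
  have hL0 : 0 < L := by linarith
  have hs1 : (1:ℝ) ≤ s := le_trans (by rw [Real.one_le_sqrt]; exact hL) hs
  have h1 := Real.pow_div_factorial_le_exp (J:ℝ) (by positivity) J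
  have hf : (0:ℝ) < J.factorial := by positivity
  rw [div_le_iff₀ hf] at h1
  have e1 : (J:ℝ) ^ J = (2 * k : ℝ) ^ J * (10 * s) ^ J := by
    rw [← mul_pow]; congr 1; rw [hJ]; push_cast; ring
  have e2 : Real.exp J * L ^ k ≤ (10 * s : ℝ) ^ J := by
    have a1 : L ^ k ≤ Real.exp J := by
      have : L ≤ Real.exp (20 * s) := by
        have b1 : Real.sqrt L ≤ Real.exp s := hs.trans (le_exp_self _)
        have b2 : L = Real.sqrt L * Real.sqrt L := (Real.mul_self_sqrt hL0.le).symm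
        rw [b2]
        refine (mul_le_exp (Real.sqrt_nonneg _) b1 b1).trans (Real.exp_le_exp.2 ?_)
        linarith
      refine pow_le_exp' hL0.le this k ?_
      rw [hJ]; push_cast; linarith
    have a2 : Real.exp J * Real.exp J ≤ 10 ^ J := by
      have : Real.exp 2 ≤ 10 := by
        have := Real.exp_one_lt_d9
        rw [show (2:ℝ) = 1 + 1 by norm_num, Real.exp_add]
        nlinarith [Real.exp_pos 1]
      rw [← Real.exp_add, show (J:ℝ) + J = J * 2 by ring, Real.exp_nat_mul]
      exact pow_le_pow_left₀ (Real.exp_pos _).le this J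
    calc Real.exp J * L ^ k ≤ Real.exp J * Real.exp J := by gcongr
      _ ≤ 10 ^ J := a2
      _ ≤ _ := by gcongr; linarith
  have h2 : (2 * k : ℝ) ^ J * L ^ k ≤ J.factorial := by
    have h3 : (2 * k : ℝ) ^ J * (Real.exp J * L ^ k) ≤ Real.exp J * J.factorial := by
      calc _ ≤ (2 * k : ℝ) ^ J * (10 * s : ℝ) ^ J := by gcongr
        _ = (J:ℝ) ^ J := e1.symm
        _ ≤ _ := h1
    have := Real.exp_pos (J:ℝ)
    nlinarith
  rw [div_pow, mul_div_assoc', le_div_iff₀ (by positivity)]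
  refine h2.trans (le_mul_of_one_le_right hf.le (one_le_pow₀ (by norm_num)))

lemma err_num (h : Prm κ U L) (k s J Pm : ℕ) (hs : (s:ℝ) ≤ Real.sqrt L + 1) (hJ : J = 20 * k * s)
    (hk : (k:ℝ) ≤ 8 * U ^ 20) (hk1 : 1 ≤ k)
    (hPm : (Pm:ℝ) ≤ Real.exp (U ^ 20)) :
    (2 * Pm) ^ k * (2 * (J + 1) * (Pm:ℝ) ^ (k + 2 * J)) ≤ Real.exp (L * U ^ 40 / 2 ^ 40) := by
  have h2e : (2:ℝ) ≤ Real.exp 1 := by linarith [Real.add_one_le_exp 1]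
  have hU1 : 1 ≤ U := le_trans (by norm_num) h.Ubig
  have hkR : (1:ℝ) ≤ k := by exact_mod_cast hk1
  have hL0 : 0 ≤ L := le_trans (by positivity) h.hL
  set q := Real.sqrt L with hq
  have hqq : L = q * q := (Real.mul_self_sqrt hL0).symm
  have hq1 : 2 ^ 55 ≤ q := by
    rw [hq]
    refine Real.le_sqrt_of_sq_le (le_trans (by norm_num) h.hL)
  have hJR : (J:ℝ) ≤ 40 * (k * q) := by
    rw [hJ]; push_cast
    have : (s:ℝ) ≤ 2 * q := by linarith
    have := mul_le_mul_of_nonneg_left this (show (0:ℝ) ≤ 20 * k by positivity)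
    linarith
  have hkq : (k:ℝ) ≤ k * q := by
    refine le_mul_of_one_le_right (by positivity) (le_trans (by norm_num) hq1)
  have a1 : (2 * (Pm:ℝ)) ^ k ≤ Real.exp (k * (1 + U ^ 20)) :=
    pow_le_exp (by positivity) (mul_le_exp (by norm_num) h2e hPm) k
  have a2 : 2 * ((J:ℝ) + 1) ≤ Real.exp (1 + J) :=
    mul_le_exp (by norm_num) h2e (Real.add_one_le_exp _)
  have a3 : (Pm:ℝ) ^ (k + 2 * J) ≤ Real.exp (((k + 2 * J : ℕ):ℝ) * U ^ 20) :=
    pow_le_exp (by positivity) hPm _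
  refine (mul_le_exp (by positivity) a1 (mul_le_exp (by positivity) a2 a3)).trans (Real.exp_le_exp.2 ?_)
  push_cast
  have hV : 1 ≤ U ^ 20 := one_le_pow₀ hU1
  set V := U ^ 20 with hVd
  have hV2 : U ^ 40 = V * V := by rw [hVd]; ring
  have hJ0 : (0:ℝ) ≤ J := by positivity
  have b1 : (k:ℝ) * (1 + V) + (1 + J + (k + 2 * J) * V) ≤ (124 * (k * q)) * V := by
    have c1 : (k:ℝ) ≤ k * V := le_mul_of_one_le_right (by positivity) hV
    have c2 : (J:ℝ) ≤ J * V := le_mul_of_one_le_right (by positivity) hV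
    have c3 : (1:ℝ) ≤ k * V := by nlinarith
    have c4 : (4 * k + 3 * J) * V ≤ (124 * (k * q)) * V :=
      mul_le_mul_of_nonneg_right (by linarith) (by linarith)
    linarith
  refine b1.trans ?_
  rw [hV2, hqq, le_div_iff₀ (by norm_num)]
  have b2 : (k:ℝ) * (q * V) ≤ 8 * V * (q * V) := mul_le_mul_of_nonneg_right hk (by positivity)
  have b3 : 2 ^ 55 * (q * (V * V)) ≤ q * (q * (V * V)) := mul_le_mul_of_nonneg_right hq1 (by positivity)
  have b4 : 0 ≤ q * (V * V) := by positivity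
  linarith [show 124 * (↑k * q) * V * 2 ^ 40 = 124 * 2 ^ 40 * (k * (q * V)) by ring,
    show 8 * V * (q * V) = 8 * (q * (V * V)) by ring, show q * q * (V * V) = q * (q * (V * V)) by ring]

lemma bet_num (h : Prm κ U L) (u g Pm M0 N : ℕ) (hu : (u:ℝ) = U)
    (hg : g ≤ u ^ 16) (hM0 : M0 = 4 * u ^ 20)
    (hPm : (Pm:ℝ) ≤ Real.exp (U ^ 20)) (xm : ℝ) (hxm : xm = Real.exp (-U ^ 18))
    (hN : Real.exp (L * U ^ 40 / 2 ^ 40) ≤ N) :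
    N * (2 ^ g * (g ^ g * (2 ^ g * L ^ g * (2 * xm + g * g * (g + 1) * (2 * (M0 * xm)))))) +
        (2 * Pm) ^ g * (2 * (Pm:ℝ) ^ g) ≤ N * Real.exp (-2 * U) := by
  have h2e : (2:ℝ) ≤ Real.exp 1 := by linarith [Real.add_one_le_exp 1]
  have hκ : (110:ℝ) ≤ κ := by exact_mod_cast h.kap
  have hL0 : 0 ≤ L := le_trans (by positivity) h.hL
  have hU1 : 1 ≤ U := le_trans (by norm_num) h.Ubig
  have hgR : (g:ℝ) ≤ U ^ 16 := by rw [← hu]; exact_mod_cast hg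
  have hM0R : (M0:ℝ) = 4 * U ^ 20 := by rw [← hu, hM0]; push_cast; ring
  have hge : (g:ℝ) ≤ Real.exp (16 * κ) := hgR.trans (by simpa using h.Upow 16)
  have hg1 : ((g:ℝ)+1) ≤ Real.exp (17 * κ) :=
    add_le_exp hge (b := 0) (by simp) (by linarith) (by linarith)
  have hM0e : (M0:ℝ) ≤ Real.exp (21 * κ) := by
    rw [hM0R]
    refine (mul_le_exp (by norm_num) (show (4:ℝ) ≤ Real.exp κ by linarith [le_exp_self (κ:ℝ)]) (h.Upow 20)).trans (Real.exp_le_exp.2 (by push_cast; linarith))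
  have hx0 : 0 ≤ xm := by rw [hxm]; positivity
  have a1 : (g:ℝ) * g * (g + 1) * (2 * (M0 * xm)) ≤ Real.exp (16 * κ + 16 * κ + 17 * κ + (1 + (21 * κ + - U ^ 18))) :=
    mul_le_exp (by positivity) (mul_le_exp (by positivity) (mul_le_exp (by positivity) hge hge) hg1)
      (mul_le_exp (by positivity) h2e (mul_le_exp (by positivity) hM0e hxm.le))
  have a2 : 2 * xm ≤ Real.exp (1 + - U ^ 18) := mul_le_exp (by norm_num) h2e hxm.le
  have a3 : 2 * xm + (g:ℝ) * g * (g + 1) * (2 * (M0 * xm)) ≤ Real.exp (72 * κ - U ^ 18) :=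
    add_le_exp a2 a1 (by linarith) (by linarith)
  have a4 : (2 ^ g * ((g:ℝ) ^ g * (2 ^ g * L ^ g * (2 * xm + g * g * (g + 1) * (2 * (M0 * xm)))))) ≤ 
      Real.exp (g * 1 + (g * (16 * κ) + (g * 1 + g * κ + (72 * κ - U ^ 18)))) :=
    mul_le_exp (by positivity) (pow_le_exp (by norm_num) h2e g) (mul_le_exp (by positivity)
      (pow_le_exp (by positivity) hge g) (mul_le_exp (by positivity) (mul_le_exp (by positivity)
      (pow_le_exp (by norm_num) h2e g) (pow_le_exp hL0 (h.hLU.trans h.Uexp) g)) a3))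
  have s1 := h.step (show 1 < 18 by norm_num)
  have s2 := h.step (show 16 < 18 by norm_num)
  have s3 := h.stepk (show 16 < 18 by norm_num)
  have s4 := h.stepk (show 0 < 18 by norm_num)
  have s5 := h.step (show 0 < 18 by norm_num)
  rw [pow_zero] at s4 s5
  rw [pow_one] at s1
  have hgk : (g:ℝ) * κ ≤ κ * U ^ 16 := by
    have := mul_le_mul_of_nonneg_right hgR (show (0:ℝ) ≤ κ by linarith)
    linarith
  have a5 : (2 ^ g * ((g:ℝ) ^ g * (2 ^ g * L ^ g * (2 * xm + g * g * (g + 1) * (2 * (M0 * xm)))))) ≤ 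
      Real.exp (-2 * U - 1) := a4.trans (Real.exp_le_exp.2 (by linarith))
  have b1 : (2 * (Pm:ℝ)) ^ g * (2 * (Pm:ℝ) ^ g) ≤ Real.exp (g * (1 + U ^ 20) + (1 + g * U ^ 20)) :=
    mul_le_exp (by positivity) (pow_le_exp (by positivity) (mul_le_exp (by norm_num) h2e hPm) g)
      (mul_le_exp (by norm_num) h2e (pow_le_exp (by positivity) hPm g))
  have t1 := h.step (show 36 < 40 by norm_num)
  have t2 := h.step (show 16 < 40 by norm_num)
  have t3 := h.step (show 1 < 40 by norm_num)
  have t4 := h.step (show 0 < 40 by norm_num)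
  rw [pow_zero] at t4
  rw [pow_one] at t3
  have hg36 : (g:ℝ) * U ^ 20 ≤ U ^ 36 := by
    have := mul_le_mul_of_nonneg_right hgR (show (0:ℝ) ≤ U ^ 20 by positivity)
    linarith [show U ^ 16 * U ^ 20 = U ^ 36 by ring]
  have hLU : 2 ^ 70 * U ^ 40 ≤ L * U ^ 40 / 2 ^ 40 := by
    rw [le_div_iff₀ (by norm_num)]
    have := mul_le_mul_of_nonneg_right h.hL (show (0:ℝ) ≤ U ^ 40 by positivity)
    linarith
  have b2 : (2 * (Pm:ℝ)) ^ g * (2 * (Pm:ℝ) ^ g) ≤ N * Real.exp (-2 * U - 1) := by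
    refine b1.trans ?_
    calc _ ≤ Real.exp (L * U ^ 40 / 2 ^ 40 + (-2 * U - 1)) := Real.exp_le_exp.2 (by linarith)
      _ ≤ _ := by rw [Real.exp_add]; gcongr
  have b3 : Real.exp (-2 * U - 1) * 2 ≤ Real.exp (-2 * U) := by
    rw [show -2 * U = -2 * U - 1 + 1 by ring, Real.exp_add (-2 * U - 1) 1]
    simp only [sub_add_cancel, add_sub_cancel_right]
    exact mul_le_mul_of_nonneg_left h2e (Real.exp_pos _).le
  have b4 := mul_le_mul_of_nonneg_left a5 (show (0:ℝ) ≤ N by positivity)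
  have b5 := mul_le_mul_of_nonneg_left b3 (show (0:ℝ) ≤ N by positivity)
  linarith

set_option maxHeartbeats 1000000 in
/-- The class theorem. -/
theorem class_thm (h : Prm κ U L) (P : Finset ℕ) (hP : ∀ p ∈ P, p.Prime)
    (hlo : ∀ p ∈ P, Real.exp (U ^ 18) ≤ p) (hhi : ∀ p ∈ P, (p:ℝ) ≤ Real.exp (U ^ 20))
    (hPL : ∑ p ∈ P, 1 / (p:ℝ) ≤ L) (N : ℕ) (hN : Real.exp (L * U ^ 40 / 2 ^ 40) ≤ N) :
    ∃ E : Finset ℤ, (E.card : ℝ) ≤ N * Real.exp (-U) ∧ ∀ (Dd : ℝ) (f : ℤ → ℝ),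
      (∀ n, f n ≠ 0 → n ∈ Ioc (N:ℤ) (2 * N) ∧ n ∉ E ∧ (om P n : ℝ) ≤ Dd * L) →
      |∑ n ∈ Ioc (N:ℤ) (2 * N), ∑ s : Lt P, f n * lit s.1.1 n * f (n + stp s)| ≤
        24 * (1024 * Real.sqrt L) * Real.exp (2 * Dd) * ∑ n ∈ Ioc (N:ℤ) (2 * N), f n ^ 2 := by
  have h2e : (2:ℝ) ≤ Real.exp 1 := by linarith [Real.add_one_le_exp 1]
  have hκ1 := h.kap
  have hκ : (110:ℝ) ≤ κ := by exact_mod_cast hκ1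
  have hL0 : 0 ≤ L := le_trans (by positivity) h.hL
  have hL2 : 2 ≤ L := le_trans (by norm_num) h.hL
  have hU1 : 1 ≤ U := le_trans (by norm_num) h.Ubig
  obtain ⟨u, hud⟩ : ∃ u : ℕ, u = 2 ^ κ := ⟨_, rfl⟩
  have hu : (u:ℝ) = U := by rw [h.hU, hud]; push_cast; rfl
  have hu1 : 2 ≤ u := by
    rw [hud]; calc 2 = 2 ^ 1 := by norm_num
      _ ≤ _ := Nat.pow_le_pow_right (by norm_num) (by omega)
  obtain ⟨Pm, hPmd⟩ : ∃ Pm : ℕ, Pm = ⌊Real.exp (U ^ 20)⌋₊ := ⟨_, rfl⟩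
  have hPmR : (Pm:ℝ) ≤ Real.exp (U ^ 20) := by rw [hPmd]; exact Nat.floor_le (Real.exp_pos _).le
  have hPm : ∀ p ∈ P, p ≤ Pm := fun p hp => by rw [hPmd]; exact Nat.le_floor (hhi p hp)
  have hPm1 : 1 ≤ Pm := by
    rw [hPmd]; apply Nat.le_floor
    rw [Nat.cast_one]; exact Real.one_le_exp (by positivity)
  obtain ⟨s, hsd⟩ : ∃ s : ℕ, s = ⌈Real.sqrt L⌉₊ := ⟨_, rfl⟩
  have hs1 : Real.sqrt L ≤ s := by rw [hsd]; exact Nat.le_ceil _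
  have hs2 : (s:ℝ) ≤ Real.sqrt L + 1 := by rw [hsd]; exact (Nat.ceil_lt_add_one (Real.sqrt_nonneg _)).le
  set M : ℕ := 2 ^ (4 * κ + 2 + 1) with hMd
  have hM : M = 8 * u ^ 4 := by rw [hMd, hud, ← pow_mul]; ring
  have hgt : 2 ^ (16 * κ - 1 + 1) = u ^ 16 := by
    rw [hud, ← pow_mul]; congr 1; omega
  have hgs : ∀ g, (g = 2 ^ (16 * κ - 1 + 1) ∨ g = 2 ^ (16 * κ - 1 + 1) - 2) → g ≤ u ^ 16 ∧ u ^ 16 ≤ g + 2 := by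
    intro g hg
    rw [hgt] at hg
    rcases hg with rfl | rfl <;> omega
  set xm : ℝ := Real.exp (-U ^ 18) with hxm
  obtain ⟨M0, hM0⟩ : ∃ M0 : ℕ, M0 = 4 * u ^ 20 := ⟨_, rfl⟩
  have hM0R : (M0:ℝ) = 4 * U ^ 20 := by rw [← hu, hM0]; push_cast; ring
  have hM01 : 1 ≤ M0 := by rw [hM0]; have : 0 < u ^ 20 := by positivity
                           omega
  have s0 := h.step (show 0 < 18 by norm_num)
  have s20 := h.step (show 18 < 20 by norm_num)
  have sk20 := h.stepk (show 0 < 18 by norm_num)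
  rw [pow_zero] at s0 sk20
  have hη1 : 2 * xm ≤ 1 := by
    refine (mul_le_exp (by norm_num) h2e le_rfl).trans (Real.exp_le_one_iff.2 ?_)
    linarith
  have hxmp : ∀ p ∈ P, 1 / (p:ℝ) ≤ xm := by
    intro p hp
    rw [hxm, Real.exp_neg, one_div]
    exact inv_anti₀ (Real.exp_pos _) (hlo p hp)
  have hηp : ∀ p ∈ P, 3 / (2 * (p:ℝ)) ≤ 2 * xm := by
    intro p hp
    have h1 := hxmp p hp
    have h2 : 0 ≤ 1 / (p:ℝ) := by positivity
    have : 3 / (2 * (p:ℝ)) = 3 / 2 * (1 / (p:ℝ)) := by ring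
    linarith
  have hxm0 : 0 ≤ xm := (Real.exp_pos _).le
  -- the big interval
  obtain ⟨B, hB⟩ : ∃ B : ℕ, B = 2 * (M * u ^ 16 * Pm) := ⟨_, rfl⟩
  set I : Finset ℤ := Ioc ((N:ℤ) - B) (N + N + B) with hI
  have hkb : ∀ g, g ≤ u ^ 16 → ((M * g : ℕ):ℝ) ≤ 8 * U ^ 20 := by
    intro g hg
    have : M * g ≤ 8 * u ^ 20 := by
      rw [hM]
      calc 8 * u ^ 4 * g ≤ 8 * u ^ 4 * u ^ 16 := Nat.mul_le_mul_left _ hg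
        _ = _ := by ring
    rw [← hu]; exact_mod_cast this
  have h8 : (8:ℝ) ≤ Real.exp κ := by linarith [le_exp_self (κ:ℝ)]
  have hk21 : ∀ g, g ≤ u ^ 16 → ((M * g : ℕ):ℝ) ≤ Real.exp (21 * κ) := fun g hg =>
    (hkb g hg).trans ((mul_le_exp (by norm_num) h8 (h.Upow 20)).trans (Real.exp_le_exp.2 (by push_cast; linarith)))
  have hkp : ∀ g, g ≤ u ^ 16 → ∀ p ∈ P, M * g ≤ p := by
    intro g hg p hp
    have h1 := (hk21 g hg).trans (Real.exp_le_exp.2 (show 21 * (κ:ℝ) ≤ U ^ 18 by linarith))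
    exact_mod_cast h1.trans (hlo p hp)
  have hMP : ∀ g, g ≤ u ^ 16 → 5 * M * g * Pm ≤ 2 ^ M0 := by
    intro g hg
    have h1 : (5:ℝ) * ((M * g : ℕ):ℝ) * Pm ≤ Real.exp (κ + 21 * κ + U ^ 20) :=
      mul_le_exp (by positivity) (mul_le_exp (by norm_num) (by linarith) (hk21 g hg)) hPmR
    have h2 : Real.exp (κ + 21 * κ + U ^ 20) ≤ 2 ^ M0 := exp_le_two_pow (by rw [hM0R]; linarith)
    have h3 := h1.trans h2
    have h4 : ((5 * M * g * Pm : ℕ):ℝ) ≤ ((2 ^ M0 : ℕ):ℝ) := by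
      push_cast at h3 ⊢; linarith
    exact_mod_cast h4
  have hM1 : 1 ≤ M := by rw [hMd]; exact Nat.one_le_two_pow
  have hsq : Real.sqrt L ^ 2 = L := Real.sq_sqrt hL0
  have hsq1 : 1 ≤ Real.sqrt L := by rw [Real.one_le_sqrt]; linarith
  obtain ⟨E, hE1, hE2⟩ := del_thm hP L hL2 hPL (16 * κ - 1) (4 * κ + 2) (by omega) (N:ℤ) N B Pm hPm hPm1 I hI
    (1024 * Real.sqrt L) (N * Real.exp (-7 * U ^ 20)) (N * Real.exp (-2 * U))
    (by linarith) (by rw [mul_pow, hsq]; linarith)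
    (by
      intro g hg
      obtain ⟨hg1, hg2⟩ := hgs g hg
      have hm := phi_mask hP I L (by linarith) hPL
      refine (bad_sum hP (phi P I L) hm.nonneg hm.le_one L xm (2 * xm) (by linarith) hPL hηp (by positivity)
        hη1 hxm0 hxmp Pm M0 hPm hPm1 ?_ hM01 N N).trans (bet_num h u g Pm M0 N hu hg1 hM0 hPmR xm hxm hN)
      refine le_trans ?_ (hMP g hg1)
      calc 2 * g * Pm ≤ 5 * M * g * Pm := by
            refine Nat.mul_le_mul_right _ (Nat.mul_le_mul_right _ ?_); omega
        _ ≤ _ := le_rfl)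
    (by
      intro g hg
      obtain ⟨hg1, hg2⟩ := hgs g hg
      obtain ⟨k, hk⟩ : ∃ k, M * g = k := ⟨_, rfl⟩
      obtain ⟨J, hJ⟩ : ∃ J, J = 20 * k * s := ⟨_, rfl⟩
      obtain ⟨n1, n2, n3⟩ := tame_num h u (u ^ 3) g M k hu rfl hM hg1 hg2 hk
      have n4 := wild_num h u (u ^ 3) g M Pm k M0 hu rfl hM hg1 hk hM0 hPmR xm hxm
      have pat := pattern_sum (M := M) (g := g) hP (u ^ 3) k hk L xm (2 * xm) hL2 hPL (by positivity) hη1 hxm0 hxmp Pm M0 hPm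
        (hMP g hg1) hM01
      have hk1 : 1 ≤ k := by
        have h1 : (1:ℝ) ≤ k := by
          have : 1 ≤ U ^ 20 := one_le_pow₀ hU1
          linarith
        exact_mod_cast h1
      have er := err_num h k s J Pm hs2 hJ n2 hk1 hPmR
      have td := tdiag_sum (M := M) (g := g) hP I L hL2 hPL Pm k hk (by rw [← hk]; exact hkp g hg1) hPm hPm1 (2 * xm) hηp (by positivity)
        J (j_num L (by linarith) k s J hs1 hJ) N N B (by
          rw [hB, ← hk]
          refine Nat.mul_le_mul_left _ (Nat.mul_le_mul_right _ (Nat.mul_le_mul_left _ hg1))) (by rw [hI])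
      rw [hk]
      refine td.trans ?_
      have hS : (1:ℝ) ≤ (16 * Real.sqrt L) ^ k := one_le_pow₀ (by linarith)
      have pat2 := pat.trans (mul_le_mul_of_nonneg_left (add_le_add n4 n3) (by positivity))
      have pat3 := pat2.trans (show (2:ℝ) ^ k * (1 + (16 * Real.sqrt L) ^ k) ≤ 2 * (32 * Real.sqrt L) ^ k by
        have : (32 * Real.sqrt L) ^ k = 2 ^ k * (16 * Real.sqrt L) ^ k := by rw [← mul_pow]; congr 1; ring
        rw [this]
        have h2k : (0:ℝ) < 2 ^ k := by positivity
        nlinarith)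
      have er2 := er.trans hN
      have hT : (1:ℝ) ≤ (32 * Real.sqrt L) ^ k := one_le_pow₀ (by linarith)
      have hN0 : (0:ℝ) ≤ N := by positivity
      calc _ ≤ 3 * N * (2 * (32 * Real.sqrt L) ^ k) + N := add_le_add (mul_le_mul_of_nonneg_left pat3 (by positivity)) er2
        _ ≤ N * (7 * (32 * Real.sqrt L) ^ k) := by
            have := mul_le_mul_of_nonneg_left hT hN0
            linarith
        _ ≤ N * (Real.exp (-7 * U ^ 20) * (1024 * Real.sqrt L) ^ k) := by
            refine mul_le_mul_of_nonneg_left ?_ hN0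
            have : (1024 * Real.sqrt L) ^ k = 32 ^ k * (32 * Real.sqrt L) ^ k := by rw [← mul_pow]; congr 1; ring
            rw [this, ← mul_assoc]
            refine mul_le_mul_of_nonneg_right ?_ (by positivity)
            have e1 : Real.exp 3 ≤ 32 := by
              have := Real.exp_one_lt_d9
              have e : Real.exp 3 = Real.exp 1 * Real.exp 1 * Real.exp 1 := by
                rw [← Real.exp_add, ← Real.exp_add]; norm_num
              rw [e]
              have p := Real.exp_pos 1
              have : Real.exp 1 * Real.exp 1 ≤ 8 := by nlinarith
              nlinarith
            have e2 : Real.exp (k * 3) ≤ 32 ^ k := by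
              rw [Real.exp_nat_mul]; exact pow_le_pow_left₀ (Real.exp_pos _).le e1 k
            calc (7:ℝ) ≤ Real.exp 7 := le_exp_self 7
              _ ≤ Real.exp (-7 * U ^ 20 + k * 3) := Real.exp_le_exp.2 (by
                  have : 1 ≤ U ^ 20 := one_le_pow₀ hU1
                  linarith)
              _ ≤ _ := by rw [Real.exp_add]; exact mul_le_mul_of_nonneg_left e2 (Real.exp_pos _).le
        _ = _ := by ring)
  refine ⟨E, hE1.trans ?_, ?_⟩
  · have hN0 : (0:ℝ) ≤ N := by positivity
    have s1 := h.step (show 1 < 20 by norm_num)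
    rw [pow_one] at s1
    have c1 : (Pm:ℝ) * (N * Real.exp (-7 * U ^ 20)) ≤ N * Real.exp (-2 * U) := by
      calc (Pm:ℝ) * (N * Real.exp (-7 * U ^ 20)) = N * (Pm * Real.exp (-7 * U ^ 20)) := by ring
        _ ≤ N * Real.exp (U ^ 20 + -7 * U ^ 20) :=
            mul_le_mul_of_nonneg_left (mul_le_exp (by positivity) hPmR le_rfl) hN0
        _ ≤ _ := mul_le_mul_of_nonneg_left (Real.exp_le_exp.2 (by linarith)) hN0
    have c2 : 4 * Real.exp (-2 * U) ≤ Real.exp (-U) := by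
      refine (mul_le_exp (by norm_num) (show (4:ℝ) ≤ Real.exp U by
        linarith [le_exp_self U, h.Ubig]) le_rfl).trans (Real.exp_le_exp.2 (by linarith))
    have c3 := mul_le_mul_of_nonneg_left c2 hN0
    linarith
  · have e : (2:ℤ) * N = N + N := by ring
    rw [e]
    exact hE2

end Cls

open Finset

section Mert

lemma mert_dyad (Q : Finset ℕ) (hQ : ∀ p ∈ Q, p.Prime) (i : ℕ) (hi : 1 ≤ i)
    (hlog : ∀ p ∈ Q, Nat.log 2 p = i) : ∑ p ∈ Q, 1 / (p:ℝ) ≤ 4 / (i:ℝ) := by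
  have hl2 : 0 < Real.log 2 := Real.log_pos (by norm_num)
  have hi0 : (0:ℝ) < i := by exact_mod_cast hi
  have hlow : ∀ p ∈ Q, (2:ℝ) ^ i ≤ p := by
    intro p hp
    have := Nat.pow_log_le_self 2 (hQ p hp).ne_zero
    rw [hlog p hp] at this
    exact_mod_cast this
  have hhigh : ∀ p ∈ Q, p < 2 ^ (i+1) := by
    intro p hp
    have := Nat.lt_pow_succ_log_self (b := 2) (by norm_num) p
    rwa [hlog p hp] at this
  have h1 : ∑ p ∈ Q, 1 / (p:ℝ) ≤ Q.card * (1 / 2 ^ i) := by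
    rw [← nsmul_eq_mul]
    refine Finset.sum_le_card_nsmul _ _ _ fun p hp => ?_
    exact one_div_le_one_div_of_le (by positivity) (hlow p hp)
  have h2 : (Q.card:ℝ) * (i * Real.log 2) ≤ ∑ p ∈ Q, Real.log p := by
    rw [← nsmul_eq_mul]
    refine Finset.card_nsmul_le_sum _ _ _ fun p hp => ?_
    rw [← Real.log_pow]
    exact Real.log_le_log (by positivity) (hlow p hp)
  have h3 : ∑ p ∈ Q, Real.log p ≤ Real.log 4 * 2 ^ (i+1) := by
    refine le_trans ?_ (Chebyshev.theta_le_log4_mul_x (x := 2 ^ (i+1)) (by positivity))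
    unfold Chebyshev.theta
    refine Finset.sum_le_sum_of_subset_of_nonneg ?_ ?_
    · intro p hp
      simp only [Finset.mem_filter, Finset.mem_Ioc]
      refine ⟨⟨(hQ p hp).pos, ?_⟩, hQ p hp⟩
      apply Nat.le_floor
      have := (hhigh p hp).le
      exact_mod_cast this
    · intro p hp _
      exact Real.log_natCast_nonneg p
  have h4 : Real.log 4 = 2 * Real.log 2 := by
    rw [show (4:ℝ) = 2 ^ 2 by norm_num, Real.log_pow]; norm_num
  have h5 : (Q.card:ℝ) * i ≤ 4 * 2 ^ i := by
    have : ((Q.card:ℝ) * i) * Real.log 2 ≤ (4 * 2 ^ i) * Real.log 2 := by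
      rw [h4] at h3
      have := h2.trans h3
      rw [pow_succ] at this
      linarith
    exact le_of_mul_le_mul_right this hl2
  refine h1.trans ?_
  rw [mul_one_div, div_le_div_iff₀ (by positivity) hi0]
  exact h5

/-- Mertens type upper bound -/
lemma mertens (t : ℝ) (ht : 2 ≤ t) (Q : Finset ℕ) (hQ : ∀ p ∈ Q, p.Prime)
    (hle : ∀ p ∈ Q, Real.log p ≤ t) : ∑ p ∈ Q, 1 / (p:ℝ) ≤ 16 * Real.log t := by
  set k := ⌊2 * t⌋₊ with hk
  have hl2 : 0.69 < Real.log 2 := by linarith [Real.log_two_gt_d9]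
  have hl2' : Real.log 2 < 0.7 := by linarith [Real.log_two_lt_d9]
  have hmem : ∀ p ∈ Q, Nat.log 2 p ∈ Finset.Icc 1 k := by
    intro p hp
    rw [Finset.mem_Icc]
    constructor
    · exact Nat.log_pos (by norm_num) (hQ p hp).two_le
    · apply Nat.le_floor
      have h1 := Nat.pow_log_le_self 2 (hQ p hp).ne_zero
      have h2 : (2:ℝ) ^ (Nat.log 2 p) ≤ p := by exact_mod_cast h1
      have h3 := Real.log_le_log (by positivity) h2
      rw [Real.log_pow] at h3
      have h4 := hle p hp
      have h5 : (0:ℝ) ≤ (Nat.log 2 p : ℕ) := by positivity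
      nlinarith
  rw [← Finset.sum_fiberwise_of_maps_to hmem]
  have h1 : ∑ i ∈ Finset.Icc 1 k, ∑ p ∈ Q with Nat.log 2 p = i, 1 / (p:ℝ)
      ≤ ∑ i ∈ Finset.Icc 1 k, 4 / (i:ℝ) := by
    refine Finset.sum_le_sum fun i hi => ?_
    refine mert_dyad _ (fun p hp => hQ p (Finset.mem_filter.mp hp).1) i (Finset.mem_Icc.mp hi).1
      (fun p hp => (Finset.mem_filter.mp hp).2)
  refine h1.trans ?_
  have h2 : ∑ i ∈ Finset.Icc 1 k, 4 / (i:ℝ) = 4 * (harmonic k : ℝ) := by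
    rw [harmonic_eq_sum_Icc]
    push_cast
    rw [Finset.mul_sum]
    exact Finset.sum_congr rfl fun _ _ => by rw [div_eq_mul_inv]
  rw [h2]
  have h3 := harmonic_le_one_add_log k
  have hk0 : (0:ℝ) < k := by
    have : 0 < k := Nat.floor_pos.mpr (by linarith)
    exact_mod_cast this
  have h4 : Real.log k ≤ Real.log (2 * t) :=
    Real.log_le_log hk0 (Nat.floor_le (by linarith))
  rw [Real.log_mul (by norm_num) (by linarith)] at h4
  have h5 : Real.log 2 ≤ Real.log t := Real.log_le_log (by norm_num) ht
  linarith

end Mert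

open Finset


section Eig

/-- the bilinear form of the operator -/
noncomputable def frm (Q : Finset ℕ) (N : ℕ) (f g : ℤ → ℝ) : ℝ :=
  ∑ n ∈ Ioc (N:ℤ) (2 * N), ∑ p ∈ Q, f n * lit p n * (g (n + p) + g (n - p))

lemma frm_eq (Q : Finset ℕ) (N : ℕ) (f : ℤ → ℝ) :
    frm Q N f f = ∑ n ∈ Ioc (N:ℤ) (2 * N), ∑ s : Lt Q, f n * lit s.1.1 n * f (n + stp s) := by
  unfold frm
  refine Finset.sum_congr rfl fun n _ => ?_
  rw [Fintype.sum_prod_type, ← Finset.sum_coe_sort Q]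
  refine Finset.sum_congr rfl fun p _ => ?_
  simp [stp, sub_eq_add_neg]; ring

lemma frm_union {Q R : Finset ℕ} (h : Disjoint Q R) (N : ℕ) (f : ℤ → ℝ) :
    frm (Q ∪ R) N f f = frm Q N f f + frm R N f f := by
  unfold frm
  rw [← Finset.sum_add_distrib]
  exact Finset.sum_congr rfl fun n _ => Finset.sum_union h

lemma frm_symm (Q : Finset ℕ) (N : ℕ) (f g : ℤ → ℝ)
    (hf : ∀ n, f n ≠ 0 → n ∈ Ioc (N:ℤ) (2 * N)) (hg : ∀ n, g n ≠ 0 → n ∈ Ioc (N:ℤ) (2 * N)) :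
    frm Q N f g = frm Q N g f := by
  unfold frm
  rw [Finset.sum_comm, Finset.sum_comm (s := Ioc (N:ℤ) (2 * N))]
  refine Finset.sum_congr rfl fun p _ => ?_
  have key : ∀ (f g : ℤ → ℝ), (∀ n, f n ≠ 0 → n ∈ Ioc (N:ℤ) (2 * N)) →
      (∀ n, g n ≠ 0 → n ∈ Ioc (N:ℤ) (2 * N)) →
      ∑ n ∈ Ioc (N:ℤ) (2 * N), f n * lit p n * g (n + p)
        = ∑ n ∈ Ioc (N:ℤ) (2 * N), g n * lit p n * f (n - p) := by
    intro f g hf hg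
    rw [shift_sum _ (p:ℤ) (fun n => f n * lit p n * g (n + p))]
    · refine Finset.sum_congr rfl fun n _ => ?_
      have : lit p (n - p) = lit p n := lit_congr (by simp)
      rw [this]; simp only [sub_add_cancel]; ring
    · intro n hn
      exact ⟨hf _ (left_ne_zero_of_mul (left_ne_zero_of_mul hn)), hg _ (right_ne_zero_of_mul hn)⟩
  simp only [mul_add, Finset.sum_add_distrib]
  rw [key f g hf hg, key g f hg hf]; ring

lemma opA_eq (N : ℕ) (P : Finset ℕ) (f : ℤ → ℂ)
    (hf : ∀ n, f n ≠ 0 → n ∈ Ioc (N:ℤ) (2 * N)) (n : ℤ) :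
    opA N P f n = ∑ p ∈ P, (lit p n : ℂ) * (f (n + p) + f (n - p)) := by
  unfold opA
  have h0 : ∀ m : ℤ, (if m ∈ Ioc (N:ℤ) (2 * N) then f m else 0) = f m := by
    intro m
    split_ifs with h
    · rfl
    · by_contra h2; exact h (hf m (Ne.symm h2))
  have h1 : ∀ (p : ℕ) (m : ℤ), (if (p:ℤ) ∣ n ∧ m ∈ Ioc (N:ℤ) (2 * N) then f m else 0)
      = (if (p:ℤ) ∣ n then 1 else 0) * f m := by
    intro p m
    rw [ite_and, h0]; split_ifs <;> simp
  have h2 : ∀ (p : ℕ) (m : ℤ), (if m ∈ Ioc (N:ℤ) (2 * N) then f m / (p:ℂ) else 0)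
      = f m / p := by
    intro p m
    conv_rhs => rw [← h0 m]
    split_ifs <;> simp
  simp only [h1, h2]
  rw [Finset.sum_pair (by norm_num), Finset.sum_pair (by norm_num), ← Finset.sum_add_distrib,
    ← Finset.sum_add_distrib, ← Finset.sum_sub_distrib]
  refine Finset.sum_congr rfl fun p _ => ?_
  have e1 : n + -1 * (p:ℤ) = n - p := by ring
  have e2 : n + 1 * (p:ℤ) = n + p := by ring
  rw [e1, e2]
  unfold lit
  split_ifs <;> push_cast <;> ring

lemma eig (N : ℕ) (P : Finset ℕ) (X : Finset ℤ) (τ : ℝ) (hτ : 0 ≤ τ)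
    (hX : X ⊆ Ioc (N:ℤ) (2 * N))
    (h : ∀ f : ℤ → ℝ, (∀ n, f n ≠ 0 → n ∈ X) →
      |frm P N f f| ≤ τ * ∑ n ∈ Ioc (N:ℤ) (2 * N), f n ^ 2)
    (μ : ℂ) (f : ℤ → ℂ) (hf : f ≠ 0) (he : ∀ n : ℤ, opARestrict N P X f n = μ * f n) :
    ‖μ‖ ≤ τ := by
  by_cases hμ : μ = 0
  · rw [hμ, norm_zero]; exact hτ
  have hfX : ∀ n, f n ≠ 0 → n ∈ X := by
    intro n hn
    by_contra hnX
    have := he n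
    unfold opARestrict at this
    rw [if_neg hnX] at this
    exact (mul_ne_zero hμ hn) this.symm
  have hfe : (fun m => if m ∈ X then f m else 0) = f := by
    funext m
    split_ifs with h1
    · rfl
    · by_contra h2; exact h1 (hfX m (Ne.symm h2))
  have hop : ∀ n ∈ X, μ * f n = ∑ p ∈ P, (lit p n : ℂ) * (f (n + p) + f (n - p)) := by
    intro n hn
    rw [← he n, opARestrict, if_pos hn, hfe]
    exact opA_eq N P f (fun m hm => hX (hfX m hm)) n
  set u : ℤ → ℝ := fun n => (f n).re with hu
  set v : ℤ → ℝ := fun n => (f n).im with hv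
  have huX : ∀ n, u n ≠ 0 → n ∈ X := fun n hn => hfX n (by
    intro h; exact hn (by simp [hu, h]))
  have hvX : ∀ n, v n ≠ 0 → n ∈ X := fun n hn => hfX n (by
    intro h; exact hn (by simp [hv, h]))
  set D : ℝ := ∑ n ∈ Ioc (N:ℤ) (2 * N), (u n ^ 2 + v n ^ 2) with hD
  have hDpos : 0 < D := by
    obtain ⟨n, hn⟩ := Function.ne_iff.mp hf
    refine Finset.sum_pos' (fun i _ => by positivity) ⟨n, hX (hfX n hn), ?_⟩
    have : 0 < Complex.normSq (f n) := Complex.normSq_pos.mpr hn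
    rw [Complex.normSq_apply] at this
    simp only [hu, hv]; linarith [this]
  have hre : ∀ n, μ.re * (u n ^ 2 + v n ^ 2) =
      ∑ p ∈ P, (u n * lit p n * (u (n + p) + u (n - p)) + v n * lit p n * (v (n + p) + v (n - p)))
      ∧ μ.im * (u n ^ 2 + v n ^ 2) =
      ∑ p ∈ P, (u n * lit p n * (v (n + p) + v (n - p)) - v n * lit p n * (u (n + p) + u (n - p))) := by
    intro n
    by_cases hn : n ∈ X
    · have h1 := hop n hn
      have h2 := congrArg Complex.re h1
      have h3 := congrArg Complex.im h1
      simp only [Complex.re_sum, Complex.im_sum, Complex.ofReal_re, Complex.ofReal_im,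
        Complex.add_re, Complex.add_im, Complex.mul_re, Complex.mul_im, zero_mul, sub_zero, add_zero] at h2 h3
      have e1 : ∀ a b : ℕ → ℝ, ∀ x y : ℝ, ∑ p ∈ P, (x * lit p n * a p + y * lit p n * b p)
          = x * ∑ p ∈ P, lit p n * a p + y * ∑ p ∈ P, lit p n * b p := by
        intro a b x y
        rw [Finset.sum_add_distrib, Finset.mul_sum, Finset.mul_sum]
        simp only [mul_assoc]
      have e2 : ∀ a b : ℕ → ℝ, ∀ x y : ℝ, ∑ p ∈ P, (x * lit p n * a p - y * lit p n * b p)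
          = x * ∑ p ∈ P, lit p n * a p - y * ∑ p ∈ P, lit p n * b p := by
        intro a b x y
        rw [Finset.sum_sub_distrib, Finset.mul_sum, Finset.mul_sum]
        simp only [mul_assoc]
      constructor
      · rw [e1 (fun p => u (n + p) + u (n - p)) (fun p => v (n + p) + v (n - p))]
        simp only [hu, hv]
        rw [← h2, ← h3]; ring
      · rw [e2 (fun p => v (n + p) + v (n - p)) (fun p => u (n + p) + u (n - p))]
        simp only [hu, hv]
        rw [← h2, ← h3]; ring
    · have hu0 : u n = 0 := by by_contra h; exact hn (huX n h)
      have hv0 : v n = 0 := by by_contra h; exact hn (hvX n h)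
      simp [hu0, hv0]
  have hR : μ.re * D = frm P N u u + frm P N v v := by
    rw [hD, Finset.mul_sum]
    unfold frm
    rw [← Finset.sum_add_distrib]
    refine Finset.sum_congr rfl fun n _ => ?_
    rw [(hre n).1, Finset.sum_add_distrib]
  have hI : μ.im * D = 0 := by
    have : μ.im * D = frm P N u v - frm P N v u := by
      rw [hD, Finset.mul_sum]
      unfold frm
      rw [← Finset.sum_sub_distrib]
      refine Finset.sum_congr rfl fun n _ => ?_
      rw [(hre n).2, Finset.sum_sub_distrib]
    rw [this, frm_symm P N u v (fun n hn => hX (huX n hn)) (fun n hn => hX (hvX n hn))]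
    ring
  have hI0 : μ.im = 0 := by
    rcases mul_eq_zero.mp hI with h | h
    · exact h
    · exact absurd h hDpos.ne'
  have hnorm : ‖μ‖ = |μ.re| := by
    have : μ = (μ.re : ℂ) := by apply Complex.ext <;> simp [hI0]
    rw [this, Complex.norm_real]; simp
  rw [hnorm]
  have h1 := h u huX
  have h2 := h v hvX
  have h3 : |μ.re| * D ≤ τ * D := by
    rw [← abs_of_pos hDpos, ← abs_mul, abs_of_pos hDpos, hR]
    refine (abs_add_le _ _).trans ?_
    rw [hD, Finset.sum_add_distrib, mul_add]
    exact add_le_add h1 h2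
  exact le_of_mul_le_mul_right h3 hDpos

/-- trivial bound for the form -/
lemma triv_form (Q : Finset ℕ) (hQ : ∀ p ∈ Q, p.Prime) (N : ℕ) (T : ℝ) (hT : 1 ≤ T)
    (hL : ∑ p ∈ Q, 1 / (p:ℝ) ≤ T) (f : ℤ → ℝ)
    (hf : ∀ n, f n ≠ 0 → n ∈ Ioc (N:ℤ) (2 * N) ∧ (om Q n : ℝ) ≤ T) :
    |frm Q N f f| ≤ 4 * T * ∑ n ∈ Ioc (N:ℤ) (2 * N), f n ^ 2 := by
  classical
  set φ : ℤ → ℝ := fun n => if n ∈ Ioc (N:ℤ) (2 * N) ∧ (om Q n : ℝ) ≤ T then 1 else 0 with hφ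
  have hM : Mask Q (Ioc (N:ℤ) (2 * N)) T φ := by
    refine ⟨hQ, ?_, ?_, ?_, ?_, hL, hT⟩
    · intro n; simp only [hφ]; split_ifs <;> norm_num
    · intro n; simp only [hφ]; split_ifs <;> norm_num
    · intro n hn; simp only [hφ]; rw [if_neg (fun h => hn h.1)]
    · intro n; simp only [hφ]; split_ifs with h
      · linarith [h.2]
      · linarith
  have hfφ : ∀ n, f n = φ n * f n := by
    intro n
    by_cases h : f n = 0
    · simp [h]
    · have : φ n = 1 := if_pos (hf n h)
      rw [this, one_mul]
  rw [frm_eq]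
  have h1 : ∀ n, ∀ s : Lt Q, |f n * lit s.1.1 n * f (n + stp s)| ≤
      (1/2) * (f n ^ 2 * |al φ s n|) + (1/2) * (|al φ s n| * (fun m => f m ^ 2) (n + stp s)) := by
    intro n s
    have e : f n * lit s.1.1 n * f (n + stp s) = al φ s n * (f n * f (n + stp s)) := by
      conv_lhs => rw [hfφ n, hfφ (n + stp s)]
      unfold al; ring
    rw [e, abs_mul]
    have : |f n * f (n + stp s)| ≤ (1/2) * (f n ^ 2 + f (n + stp s) ^ 2) := by
      rw [abs_le]; constructor <;> nlinarith [sq_nonneg (f n + f (n + stp s)), sq_nonneg (f n - f (n + stp s))]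
    have := mul_le_mul_of_nonneg_left this (abs_nonneg (al φ s n))
    simp only
    linarith
  calc |∑ n ∈ Ioc (N:ℤ) (2 * N), ∑ s : Lt Q, f n * lit s.1.1 n * f (n + stp s)|
      ≤ ∑ n ∈ Ioc (N:ℤ) (2 * N), ∑ s : Lt Q, |f n * lit s.1.1 n * f (n + stp s)| :=
        (Finset.abs_sum_le_sum_abs _ _).trans
          (Finset.sum_le_sum fun n _ => Finset.abs_sum_le_sum_abs _ _)
    _ ≤ ∑ n ∈ Ioc (N:ℤ) (2 * N), ∑ s : Lt Q, ((1/2) * (f n ^ 2 * |al φ s n|)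
          + (1/2) * (|al φ s n| * (fun m => f m ^ 2) (n + stp s))) :=
        Finset.sum_le_sum fun n _ => Finset.sum_le_sum fun s _ => h1 n s
    _ = (1/2) * ∑ n ∈ Ioc (N:ℤ) (2 * N), f n ^ 2 * ∑ s : Lt Q, |al φ s n|
        + (1/2) * ∑ n ∈ Ioc (N:ℤ) (2 * N), ∑ s : Lt Q, |al φ s n| * (fun m => f m ^ 2) (n + stp s) := by
        simp only [Finset.sum_add_distrib, Finset.mul_sum]
    _ ≤ (1/2) * ∑ n ∈ Ioc (N:ℤ) (2 * N), f n ^ 2 * (4 * T)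
        + (1/2) * (4 * T * ∑ n ∈ Ioc (N:ℤ) (2 * N), (fun m => f m ^ 2) n) := by
        gcongr with n hn
        · exact row_sum_le hM n
        · exact col_sum_le hM _ (fun n => sq_nonneg _)
    _ = _ := by
        rw [← Finset.sum_mul]; ring

end Eig

open Finset

section Dele

lemma card_dvd_Ioc (N d : ℕ) (hd : 0 < d) :
    (((Ioc (N:ℤ) (2 * N)).filter fun n => (d:ℤ) ∣ n).card : ℝ) ≤ N / d + 1 := by
  have h := Int.Ioc_filter_dvd_card (N:ℤ) (2 * N) (r := (d:ℤ)) (by exact_mod_cast hd)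
  have hd' : (0:ℝ) < d := by exact_mod_cast hd
  have hdq : (0:ℚ) < d := by exact_mod_cast hd
  have h2 : ((((Ioc (N:ℤ) (2 * N)).filter fun n => (d:ℤ) ∣ n).card : ℤ) : ℚ) ≤ N / d + 1 := by
    rw [h]
    push_cast
    have a1 := Int.floor_le ((2 * N : ℚ) / d)
    have a2 := Int.lt_floor_add_one ((N : ℚ) / d)
    have a3 : ((2 * N : ℚ) / d) = N / d + N / d := by ring
    have a4 : (⌊(N:ℚ)/d⌋:ℚ) ≤ ⌊(2 * N:ℚ)/d⌋ := by
      have : ⌊(N:ℚ)/d⌋ ≤ ⌊(2 * N:ℚ)/d⌋ := Int.floor_le_floor (by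
        rw [a3]; have : (0:ℚ) ≤ N / d := by positivity
        linarith)
      exact_mod_cast this
    rw [max_eq_left (by linarith)]
    linarith
  have h3 : ((((Ioc (N:ℤ) (2 * N)).filter fun n => (d:ℤ) ∣ n).card : ℚ)) ≤ N / d + 1 := by
    exact_mod_cast h2
  have h4 := (Rat.cast_le (K := ℝ)).mpr h3
  push_cast at h4
  exact h4

lemma del_om (Q : Finset ℕ) (hQ : ∀ p ∈ Q, p.Prime) (N : ℕ) (hN : 0 < N) (h L' T c : ℝ)
    (hh : ∀ p ∈ Q, Real.log p ≤ h) (hh0 : 0 ≤ h)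
    (hL0 : 0 < L') (hL : ∑ p ∈ Q, 1 / (p:ℝ) ≤ L') (hT : 1 ≤ T) (hc : 0 ≤ c)
    (hTL : Real.exp (c + 1) * L' ≤ T) (hTN : 2 * T * h ≤ Real.log N) :
    (((Ioc (N:ℤ) (2 * N)).filter fun n => T < (om Q n : ℝ)).card : ℝ) ≤
      2 * N * Real.exp (-(c * T)) := by
  classical
  set j := ⌈T⌉₊ with hj
  have hjT : T ≤ j := Nat.le_ceil T
  have hj2 : (j:ℝ) ≤ 2 * T := by
    have := Nat.ceil_lt_add_one (by linarith : 0 ≤ T)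
    linarith
  have hN' : (0:ℝ) < N := by exact_mod_cast hN
  have hsub : ((Ioc (N:ℤ) (2 * N)).filter fun n => T < (om Q n : ℝ)) ⊆
      (Q.powersetCard j).biUnion fun A => (Ioc (N:ℤ) (2 * N)).filter fun n => ((∏ q ∈ A, q : ℕ):ℤ) ∣ n := by
    intro n hn
    rw [Finset.mem_filter] at hn
    have h1 : j ≤ (Q.filter fun p : ℕ => (p:ℤ) ∣ n).card := by
      apply Nat.ceil_le.mpr; exact hn.2.le
    obtain ⟨A, hA, hAc⟩ := Finset.exists_subset_card_eq h1
    rw [Finset.mem_biUnion]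
    refine ⟨A, Finset.mem_powersetCard.mpr ⟨hA.trans (Finset.filter_subset _ _), hAc⟩, ?_⟩
    rw [Finset.mem_filter]
    refine ⟨hn.1, ?_⟩
    rw [Int.natCast_dvd]
    refine Finset.prod_primes_dvd _ (fun a ha => ?_) (fun a ha => ?_)
    · exact (hQ a (Finset.mem_filter.mp (hA ha)).1).prime
    · exact Int.natCast_dvd.mp (Finset.mem_filter.mp (hA ha)).2
  have hcard : (((Ioc (N:ℤ) (2 * N)).filter fun n => T < (om Q n : ℝ)).card : ℝ) ≤
      ∑ A ∈ Q.powersetCard j, (2 * N) * ∏ q ∈ A, (1 / (q:ℝ)) := by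
    have h1 : (((Ioc (N:ℤ) (2 * N)).filter fun n => T < (om Q n : ℝ)).card : ℝ) ≤
      ((∑ A ∈ Q.powersetCard j, ((Ioc (N:ℤ) (2 * N)).filter fun n => ((∏ q ∈ A, q : ℕ):ℤ) ∣ n).card : ℕ) : ℝ) := by
      exact_mod_cast (Finset.card_le_card hsub).trans Finset.card_biUnion_le
    refine h1.trans ?_
    push_cast
    refine Finset.sum_le_sum fun A hA => ?_
    rw [Finset.mem_powersetCard] at hA
    have hAp : ∀ q ∈ A, q.Prime := fun q hq => hQ q (hA.1 hq)
    have hpos : 0 < ∏ q ∈ A, q := Finset.prod_pos fun q hq => (hAp q hq).pos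
    have h2 := card_dvd_Ioc N _ hpos
    push_cast at h2
    refine h2.trans ?_
    have h3 : (0:ℝ) < ∏ q ∈ A, (q:ℝ) := Finset.prod_pos fun q hq => by exact_mod_cast (hAp q hq).pos
    have h4 : ∏ q ∈ A, (q:ℝ) ≤ N := by
      rw [← Real.log_le_log_iff h3 hN', Real.log_prod]
      · calc ∑ q ∈ A, Real.log q ≤ A.card • h := Finset.sum_le_card_nsmul _ _ _ fun q hq => hh q (hA.1 hq)
          _ = j * h := by rw [hA.2, nsmul_eq_mul]
          _ ≤ 2 * T * h := mul_le_mul_of_nonneg_right hj2 hh0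
          _ ≤ _ := hTN
      · intro q hq; exact_mod_cast (hAp q hq).ne_zero
    have h5 : 1 ≤ (N:ℝ) / ∏ q ∈ A, (q:ℝ) := by rwa [one_le_div h3]
    rw [Finset.prod_div_distrib]
    simp only [Finset.prod_const_one]
    have : 2 * (N:ℝ) * (1 / ∏ q ∈ A, (q:ℝ)) = N / (∏ q ∈ A, (q:ℝ)) + N / ∏ q ∈ A, (q:ℝ) := by ring
    linarith
  refine hcard.trans ?_
  rw [← Finset.mul_sum]
  refine mul_le_mul_of_nonneg_left ?_ (by positivity)
  change es (fun q => 1 / (q:ℝ)) Q j ≤ _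
  have h1 := es_le (x := fun q => 1 / (q:ℝ)) (S := Q) (fun q _ => by positivity) j
  have h2 : (∑ q ∈ Q, 1 / (q:ℝ)) ^ j ≤ L' ^ j :=
    pow_le_pow_left₀ (Finset.sum_nonneg fun _ _ => by positivity) hL j
  have h3 := Real.pow_div_factorial_le_exp (j:ℝ) (by positivity) j
  have hjf : (0:ℝ) < j.factorial := by exact_mod_cast j.factorial_pos
  have hj0 : (0:ℝ) < j := by linarith
  rw [div_le_iff₀ hjf] at h3
  -- L'^j <= (j exp(-c-1))^j
  have h4 : L' ≤ j * Real.exp (-(c+1)) := by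
    have : L' = Real.exp (c+1) * L' * Real.exp (-(c+1)) := by
      rw [mul_comm (Real.exp (c+1)), mul_assoc, ← Real.exp_add]; simp
    rw [this]
    exact mul_le_mul_of_nonneg_right (hTL.trans hjT) (Real.exp_pos _).le
  have h5 : L' ^ j ≤ (j:ℝ) ^ j * Real.exp (-(c+1) * j) := by
    refine (pow_le_pow_left₀ hL0.le h4 j).trans ?_
    rw [mul_pow, ← Real.exp_nat_mul, mul_comm (j:ℝ) (-(c+1))]
  have h6 : es (fun q => 1 / (q:ℝ)) Q j * j.factorial ≤ Real.exp (-(c * T)) * j.factorial := by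
    calc _ ≤ (j:ℝ) ^ j * Real.exp (-(c+1) * j) := h1.trans (h2.trans h5)
      _ ≤ (Real.exp j * j.factorial) * Real.exp (-(c+1) * j) :=
          mul_le_mul_of_nonneg_right h3 (Real.exp_pos _).le
      _ = Real.exp (-(c * j)) * j.factorial := by
          rw [mul_right_comm, ← Real.exp_add]; ring_nf
      _ ≤ _ := by
          apply mul_le_mul_of_nonneg_right _ hjf.le
          apply Real.exp_le_exp.mpr
          nlinarith
  exact le_of_mul_le_mul_right h6 hjf

end Dele

open Finset

section Chain

lemma om_mono {Q P : Finset ℕ} (h : Q ⊆ P) (n : ℤ) : (om Q n : ℝ) ≤ om P n := by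
  unfold om
  exact_mod_cast Finset.card_le_card (Finset.filter_subset_filter _ h)

lemma chain (P : Finset ℕ) (hP : ∀ p ∈ P, p.Prime) (N : ℕ) (L T : ℝ) (c : ℕ → ℕ)
    (hL : 2 ^ 110 ≤ L) (hLU : L ≤ 2 ^ (c 0)) (hPL : ∑ p ∈ P, 1 / (p:ℝ) ≤ L) (hT : 1 ≤ T)
    (hPs : ∑ p ∈ P.filter (fun p : ℕ => Real.log p ≤ 2 ^ (20 * c 0)), 1 / (p:ℝ) ≤ T)
    (hc : ∀ j, c j ≤ c (j+1)) (hc2 : ∀ j, 18 * c (j+1) ≤ 20 * c j)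
    (hN : ∀ j, c j < c (j+1) → Real.exp (L * (2 ^ (c (j+1))) ^ 40 / 2 ^ 40) ≤ N) (j : ℕ) :
    ∃ E : Finset ℤ, (E.card : ℝ) ≤ j * (N * Real.exp (-(2 ^ (c 0)))) ∧ ∀ f : ℤ → ℝ,
      (∀ n, f n ≠ 0 → n ∈ Ioc (N:ℤ) (2 * N) ∧ n ∉ E ∧ (om P n : ℝ) ≤ 8 * L ∧
        (om (P.filter (fun p : ℕ => Real.log p ≤ 2 ^ (20 * c 0))) n : ℝ) ≤ T) →
      |frm (P.filter (fun p : ℕ => Real.log p ≤ 2 ^ (20 * c j))) N f f| ≤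
        (4 * T + j * (24 * (1024 * Real.sqrt L) * Real.exp 16)) *
          ∑ n ∈ Ioc (N:ℤ) (2 * N), f n ^ 2 := by
  classical
  have hc0 : ∀ j, c 0 ≤ c j := fun j => monotone_nat_of_le_succ hc (Nat.zero_le j)
  induction j with
  | zero =>
    refine ⟨∅, by simp, fun f hf => ?_⟩
    have := triv_form (P.filter (fun p : ℕ => Real.log p ≤ 2 ^ (20 * c 0)))
      (fun p hp => hP p (Finset.mem_filter.mp hp).1) N T hT hPs f
      (fun n hn => ⟨(hf n hn).1, (hf n hn).2.2.2⟩)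
    simpa using this
  | succ j ih =>
    obtain ⟨E, hE, hEf⟩ := ih
    rcases (hc j).eq_or_lt with heq | hlt
    · refine ⟨E, hE.trans ?_, fun f hf => ?_⟩
      · apply mul_le_mul_of_nonneg_right _ (by positivity)
        push_cast; linarith
      · rw [← heq]
        refine (hEf f hf).trans ?_
        apply mul_le_mul_of_nonneg_right _ (Finset.sum_nonneg fun _ _ => sq_nonneg _)
        push_cast
        have : 0 ≤ (24 * (1024 * Real.sqrt L) * Real.exp 16) := by positivity
        linarith
    · set R := P.filter (fun p : ℕ => 2 ^ (20 * c j) < Real.log p ∧ Real.log p ≤ 2 ^ (20 * c (j+1))) with hR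
      have hRP : R ⊆ P := Finset.filter_subset _ _
      have hlog : ∀ p ∈ R, (0:ℝ) < p := fun p hp => by exact_mod_cast (hP p (hRP hp)).pos
      have hprm : Prm (c (j+1)) (2 ^ (c (j+1))) L := by
        refine ⟨rfl, hL, hLU.trans ?_⟩
        exact pow_le_pow_right₀ (by norm_num) (hc0 _)
      obtain ⟨E2, hE2, hE2f⟩ := class_thm hprm R (fun p hp => hP p (hRP hp))
        (fun p hp => by
          have h1 := (Finset.mem_filter.mp hp).2.1
          rw [← Real.le_log_iff_exp_le (hlog p hp)]
          refine le_trans ?_ h1.le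
          rw [← pow_mul]
          apply pow_le_pow_right₀ (by norm_num)
          have := hc2 j
          omega)
        (fun p hp => by
          have h1 := (Finset.mem_filter.mp hp).2.2
          rw [← Real.log_le_iff_le_exp (hlog p hp)]
          rwa [← pow_mul, mul_comm])
        ((Finset.sum_le_sum_of_subset_of_nonneg hRP fun _ _ _ => by positivity).trans hPL)
        N (hN j hlt)
      refine ⟨E ∪ E2, ?_, fun f hf => ?_⟩
      · have h1 : ((E ∪ E2).card : ℝ) ≤ E.card + E2.card := by
          exact_mod_cast Finset.card_union_le _ _
        have h2 : N * Real.exp (-(2 ^ (c (j+1)))) ≤ N * Real.exp (-(2 ^ (c 0))) := by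
          apply mul_le_mul_of_nonneg_left _ (by positivity)
          apply Real.exp_le_exp.mpr
          have : (2:ℝ) ^ (c 0) ≤ 2 ^ (c (j+1)) := pow_le_pow_right₀ (by norm_num) (hc0 _)
          linarith
        push_cast
        linarith
      · have hsplit : P.filter (fun p : ℕ => Real.log p ≤ 2 ^ (20 * c (j+1)))
            = P.filter (fun p : ℕ => Real.log p ≤ 2 ^ (20 * c j)) ∪ R := by
          have hle : (2:ℝ) ^ (20 * c j) ≤ 2 ^ (20 * c (j+1)) :=
            pow_le_pow_right₀ (by norm_num) (by omega)
          ext p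
          simp only [hR, Finset.mem_filter, Finset.mem_union]
          constructor
          · rintro ⟨h1, h2⟩
            by_cases h : Real.log p ≤ 2 ^ (20 * c j)
            · exact Or.inl ⟨h1, h⟩
            · exact Or.inr ⟨h1, not_le.mp h, h2⟩
          · rintro (⟨h1, h2⟩ | ⟨h1, h2, h3⟩)
            · exact ⟨h1, h2.trans hle⟩
            · exact ⟨h1, h3⟩
        have hdis : Disjoint (P.filter (fun p : ℕ => Real.log p ≤ 2 ^ (20 * c j))) R := by
          rw [Finset.disjoint_left]
          intro p hp hp2
          exact absurd (Finset.mem_filter.mp hp).2 (not_le.mpr (Finset.mem_filter.mp hp2).2.1)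
        rw [hsplit, frm_union hdis]
        have h1 := hEf f (fun n hn => by
          obtain ⟨a, b, d⟩ := hf n hn
          exact ⟨a, fun h => b (Finset.mem_union_left _ h), d⟩)
        have h2 := hE2f 8 f (fun n hn => by
          obtain ⟨a, b, d⟩ := hf n hn
          exact ⟨a, fun h => b (Finset.mem_union_right _ h), (om_mono hRP n).trans d.1⟩)
        rw [← frm_eq] at h2
        refine (abs_add_le _ _).trans ?_
        have e : (2:ℝ) * 8 = 16 := by norm_num
        rw [e] at h2
        push_cast
        linarith

end Chain

open Finset

section Glob

lemma exp_two_le : Real.exp 2 ≤ 8 := by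
  have h := Real.exp_one_lt_d9
  have : Real.exp 2 = Real.exp 1 * Real.exp 1 := by rw [← Real.exp_add]; norm_num
  rw [this]
  nlinarith [Real.exp_pos 1]

lemma exp_elev : Real.exp (1 / 11) ≤ 11 / 10 := by
  have := Real.exp_bound_div_one_sub_of_interval (x := 1 / 11) (by norm_num) (by norm_num)
  norm_num at this ⊢
  linarith

lemma basic_l (H : ℝ) (hH : 16 ≤ H) :
    2.77 ≤ Real.log H ∧ 1 ≤ Real.log (Real.log H) ∧ 1 / 100 ≤ Real.log (Real.log (Real.log H)) := by
  have h1 : 2.77 ≤ Real.log H := by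
    have : Real.log 16 ≤ Real.log H := Real.log_le_log (by norm_num) hH
    rw [show (16:ℝ) = 2 ^ 4 by norm_num, Real.log_pow] at this
    have := Real.log_two_gt_d9
    push_cast at *
    linarith
  have he := Real.exp_one_lt_d9
  have h3 : Real.exp (1 / 100) ≤ 100 / 99 := by
    have := Real.exp_bound_div_one_sub_of_interval (x := 1 / 100) (by norm_num) (by norm_num)
    norm_num at this ⊢
    linarith
  have h4 : Real.exp (1 / 99) ≤ 99 / 98 := by
    have := Real.exp_bound_div_one_sub_of_interval (x := 1 / 99) (by norm_num) (by norm_num)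
    norm_num at this ⊢
    linarith
  have h5 : Real.exp (100 / 99) ≤ Real.log H := by
    have : Real.exp (100 / 99) = Real.exp 1 * Real.exp (1 / 99) := by
      rw [← Real.exp_add]; norm_num
    rw [this]
    nlinarith [Real.exp_pos 1]
  have h6 : 100 / 99 ≤ Real.log (Real.log H) := by
    rwa [Real.le_log_iff_exp_le (by linarith)]
  refine ⟨h1, by linarith, ?_⟩
  rw [Real.le_log_iff_exp_le (by linarith)]
  linarith

/-- data of the global problem -/
structure GD (N : ℕ) (P : Finset ℕ) (lam y l L K S : ℝ) : Prop where
  N0 : 0 < N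
  pr : ∀ p ∈ P, p.Prime
  lp : ∀ p ∈ P, Real.log p ≤ lam
  hL : ∑ p ∈ P, 1 / (p:ℝ) = L
  L1 : 1 ≤ L
  K1 : 1 ≤ K
  S0 : 0 ≤ S
  S2 : S ^ 2 = K * L
  hN : S ^ 2 * lam ^ 2 ≤ Real.log N
  lam2 : 2.77 ≤ lam
  hy : y = Real.log lam
  y1 : 1 ≤ y
  hl : l = Real.log y
  l1 : 1 / 100 ≤ l

variable {N : ℕ} {P : Finset ℕ} {lam y l L K S : ℝ}

lemma GD.ylam (g : GD N P lam y l L K S) : y ≤ lam := by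
  have := g.lam2
  rw [g.hy]
  linarith [Real.log_le_sub_one_of_pos (by linarith : 0 < lam)]

lemma GD.ly (g : GD N P lam y l L K S) : l ≤ y := by
  have := g.y1
  rw [g.hl]
  linarith [Real.log_le_sub_one_of_pos (by linarith : 0 < y)]

lemma GD.Ly (g : GD N P lam y l L K S) : L ≤ 16 * y := by
  have := mertens lam (by linarith [g.lam2]) P g.pr g.lp
  rwa [g.hL, ← g.hy] at this

lemma GD.logL (g : GD N P lam y l L K S) : Real.log L ≤ 300 * l := by
  have h1 := Real.log_le_log (by linarith [g.L1]) g.Ly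
  have hy := g.y1
  rw [Real.log_mul (by norm_num) (by linarith), ← g.hl, show (16:ℝ) = 2 ^ 4 by norm_num,
    Real.log_pow] at h1
  have := Real.log_two_lt_d9
  have := g.l1
  push_cast at h1
  linarith

lemma GD.S1 (g : GD N P lam y l L K S) : 1 ≤ S := by
  have h1 := g.S2
  have h2 : 1 ≤ K * L := one_le_mul_of_one_le_of_one_le g.K1 g.L1
  nlinarith [g.S0]

lemma GD.LS (g : GD N P lam y l L K S) : Real.sqrt L ≤ S := by
  rw [Real.sqrt_le_left g.S0, g.S2]
  nlinarith [g.K1, g.L1]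

lemma GD.logK0 (g : GD N P lam y l L K S) : 0 ≤ Real.log K := Real.log_nonneg g.K1

/-- size condition for the deletion lemma -/
lemma GD.delN (g : GD N P lam y l L K S) (C : ℝ) (hC : 0 ≤ C) (hS : 2 * C ≤ S) :
    2 * (C * S * l) * lam ≤ Real.log N := by
  refine le_trans ?_ g.hN
  have h1 := g.ly
  have h2 := g.ylam
  have h3 : 0 < l := by linarith [g.l1]
  have hlam : 0 < lam := by linarith [g.lam2]
  calc 2 * (C * S * l) * lam = (2 * C) * (S * (l * lam)) := by ring
    _ ≤ S * (S * (lam * lam)) := by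
        have := g.S0
        gcongr
        linarith
    _ = _ := by ring

lemma triv_regime (g : GD N P lam y l L K S) (hS : 2 ^ 71 ≤ S) (hr : L ≤ 2 ^ 62 * S * l) :
    ∃ X : Finset ℤ, X ⊆ Ioc (N:ℤ) (2 * N) ∧
      ((Ioc (N:ℤ) (2 * N) \ X).card : ℝ) ≤ 1000 * Real.exp (-(S * Real.log K)) * N ∧
      ∀ f : ℤ → ℝ, (∀ n, f n ≠ 0 → n ∈ X) →
        |frm P N f f| ≤ (2 ^ 72 * S * l) * ∑ n ∈ Ioc (N:ℤ) (2 * N), f n ^ 2 := by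
  classical
  have hl1 := g.l1
  have hl0 : 0 < l := by linarith
  have hS0 : 0 < S := by linarith [g.S1]
  have hK0 : 0 < K := by linarith [g.K1]
  have hL0 : 0 < L := by linarith [g.L1]
  obtain ⟨T, hT⟩ : ∃ T, T = 2 ^ 70 * S * l := ⟨_, rfl⟩
  have hSl : 1 / 100 ≤ S * l := by nlinarith [g.S1]
  have hT1 : 1 ≤ T := by rw [hT]; nlinarith
  have hLT : L * 8 ≤ T := by
    rw [hT]; nlinarith
  have hTN : 2 * T * lam ≤ Real.log N := by
    rw [hT]
    exact g.delN (2 ^ 70) (by norm_num) (by linarith)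
  obtain ⟨c, hc0, hcT, hcL⟩ : ∃ c, 0 ≤ c ∧ S * Real.log K ≤ c * T ∧ Real.exp (c + 1) * L ≤ T := by
    by_cases hK : K ≤ L ^ 2
    · refine ⟨1, by norm_num, ?_, ?_⟩
      · have h1 : Real.log K ≤ 2 * Real.log L := by
          have := Real.log_le_log hK0 hK
          rw [Real.log_pow] at this
          exact_mod_cast this
        have h2 := g.logL
        have h3 : S * Real.log K ≤ S * (600 * l) := mul_le_mul_of_nonneg_left (by linarith) hS0.le
        rw [hT]; nlinarith
      · have := exp_two_le
        rw [show (1:ℝ) + 1 = 2 by norm_num]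
        nlinarith
    · push Not at hK
      refine ⟨Real.log K / (2 ^ 70 * l), div_nonneg g.logK0 (by positivity), ?_, ?_⟩
      · apply le_of_eq
        rw [hT]; field_simp
      · set w := Real.exp (Real.log K / 4) with hw
        have hw0 : 0 < w := Real.exp_pos _
        have hw4 : w ^ 4 = K := by
          rw [hw, ← Real.exp_nat_mul]
          push_cast
          rw [show (4:ℝ) * (Real.log K / 4) = Real.log K by ring, Real.exp_log hK0]
        have h1 : Real.exp (Real.log K / (2 ^ 70 * l)) ≤ w := by
          apply Real.exp_le_exp.mpr
          apply div_le_div_of_nonneg_left g.logK0 (by norm_num)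
          nlinarith
        have h2 : L ≤ w ^ 2 := by
          by_contra hcon
          push Not at hcon
          nlinarith
        have h3 : w * L ≤ S := by
          apply le_of_sq_le_sq _ hS0.le
          rw [g.S2, ← hw4]
          have : w ^ 2 * L * L ≤ w ^ 2 * L * w ^ 2 := by gcongr
          nlinarith
        rw [Real.exp_add]
        have h4 := Real.exp_one_lt_d9
        calc Real.exp (Real.log K / (2 ^ 70 * l)) * Real.exp 1 * L
            ≤ w * 3 * L := by gcongr; linarith
          _ = 3 * (w * L) := by ring
          _ ≤ 3 * S := by linarith
          _ ≤ T := by rw [hT]; nlinarith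
  have hdel := del_om P g.pr N g.N0 lam L T c g.lp (by linarith [g.lam2]) hL0 g.hL.le hT1 hc0 hcL hTN
  refine ⟨(Ioc (N:ℤ) (2 * N)).filter (fun n => (om P n : ℝ) ≤ T), Finset.filter_subset _ _, ?_, ?_⟩
  · have e : Ioc (N:ℤ) (2 * N) \ (Ioc (N:ℤ) (2 * N)).filter (fun n => (om P n : ℝ) ≤ T)
        = (Ioc (N:ℤ) (2 * N)).filter (fun n => T < (om P n : ℝ)) := by
      ext n; simp only [Finset.mem_sdiff, Finset.mem_filter, not_and, not_le]; tauto
    rw [e]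
    refine hdel.trans ?_
    have h1 : Real.exp (-(c * T)) ≤ Real.exp (-(S * Real.log K)) := Real.exp_le_exp.mpr (by linarith)
    have hN0 : (0:ℝ) ≤ N := by positivity
    have := mul_le_mul_of_nonneg_right h1 hN0
    have := mul_nonneg (Real.exp_pos (-(S * Real.log K))).le hN0
    linarith
  · intro f hf
    have := triv_form P g.pr N T hT1 (by rw [g.hL]; linarith) f
      (fun n hn => Finset.mem_filter.mp (hf n hn))
    refine this.trans (le_of_eq ?_)
    rw [hT]; ring

end Glob

open Finset

section Fin1

variable {N : ℕ} {P : Finset ℕ} {lam y l L K S : ℝ}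

/-- exponents of the classes -/
def aseq (κ : ℕ) : ℕ → ℕ
  | 0 => κ
  | j + 1 => aseq κ j + aseq κ j / 9

lemma aseq_mono (κ j : ℕ) : aseq κ j ≤ aseq κ (j+1) := Nat.le_add_right _ _

lemma aseq_ge (κ j : ℕ) : κ ≤ aseq κ j := by
  induction j with
  | zero => exact le_rfl
  | succ j ih => exact ih.trans (aseq_mono κ j)

lemma aseq_exp (κ : ℕ) (hκ : 110 ≤ κ) (j : ℕ) : Real.exp (j / 11) ≤ aseq κ j := by
  induction j with
  | zero =>
    have : (110:ℝ) ≤ κ := by exact_mod_cast hκ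
    simp [aseq]; linarith
  | succ j ih =>
    have h0 := hκ.trans (aseq_ge κ j)
    have h1 : 11 * aseq κ j ≤ 10 * aseq κ (j+1) := by
      simp only [aseq]; omega
    have h2 : 11 * (aseq κ j : ℝ) ≤ 10 * aseq κ (j+1) := by exact_mod_cast h1
    have h3 : Real.exp (((j+1:ℕ):ℝ) / 11) = Real.exp (j / 11) * Real.exp (1 / 11) := by
      rw [← Real.exp_add]; push_cast; ring_nf
    rw [h3]
    have h4 := mul_le_mul ih exp_elev (Real.exp_pos _).le (by positivity)
    linarith

set_option maxHeartbeats 2000000 in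
lemma nontriv_regime (g : GD N P lam y l L K S) (hr : 2 ^ 62 * S * l < L) :
    ∃ X : Finset ℤ, X ⊆ Ioc (N:ℤ) (2 * N) ∧
      ((Ioc (N:ℤ) (2 * N) \ X).card : ℝ) ≤ 1000 * Real.exp (-(S * Real.log K)) * N ∧
      ∀ f : ℤ → ℝ, (∀ n, f n ≠ 0 → n ∈ X) →
        |frm P N f f| ≤ ((4 * 10 ^ 6 + 4000 * (24 * 1024 * Real.exp 16)) * S * l) *
          ∑ n ∈ Ioc (N:ℤ) (2 * N), f n ^ 2 := by
  classical
  have hl1 := g.l1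
  have hl0 : 0 < l := by linarith
  have hS1 := g.S1
  have hS0 : 0 < S := by linarith
  have hK1 := g.K1
  have hK0 : 0 < K := by linarith
  have hL0 : 0 < L := by linarith [g.L1]
  have hy1 := g.y1
  have hlam := g.lam2
  have hly := g.ly
  have hylam := g.ylam
  have hN0 : (0:ℝ) < N := by exact_mod_cast g.N0
  have hsq := Real.sq_sqrt hL0.le
  have hsq0 := Real.sqrt_nonneg L
  -- L is large
  have hsL : 2 ^ 62 / 100 ≤ Real.sqrt L := by
    by_contra hcon
    push Not at hcon
    have h1 := g.LS
    have h2 : Real.sqrt L * Real.sqrt L ≤ (2 ^ 62 / 100) * S := by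
      apply mul_le_mul hcon.le h1 hsq0 (by norm_num)
    nlinarith
  have hLbig : 2 ^ 110 ≤ L := by
    rw [← hsq]
    have := pow_le_pow_left₀ (by norm_num) hsL 2
    refine le_trans ?_ this
    norm_num
  have hSbig : 2 * 10 ^ 6 ≤ S := by
    have := g.LS
    refine le_trans ?_ (hsL.trans this)
    norm_num
  have hSL : S ≤ L := by nlinarith
  have hKL : K ≤ L := by
    by_contra hcon
    push Not at hcon
    have := g.S2
    nlinarith
  have hlogK : Real.log K ≤ 300 * l := (Real.log_le_log hK0 hKL).trans g.logL
  have hSK : S * Real.log K ≤ 300 * (S * l) := by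
    have := mul_le_mul_of_nonneg_left hlogK hS0.le
    linarith
  have hSl0 : 0 < S * l := by positivity
  have hSKL : S * Real.log K ≤ L / 2 := by nlinarith
  have hlog32 : Real.log (32 * y) ≤ 348 * l := by
    rw [Real.log_mul (by norm_num) (by linarith), ← g.hl, show (32:ℝ) = 2 ^ 5 by norm_num,
      Real.log_pow]
    have := Real.log_two_lt_d9
    push_cast
    linarith
  -- the exponents
  obtain ⟨k1, hk1, hk1'⟩ := exists_nat_pow_near (x := 16 * y) (y := (2:ℝ)) (by linarith) (by norm_num)
  obtain ⟨k2, hk2, hk2'⟩ := exists_nat_pow_near (x := lam) (y := (2:ℝ) ^ 20) (by linarith) (by norm_num)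
  obtain ⟨κ0, hκ0⟩ : ∃ κ0, κ0 = k1 + 1 := ⟨_, rfl⟩
  obtain ⟨κf, hκf⟩ : ∃ κf, κf = k2 + 1 := ⟨_, rfl⟩
  rw [← hκ0] at hk1'
  rw [← hκf, ← pow_mul] at hk2'
  have hU0 : (2:ℝ) ^ κ0 ≤ 32 * y := by rw [hκ0, pow_succ]; linarith
  have hLU : L ≤ 2 ^ κ0 := g.Ly.trans hk1'.le
  have hκ110 : 110 ≤ κ0 := by
    have : (2:ℝ) ^ 110 ≤ 2 ^ κ0 := hLbig.trans hLU
    exact (pow_le_pow_iff_right₀ (by norm_num)).mp this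
  have hκfU : (2:ℝ) ^ (20 * κf) ≤ 2 ^ 20 * lam := by
    rw [hκf, pow_mul, pow_succ]; linarith
  obtain ⟨F, hF⟩ : ∃ F, F = max κ0 κf := ⟨_, rfl⟩
  have hFy : (F:ℝ) ≤ 32 * y := by
    have h1 : (κ0:ℝ) ≤ 32 * y := by
      have : (κ0:ℝ) ≤ 2 ^ κ0 := by exact_mod_cast Nat.lt_two_pow_self.le
      linarith
    have h2 : (κf:ℝ) ≤ 32 * y := by
      have h3 := Real.log_le_log (by positivity) hk2
      rw [← pow_mul, Real.log_pow, ← g.hy] at h3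
      push_cast at h3
      have := Real.log_two_gt_d9
      have h4 : (0:ℝ) ≤ k2 := by positivity
      rw [hκf]; push_cast
      nlinarith
    rw [hF]; push_cast
    exact max_le h1 h2
  obtain ⟨c, hc⟩ : ∃ c : ℕ → ℕ, c = fun j => min (aseq κ0 j) F := ⟨_, rfl⟩
  have hcj : ∀ j, c j = min (aseq κ0 j) F := fun j => by rw [hc]
  have hc0 : c 0 = κ0 := by rw [hcj, hF]; simp [aseq]
  obtain ⟨r, hrd⟩ : ∃ r, r = ⌈11 * (348 * l)⌉₊ := ⟨_, rfl⟩
  have hr1 : (r:ℝ) ≤ 4000 * l := by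
    have := Nat.ceil_lt_add_one (by positivity : 0 ≤ 11 * (348 * l))
    rw [← hrd] at this
    linarith
  have hr2 : F ≤ aseq κ0 r := by
    have h1 : (11 * (348 * l)) ≤ r := by rw [hrd]; exact Nat.le_ceil _
    have h2 := aseq_exp κ0 hκ110 r
    have h3 : 32 * y ≤ Real.exp (r / 11) := by
      rw [← Real.log_le_iff_le_exp (by linarith)]
      linarith
    have : (F:ℝ) ≤ aseq κ0 r := by linarith
    exact_mod_cast this
  have hcr : c r = F := by rw [hcj]; exact min_eq_right hr2
  -- small primes
  obtain ⟨Q, hQ⟩ : ∃ Q, Q = P.filter (fun p : ℕ => Real.log p ≤ 2 ^ (20 * κ0)) := ⟨_, rfl⟩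
  have hQP : Q ⊆ P := by rw [hQ]; exact Finset.filter_subset _ _
  have hQs : ∑ p ∈ Q, 1 / (p:ℝ) ≤ 111360 * l := by
    have h1 : (2:ℝ) ≤ 2 ^ (20 * κ0) := by
      calc (2:ℝ) = 2 ^ 1 := by norm_num
        _ ≤ _ := pow_le_pow_right₀ (by norm_num) (by omega)
    have h2 := mertens (2 ^ (20 * κ0)) h1 Q (fun p hp => g.pr p (hQP hp))
      (fun p hp => by rw [hQ] at hp; exact (Finset.mem_filter.mp hp).2)
    have h3 : Real.log ((2:ℝ) ^ (20 * κ0)) = 20 * Real.log (2 ^ κ0) := by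
      rw [Real.log_pow, Real.log_pow]; push_cast; ring
    rw [h3] at h2
    have h4 := Real.log_le_log (by positivity) hU0
    linarith
  obtain ⟨T, hT⟩ : ∃ T, T = 10 ^ 6 * S * l := ⟨_, rfl⟩
  have hT1 : 1 ≤ T := by rw [hT]; nlinarith
  have hSll : l ≤ S * l := by nlinarith
  have hQT : ∑ p ∈ Q, 1 / (p:ℝ) ≤ T := by rw [hT]; linarith
  have hdel1 := del_om Q (fun p hp => g.pr p (hQP hp)) N g.N0 lam (111360 * l) T 1
    (fun p hp => g.lp p (hQP hp)) (by linarith) (by positivity) hQs hT1 (by norm_num)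
    (by
      have := exp_two_le
      rw [show (1:ℝ) + 1 = 2 by norm_num, hT]
      nlinarith)
    (by rw [hT]; exact g.delN (10 ^ 6) (by norm_num) (by linarith))
  have hdel2 := del_om P g.pr N g.N0 lam L (8 * L) 1 g.lp (by linarith) hL0 g.hL.le
    (by linarith [g.L1]) (by norm_num)
    (by
      have := exp_two_le
      rw [show (1:ℝ) + 1 = 2 by norm_num]
      nlinarith)
    (by
      refine le_trans ?_ g.hN
      rw [g.S2]
      have h16 : 16 ≤ lam := by
        have := g.Ly
        have : (16:ℝ) * 16 ≤ 2 ^ 110 := by norm_num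
        linarith
      have h1 : 16 * lam ≤ lam ^ 2 := by nlinarith
      have h2 : L ≤ K * L := by nlinarith
      have h3 : L * (16 * lam) ≤ (K * L) * lam ^ 2 := by gcongr
      linarith)
  obtain ⟨E, hE, hEf⟩ := chain P g.pr N L T c hLbig (by rw [hc0]; exact hLU) g.hL.le hT1
    (by rw [hc0, ← hQ]; exact hQT)
    (fun j => by
      rw [hcj, hcj]; exact min_le_min_right _ (aseq_mono κ0 j))
    (fun j => by
      rw [hcj, hcj]
      have : aseq κ0 (j+1) = aseq κ0 j + aseq κ0 j / 9 := rfl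
      omega)
    (fun j hj => by
      have h1 : c (j+1) ≤ κf := by
        have h2 := aseq_ge κ0 j
        rw [hcj, hcj] at hj
        rw [hcj]
        omega
      rw [← Real.le_log_iff_exp_le hN0]
      refine le_trans ?_ g.hN
      rw [g.S2]
      have h2 : ((2:ℝ) ^ (c (j+1))) ^ 40 ≤ 2 ^ 40 * lam ^ 2 := by
        calc ((2:ℝ) ^ (c (j+1))) ^ 40 ≤ ((2:ℝ) ^ κf) ^ 40 := by
              gcongr
              · norm_num
          _ = ((2:ℝ) ^ (20 * κf)) ^ 2 := by rw [← pow_mul, ← pow_mul]; congr 1; ring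
          _ ≤ (2 ^ 20 * lam) ^ 2 := by gcongr
          _ = _ := by ring
      have h3 : L ≤ K * L := by nlinarith
      rw [div_le_iff₀ (by positivity)]
      have h4 : L * ((2:ℝ) ^ (c (j+1))) ^ 40 ≤ (K * L) * (2 ^ 40 * lam ^ 2) := by gcongr
      linarith)
    r
  have hPF : P.filter (fun p : ℕ => Real.log p ≤ 2 ^ (20 * c r)) = P := by
    rw [Finset.filter_eq_self]
    intro p hp
    refine (g.lp p hp).trans (hk2'.le.trans ?_)
    apply pow_le_pow_right₀ (by norm_num)
    rw [hcr, hF]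
    have := le_max_right κ0 κf
    omega
  rw [hPF, hc0, ← hQ] at hEf
  rw [hc0] at hE
  refine ⟨(Ioc (N:ℤ) (2 * N)).filter (fun n => n ∉ E ∧ (om P n : ℝ) ≤ 8 * L ∧ (om Q n : ℝ) ≤ T),
    Finset.filter_subset _ _, ?_, ?_⟩
  · have hsub : Ioc (N:ℤ) (2 * N) \ (Ioc (N:ℤ) (2 * N)).filter
          (fun n => n ∉ E ∧ (om P n : ℝ) ≤ 8 * L ∧ (om Q n : ℝ) ≤ T)
        ⊆ E ∪ ((Ioc (N:ℤ) (2 * N)).filter (fun n => 8 * L < (om P n : ℝ)) ∪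
          (Ioc (N:ℤ) (2 * N)).filter (fun n => T < (om Q n : ℝ))) := by
      intro n hn
      simp only [Finset.mem_sdiff, Finset.mem_filter, Finset.mem_union] at hn ⊢
      by_contra hcon
      push Not at hcon
      exact hn.2 ⟨hn.1, hcon.1, hcon.2.1 hn.1, hcon.2.2 hn.1⟩
    have h1 : ((Ioc (N:ℤ) (2 * N) \ (Ioc (N:ℤ) (2 * N)).filter
          (fun n => n ∉ E ∧ (om P n : ℝ) ≤ 8 * L ∧ (om Q n : ℝ) ≤ T)).card : ℝ) ≤
        E.card + (((Ioc (N:ℤ) (2 * N)).filter (fun n => 8 * L < (om P n : ℝ))).card +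
          ((Ioc (N:ℤ) (2 * N)).filter (fun n => T < (om Q n : ℝ))).card) := by
      have := (Finset.card_le_card hsub).trans ((Finset.card_union_le _ _).trans
        (Nat.add_le_add_left (Finset.card_union_le _ _) _))
      exact_mod_cast this
    refine h1.trans ?_
    have e1 : Real.exp (-(1 * T)) ≤ Real.exp (-(S * Real.log K)) := by
      apply Real.exp_le_exp.mpr
      rw [hT]; linarith
    have e2 : Real.exp (-(1 * (8 * L))) ≤ Real.exp (-(S * Real.log K)) := by
      apply Real.exp_le_exp.mpr
      linarith
    have e3 : (r:ℝ) * Real.exp (-(2 ^ κ0)) ≤ 500 * Real.exp (-(S * Real.log K)) := by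
      have a1 : (r:ℝ) ≤ 250 * 2 ^ κ0 := by linarith
      have a2 : (2:ℝ) ^ κ0 ≤ 2 * Real.exp (2 ^ κ0 / 2) := by
        have := Real.add_one_le_exp ((2:ℝ) ^ κ0 / 2)
        linarith
      have a3 : Real.exp ((2:ℝ) ^ κ0 / 2) * Real.exp (-(2 ^ κ0)) ≤ Real.exp (-(S * Real.log K)) := by
        rw [← Real.exp_add]
        apply Real.exp_le_exp.mpr
        linarith
      calc (r:ℝ) * Real.exp (-(2 ^ κ0)) ≤ (500 * Real.exp (2 ^ κ0 / 2)) * Real.exp (-(2 ^ κ0)) :=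
            mul_le_mul_of_nonneg_right (by linarith) (Real.exp_pos _).le
        _ = 500 * (Real.exp (2 ^ κ0 / 2) * Real.exp (-(2 ^ κ0))) := by ring
        _ ≤ _ := by linarith
    have e4 : (E.card:ℝ) ≤ 500 * Real.exp (-(S * Real.log K)) * N := by
      refine hE.trans ?_
      calc (r:ℝ) * (N * Real.exp (-(2 ^ κ0))) = (r * Real.exp (-(2 ^ κ0))) * N := by ring
        _ ≤ _ := mul_le_mul_of_nonneg_right e3 hN0.le
    have e5 := mul_le_mul_of_nonneg_left e1 hN0.le
    have e6 := mul_le_mul_of_nonneg_left e2 hN0.le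
    have e7 : 0 ≤ N * Real.exp (-(S * Real.log K)) := by positivity
    linarith
  · intro f hf
    have := hEf f (fun n hn => by
      have := Finset.mem_filter.mp (hf n hn)
      exact this)
    refine this.trans ?_
    apply mul_le_mul_of_nonneg_right _ (Finset.sum_nonneg fun _ _ => sq_nonneg _)
    have h1 : (r:ℝ) * (24 * (1024 * Real.sqrt L) * Real.exp 16) ≤
        (4000 * l) * (24 * (1024 * S) * Real.exp 16) := by
      have := g.LS
      gcongr
    rw [hT]
    linarith

end Fin1

theorem cor_sansH0 :
    ∃ C₁ C₂ : ℝ, 0 < C₁ ∧ 0 < C₂ ∧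
      ∀ (N : ℕ) (H : ℝ) (P : Finset ℕ) (L : ℝ),
        0 < N →
        16 ≤ H →
        (∀ p ∈ P, Nat.Prime p ∧ 1 ≤ (p : ℝ) ∧ (p : ℝ) ≤ H) →
        L = ∑ p ∈ P, (1 : ℝ) / (p : ℝ) →
        1 ≤ L →
        Real.log H ≤ Real.sqrt (Real.log (N : ℝ) / L) →
        ∀ K : ℝ, 1 ≤ K → K ≤ Real.log (N : ℝ) / (L * Real.log H ^ 2) →
          ∃ X : Finset ℤ, X ⊆ Finset.Ioc (N : ℤ) (2 * (N : ℤ)) ∧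
            ((Finset.Ioc (N : ℤ) (2 * (N : ℤ)) \ X).card : ℝ) ≤
              C₁ * Real.exp (-(Real.sqrt (K * L) * Real.log K)) * (N : ℝ) ∧
            ∀ (μ : ℂ) (f : ℤ → ℂ), f ≠ 0 →
              (∀ n : ℤ, n ∉ Finset.Ioc (N : ℤ) (2 * (N : ℤ)) → f n = 0) →
              (∀ n : ℤ, opARestrict N P X f n = μ * f n) →
              ‖μ‖ ≤ C₂ * Real.sqrt (K * L) * Real.log (Real.log (Real.log H)) := by
  obtain ⟨B, hB⟩ : ∃ B : ℝ, B = 2 ^ 71 * Real.log ((2 ^ 71) ^ 2) := ⟨_, rfl⟩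
  obtain ⟨D, hD⟩ : ∃ D : ℝ, D = 4 * 10 ^ 6 + 4000 * (24 * 1024 * Real.exp 16) := ⟨_, rfl⟩
  have hD0 : 0 < D := by rw [hD]; positivity
  refine ⟨1000 + Real.exp B, 2 ^ 72 + D, by positivity, by positivity, ?_⟩
  intro N H P L hN hH hP hL hL1 _ K hK1 hK
  obtain ⟨b1, b2, b3⟩ := basic_l H hH
  have hKL1 : 1 ≤ K * L := one_le_mul_of_one_le_of_one_le hK1 hL1
  have hlogH : 0 < Real.log H := by linarith
  have g : GD N P (Real.log H) (Real.log (Real.log H)) (Real.log (Real.log (Real.log H))) L K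
      (Real.sqrt (K * L)) := by
    refine ⟨hN, fun p hp => (hP p hp).1, ?_, hL.symm, hL1, hK1, Real.sqrt_nonneg _,
      Real.sq_sqrt (by linarith), ?_, b1, rfl, b2, rfl, b3⟩
    · intro p hp
      exact Real.log_le_log (by linarith [(hP p hp).2.1]) (hP p hp).2.2
    · rw [Real.sq_sqrt (by linarith)]
      rw [le_div_iff₀ (by positivity)] at hK
      linarith
  set S := Real.sqrt (K * L) with hS
  set l := Real.log (Real.log (Real.log H)) with hl
  have hS1 := g.S1
  have hl0 : 0 < l := by linarith
  have hSl : 0 < S * l := by positivity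
  have hN0 : (0:ℝ) < N := by exact_mod_cast hN
  have hNe : 0 < Real.exp (-(S * Real.log K)) * N := by positivity
  -- common conclusion
  have fin : ∀ C : ℝ, C ≤ 2 ^ 72 + D → 0 ≤ C →
      (∃ X : Finset ℤ, X ⊆ Ioc (N:ℤ) (2 * N) ∧
      ((Ioc (N:ℤ) (2 * N) \ X).card : ℝ) ≤ 1000 * Real.exp (-(S * Real.log K)) * N ∧
      ∀ f : ℤ → ℝ, (∀ n, f n ≠ 0 → n ∈ X) →
        |frm P N f f| ≤ (C * S * l) * ∑ n ∈ Ioc (N:ℤ) (2 * N), f n ^ 2) →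
      ∃ X : Finset ℤ, X ⊆ Finset.Ioc (N : ℤ) (2 * (N : ℤ)) ∧
            ((Finset.Ioc (N : ℤ) (2 * (N : ℤ)) \ X).card : ℝ) ≤
              (1000 + Real.exp B) * Real.exp (-(S * Real.log K)) * (N : ℝ) ∧
            ∀ (μ : ℂ) (f : ℤ → ℂ), f ≠ 0 →
              (∀ n : ℤ, n ∉ Finset.Ioc (N : ℤ) (2 * (N : ℤ)) → f n = 0) →
              (∀ n : ℤ, opARestrict N P X f n = μ * f n) →
              ‖μ‖ ≤ (2 ^ 72 + D) * S * l := by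
    rintro C hC hC0 ⟨X, hX, hXc, hXf⟩
    refine ⟨X, hX, hXc.trans ?_, ?_⟩
    · have := mul_pos (Real.exp_pos B) hNe
      linarith
    · intro μ f hf _ he
      have h1 := eig N P X (C * S * l) (by positivity) hX hXf μ f hf he
      refine h1.trans ?_
      gcongr
  by_cases h1 : S < 2 ^ 71
  · refine ⟨∅, Finset.empty_subset _, ?_, ?_⟩
    · have hKs : K ≤ (2 ^ 71) ^ 2 := by
        have h2 := g.S2
        have h3 : S ^ 2 ≤ (2 ^ 71) ^ 2 := pow_le_pow_left₀ (by linarith) h1.le 2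
        have h4 : K ≤ K * L := by nlinarith
        linarith
      have hlogK := Real.log_le_log (by linarith) hKs
      have hSB : S * Real.log K ≤ B := by
        rw [hB]
        exact mul_le_mul h1.le hlogK g.logK0 (by norm_num)
      have h5 : 1 ≤ Real.exp B * Real.exp (-(S * Real.log K)) := by
        rw [← Real.exp_add]
        exact Real.one_le_exp (by linarith)
      have h6 : ((Finset.Ioc (N : ℤ) (2 * (N : ℤ)) \ ∅).card : ℝ) = N := by
        rw [Finset.sdiff_empty, Int.card_Ioc]
        have : (2 * (N:ℤ) - N).toNat = N := by omega
        rw [this]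
      rw [h6]
      have h7 := mul_le_mul_of_nonneg_right h5 hN0.le
      linarith
    · intro μ f hf _ he
      refine eig N P ∅ _ (by positivity) (Finset.empty_subset _) ?_ μ f hf he
      intro f hf
      have hf0 : ∀ n, f n = 0 := by
        intro n
        by_contra h
        simpa using hf n h
      simp [frm, hf0]
  · push Not at h1
    by_cases h2 : L ≤ 2 ^ 62 * S * l
    · exact fin (2 ^ 72) (by linarith) (by norm_num) (triv_regime g h1 h2)
    · push Not at h2
      exact fin D (by linarith) hD0.le (by rw [hD]; exact nontriv_regime g h2)
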